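/- Let F be a finite field, n ≥ 1, and G = GL_n(F) the general linear group of degree n over F. Suppose χ is an irreducible complex character of G and g ∈ G satisfies χ(g) ≠ 0. Then the order of gZ(G) in G/Z(G) divides |G/Z(G)|/χ(1); equivalently, o(gZ(G))·χ(1) divides |G : Z(G)|. -/

import Mathlib

set_option linter.all false
section
universe u
open scoped MatrixGroups
noncomputable section
namespace GLW
structure Ob (F : Type) [Field F] where
  V : Type
  [grp : AddCommGroup V]
  [mod : Module F V]
  [fin : Finite V]
  x : Module.End F V
attribute [instance] Ob.grp Ob.mod Ob.fin
variable {F : Type} [Field F] [Fintype F]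
abbrev Hom (M N : Ob F) := {φ : M.V →ₗ[F] N.V // ∀ v, φ (M.x v) = N.x (φ v)}
def Iso (M N : Ob F) : Prop := ∃ e : M.V ≃ₗ[F] N.V, ∀ v, e (M.x v) = N.x (e v)
def Ob.S (M : Ob F) := {W : Submodule F M.V // ∀ v ∈ W, M.x v ∈ W}
instance (M : Ob F) : Finite M.S := by
  have : Finite (Submodule F M.V) := Finite.of_injective _ SetLike.coe_injective
  exact Subtype.finite
instance (M : Ob F) : Fintype M.S := Fintype.ofFinite _
abbrev Ob.sub (M : Ob F) (W : M.S) : Ob F := ⟨W.1, M.x.restrict W.2⟩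
instance {V : Type} [AddCommGroup V] [Module F V] [Finite V] (W : Submodule F V) : Finite (V ⧸ W) :=
  Finite.of_surjective _ W.mkQ_surjective
abbrev Ob.quot (M : Ob F) (W : M.S) : Ob F := ⟨M.V ⧸ W.1, W.1.mapQ W.1 M.x W.2⟩
def Ob.d (M : Ob F) : ℕ := Module.finrank F M.V
instance (M : Ob F) : FiniteDimensional F M.V := Module.Finite.of_finite
theorem Iso.refl (M : Ob F) : Iso M M := ⟨.refl _ _, fun _ => rfl⟩
theorem Iso.symm {M N : Ob F} : Iso M N → Iso N M := fun ⟨e, h⟩ =>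
  ⟨e.symm, fun v => e.injective (by simp [h])⟩
theorem Iso.trans {M N L : Ob F} : Iso M N → Iso N L → Iso M L := fun ⟨e, h⟩ ⟨e', h'⟩ =>
  ⟨e.trans e', fun v => by simp [h, h']⟩
theorem Iso.d {M N : Ob F} : Iso M N → M.d = N.d := fun ⟨e, _⟩ => e.finrank_eq
theorem iso_sub {M N : Ob F} (φ : M.V →ₗ[F] N.V) (h : ∀ v, φ (M.x v) = N.x (φ v)) (W : N.S)
    (hi : Function.Injective φ) (hr : LinearMap.range φ = W.1) : Iso M (N.sub W) :=
  ⟨(LinearEquiv.ofInjective φ hi).trans (LinearEquiv.ofEq _ _ hr), fun v => Subtype.ext (h v)⟩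
theorem iso_quot {M N : Ob F} (φ : M.V →ₗ[F] N.V) (h : ∀ v, φ (M.x v) = N.x (φ v)) (W : M.S)
    (hi : Function.Surjective φ) (hr : LinearMap.ker φ = W.1) : Iso (M.quot W) N :=
  ⟨(Submodule.quotEquivOfEq _ _ hr.symm).trans (φ.quotKerEquivOfSurjective hi), fun v => by
    induction v using Submodule.Quotient.induction_on with | _ v => exact h v⟩
theorem iso_qs {M N : Ob F} (φ : M.V →ₗ[F] N.V) (h : ∀ v, φ (M.x v) = N.x (φ v)) (W : M.S) (W' : N.S)
    (hr : LinearMap.ker φ = W.1) (hr' : LinearMap.range φ = W'.1) :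
    Iso (M.quot W) (N.sub W') :=
  ⟨(Submodule.quotEquivOfEq _ _ hr.symm).trans (φ.quotKerEquivRange.trans (LinearEquiv.ofEq _ _ hr')), fun v => by
    induction v using Submodule.Quotient.induction_on with | _ v => exact Subtype.ext (h v)⟩
theorem d_add (M : Ob F) (W : M.S) : (M.sub W).d + (M.quot W).d = M.d := by
  rw [add_comm]; exact Submodule.finrank_quotient_add_finrank W.1
variable (F) in
@[ext] structure Hall (K : Type u) where
  f : Ob F → K
  inv : ∀ {M N}, Iso M N → f M = f N
namespace Hall
variable {K : Type u} [Ring K]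
instance : CoeFun (Hall F K) (fun _ => Ob F → K) := ⟨f⟩
@[ext] theorem ex {a b : Hall F K} (h : ∀ M, a M = b M) : a = b := Hall.ext (funext h)
instance : Add (Hall F K) := ⟨fun a b => ⟨fun M => a M + b M, fun h => by rw [a.inv h, b.inv h]⟩⟩
instance : Zero (Hall F K) := ⟨⟨fun M => 0, fun h => rfl⟩⟩
instance : Neg (Hall F K) := ⟨fun a => ⟨fun M => - a M, fun h => by rw [a.inv h]⟩⟩
instance : Sub (Hall F K) := ⟨fun a b => ⟨fun M => a M - b M, fun h => by rw [a.inv h, b.inv h]⟩⟩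
instance {R : Type*} [SMul R K] : SMul R (Hall F K) := ⟨fun r a => ⟨fun M => r • a M, fun h => by rw [a.inv h]⟩⟩
theorem f_inj : Function.Injective (f : Hall F K → _) := fun a b h => Hall.ext h
instance : AddCommGroup (Hall F K) := f_inj.addCommGroup f rfl (fun _ _ => rfl) (fun _ => rfl)
  (fun _ _ => rfl) (fun _ _ => rfl) (fun _ _ => rfl)
variable (F K) in
def fHom : Hall F K →+ (Ob F → K) := ⟨⟨f, rfl⟩, fun _ _ => rfl⟩
instance {R : Type*} [Semiring R] [Module R K] : Module R (Hall F K) :=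
  f_inj.module R (fHom F K) (fun _ _ => rfl)
theorem sum_f {ι : Type*} (s : Finset ι) (a : ι → Hall F K) (M) : (∑ i ∈ s, a i).f M = ∑ i ∈ s, a i M :=
  (congrFun (map_sum (fHom F K) a s) M).trans (Finset.sum_apply _ _ _)
@[simp] theorem add_f (a b : Hall F K) (M) : (a + b).f M = a M + b M := rfl
@[simp] theorem sub_f (a b : Hall F K) (M) : (a - b).f M = a M - b M := rfl
@[simp] theorem neg_f (a : Hall F K) (M) : (-a).f M = - a M := rfl
@[simp] theorem zero_f (M) : (0 : Hall F K).f M = 0 := rfl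
@[simp] theorem smul_f {R : Type*} [SMul R K] (r : R) (a : Hall F K) (M) : (r • a).f M = r • a M := rfl
end Hall
def mapS {M N : Ob F} (e : M.V ≃ₗ[F] N.V) (h : ∀ v, e (M.x v) = N.x (e v)) : M.S ≃ N.S where
  toFun W := ⟨W.1.map e.toLinearMap, by
    rintro _ ⟨v, hv, rfl⟩; exact ⟨_, W.2 v hv, h v⟩⟩
  invFun W := ⟨W.1.comap e.toLinearMap, fun v hv => by
    have := W.2 _ hv; simpa [h] using this⟩
  left_inv W := Subtype.ext (Submodule.comap_map_eq_of_injective e.injective _)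
  right_inv W := Subtype.ext (Submodule.map_comap_eq_of_surjective e.surjective _)
theorem mapS_sub {M N : Ob F} (e : M.V ≃ₗ[F] N.V) (h : ∀ v, e (M.x v) = N.x (e v)) (W : M.S) :
    Iso (M.sub W) (N.sub (mapS e h W)) :=
  iso_sub (M := M.sub W) (e.toLinearMap ∘ₗ W.1.subtype) (fun v => h _) _
    (e.injective.comp Subtype.val_injective) (by
      rw [LinearMap.range_comp, Submodule.range_subtype]; rfl)
theorem mapS_quot {M N : Ob F} (e : M.V ≃ₗ[F] N.V) (h : ∀ v, e (M.x v) = N.x (e v)) (W : M.S) :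
    Iso (M.quot W) (N.quot (mapS e h W)) :=
  iso_quot (N := N.quot (mapS e h W)) ((mapS e h W).1.mkQ ∘ₗ e.toLinearMap) (fun v => by
    change Submodule.Quotient.mk (e (M.x v)) = Submodule.Quotient.mk (N.x (e v)); rw [h]) _
    ((Submodule.mkQ_surjective _).comp e.surjective) (by
      rw [LinearMap.ker_comp, Submodule.ker_mkQ]; exact Submodule.comap_map_eq_of_injective e.injective _)
def eSub {M : Ob F} (W : M.S) : {U : M.S // U.1 ≤ W.1} ≃ (M.sub W).S where
  toFun U := ⟨U.1.1.comap W.1.subtype, fun v hv => U.1.2 _ hv⟩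
  invFun U := ⟨⟨U.1.map W.1.subtype, by rintro _ ⟨v, hv, rfl⟩; exact ⟨_, U.2 v hv, rfl⟩⟩, Submodule.map_subtype_le _ _⟩
  left_inv U := Subtype.ext (Subtype.ext ((Submodule.map_comap_subtype _ _).trans (inf_eq_right.2 U.2)))
  right_inv U := Subtype.ext (Submodule.comap_map_eq_of_injective W.1.injective_subtype _)
def eQuot {M : Ob F} (U : M.S) : {W : M.S // U.1 ≤ W.1} ≃ (M.quot U).S where
  toFun W := ⟨W.1.1.map U.1.mkQ, by rintro _ ⟨v, hv, rfl⟩; exact ⟨_, W.1.2 v hv, rfl⟩⟩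
  invFun W := ⟨⟨W.1.comap U.1.mkQ, fun v hv => W.2 _ hv⟩, Submodule.le_comap_mkQ _ _⟩
  left_inv W := Subtype.ext (Subtype.ext ((Submodule.comap_map_mkQ _ _).trans (sup_eq_right.2 W.2)))
  right_inv W := Subtype.ext (Submodule.map_comap_eq_of_surjective U.1.mkQ_surjective _)
theorem iso1 {M : Ob F} (W : M.S) (U : {U : M.S // U.1 ≤ W.1}) :
    Iso ((M.sub W).sub (eSub W U)) (M.sub U) :=
  iso_sub (M := (M.sub W).sub (eSub W U)) (W.1.subtype ∘ₗ (eSub W U).1.subtype) (fun _ => rfl) _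
    (Subtype.val_injective.comp Subtype.val_injective) (by
      rw [LinearMap.range_comp, Submodule.range_subtype]
      exact congrArg (fun z => z.1.1) ((eSub W).left_inv U))
theorem iso2 {M : Ob F} (U : M.S) (W : {W : M.S // U.1 ≤ W.1}) :
    Iso (M.quot W) ((M.quot U).quot (eQuot U W)) :=
  iso_quot (N := (M.quot U).quot (eQuot U W)) ((eQuot U W).1.mkQ ∘ₗ U.1.mkQ) (fun _ => rfl) _
    ((Submodule.mkQ_surjective _).comp (Submodule.mkQ_surjective _)) (by
      rw [LinearMap.ker_comp, Submodule.ker_mkQ]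
      exact congrArg (fun z => z.1.1) ((eQuot U).left_inv W))
theorem iso3 {M : Ob F} (U W : M.S) (h : U.1 ≤ W.1) :
    Iso ((M.sub W).quot (eSub W ⟨U, h⟩)) ((M.quot U).sub (eQuot U ⟨W, h⟩)) :=
  iso_qs (M := M.sub W) (N := M.quot U) (U.1.mkQ ∘ₗ W.1.subtype) (fun _ => rfl) _ _
    (by rw [LinearMap.ker_comp, Submodule.ker_mkQ]; rfl)
    (by rw [LinearMap.range_comp, Submodule.range_subtype]; rfl)
theorem d_zero_iff {M : Ob F} : M.d = 0 ↔ Subsingleton M.V := Module.finrank_zero_iff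
namespace Hall
variable {K : Type u} [Ring K]
instance : Mul (Hall F K) := ⟨fun a b => ⟨fun M => ∑ W : M.S, a (M.sub W) * b (M.quot W), fun {M N} ⟨e, h⟩ =>
  Fintype.sum_equiv (mapS e h) _ _ fun W => by rw [a.inv (mapS_sub e h W), b.inv (mapS_quot e h W)]⟩⟩
instance : One (Hall F K) := ⟨⟨fun M => if M.d = 0 then 1 else 0, fun h => by rw [h.d]⟩⟩
theorem mul_f (a b : Hall F K) (M) : (a * b).f M = ∑ W : M.S, a (M.sub W) * b (M.quot W) := rfl
theorem one_f (M) : (1 : Hall F K).f M = if M.d = 0 then 1 else 0 := rfl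
instance : Ring (Hall F K) where
  __ := (inferInstance : AddCommGroup (Hall F K))
  zero_mul a := by ext M; simp [mul_f]
  mul_zero a := by ext M; simp [mul_f]
  left_distrib a b c := by ext M; simp [mul_f, mul_add, Finset.sum_add_distrib]
  right_distrib a b c := by ext M; simp [mul_f, add_mul, Finset.sum_add_distrib]
  one_mul a := by
    ext M
    rw [mul_f, Fintype.sum_eq_single ⟨⊥, by simp⟩]
    · rw [one_f, if_pos (by exact finrank_bot F M.V), one_mul]
      exact a.inv (iso_quot (M := M) LinearMap.id (fun _ => rfl) _ Function.surjective_id (by simp))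
    · intro W hW
      rw [one_f, if_neg, zero_mul]
      intro h; exact hW (Subtype.ext (Submodule.finrank_eq_zero.1 h))
  mul_one a := by
    ext M
    rw [mul_f, Fintype.sum_eq_single ⟨⊤, by simp⟩]
    · rw [one_f, if_pos, mul_one]
      · exact a.inv (iso_sub (M := M) LinearMap.id (fun _ => rfl) _ Function.injective_id (by simp)).symm
      · exact d_zero_iff.2 (Submodule.Quotient.subsingleton_iff.2 rfl)
    · intro W hW
      rw [one_f, if_neg, mul_zero]
      intro h; exact hW (Subtype.ext (Submodule.Quotient.subsingleton_iff.1 (d_zero_iff.1 h)))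
  mul_assoc a b c := by
    classical
    ext M
    simp only [mul_f, Finset.sum_mul, Finset.mul_sum]
    have e1 : ∀ (W : M.S) (φ : (M.sub W).S → K), ∑ U, φ U = ∑ U, φ (eSub W U) :=
      fun W φ => ((eSub W).sum_comp φ).symm
    have e2 : ∀ (W : M.S) (φ : (M.quot W).S → K), ∑ U, φ U = ∑ U, φ (eQuot W U) :=
      fun W φ => ((eQuot W).sum_comp φ).symm
    rw [Finset.sum_congr rfl fun W _ => e1 W _, Finset.sum_congr rfl fun W _ => e2 W _]
    rw [Finset.sum_sigma', Finset.sum_sigma']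
    refine Finset.sum_bij' (fun z _ => ⟨z.2.1, z.1, z.2.2⟩) (fun z _ => ⟨z.2.1, z.1, z.2.2⟩) (by simp) (by simp)
      (fun _ _ => rfl) (fun _ _ => rfl) fun z _ => ?_
    rw [a.inv (iso1 z.1 z.2), b.inv (iso3 z.2.1 z.1 z.2.2), c.inv (iso2 z.2.1 ⟨z.1, z.2.2⟩), mul_assoc]
instance {R : Type*} [CommSemiring R] [Algebra R K] : Algebra R (Hall F K) :=
  Algebra.ofModule (fun r a b => by ext M; simp [mul_f, Finset.smul_sum])
    (fun r a b => by ext M; simp [mul_f, Finset.smul_sum])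
end Hall
end GLW
end
end
section
universe u
open scoped MatrixGroups
noncomputable section
namespace GLW
variable {F : Type} [Field F] [Fintype F]
instance {V W : Type} [AddCommGroup V] [Module F V] [Finite V] [AddCommGroup W] [Module F W] [Finite W] :
    Finite (V →ₗ[F] W) := DFunLike.finite _
instance {V W : Type} [AddCommGroup V] [Module F V] [Finite V] [AddCommGroup W] [Module F W] [Finite W] :
    Fintype (V →ₗ[F] W) := Fintype.ofFinite _
abbrev ext (M N : Ob F) (B : N.V →ₗ[F] M.V) : Ob F :=
  ⟨M.V × N.V, (M.x ∘ₗ .fst F _ _ + B ∘ₗ .snd F _ _).prod (N.x ∘ₗ .snd F _ _)⟩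
def avg {X : Type} [Fintype X] (f : X → ℂ) : ℂ := (Fintype.card X : ℂ)⁻¹ * ∑ x, f x
theorem avg_equiv {X Y : Type} [Fintype X] [Fintype Y] (e : X ≃ Y) (f : Y → ℂ) : avg (fun x => f (e x)) = avg f := by
  rw [avg, avg, Fintype.card_congr e, e.sum_comp]
theorem avg_surj {X Y : Type} [AddCommGroup X] [AddCommGroup Y] [Fintype X] [Fintype Y] (e : X →+ Y)
    (he : Function.Surjective e) (f : Y → ℂ) : avg (fun x => f (e x)) = avg f := by
  classical
  have key : ∀ y, (Finset.univ.filter fun x => e x = y).card = (Finset.univ.filter fun x => e x = 0).card := by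
    intro y
    obtain ⟨x₀, rfl⟩ := he y
    refine Finset.card_bij' (fun x _ => x - x₀) (fun x _ => x + x₀) ?_ ?_ ?_ ?_ <;> simp +contextual
  have h1 : ∀ g : Y → ℂ, ∑ x, g (e x) = (Finset.univ.filter fun x => e x = 0).card * ∑ y, g y := by
    intro g
    rw [← Finset.sum_fiberwise (s := Finset.univ) (g := e), Finset.mul_sum]
    refine Finset.sum_congr rfl fun y _ => ?_
    rw [Finset.sum_congr rfl (g := fun _ => g y) (by simp +contextual), Finset.sum_const, key, nsmul_eq_mul]
  have h2 := h1 fun _ => 1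
  simp only [Finset.sum_const, Finset.card_univ, nsmul_eq_mul, mul_one] at h2
  have h3 : ((Finset.univ.filter fun x => e x = 0).card : ℂ) ≠ 0 := by
    simp only [ne_eq, Nat.cast_eq_zero, Finset.card_eq_zero]
    exact Finset.nonempty_iff_ne_empty.1 ⟨0, by simp⟩
  rw [avg, avg, h1, h2, mul_inv]; field_simp
theorem ext_congr {M M' N N' : Ob F} (e : M.V ≃ₗ[F] M'.V) (h : ∀ v, e (M.x v) = M'.x (e v))
    (e' : N.V ≃ₗ[F] N'.V) (h' : ∀ v, e' (N.x v) = N'.x (e' v)) (B : N.V →ₗ[F] M.V) :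
    Iso (ext M N B) (ext M' N' (e'.arrowCongr e B)) :=
  ⟨e.prodCongr e', fun v => by simp [h, h']⟩
def Phi (a : Hall F ℂ) : Hall F (Hall F ℂ) where
  f M := ⟨fun N => avg fun B => a (ext M N B), fun {N N'} ⟨e, h⟩ => by
    rw [← avg_equiv (e.arrowCongr (.refl F M.V)).toEquiv]
    congr 1; ext B; exact a.inv (ext_congr (.refl F M.V) (fun _ => rfl) e h B)⟩
  inv {M M'} := fun ⟨e, h⟩ => by
    ext N; change avg _ = avg _
    rw [← avg_equiv ((LinearEquiv.refl F N.V).arrowCongr e).toEquiv]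
    congr 1; ext B; exact a.inv (ext_congr e h (.refl F N.V) (fun _ => rfl) B)
theorem Phi_f (a : Hall F ℂ) (M N : Ob F) : (Phi a M).f N = avg fun B => a (ext M N B) := rfl
section mackey
variable {M N : Ob F}
def shear {V W : Type} [AddCommGroup V] [Module F V] [AddCommGroup W] [Module F W] (C : W →ₗ[F] V) : (V × W) ≃ₗ[F] V × W :=
  LinearEquiv.ofLinear ((LinearMap.fst F _ _ + C ∘ₗ .snd F _ _).prod (.snd F _ _))
    ((LinearMap.fst F _ _ - C ∘ₗ .snd F _ _).prod (.snd F _ _)) (by ext <;> simp) (by ext <;> simp)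
theorem shear_apply {V W : Type} [AddCommGroup V] [Module F V] [AddCommGroup W] [Module F W] (C : W →ₗ[F] V) (v) : shear C v = (v.1 + C v.2, v.2) := rfl
theorem shear_ext (C B : N.V →ₗ[F] M.V) (v) :
    shear C ((ext M N B).x v) = (ext M N (B - M.x ∘ₗ C + C ∘ₗ N.x)).x (shear C v) := by
  simp [shear_apply]; abel
def Hp (W₁ : M.S) (W₂ : N.S) : AddSubgroup (N.V →ₗ[F] M.V) where
  carrier := {C | ∀ w ∈ W₂.1, C w ∈ W₁.1}
  zero_mem' := by simp
  add_mem' h h' w hw := add_mem (h w hw) (h' w hw)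
  neg_mem' h w hw := neg_mem (h w hw)
instance (W₁ : M.S) (W₂ : N.S) : Fintype (Hp W₁ W₂) := Fintype.ofFinite _
theorem shear_iff (W : Submodule F (M.V × N.V)) (C : N.V →ₗ[F] M.V) :
    ((W.comap (.inl F _ _)).prod (W.map (.snd F _ _))).map (shear C).toLinearMap = W ↔
      ∀ w ∈ W.map (.snd F _ _), (C w, w) ∈ W := by
  constructor
  · intro h w hw
    rw [← h]
    exact ⟨(0, w), ⟨W.zero_mem, hw⟩, by simp [shear_apply]⟩
  · intro h
    apply le_antisymm
    · rintro _ ⟨⟨v, w⟩, ⟨hv, hw⟩, rfl⟩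
      have := W.add_mem hv (h w hw)
      simpa [shear_apply] using this
    · rintro ⟨a, w⟩ hw
      have hw' : w ∈ W.map (.snd F _ _) := ⟨_, hw, rfl⟩
      have := W.sub_mem hw (h w hw')
      exact ⟨(a - C w, w), ⟨by simpa using this, hw'⟩, by simp [shear_apply]⟩
theorem shear_cnt (W : Submodule F (M.V × N.V)) (W₁ : M.S) (W₂ : N.S) (h₁ : W.comap (.inl F _ _) = W₁.1)
    (h₂ : W.map (.snd F _ _) = W₂.1) :
    Nat.card {C : N.V →ₗ[F] M.V // (W₁.1.prod W₂.1).map (shear C).toLinearMap = W} = Nat.card (Hp W₁ W₂) := by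
  have hs : Function.Surjective ((LinearMap.snd F M.V N.V).restrict (p := W) (q := W.map (.snd F _ _))
      (fun v hv => ⟨v, hv, rfl⟩)) := by
    rintro ⟨_, v, hv, rfl⟩; exact ⟨⟨v, hv⟩, rfl⟩
  obtain ⟨s, hs'⟩ := LinearMap.exists_rightInverse_of_surjective _ (LinearMap.range_eq_top.2 hs)
  obtain ⟨C₀, hC₀⟩ := LinearMap.exists_extend (LinearMap.fst F M.V N.V ∘ₗ W.subtype ∘ₗ s)
  have hC : ∀ w ∈ W.map (.snd F _ _), (C₀ w, w) ∈ W := by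
    intro w hw
    have e1 := LinearMap.congr_fun hC₀ ⟨w, hw⟩
    have e2 := congrArg Subtype.val (LinearMap.congr_fun hs' ⟨w, hw⟩)
    have : (C₀ w, w) = (s ⟨w, hw⟩ : M.V × N.V) := Prod.ext e1 e2.symm
    rw [this]; exact (s _).2
  rw [← h₁, ← h₂]
  refine Nat.card_congr ⟨fun C => ⟨C.1 - C₀, fun w hw => ?_⟩, fun C => ⟨C.1 + C₀, ?_⟩, fun C => by simp, fun C => by simp⟩
  · rw [← h₁]; rw [← h₂] at hw
    have := W.sub_mem ((shear_iff W C.1).1 C.2 w hw) (hC w hw)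
    simpa using this
  · rw [shear_iff]
    intro w hw
    have h3 : (C.1 w, 0) ∈ W := by
      have := C.2 w (by rwa [← h₂]); rw [← h₁] at this; exact this
    have := W.add_mem h3 (hC w hw)
    simpa using this
theorem prod_mem_iff (W₁ : M.S) (W₂ : N.S) (B : N.V →ₗ[F] M.V) :
    (∀ v ∈ W₁.1.prod W₂.1, (ext M N B).x v ∈ W₁.1.prod W₂.1) ↔ B ∈ Hp W₁ W₂ := by
  constructor
  · intro h w hw
    simpa using (h (0, w) ⟨by simp, hw⟩).1
  · rintro h ⟨v, w⟩ ⟨hv, hw⟩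
    exact ⟨add_mem (W₁.2 v hv) (h w hw), W₂.2 w hw⟩
def HpMap (W₁ : M.S) (W₂ : N.S) : Hp W₁ W₂ →+ (W₂.1 →ₗ[F] W₁.1) × ((N.V ⧸ W₂.1) →ₗ[F] (M.V ⧸ W₁.1)) where
  toFun B := (B.1.restrict B.2, W₂.1.mapQ W₁.1 B.1 B.2)
  map_zero' := by
    refine Prod.ext ?_ ?_
    · ext; simp
    · ext; simp
  map_add' B B' := by
    refine Prod.ext ?_ ?_
    · ext; rfl
    · ext; rfl
theorem HpMap_surj (W₁ : M.S) (W₂ : N.S) : Function.Surjective (HpMap W₁ W₂) := by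
  rintro ⟨β, γ⟩
  obtain ⟨P, hP⟩ := W₂.1.subtype.exists_leftInverse_of_injective (by simp)
  obtain ⟨s, hs⟩ := W₁.1.mkQ.exists_rightInverse_of_surjective (by simp)
  have hP' : ∀ w : W₂.1, P w = w := fun w => LinearMap.congr_fun hP w
  have hs' : ∀ w, W₁.1.mkQ (s w) = w := fun w => LinearMap.congr_fun hs w
  let B : N.V →ₗ[F] M.V := W₁.1.subtype ∘ₗ β ∘ₗ P + s ∘ₗ γ ∘ₗ W₂.1.mkQ ∘ₗ (LinearMap.id - W₂.1.subtype ∘ₗ P)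
  have hB : ∀ w : W₂.1, B w = β w := by
    intro w; simp [B, hP']
  refine ⟨⟨B, fun w hw => by rw [hB ⟨w, hw⟩]; exact (β _).2⟩, Prod.ext ?_ ?_⟩
  · ext w; exact hB w
  · ext w
    change W₁.1.mkQ (B w) = γ (W₂.1.mkQ w)
    simp only [B, LinearMap.add_apply, LinearMap.comp_apply, map_add, hs']
    rw [LinearMap.sub_apply, map_sub, LinearMap.comp_apply]
    have e1 : W₁.1.mkQ (W₁.1.subtype (β (P w))) = 0 := (Submodule.Quotient.mk_eq_zero _).2 (β (P w)).2
    have e2 : W₂.1.mkQ (W₂.1.subtype (P w)) = 0 := (Submodule.Quotient.mk_eq_zero _).2 (P w).2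
    rw [e1, e2]; simp
theorem iso_prod_sub (W₁ : M.S) (W₂ : N.S) (B : Hp W₁ W₂) :
    Iso (ext (M.sub W₁) (N.sub W₂) (HpMap W₁ W₂ B).1)
      ((ext M N B.1).sub ⟨W₁.1.prod W₂.1, (prod_mem_iff W₁ W₂ B.1).2 B.2⟩) :=
  iso_sub (W₁.1.subtype.prodMap W₂.1.subtype) (fun v => rfl) _
    (Function.Injective.prodMap Subtype.val_injective Subtype.val_injective)
    (by rw [LinearMap.range_prodMap]; simp)
theorem iso_prod_quot (W₁ : M.S) (W₂ : N.S) (B : Hp W₁ W₂) :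
    Iso ((ext M N B.1).quot ⟨W₁.1.prod W₂.1, (prod_mem_iff W₁ W₂ B.1).2 B.2⟩)
      (ext (M.quot W₁) (N.quot W₂) (HpMap W₁ W₂ B).2) :=
  iso_quot (W₁.1.mkQ.prodMap W₂.1.mkQ) (fun v => rfl) _
    (Function.Surjective.prodMap (Submodule.mkQ_surjective _) (Submodule.mkQ_surjective _))
    (by rw [LinearMap.ker_prodMap]; simp)
open Classical in
theorem mackey (a b : Hall F ℂ) (M N : Ob F) :
    (Phi (a * b) M).f N = ∑ W₁ : M.S, ∑ W₂ : N.S,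
      (Phi a (M.sub W₁)).f (N.sub W₂) * (Phi b (M.quot W₁)).f (N.quot W₂) := by
  let T (W₁ : M.S) (W₂ : N.S) (B : N.V →ₗ[F] M.V) (C : N.V →ₗ[F] M.V) : ℂ :=
    ∑ W : (ext M N B).S, if (W₁.1.prod W₂.1).map (shear C).toLinearMap = W.1 then
      a ((ext M N B).sub W) * b ((ext M N B).quot W) else 0
  have h1 : ∀ B, (a * b) (ext M N B) = ∑ W₁ : M.S, ∑ W₂ : N.S, (Fintype.card (Hp W₁ W₂) : ℂ)⁻¹ * ∑ C, T W₁ W₂ B C := by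
    intro B
    rw [Hall.mul_f]
    have h : ∀ W₁ W₂, (Fintype.card (Hp W₁ W₂) : ℂ)⁻¹ * ∑ C, T W₁ W₂ B C = ∑ W : (ext M N B).S,
        if W.1.comap (.inl F _ _) = W₁.1 ∧ W.1.map (.snd F _ _) = W₂.1 then
          a ((ext M N B).sub W) * b ((ext M N B).quot W) else 0 := by
      intro W₁ W₂
      simp only [T]
      rw [Finset.sum_comm, Finset.mul_sum]
      refine Finset.sum_congr rfl fun W _ => ?_
      split_ifs with hW
      · have := shear_cnt W.1 W₁ W₂ hW.1 hW.2
        rw [Nat.card_eq_fintype_card, Nat.card_eq_fintype_card, Fintype.card_subtype] at this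
        rw [← Finset.sum_filter, Finset.sum_const, this, nsmul_eq_mul, ← mul_assoc, inv_mul_cancel₀, one_mul]
        exact Nat.cast_ne_zero.2 Fintype.card_ne_zero
      · rw [Finset.sum_eq_zero, mul_zero]
        intro C _
        rw [if_neg]
        rintro h
        apply hW
        rw [← h]
        constructor
        · ext v
          simp only [Submodule.mem_comap, Submodule.mem_map, LinearMap.inl_apply]
          constructor
          · rintro ⟨⟨v', w'⟩, ⟨h1, h2⟩, h3⟩
            simp only [LinearEquiv.coe_coe, shear_apply, Prod.mk.injEq] at h3
            rw [h3.2, map_zero, add_zero] at h3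
            rw [← h3.1]; exact h1
          · intro hv
            exact ⟨(v, 0), ⟨hv, by simp⟩, by simp [shear_apply]⟩
        · ext w
          simp only [Submodule.mem_map, exists_exists_and_eq_and]
          constructor
          · rintro ⟨v, h1, rfl⟩; exact h1.2
          · intro h; exact ⟨(0, w), ⟨by simp, h⟩, by simp [shear_apply]⟩
    simp_rw [h]
    symm
    calc _ = ∑ W₁ : M.S, ∑ W : (ext M N B).S, ∑ W₂ : N.S, _ := Finset.sum_congr rfl fun W₁ _ => Finset.sum_comm
      _ = ∑ W : (ext M N B).S, ∑ W₁ : M.S, ∑ W₂ : N.S, _ := Finset.sum_comm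
      _ = _ := ?_
    refine Finset.sum_congr rfl fun W _ => ?_
    let W1 : M.S := ⟨W.1.comap (.inl F _ _), fun v hv => by
        have := W.2 _ hv; simpa using this⟩
    let W2 : N.S := ⟨W.1.map (.snd F _ _), by
        rintro _ ⟨v, hv, rfl⟩; exact ⟨_, W.2 _ hv, rfl⟩⟩
    refine (Fintype.sum_eq_single W1 ?_).trans ((Fintype.sum_eq_single W2 ?_).trans ?_)
    · intro W₁ h; apply Finset.sum_eq_zero; intro W₂ _; rw [if_neg]; rintro ⟨h', _⟩; exact h (Subtype.ext h'.symm)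
    · intro W₂ h; rw [if_neg]; rintro ⟨_, h'⟩; exact h (Subtype.ext h'.symm)
    · rw [if_pos ⟨rfl, rfl⟩]
  have h2 : ∀ W₁ W₂ C, ∑ B, T W₁ W₂ B C = ∑ B, T W₁ W₂ B 0 := by
    intro W₁ W₂ C
    rw [← Equiv.sum_comp (Equiv.addRight (- M.x ∘ₗ C + C ∘ₗ N.x))]
    refine Finset.sum_congr rfl fun B _ => ?_
    have e : (Equiv.addRight (- M.x ∘ₗ C + C ∘ₗ N.x)) B = B - M.x ∘ₗ C + C ∘ₗ N.x := by
      ext; simp; abel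
    rw [e]
    simp only [T]
    rw [← (mapS (M := ext M N B) (N := ext M N (B - M.x ∘ₗ C + C ∘ₗ N.x)) (shear C) (shear_ext C B)).sum_comp]
    refine Finset.sum_congr rfl fun W _ => ?_
    rw [a.inv (mapS_sub (M := ext M N B) (N := ext M N (B - M.x ∘ₗ C + C ∘ₗ N.x)) (shear C) (shear_ext C B) W), b.inv (mapS_quot (M := ext M N B) (N := ext M N (B - M.x ∘ₗ C + C ∘ₗ N.x)) (shear C) (shear_ext C B) W)]
    congr 1
    have : (shear (0 : N.V →ₗ[F] M.V)).toLinearMap = LinearMap.id := by ext <;> simp [shear_apply]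
    rw [this, Submodule.map_id]
    exact propext (Submodule.map_injective_of_injective (shear C).injective).eq_iff
  have h3 : ∀ W₁ W₂, ∑ B, T W₁ W₂ B 0 = ∑ B : Hp W₁ W₂,
      a (ext (M.sub W₁) (N.sub W₂) (HpMap W₁ W₂ B).1) * b (ext (M.quot W₁) (N.quot W₂) (HpMap W₁ W₂ B).2) := by
    intro W₁ W₂
    have h0 : (shear (0 : N.V →ₗ[F] M.V)).toLinearMap = LinearMap.id := by ext <;> simp [shear_apply]
    have hz : ∀ B, B ∉ Hp W₁ W₂ → T W₁ W₂ B 0 = 0 := by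
      intro B hB
      refine Finset.sum_eq_zero fun W _ => if_neg fun h => hB ?_
      rw [h0, Submodule.map_id] at h
      rw [← prod_mem_iff, h]; exact W.2
    have hs : ∑ B : Hp W₁ W₂, T W₁ W₂ B.1 0 = ∑ B, T W₁ W₂ B 0 := by
      rw [← Finset.sum_subset (Finset.subset_univ (Finset.univ.filter fun B => B ∈ Hp W₁ W₂))
        (fun B _ hB => hz B (by simpa using hB))]
      exact (Finset.sum_subtype (Finset.univ.filter fun B => B ∈ Hp W₁ W₂) (by simp) fun B => T W₁ W₂ B 0).symm
    rw [← hs]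
    refine Finset.sum_congr rfl fun B _ => ?_
    let W0 : (ext M N B.1).S := ⟨W₁.1.prod W₂.1, (prod_mem_iff W₁ W₂ B.1).2 B.2⟩
    refine (Fintype.sum_eq_single W0 ?_).trans ?_
    · intro W h; rw [if_neg]; intro h'; rw [h0, Submodule.map_id] at h'; exact h (Subtype.ext h'.symm)
    · rw [if_pos (by rw [h0, Submodule.map_id]), a.inv (iso_prod_sub W₁ W₂ B), b.inv (iso_prod_quot W₁ W₂ B)]
  rw [Phi_f, avg]
  simp_rw [h1]
  rw [Finset.sum_comm, Finset.mul_sum]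
  refine Finset.sum_congr rfl fun W₁ _ => ?_
  rw [Finset.sum_comm, Finset.mul_sum]
  refine Finset.sum_congr rfl fun W₂ _ => ?_
  rw [← Finset.mul_sum, Finset.sum_comm, Finset.sum_congr rfl fun C _ => h2 W₁ W₂ C, Finset.sum_const, h3, Finset.card_univ,
    nsmul_eq_mul, mul_left_comm, inv_mul_cancel_left₀ (Nat.cast_ne_zero.2 Fintype.card_ne_zero)]
  refine (avg_surj (HpMap W₁ W₂) (HpMap_surj W₁ W₂) fun z =>
    a (ext (M.sub W₁) (N.sub W₂) z.1) * b (ext (M.quot W₁) (N.quot W₂) z.2)).trans ?_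
  rw [avg, Phi_f, Phi_f, avg, avg, Fintype.sum_prod_type, Fintype.card_prod, mul_mul_mul_comm, Finset.sum_mul_sum, Nat.cast_mul, mul_inv]
end mackey
end GLW
end
end
section
universe u
open scoped MatrixGroups
noncomputable section
namespace GLW
variable {F : Type} [Field F] [Fintype F]
abbrev mat (n : ℕ) (x : Module.End F (Fin n → F)) : Ob F := ⟨Fin n → F, x⟩
instance : Fintype (Module.End F (Fin n → F)) := Fintype.ofFinite _
instance {V W : Type} [AddCommGroup V] [Module F V] [Finite V] [AddCommGroup W] [Module F W] [Finite W] :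
    Finite (V ≃ₗ[F] W) := DFunLike.finite _
instance {V W : Type} [AddCommGroup V] [Module F V] [Finite V] [AddCommGroup W] [Module F W] [Finite W] :
    Fintype (V ≃ₗ[F] W) := Fintype.ofFinite _
instance {V : Type} [AddCommGroup V] [Module F V] [Finite V] : Finite (Submodule F V) :=
  Finite.of_injective _ SetLike.coe_injective
instance {V : Type} [AddCommGroup V] [Module F V] [Finite V] : Fintype (Submodule F V) := Fintype.ofFinite _
variable (F) in
def gl (n : ℕ) : ℕ := Fintype.card ((Fin n → F) ≃ₗ[F] (Fin n → F))
theorem gl_pos (n) : (gl F n : ℂ) ≠ 0 := Nat.cast_ne_zero.2 Fintype.card_ne_zero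
theorem mat_d (n) (x) : (mat (F := F) n x).d = n := by simp [Ob.d]
def conjE {V V' : Type} [AddCommGroup V] [Module F V] [AddCommGroup V'] [Module F V'] (e : V ≃ₗ[F] V') :
  Module.End F V ≃ Module.End F V' := (e.conj).toEquiv
theorem iso_conj {V V' : Type} [AddCommGroup V] [Module F V] [AddCommGroup V'] [Module F V'] [Finite V] [Finite V'] (e : V ≃ₗ[F] V') (x) :
    Iso (⟨V, x⟩ : Ob F) ⟨V', conjE e x⟩ := ⟨e, fun v => by simp [conjE, LinearEquiv.conj_apply]⟩
theorem exists_mat (M : Ob F) : ∃ x, Iso M (mat M.d x) :=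
  ⟨_, iso_conj (LinearEquiv.ofFinrankEq M.V (Fin M.d → F) (by rw [Module.finrank_fin_fun]; rfl)) M.x⟩
variable {K : Type u} [AddCommGroup K] [Module ℂ K]
def pr (n : ℕ) (a : Hall F ℂ) (h : Hall F K) : K :=
  (gl F n : ℂ)⁻¹ • ∑ x, starRingEnd ℂ (a (mat n x)) • h (mat n x)
theorem pr_add_l (n) (a b : Hall F ℂ) (h : Hall F K) : pr n (a + b) h = pr n a h + pr n b h := by
  simp only [pr, Hall.add_f, map_add, add_smul, Finset.sum_add_distrib, smul_add]
theorem pr_sub_l (n) (a b : Hall F ℂ) (h : Hall F K) : pr n (a - b) h = pr n a h - pr n b h := by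
  simp only [pr, Hall.sub_f, map_sub, sub_smul, Finset.sum_sub_distrib, smul_sub]
theorem pr_smul_l (n) (r : ℂ) (a : Hall F ℂ) (h : Hall F K) : pr n (r • a) h = starRingEnd ℂ r • pr n a h := by
  simp only [pr, Hall.smul_f, smul_eq_mul, map_mul, mul_smul, ← Finset.smul_sum]
  rw [smul_comm]
abbrev ip (n : ℕ) (a h : Hall F ℂ) : ℂ := pr n a h
abbrev perp (n : ℕ) (a h : Hall F ℂ) : Hall F ℂ := pr n a (Phi h)
section adj
variable (a b h : Hall F ℂ)
open Classical in
def GG (M : Ob F) (W : Submodule F M.V) : ℂ :=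
  if H : ∀ v ∈ W, M.x v ∈ W then starRingEnd ℂ (a (M.sub ⟨W, H⟩) * b (M.quot ⟨W, H⟩)) * h M else 0
theorem GG_inv {M N : Ob F} (e : M.V ≃ₗ[F] N.V) (he : ∀ v, e (M.x v) = N.x (e v)) (W) :
    GG a b h N (W.map e.toLinearMap) = GG a b h M W := by
  by_cases H : ∀ v ∈ W, M.x v ∈ W
  · have H' := (mapS e he ⟨W, H⟩).2
    refine (dif_pos H').trans (Eq.trans ?_ (dif_pos H).symm)
    rw [h.inv ⟨e, he⟩, a.inv (mapS_sub e he ⟨W, H⟩), b.inv (mapS_quot e he ⟨W, H⟩)]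
    rfl
  · rw [GG, GG, dif_neg H, dif_neg]
    intro H'
    apply H
    intro v hv
    obtain ⟨w, hw, hw'⟩ := H' _ ⟨v, hv, rfl⟩
    have : e w = e (M.x v) := by rw [he]; exact hw'
    rw [← e.injective this]; exact hw
abbrev U1 (F : Type) [Field F] (i j : ℕ) : Submodule F ((Fin i → F) × (Fin j → F)) := (⊤ : Submodule F (Fin i → F)).prod ⊥
theorem U1_x (i j) (x : Module.End F ((Fin i → F) × (Fin j → F))) (H : ∀ v ∈ U1 F i j, x v ∈ U1 F i j) (v) : (x (v, 0)).2 = 0 :=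
  (H (v, 0) ⟨trivial, by simp⟩).2
theorem sum_U (i j : ℕ) : ∑ x : Module.End F ((Fin i → F) × (Fin j → F)), GG a b h ⟨_, x⟩ (U1 F i j) =
    Fintype.card ((Fin j → F) →ₗ[F] (Fin i → F)) * ∑ y : Module.End F (Fin j → F), starRingEnd ℂ (b (mat j y)) *
      ∑ x : Module.End F (Fin i → F), starRingEnd ℂ (a (mat i x)) * (Phi h (mat i x)).f (mat j y) := by
  classical
  simp_rw [Phi_f, avg, Finset.mul_sum]
  rw [← Finset.sum_product']
  refine Eq.trans ?_ (Finset.sum_product (Finset.univ ×ˢ Finset.univ) Finset.univ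
    fun z : (Module.End F (Fin j → F) × Module.End F (Fin i → F)) × ((Fin j → F) →ₗ[F] Fin i → F) =>
      (Fintype.card ((Fin j → F) →ₗ[F] Fin i → F) : ℂ) * ((starRingEnd ℂ) (b.f (mat j z.1.1)) * ((starRingEnd ℂ) (a.f (mat i z.1.2)) *
        ((Fintype.card ((Fin j → F) →ₗ[F] Fin i → F) : ℂ)⁻¹ * h.f (ext (mat i z.1.2) (mat j z.1.1) z.2)))))
  rw [
    ← Finset.sum_subset (Finset.subset_univ (Finset.univ.filter fun x : Module.End F ((Fin i → F) × (Fin j → F)) => ∀ v ∈ U1 F i j, x v ∈ U1 F i j))]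
  · refine Finset.sum_bij' (fun x _ => ((.snd F _ _ ∘ₗ x ∘ₗ .inr F _ _, .fst F _ _ ∘ₗ x ∘ₗ .inl F _ _), .fst F _ _ ∘ₗ x ∘ₗ .inr F _ _))
      (fun z _ => (ext (mat i z.1.2) (mat j z.1.1) z.2).x) (by simp) ?_ ?_ ?_ ?_
    · rintro ⟨⟨y, x⟩, B⟩ _
      simp only [Finset.mem_filter, Finset.mem_univ, true_and]
      rintro ⟨v, w⟩ ⟨_, hw⟩
      simp at hw
      simp [hw]
    · intro x hx
      have hx := U1_x i j x (by simpa using hx)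
      refine LinearMap.ext fun v => ?_
      have : x v = x (v.1, 0) + x (0, v.2) := by rw [← map_add]; simp
      rw [this]
      refine Prod.ext ?_ ?_
      · rfl
      · simp [hx]
    · rintro ⟨⟨y, x⟩, B⟩ _
      refine Prod.ext (Prod.ext ?_ ?_) ?_ <;> · refine LinearMap.ext fun v => ?_; simp
    · intro x hx
      have H : ∀ v ∈ U1 F i j, x v ∈ U1 F i j := by simpa using hx
      have hx := U1_x i j x H
      have hx' : x = (ext (mat i (.fst F _ _ ∘ₗ x ∘ₗ .inl F _ _)) (mat j (.snd F _ _ ∘ₗ x ∘ₗ .inr F _ _)) (.fst F _ _ ∘ₗ x ∘ₗ .inr F _ _)).x := by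
        refine LinearMap.ext fun v => ?_
        have : x v = x (v.1, 0) + x (0, v.2) := by rw [← map_add]; simp
        rw [this]
        refine Prod.ext ?_ ?_
        · rfl
        · simp [hx]
      rw [GG, dif_pos H]
      rw [← a.inv (iso_sub (M := mat i (.fst F _ _ ∘ₗ x ∘ₗ .inl F _ _)) (N := ⟨_, x⟩) (.inl F _ _) (fun v => Prod.ext rfl (hx v).symm) ⟨_, H⟩
        LinearMap.inl_injective (by rw [LinearMap.range_inl]; ext; simp)),
        b.inv (iso_quot (M := ⟨_, x⟩) (N := mat j (.snd F _ _ ∘ₗ x ∘ₗ .inr F _ _)) (.snd F _ _) (fun v => by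
          have : x v = x (v.1, 0) + x (0, v.2) := by rw [← map_add]; simp
          rw [this]; simp [hx]) ⟨_, H⟩
        LinearMap.snd_surjective (by ext; simp))]
      have hh := congrArg (fun x => h ⟨_, x⟩) hx'
      rw [map_mul]
      refine (congrArg _ hh).trans ?_
      have := Nat.cast_ne_zero (R := ℂ).2 (Fintype.card_ne_zero (α := ((Fin j → F) →ₗ[F] (Fin i → F))))
      field_simp
  · intro x _ hx
    rw [GG, dif_neg]; simpa using hx
theorem stab_cnt (i j : ℕ) : Nat.card {g : ((Fin i → F) × (Fin j → F)) ≃ₗ[F] ((Fin i → F) × (Fin j → F)) // (U1 F i j).map g.toLinearMap = U1 F i j} =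
    gl F i * gl F j * Fintype.card ((Fin j → F) →ₗ[F] (Fin i → F)) := by
  rw [gl, gl, ← Fintype.card_prod, ← Fintype.card_prod, ← Nat.card_eq_fintype_card]
  symm
  refine Nat.card_eq_of_bijective (fun z => ⟨(z.1.1.prodCongr z.1.2).trans (shear z.2), ?_⟩) ⟨?_, ?_⟩
  · ext ⟨v, w⟩
    simp only [Submodule.mem_map, Submodule.mem_prod, Submodule.mem_top, true_and, Submodule.mem_bot, Prod.exists]
    constructor
    · rintro ⟨v', w', rfl, h⟩
      have := congrArg Prod.snd h
      simpa [shear_apply] using this.symm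
    · rintro rfl
      exact ⟨z.1.1.symm v, 0, rfl, by simp [shear_apply]⟩
  · rintro ⟨⟨α, β⟩, B⟩ ⟨⟨α', β'⟩, B'⟩ h
    have h : ∀ v w, (α v + B (β w), β w) = (α' v + B' (β' w), β' w) := fun v w =>
      LinearEquiv.congr_fun (congrArg Subtype.val h) (v, w)
    have h1 : β = β' := LinearEquiv.ext fun w => congrArg Prod.snd (h 0 w)
    have h2 : α = α' := LinearEquiv.ext fun v => by simpa using congrArg Prod.fst (h v 0)
    subst h1; subst h2
    have h3 : B = B' := LinearMap.ext fun w => by simpa using congrArg Prod.fst (h 0 (β.symm w))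
    rw [h3]
  · rintro ⟨g, hg⟩
    have hx := U1_x i j g.toLinearMap (fun v hv => by rw [← hg]; exact ⟨v, hv, rfl⟩)
    have hg' : ∀ v, g v = g (v.1, 0) + g (0, v.2) := fun v => by rw [← map_add]; simp
    have h1 : Function.Injective (LinearMap.fst F _ _ ∘ₗ g.toLinearMap ∘ₗ .inl F _ _) := by
      intro v v' h
      have : g (v, 0) = g (v', 0) := Prod.ext h ((hx v).trans (hx v').symm)
      simpa using this
    have h2 : Function.Surjective (LinearMap.snd F _ _ ∘ₗ g.toLinearMap ∘ₗ .inr F _ _) := by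
      intro w
      have := hg' (g.symm (0, w))
      rw [g.apply_symm_apply] at this
      refine ⟨(g.symm (0, w)).2, ?_⟩
      have h3 := congrArg Prod.snd this
      have h4 := hx (g.symm (0, w)).1
      simp only [Prod.snd_add] at h3
      erw [h4] at h3
      simp at h3 ⊢; exact h3.symm
    have h2' := LinearMap.injective_iff_surjective.2 h2
    let α := LinearEquiv.ofInjectiveEndo _ h1
    let β := LinearEquiv.ofInjectiveEndo _ h2'
    have hα : ∀ v, α v = (g (v, 0)).1 := fun v => rfl
    have hβ : ∀ v, β v = (g (0, v)).2 := fun v => rfl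
    refine ⟨((α, β), LinearMap.fst F _ _ ∘ₗ g.toLinearMap ∘ₗ .inr F _ _ ∘ₗ β.symm.toLinearMap), Subtype.ext (LinearEquiv.ext fun v => ?_)⟩
    have h4 : (g (v.1, 0)).2 = 0 := hx v.1
    rw [hg' v]
    refine Prod.ext ?_ ?_
    · simp [shear_apply, hα]
    · simp [shear_apply, hβ, h4]
open Classical in
theorem W_cnt {n i j : ℕ} (hij : i + j = n) :
    (Finset.univ.filter fun W : Submodule F (Fin n → F) => Module.finrank F W = i).card *
      (gl F i * gl F j * Fintype.card ((Fin j → F) →ₗ[F] (Fin i → F))) = gl F n ∧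
    ∀ W : Submodule F (Fin n → F), Module.finrank F W = i →
      ∃ e : ((Fin i → F) × (Fin j → F)) ≃ₗ[F] (Fin n → F), (U1 F i j).map e.toLinearMap = W := by
  have hex : ∀ W : Submodule F (Fin n → F), Module.finrank F W = i →
      ∃ e : ((Fin i → F) × (Fin j → F)) ≃ₗ[F] (Fin n → F), (U1 F i j).map e.toLinearMap = W := by
    intro W hW
    obtain ⟨W', hc⟩ := W.exists_isCompl
    have h1 := Submodule.finrank_add_eq_of_isCompl hc
    rw [hW, Module.finrank_fin_fun] at h1
    let e1 : (Fin i → F) ≃ₗ[F] W := LinearEquiv.ofFinrankEq _ _ (by simp [hW])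
    let e2 : (Fin j → F) ≃ₗ[F] W' := LinearEquiv.ofFinrankEq _ _ (by simp; omega)
    refine ⟨(e1.prodCongr e2).trans (W.prodEquivOfIsCompl W' hc), ?_⟩
    ext v
    constructor
    · rintro ⟨⟨u, w⟩, ⟨_, hw⟩, rfl⟩
      simp at hw
      simp [hw]
    · intro hv
      exact ⟨(e1.symm ⟨v, hv⟩, 0), ⟨trivial, by simp⟩, by simp⟩
  refine ⟨?_, hex⟩
  let e0 : ((Fin i → F) × (Fin j → F)) ≃ₗ[F] (Fin n → F) := LinearEquiv.ofFinrankEq _ _ (by simp [hij])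
  have h1 : gl F n = (Finset.univ : Finset (((Fin i → F) × (Fin j → F)) ≃ₗ[F] (Fin n → F))).card := by
    rw [Finset.card_univ, gl]
    exact Fintype.card_congr ⟨fun g => e0.trans g, fun g => e0.symm.trans g, fun g => by ext; simp, fun g => by ext <;> simp⟩
  rw [h1]; rw [Finset.card_eq_sum_card_fiberwise (s := (Finset.univ : Finset (((Fin i → F) × (Fin j → F)) ≃ₗ[F] (Fin n → F)))) (f := fun e => (U1 F i j).map e.toLinearMap) (t := Finset.univ.filter fun W : Submodule F (Fin n → F) => Module.finrank F W = i)]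
  · rw [Finset.sum_congr rfl (g := fun _ => gl F i * gl F j * Fintype.card ((Fin j → F) →ₗ[F] (Fin i → F))), Finset.sum_const, smul_eq_mul]
    intro W hW
    obtain ⟨e, he⟩ := hex W (by simpa using hW)
    rw [← stab_cnt, ← Fintype.card_subtype, ← Nat.card_eq_fintype_card]
    have hm : ∀ (f : ((Fin i → F) × (Fin j → F)) ≃ₗ[F] (Fin n → F)) (g : (Fin n → F) ≃ₗ[F] ((Fin i → F) × (Fin j → F))),
      (U1 F i j).map (f.trans g).toLinearMap = ((U1 F i j).map f.toLinearMap).map g.toLinearMap := fun f g => by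
        rw [← Submodule.map_comp]; rfl
    refine Nat.card_congr ⟨fun f => ⟨f.1.trans e.symm, ?_⟩, fun g => ⟨g.1.trans e, ?_⟩, fun f => by ext; simp, fun f => by ext <;> simp⟩
    · rw [hm, f.2, ← he, ← hm]; simp
    · have : (U1 F i j).map (g.1.trans e).toLinearMap = ((U1 F i j).map g.1.toLinearMap).map e.toLinearMap := by
        rw [← Submodule.map_comp]; rfl
      rw [this, g.2, he]
  · intro e _
    simp only [Finset.coe_filter, Set.mem_setOf_eq, Finset.mem_univ, true_and]
    rw [LinearEquiv.finrank_map_eq e, show U1 F i j = LinearMap.range (LinearMap.inl F _ _) from by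
      rw [LinearMap.range_inl]; ext; simp]
    rw [LinearMap.finrank_range_of_inj LinearMap.inl_injective]; simp
theorem adj (n : ℕ) : ip n (a * b) h = ∑ p ∈ Finset.HasAntidiagonal.antidiagonal n, ip p.2 b (perp p.1 a h) := by
  classical
  have h1 : ∀ M : Ob F, starRingEnd ℂ ((a * b) M) * h M = ∑ W : Submodule F M.V, GG a b h M W := by
    intro M
    rw [Hall.mul_f, map_sum, Finset.sum_mul]
    refine Fintype.sum_of_injective (fun W : M.S => W.1) Subtype.val_injective _ _ ?_ ?_
    · intro W hW
      refine dif_neg fun h => hW ⟨⟨W, h⟩, rfl⟩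
    · intro W; symm; unfold GG; exact dif_pos W.2
  rw [ip, pr]
  simp_rw [smul_eq_mul, h1]
  have hc : ∑ x : Module.End F (Fin n → F), ∑ W : Submodule F (Fin n → F), GG a b h (mat n x) W =
    ∑ W : Submodule F (Fin n → F), ∑ x : Module.End F (Fin n → F), GG a b h (mat n x) W := Finset.sum_comm
  rw [hc, ← Finset.sum_fiberwise_of_maps_to (s := Finset.univ) (t := Finset.HasAntidiagonal.antidiagonal n)
    (g := fun W : Submodule F (Fin n → F) => (Module.finrank F W, n - Module.finrank F W)), Finset.mul_sum]
  · refine Finset.sum_congr rfl fun p hp => ?_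
    obtain ⟨i, j⟩ := p
    have hij : i + j = n := by simpa using hp
    obtain ⟨h2, h3⟩ := W_cnt (F := F) hij
    rw [Finset.sum_congr (s₂ := Finset.univ.filter fun W : Submodule F (Fin n → F) => Module.finrank F W = i)
      (g := fun _ => ∑ x : Module.End F ((Fin i → F) × (Fin j → F)), GG a b h ⟨_, x⟩ (U1 F i j)), Finset.sum_const, sum_U, nsmul_eq_mul]
    · simp only [pr, Hall.smul_f, Hall.sum_f, smul_eq_mul, Finset.mul_sum]
      rw [← h2]
      push_cast
      have e1 := gl_pos (F := F) i
      have e2 := gl_pos (F := F) j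
      have e3 := gl_pos (F := F) n
      rw [← h2] at e3; push_cast at e3
      have e4 := left_ne_zero_of_mul e3
      have e5 := right_ne_zero_of_mul (right_ne_zero_of_mul e3)
      refine Finset.sum_congr rfl fun y _ => Finset.sum_congr rfl fun x _ => ?_
      field_simp
    · ext W; simp; omega
    · intro W hW
      obtain ⟨e, rfl⟩ := h3 W (by simpa using hW)
      rw [← (conjE e).sum_comp]
      refine Finset.sum_congr rfl fun x _ => ?_
      exact GG_inv a b h (M := ⟨_, x⟩) (N := ⟨_, conjE e x⟩) e (fun v => by simp [conjE, LinearEquiv.conj_apply]) _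
  · intro W _
    have := Submodule.finrank_le W
    simp at this ⊢; omega
end adj
end GLW
end
end
section
universe u
open scoped MatrixGroups
noncomputable section
namespace GLW
variable {F : Type} [Field F] [Fintype F]
theorem ext_d (M N : Ob F) (B) : (ext M N B).d = M.d + N.d := Module.finrank_prod
theorem ext_right {M N : Ob F} (h : N.d = 0) (B) : Iso (ext M N B) M := by
  have := d_zero_iff.1 h
  refine ⟨LinearEquiv.ofLinear (.fst F _ _) (.inl F _ _) (by ext; simp) ?_, fun v => ?_⟩
  · refine LinearMap.ext fun v => Prod.ext rfl (Subsingleton.elim _ _)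
  · simp [Subsingleton.elim v.2 0]
theorem ext_left {M N : Ob F} (h : M.d = 0) (B) : Iso (ext M N B) N := by
  have := d_zero_iff.1 h
  refine ⟨LinearEquiv.ofLinear (.snd F _ _) (.inr F _ _) (by ext; simp) ?_, fun v => ?_⟩
  · refine LinearMap.ext fun v => Prod.ext (Subsingleton.elim _ _) rfl
  · simp
theorem avg_const {X : Type} [Fintype X] [Nonempty X] (f : X → ℂ) (c : ℂ) (h : ∀ x, f x = c) : avg f = c := by
  simp [avg, h]
theorem Phi_right (a : Hall F ℂ) {M N : Ob F} (h : N.d = 0) : (Phi a M).f N = a M :=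
  avg_const _ _ fun B => a.inv (ext_right h B)
theorem Phi_left (a : Hall F ℂ) {M N : Ob F} (h : M.d = 0) : (Phi a M).f N = a N :=
  avg_const _ _ fun B => a.inv (ext_left h B)
variable (F) in
def PhiH : Hall F ℂ →ₐ[ℂ] Hall F (Hall F ℂ) := AlgHom.ofLinearMap
  { toFun := Phi
    map_add' := fun a b => by ext M N; simp [Phi_f, avg, Finset.sum_add_distrib, mul_add]
    map_smul' := fun r a => by
      ext M N; simp [Phi_f, avg, Finset.mul_sum]; exact Finset.sum_congr rfl fun _ _ => by ring }
  (by
    ext M N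
    refine (avg_const _ (if M.d + N.d = 0 then 1 else 0) fun B => by rw [Hall.one_f, ext_d]).trans ?_
    rw [Hall.one_f]
    by_cases h : M.d = 0 <;> simp [h, Hall.one_f])
  (fun a b => by
    ext M N
    exact (mackey a b M N).trans (by simp [Hall.mul_f, Hall.sum_f]))
theorem PhiH_apply (a : Hall F ℂ) : PhiH F a = Phi a := rfl
instance : Subsingleton (Fin 0 → F) := inferInstance
theorem gl_zero : gl F 0 = 1 := by
  rw [gl, Fintype.card_eq_one_iff_nonempty_unique]
  exact ⟨⟨⟨.refl _ _⟩, fun e => by ext v i; exact i.elim0⟩⟩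
theorem iso_zero {M N : Ob F} (h : M.d = 0) (h' : N.d = 0) : Iso M N := by
  have := d_zero_iff.1 h
  have := d_zero_iff.1 h'
  exact ⟨LinearEquiv.ofSubsingleton _ _, fun v => Subsingleton.elim _ _⟩
theorem pr_zero {K : Type u} [AddCommGroup K] [Module ℂ K] (a : Hall F ℂ) (h : Hall F K) : pr 0 a h = starRingEnd ℂ (a (mat 0 0)) • h (mat 0 0) := by
  rw [pr, gl_zero]
  have : ∀ x : Module.End F (Fin 0 → F), x = 0 := fun x => LinearMap.ext fun v => Subsingleton.elim _ _
  rw [Fintype.sum_eq_single 0 (fun x hx => absurd (this x) hx)]; simp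
theorem ip_self_zero {n : ℕ} {c : Hall F ℂ} (h : ip n c c = 0) {M : Ob F} (hM : M.d = n) : c M = 0 := by
  subst hM
  obtain ⟨x, hx⟩ := exists_mat M
  rw [c.inv hx]
  rw [ip, pr, smul_eq_mul, mul_eq_zero, or_iff_right (inv_ne_zero (gl_pos _))] at h
  simp_rw [smul_eq_mul, Complex.conj_mul'] at h
  norm_cast at h
  rw [Finset.sum_eq_zero_iff_of_nonneg (fun _ _ => by positivity)] at h
  simpa using h x (Finset.mem_univ _)
variable (F) in
def isoSetoid : Setoid (Ob F) := ⟨Iso, Iso.refl, Iso.symm, Iso.trans⟩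
open Classical in
def ind {K : Type u} [Ring K] (X : Ob F) : Hall F K :=
  ⟨fun M => if Iso M X then 1 else 0, fun {M N} h => by
    have : Iso M X ↔ Iso N X := ⟨h.symm.trans, h.trans⟩
    simp only [this]⟩
open Classical in
theorem ind_f {K : Type u} [Ring K] (X M : Ob F) : (ind X : Hall F K) M = if Iso M X then 1 else 0 := rfl
open Classical in
theorem comm_aux (M : Ob F) (H : ∀ a b : Hall F ℂ, (a * b) M = (b * a) M) {A : Type u} [AddCommMonoid A] (γ : Ob F → Ob F → A)
    (h1 : ∀ {X X'} Y, Iso X X' → γ X Y = γ X' Y) (h2 : ∀ X {Y Y'}, Iso Y Y' → γ X Y = γ X Y') :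
    ∑ W : M.S, γ (M.sub W) (M.quot W) = ∑ W : M.S, γ (M.quot W) (M.sub W) := by
  let Q := Quotient (isoSetoid F)
  let π : Ob F → Q := Quotient.mk _
  let γ' : Q × Q → A := fun z => Quotient.lift₂ (s₁ := isoSetoid F) (s₂ := isoSetoid F) γ (fun a b c d h h' => (h1 _ h).trans (h2 _ h')) z.1 z.2
  have key : (Finset.univ : Finset M.S).val.map (fun W => (π (M.sub W), π (M.quot W))) =
      (Finset.univ : Finset M.S).val.map (fun W => (π (M.quot W), π (M.sub W))) := by
    ext ⟨X, Y⟩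
    induction X using Quotient.inductionOn with | _ X
    induction Y using Quotient.inductionOn with | _ Y
    rw [Multiset.count_map, Multiset.count_map]
    have := H (ind X) (ind Y)
    simp only [Hall.mul_f, ind_f, ← ite_and, mul_ite, mul_one, mul_zero] at this
    rw [← Finset.sum_filter, ← Finset.sum_filter, Finset.sum_const, Finset.sum_const, nsmul_one, nsmul_one, Nat.cast_inj] at this
    have e : ∀ U V : Ob F, (Quotient.mk (isoSetoid F) U = Quotient.mk (isoSetoid F) V) ↔ Iso V U := fun U V =>
      Quotient.eq.trans ⟨Iso.symm, Iso.symm⟩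
    simp only [Prod.mk.injEq, π, e]
    convert this using 1
    · congr 1; ext; simp [and_comm]
    · simp [Finset.card_def]
  have := congrArg (fun m => (m.map γ').sum) key
  rw [Multiset.map_map, Multiset.map_map] at this
  exact this
theorem comm_main (a b : Hall F ℂ) : ∀ n, ∀ M : Ob F, M.d = n → (a * b) M = (b * a) M := by
  intro n
  induction n using Nat.strong_induction_on generalizing a b with | _ n ih
  set c := a * b - b * a with hc
  have hP : ∀ M N : Ob F, M.d < n → N.d < n → (Phi c M).f N = 0 := by
    intro M N hM hN
    have : Phi c = Phi (a * b) - Phi (b * a) := map_sub (PhiH F) _ _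
    rw [this, Hall.sub_f, Hall.sub_f, mackey, mackey, sub_eq_zero]
    rw [comm_aux M (fun a b => ih _ hM a b M rfl) (fun X Y => ∑ W₂ : N.S, (Phi a X).f (N.sub W₂) * (Phi b Y).f (N.quot W₂))
      (fun Y h => by simp only [(Phi a).inv h]) (fun X _ _ h => by simp only [(Phi b).inv h])]
    refine Finset.sum_congr rfl fun W₁ _ => ?_
    rw [comm_aux N (fun a b => ih _ hN a b N rfl) (fun X Y => (Phi a (M.quot W₁)).f X * (Phi b (M.sub W₁)).f Y)
      (fun Y h => by simp only [(Phi a _).inv h]) (fun X _ _ h => by simp only [(Phi b _).inv h])]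
    exact Finset.sum_congr rfl fun W₂ _ => mul_comm _ _
  have h0 : ∀ (a b : Hall F ℂ) i, ip i b (perp 0 a c) = ip 0 a (perp i b c) := by
    intro a b i
    rw [ip, perp, pr_zero, ip, pr_zero, perp]
    simp only [pr, Hall.smul_f, Hall.sum_f, Finset.smul_sum, Phi_left c (mat_d 0 0), Phi_right c (mat_d 0 0)]
    refine Finset.sum_congr rfl fun x _ => ?_
    simp only [smul_eq_mul]; ring
  have h1 : ∀ i j, i + j = n → ip j b (perp i a c) = ip i a (perp j b c) := by
    intro i j hij
    rcases Nat.eq_zero_or_pos i with rfl | hi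
    · exact h0 _ _ _
    rcases Nat.eq_zero_or_pos j with rfl | hj
    · exact (h0 _ _ _).symm
    have hz : ∀ (a b : Hall F ℂ) i j, i + j = n → 0 < i → 0 < j → ip j b (perp i a c) = 0 := by
      intro a b i j hij hi hj
      simp only [pr, Hall.smul_f, Hall.sum_f]
      rw [Finset.sum_eq_zero, smul_zero]
      intro x _
      rw [Finset.sum_eq_zero, smul_zero, smul_zero]
      intro y _
      rw [hP _ _ (by rw [mat_d]; omega) (by rw [mat_d]; omega), smul_zero]
    rw [hz _ _ _ _ hij hi hj, hz _ _ _ _ (by omega) hj hi]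
  have h2 : ip n c c = 0 := by
    have : ip n c c = ip n (a * b) c - ip n (b * a) c := by
      rw [← pr_sub_l]
    rw [this, adj, adj, sub_eq_zero, ← Finset.Nat.sum_antidiagonal_swap]
    refine Finset.sum_congr rfl fun p hp => ?_
    exact (h1 p.2 p.1 (by simpa [add_comm] using hp)).trans rfl
  intro M hM
  exact sub_eq_zero.1 (ip_self_zero h2 hM)
instance {K : Type u} [CommRing K] : CommRing (Hall F K) where
  mul_comm a b := by
    ext M
    rw [Hall.mul_f, Hall.mul_f, comm_aux M (fun a b => comm_main a b _ M rfl) (fun X Y => a X * b Y) (fun Y h => by rw [a.inv h]) (fun X _ _ h => by rw [b.inv h])]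
    exact Finset.sum_congr rfl fun _ _ => mul_comm _ _
end GLW
end
end
section
universe u
open scoped MatrixGroups
noncomputable section
namespace GLW
variable {F : Type} [Field F] [Fintype F]
section fin
open scoped ComplexOrder
variable {G : Type} [Group G] [Fintype G]
open Representation
def IrrC (G : Type) [Group G] : Set (G → ℂ) := {f | ∃ (V : Type) (_ : AddCommGroup V) (_ : Module ℂ V)
  (_ : FiniteDimensional ℂ V) (ρ : Representation ℂ G V), ρ.IsIrreducible ∧ ρ.character = f}
theorem char_inv {V : Type} [AddCommGroup V] [Module ℂ V] [FiniteDimensional ℂ V] (ρ : Representation ℂ G V) (g : G) :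
    ρ.character g⁻¹ = starRingEnd ℂ (ρ.character g) := by
  classical
  let b := Module.finBasis ℂ V
  let A : G →* Matrix (Fin (Module.finrank ℂ V)) (Fin (Module.finrank ℂ V)) ℂ :=
    (LinearMap.toMatrixAlgEquiv b).toMulEquiv.toMonoidHom.comp ρ
  have htr : ∀ g, ρ.character g = (A g).trace := fun g => by
    rw [Representation.character, LinearMap.trace_eq_matrix_trace ℂ b]; rfl
  let H := ∑ h : G, (A h).conjTranspose * A h
  have hH : H.PosDef := by
    have : H = (A 1).conjTranspose * A 1 + ∑ h ∈ Finset.univ.erase 1, (A h).conjTranspose * A h :=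
      (Finset.add_sum_erase _ _ (Finset.mem_univ _)).symm
    rw [this]
    refine Matrix.PosDef.add_posSemidef ?_ (Matrix.posSemidef_sum _ fun i _ => Matrix.posSemidef_conjTranspose_mul_self _)
    rw [map_one]; simpa using Matrix.PosDef.one
  have hu := hH.isUnit
  have hk : (A g).conjTranspose * H * A g = H := by
    simp only [H, Finset.mul_sum, Finset.sum_mul]
    rw [← Equiv.sum_comp (Equiv.mulRight g) (fun h => (A h).conjTranspose * A h)]
    refine Finset.sum_congr rfl fun h _ => ?_
    simp [Matrix.mul_assoc]
  have h1 : A g * A g⁻¹ = 1 := by rw [← map_mul]; simp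
  have h2 : (A g).conjTranspose * H = H * A g⁻¹ := by
    rw [← hk, Matrix.mul_assoc _ (A g), h1, hk, Matrix.mul_one]
  have h3 : (A g).conjTranspose = H * A g⁻¹ * H⁻¹ := by
    rw [← h2, Matrix.mul_assoc, Matrix.mul_nonsing_inv _ ((Matrix.isUnit_iff_isUnit_det _).1 hu), Matrix.mul_one]
  rw [htr, htr, ← Complex.star_def, ← Matrix.trace_conjTranspose, h3, Matrix.trace_mul_comm, ← Matrix.mul_assoc,
    Matrix.nonsing_inv_mul _ ((Matrix.isUnit_iff_isUnit_det _).1 hu), Matrix.one_mul]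
instance invC : Invertible (Nat.card G : ℂ) := invertibleOfNonzero (by
  rw [Nat.card_eq_fintype_card]; exact_mod_cast Fintype.card_ne_zero)
theorem irr_orth {f h : G → ℂ} (hf : f ∈ IrrC G) (hh : h ∈ IrrC G) [Decidable (f = h)] :
    (Fintype.card G : ℂ)⁻¹ * ∑ g, starRingEnd ℂ (f g) * h g = if f = h then 1 else 0 := by
  obtain ⟨V, _, _, _, ρ, hρ, rfl⟩ := hf
  obtain ⟨W, _, _, _, σ, hσ, rfl⟩ := hh
  rw [← Nat.card_eq_fintype_card]
  split_ifs with e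
  · have := char_orthonormal ρ ρ
    rw [if_pos ⟨Representation.Equiv.refl ρ⟩] at this
    rw [← e]
    refine Eq.trans ?_ this
    simp_rw [char_inv, mul_comm]
  · have := char_orthonormal σ ρ
    rw [if_neg fun ⟨i⟩ => e (char_iso i)] at this
    refine Eq.trans ?_ this
    simp_rw [char_inv, mul_comm]
theorem irr_conj {f : G → ℂ} (hf : f ∈ IrrC G) (g h : G) : f (h * g * h⁻¹) = f g := by
  obtain ⟨V, _, _, _, ρ, hρ, rfl⟩ := hf
  exact char_conj _ _ _
theorem irr_one {f : G → ℂ} (hf : f ∈ IrrC G) : ∃ d : ℕ, 0 < d ∧ f 1 = d := by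
  obtain ⟨V, _, _, _, ρ, hρ, rfl⟩ := hf
  refine ⟨_, ?_, char_one ρ⟩
  haveI := (irreducible_iff_isSimpleModule_asModule ρ).1 hρ
  haveI : Nontrivial V := IsSimpleModule.nontrivial (MonoidAlgebra ℂ G) ρ.asModule
  exact Module.finrank_pos
theorem irr_int {f : G → ℂ} (hf : f ∈ IrrC G) (g : G) : IsIntegral ℤ (f g) := by
  obtain ⟨V, _, _, _, ρ, hρ, rfl⟩ := hf
  rw [Representation.character, Module.End.trace_eq_sum_roots_charpoly_of_splits (IsAlgClosed.splits _)]
  refine IsIntegral.multiset_sum fun x hx => ?_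
  have he : Module.End.HasEigenvalue (ρ g) x := by
    rw [Module.End.hasEigenvalue_iff_isRoot_charpoly]; exact (Polynomial.mem_roots'.1 hx).2
  obtain ⟨v, hv⟩ := he.exists_hasEigenvector
  have := hv.pow_apply (Fintype.card G)
  rw [← map_pow, pow_card_eq_one, map_one] at this
  have h1 : x ^ Fintype.card G = 1 := by
    by_contra hne
    have h2 : (x ^ Fintype.card G - 1) • v = 0 := by rw [sub_smul, ← this]; simp
    rcases smul_eq_zero.1 h2 with h | h
    · exact hne (sub_eq_zero.1 h)
    · exact hv.2 h
  exact IsIntegral.of_pow Fintype.card_pos (h1 ▸ isIntegral_one)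
theorem schur0 {V : Type} [AddCommGroup V] [Module ℂ V] [FiniteDimensional ℂ V] (ρ : Representation ℂ G V) [ρ.IsIrreducible]
    (f : G → ℂ) (hf : ∀ g h, f (h * g * h⁻¹) = f g) (h0 : ∑ g, f g * ρ.character g = 0) : ∑ g, f g • ρ g = 0 := by
  let T : IntertwiningMap ρ ρ := ⟨∑ g, f g • ρ g, fun h => by
    ext v
    simp only [LinearMap.comp_apply, LinearMap.sum_apply, LinearMap.smul_apply, map_sum, map_smul]
    rw [← (MulAut.conj h).toEquiv.sum_comp]
    refine Finset.sum_congr rfl fun g _ => ?_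
    simp [hf, ← Module.End.mul_apply, ← map_mul]⟩
  obtain ⟨c, hc⟩ := (IsIrreducible.algebraMap_intertwiningMap_bijective_of_isAlgClosed (ρ := ρ)).2 T
  have hT : ∑ g, f g • ρ g = c • (1 : V →ₗ[ℂ] V) := by
    have : T.toLinearMap = (algebraMap ℂ (IntertwiningMap ρ ρ) c).toLinearMap := by rw [hc]
    refine this.trans ?_
    ext v; simp [Algebra.algebraMap_eq_smul_one]
  have htr := congrArg (LinearMap.trace ℂ V) hT
  simp only [map_sum, map_smul, LinearMap.trace_one, smul_eq_mul] at htr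
  rw [show ∑ g, f g * LinearMap.trace ℂ V (ρ g) = 0 from h0] at htr
  haveI := (irreducible_iff_isSimpleModule_asModule ρ).1 inferInstance
  haveI : Nontrivial V := IsSimpleModule.nontrivial (MonoidAlgebra ℂ G) ρ.asModule
  have : (Module.finrank ℂ V : ℂ) ≠ 0 := by exact_mod_cast Module.finrank_pos.ne'
  have : c = 0 := by
    rcases mul_eq_zero.1 htr.symm with h | h
    · exact h
    · exact absurd h this
  rw [hT, this, zero_smul]
theorem simple0 (M : Type) [AddCommGroup M] [Module ℂ M] [Module (MonoidAlgebra ℂ G) M] [IsScalarTower ℂ (MonoidAlgebra ℂ G) M]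
    [FiniteDimensional ℂ M] [IsSimpleModule (MonoidAlgebra ℂ G) M]
    (f : G → ℂ) (hf : ∀ g h, f (h * g * h⁻¹) = f g) (h0 : ∀ χ ∈ IrrC G, ∑ g, f g * χ g = 0) (m : M) :
    (∑ g, f g • MonoidAlgebra.of ℂ G g : MonoidAlgebra ℂ G) • m = 0 := by
  have h3 : ∀ t m, (ofModule' (k := ℂ) (G := G) M).asAlgebraHom t m = t • m := by
    intro t m
    rw [asAlgebraHom, ofModule', Equiv.apply_symm_apply]; rfl
  let e : (ofModule' (k := ℂ) (G := G) M).asModule ≃ₗ[MonoidAlgebra ℂ G] M :=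
    { (asModuleEquiv (ofModule' (k := ℂ) (G := G) M)) with map_smul' := fun r x => h3 r x }
  haveI := (irreducible_iff_isSimpleModule_asModule (ofModule' (k := ℂ) (G := G) M)).2 (IsSimpleModule.congr e)
  have h1 := schur0 (ofModule' (k := ℂ) (G := G) M) f hf (h0 _ ⟨_, _, _, inferInstance, _, this, rfl⟩)
  rw [← h3, map_sum]; simp only [map_smul, asAlgebraHom_of, h1, LinearMap.zero_apply]
theorem irr_complete (f : G → ℂ) (hf : ∀ g h, f (h * g * h⁻¹) = f g) (h0 : ∀ χ ∈ IrrC G, ∑ g, f g * χ g = 0) : f = 0 := by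
  classical
  let t : MonoidAlgebra ℂ G := ∑ g, f g • MonoidAlgebra.of ℂ G g
  have ht : t = 0 := by
    haveI : NeZero (Nat.card G : ℂ) := ⟨Invertible.ne_zero _⟩
    have hJ : Ring.jacobson (MonoidAlgebra ℂ G) = ⊥ := IsSemisimpleRing.jacobson_eq_bot _
    have : t ∈ Ring.jacobson (MonoidAlgebra ℂ G) := by
      rw [Ring.jacobson_eq_sInf_isMaximal, Ideal.mem_sInf]
      intro I hI
      have hI : I.IsMaximal := hI
      haveI : IsSimpleModule (MonoidAlgebra ℂ G) (MonoidAlgebra ℂ G ⧸ I) := isSimpleModule_iff_isCoatom.2 hI.out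
      haveI : Module.Finite ℂ (MonoidAlgebra ℂ G) := Module.Finite.equiv (MonoidAlgebra.coeffLinearEquiv ℂ).symm
      haveI : Module.Finite ℂ (MonoidAlgebra ℂ G ⧸ I) := Module.Finite.trans (MonoidAlgebra ℂ G) _
      have h2 := simple0 (MonoidAlgebra ℂ G ⧸ I) f hf h0 (Submodule.Quotient.mk 1)
      rw [← Submodule.Quotient.mk_smul, smul_eq_mul, mul_one] at h2
      exact (Submodule.Quotient.mk_eq_zero I).1 h2
    rw [hJ] at this; exact this
  funext g
  have := congrArg (fun u : MonoidAlgebra ℂ G => u.coeff g) ht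
  simpa [t, MonoidAlgebra.of_apply, Finsupp.finset_sum_apply, Finsupp.single_apply] using this
theorem irr_fin : (IrrC G).Finite := by
  classical
  have : LinearIndependent ℂ (fun χ : IrrC G => χ.1) := by
    rw [linearIndependent_iff']
    intro s c hc i hi
    have h1 : (Fintype.card G : ℂ)⁻¹ * ∑ g, starRingEnd ℂ (i.1 g) * (∑ j ∈ s, c j • j.1) g = 0 := by rw [hc]; simp
    simp only [Finset.sum_apply, Pi.smul_apply, smul_eq_mul, Finset.mul_sum] at h1
    rw [Finset.sum_comm] at h1
    have h2 : ∀ j ∈ s, ∑ g, (Fintype.card G : ℂ)⁻¹ * (starRingEnd ℂ (i.1 g) * (c j * j.1 g)) = c j * if i = j then 1 else 0 := by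
      intro j _
      have := irr_orth i.2 j.2
      simp only [← Subtype.ext_iff] at this
      rw [← this, Finset.mul_sum, Finset.mul_sum]
      exact Finset.sum_congr rfl fun g _ => by ring
    rw [Finset.sum_congr rfl h2] at h1
    simpa [hi] using h1
  exact Set.finite_coe_iff.1 this.finite
end fin
end GLW
end
end
section
universe u
open scoped MatrixGroups
noncomputable section
namespace GLW
structure PSH (R : Type u) [CommRing R] where
  I : Set R
  dg : R → ℕ
  fm : R →+ R →+ ℤ
  P : R →+ R →+ R
  symm : ∀ a b, fm a b = fm b a
  orth1 : ∀ u ∈ I, fm u u = 1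
  orth : ∀ u ∈ I, ∀ v ∈ I, u ≠ v → fm u v = 0
  span : AddSubgroup.closure I = ⊤
  one : 1 ∈ I
  adj : ∀ a b c, fm (a * b) c = fm b (P a c)
  pos : ∀ u ∈ I, ∀ v ∈ I, ∀ w ∈ I, 0 ≤ fm w (u * v)
  deg : ∀ u ∈ I, ∀ v ∈ I, ∀ w ∈ I, fm w (u * v) ≠ 0 → dg w = dg u + dg v
  dg0 : ∀ u ∈ I, dg u = 0 → u = 1
  hopf : ∀ a b c, P a (b * c) = ∑ᶠ u : I, P u.1 b * P (P u.1 a) c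
  hfin : ∀ a, {u : I | P u.1 a ≠ 0}.Finite
namespace PSH
variable {R : Type u} [CommRing R] (S : PSH R)
theorem fm_sum {s : Finset S.I} {c : S.I → ℤ} (u : S.I) [DecidableEq S.I] :
    S.fm u.1 (∑ v ∈ s, c v • v.1) = if u ∈ s then c u else 0 := by
  rw [map_sum]
  simp only [map_zsmul]
  rw [← Finset.sum_ite_eq s u c]
  refine Finset.sum_congr rfl fun v _ => ?_
  split_ifs with h
  · subst h; rw [S.orth1 _ u.2]; simp
  · rw [S.orth _ u.2 _ v.2 fun e => h (Subtype.ext e)]; simp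
theorem exp (a : R) : ∃ s : Finset S.I, a = ∑ v ∈ s, S.fm v.1 a • v.1 ∧ ∀ v : S.I, v ∉ s → S.fm v.1 a = 0 := by
  classical
  have h : a ∈ Submodule.span ℤ (Set.range (fun v : S.I => v.1)) := by
    rw [Subtype.range_coe, ← Submodule.mem_toAddSubgroup, Submodule.span_int_eq_addSubgroupClosure, S.span]; trivial
  obtain ⟨c, hc⟩ := (Finsupp.mem_span_range_iff_exists_finsupp).1 h
  have hc : ∑ v ∈ c.support, c v • v.1 = a := hc
  have h1 : ∀ v : S.I, S.fm v.1 a = c v := by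
    intro v
    rw [← hc, S.fm_sum]
    split_ifs with h
    · rfl
    · simpa using (Finsupp.notMem_support_iff.1 h).symm
  refine ⟨c.support, ?_, fun v hv => by rw [h1]; simpa using hv⟩
  conv_lhs => rw [← hc]
  exact Finset.sum_congr rfl fun v _ => by rw [h1]
theorem ext0 {a : R} (h : ∀ u ∈ S.I, S.fm u a = 0) : a = 0 := by
  obtain ⟨s, h1, _⟩ := S.exp a
  rw [h1]; exact Finset.sum_eq_zero fun v _ => by rw [h _ v.2]; simp
theorem ext' {a b : R} (h : ∀ u ∈ S.I, S.fm u a = S.fm u b) : a = b :=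
  sub_eq_zero.1 (S.ext0 fun u hu => by rw [map_sub, h u hu, sub_self])
theorem exu {a : R} (h : a ≠ 0) : ∃ u ∈ S.I, S.fm u a ≠ 0 := by
  by_contra! H; exact h (S.ext0 H)
theorem pars (a b : R) {s : Finset S.I} (hs : a = ∑ v ∈ s, S.fm v.1 a • v.1) :
    S.fm a b = ∑ v ∈ s, S.fm v.1 a * S.fm v.1 b := by
  conv_lhs => rw [hs]
  simp only [map_sum, AddMonoidHom.finset_sum_apply, map_zsmul, AddMonoidHom.smul_apply, smul_eq_mul]
def Pos (a : R) : Prop := ∀ u ∈ S.I, 0 ≤ S.fm u a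
variable {S}
theorem Pos.add {a b : R} (ha : S.Pos a) (hb : S.Pos b) : S.Pos (a + b) := fun u hu => by
  rw [map_add]; exact add_nonneg (ha u hu) (hb u hu)
theorem pos_zero : S.Pos 0 := fun u hu => by simp
theorem pos_I {u : R} (h : u ∈ S.I) : S.Pos u := fun v hv => by
  by_cases e : v = u
  · subst e; rw [S.orth1 _ hv]; simp
  · rw [S.orth _ hv _ h e]
theorem Pos.ind {a : R} (ha : S.Pos a) {p : R → Prop} (h0 : p 0) (hadd : ∀ u ∈ S.I, ∀ b, p b → p (u + b)) : p a := by
  obtain ⟨s, h1, h2⟩ := S.exp a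
  rw [h1]; clear h1 h2
  induction s using Finset.cons_induction with
  | empty => simpa
  | cons v s hv ih =>
    rw [Finset.sum_cons]
    obtain ⟨n, hn⟩ := Int.eq_ofNat_of_zero_le (ha _ v.2)
    rw [hn]; clear hn
    induction n with
    | zero => rw [Nat.cast_zero, zero_smul, zero_add]; exact ih
    | succ n ih' =>
      have : ((n + 1 : ℕ) : ℤ) • v.1 + ∑ v ∈ s, S.fm v.1 a • v.1 = v.1 + ((n : ℤ) • v.1 + ∑ v ∈ s, S.fm v.1 a • v.1) := by
        push_cast; rw [add_smul]; simp; ring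
      rw [this]; exact hadd _ v.2 _ ih'
theorem Pos.mul {a b : R} (ha : S.Pos a) (hb : S.Pos b) : S.Pos (a * b) := by
  refine ha.ind (p := fun a => S.Pos (a * b)) (by simpa using pos_zero) fun u hu c hc => ?_
  rw [add_mul]; refine Pos.add ?_ hc
  refine hb.ind (p := fun b => S.Pos (u * b)) (by simpa using pos_zero) fun v hv c hc => ?_
  rw [mul_add]; exact Pos.add (fun w hw => S.pos u hu v hv w hw) hc
theorem Pos.fm {a b : R} (ha : S.Pos a) (hb : S.Pos b) : 0 ≤ S.fm a b := by
  refine ha.ind (p := fun a => 0 ≤ S.fm a b) (by simp) fun u hu c hc => ?_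
  rw [map_add, AddMonoidHom.add_apply]; exact add_nonneg (hb u hu) hc
theorem Pos.P {a b : R} (ha : S.Pos a) (hb : S.Pos b) : S.Pos (S.P a b) := fun u hu => by
  rw [← S.adj]; exact (ha.mul (pos_I hu)).fm hb
theorem Pos.sub {a u : R} (ha : S.Pos a) (hu : u ∈ S.I) (h : S.fm u a ≠ 0) : S.Pos (a - u) := fun v hv => by
  rw [map_sub]
  by_cases e : v = u
  · subst e; rw [S.orth1 _ hv]; have := ha v hv; omega
  · rw [S.orth _ hv _ hu e]; simpa using ha v hv
theorem Pos.fm_ne {a b u : R} (ha : S.Pos a) (hb : S.Pos b) (hu : u ∈ S.I) (h : S.fm u a ≠ 0) (h' : S.fm u b ≠ 0) : S.fm a b ≠ 0 := by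
  have h1 := (ha.sub hu h).fm hb
  rw [map_sub, AddMonoidHom.sub_apply] at h1
  have := hb u hu
  omega
theorem Pos.exu2 {a b : R} (ha : S.Pos a) (h : S.fm a b ≠ 0) : ∃ u ∈ S.I, S.fm u a ≠ 0 ∧ S.fm u b ≠ 0 := by
  obtain ⟨s, h1, _⟩ := S.exp a
  rw [S.pars _ _ h1] at h
  obtain ⟨v, _, hv⟩ := Finset.exists_ne_zero_of_sum_ne_zero h
  exact ⟨v, v.2, left_ne_zero_of_mul hv, right_ne_zero_of_mul hv⟩
theorem Pos.split {a b u : R} (ha : S.Pos a) (hb : S.Pos b) (hu : u ∈ S.I) (h : a + b = u) : a = 0 ∨ b = 0 := by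
  have hx : ∀ v ∈ S.I, S.fm v a + S.fm v b = S.fm v u := fun v hv => by rw [← h, map_add]
  have h1 := hx u hu
  rw [S.orth1 _ hu] at h1
  have h2 : ∀ v ∈ S.I, v ≠ u → S.fm v a = 0 ∧ S.fm v b = 0 := fun v hv e => by
    have := hx v hv; rw [S.orth _ hv _ hu e] at this
    have := ha v hv; have := hb v hv; omega
  have := ha u hu; have := hb u hu
  rcases (by omega : S.fm u a = 0 ∨ S.fm u b = 0) with h | h
  · left; refine S.ext0 fun v hv => ?_
    by_cases e : v = u
    · rw [e, h]
    · exact (h2 v hv e).1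
  · right; refine S.ext0 fun v hv => ?_
    by_cases e : v = u
    · rw [e, h]
    · exact (h2 v hv e).2
theorem Pos.add_zero {a b : R} (ha : S.Pos a) (hb : S.Pos b) (h : a + b = 0) : a = 0 := S.ext0 fun v hv => by
  have : S.fm v a + S.fm v b = 0 := by rw [← map_add, h, map_zero]
  have := ha v hv; have := hb v hv; omega
theorem fm_zero_iff {a : R} (h : S.fm a a = 0) : a = 0 := by
  obtain ⟨s, h1, _⟩ := S.exp a
  rw [S.pars _ _ h1] at h
  rw [h1]
  refine Finset.sum_eq_zero fun v hv => ?_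
  have := (Finset.sum_eq_zero_iff_of_nonneg fun v _ => mul_self_nonneg _).1 h v hv
  rw [mul_self_eq_zero.1 this]; simp
theorem norm_one {a : R} (h : S.fm a a = 1) : a ∈ S.I ∨ -a ∈ S.I := by
  classical
  obtain ⟨u, hu, h1⟩ := S.exu (a := a) (by rintro rfl; simp at h)
  have key : ∀ a, S.fm a a = 1 → 0 < S.fm u a → a = u := by
    intro a h h2
    obtain ⟨s, h3, h4⟩ := S.exp a
    have h5 := S.pars a a h3
    have hm : (⟨u, hu⟩ : S.I) ∈ s := by by_contra h6; have := h4 _ h6; simp at this; omega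
    rw [h, ← Finset.add_sum_erase _ _ hm] at h5
    have h6 : 0 ≤ ∑ x ∈ s.erase ⟨u, hu⟩, S.fm x.1 a * S.fm x.1 a := Finset.sum_nonneg fun v _ => mul_self_nonneg _
    have h7 : S.fm u a = 1 := by simp at h5; nlinarith
    refine sub_eq_zero.1 (fm_zero_iff (S := S) ?_)
    simp only [map_sub, AddMonoidHom.sub_apply, h, h7, S.orth1 u hu, S.symm a u]; norm_num
  rcases lt_or_gt_of_ne h1 with h2 | h2
  · right; rw [key (-a) (by simpa using h) (by simpa using h2)]; exact hu
  · left; rw [key a h h2]; exact hu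
theorem Pos.norm_one {a : R} (ha : S.Pos a) (h : S.fm a a = 1) : a ∈ S.I := by
  rcases PSH.norm_one h with h1 | h1
  · exact h1
  · have : S.fm (-a) a = -1 := by simp [h]
    have := ha _ h1; omega
theorem Pos.norm_two {a : R} (ha : S.Pos a) (h : S.fm a a = 2) : ∃ u ∈ S.I, ∃ v ∈ S.I, u ≠ v ∧ a = u + v := by
  obtain ⟨u, hu, h1⟩ := S.exu (a := a) (by rintro rfl; simp at h)
  have h2 := ha.sub hu h1
  have h6 := h2.fm h2
  have h7 := ha u hu
  simp only [map_sub, AddMonoidHom.sub_apply, h, S.orth1 u hu, S.symm a u] at h6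
  have h8 : S.fm u a = 1 := by omega
  refine ⟨u, hu, a - u, h2.norm_one (by simp only [map_sub, AddMonoidHom.sub_apply, h, S.orth1 u hu, S.symm a u, h8]; norm_num), ?_, by ring⟩
  intro e
  have : S.fm u (a - u) = 1 := by rw [← e]; exact S.orth1 u hu
  rw [map_sub, h8, S.orth1 u hu] at this; omega
variable (S)
theorem fmP (a b c : R) : S.fm b (S.P a c) = S.fm (a * b) c := (S.adj a b c).symm
theorem PP (a b c : R) : S.P a (S.P b c) = S.P (a * b) c := S.ext' fun u hu => by
  rw [fmP, fmP, fmP, ← mul_assoc, mul_comm b a]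
theorem P_one (c : R) : S.P 1 c = c := S.ext' fun u hu => by rw [fmP, one_mul]
theorem dg_one : S.dg 1 = 0 := by
  have := S.deg 1 S.one 1 S.one 1 S.one (by simp [S.orth1 1 S.one]); omega
theorem P_ne {u v c : R} (hu : u ∈ S.I) (hc : c ∈ S.I) (h : S.P u c ≠ 0) : ∃ v ∈ S.I, S.fm c (u * v) ≠ 0 ∧ S.dg c = S.dg u + S.dg v := by
  obtain ⟨v, hv, h1⟩ := S.exu h
  rw [fmP, S.symm] at h1
  exact ⟨v, hv, h1, S.deg u hu v hv c hc h1⟩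
theorem P_self {u : R} (hu : u ∈ S.I) : S.P u u = 1 := S.ext' fun v hv => by
  rw [fmP]
  by_cases e : v = 1
  · subst e; rw [mul_one, S.orth1 _ hu, S.orth1 _ hv]
  · rw [S.orth _ hv _ S.one e]
    by_contra h
    rw [S.symm] at h
    have := S.deg _ hu _ hv _ hu h
    exact e (S.dg0 _ hv (by omega))
theorem P_one_right {u : R} (hu : u ∈ S.I) (h : u ≠ 1) : S.P u 1 = 0 := by
  by_contra H
  obtain ⟨v, hv, _, h2⟩ := S.P_ne (v := 1) hu S.one H
  rw [S.dg_one] at h2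
  exact h (S.dg0 _ hu (by omega))
theorem P_deg {u v : R} (hu : u ∈ S.I) (hv : v ∈ S.I) (hd : S.dg v ≤ S.dg u) (h : v ≠ u) : S.P u v = 0 := by
  by_contra H
  obtain ⟨w, hw, h1, h2⟩ := S.P_ne (v := 1) hu hv H
  have := S.dg0 _ hw (by omega)
  rw [this, mul_one, S.orth _ hv _ hu h] at h1
  exact h1 rfl
def Cusp : Set R := {ρ | ρ ∈ S.I ∧ ρ ≠ 1 ∧ ∀ u ∈ S.I, u ≠ 1 → u ≠ ρ → S.P u ρ = 0}
variable {S}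
theorem cusp_der {ρ : R} (h : ρ ∈ S.Cusp) (b c : R) : S.P ρ (b * c) = S.P ρ b * c + b * S.P ρ c := by
  classical
  rw [S.hopf, finsum_eq_sum_of_support_subset (s := {⟨ρ, h.1⟩, ⟨1, S.one⟩}), Finset.sum_pair]
  · simp only [S.P_self h.1, S.P_one]
  · intro e; exact h.2.1 (congrArg Subtype.val e)
  · intro u hu
    simp only [Function.mem_support] at hu
    simp only [Finset.coe_insert, Finset.coe_singleton, Set.mem_insert_iff, Set.mem_singleton_iff]
    by_contra! H
    refine hu ?_
    rw [h.2.2 u.1 u.2 (fun e => H.2 (Subtype.ext e)) (fun e => H.1 (Subtype.ext e))]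
    simp
theorem cusp_P {ρ ρ' : R} (h : ρ ∈ S.Cusp) (h' : ρ' ∈ S.Cusp) (e : ρ ≠ ρ') : S.P ρ ρ' = 0 := h'.2.2 _ h.1 h.2.1 e
theorem cusp_dg {ρ : R} (h : ρ ∈ S.Cusp) : 0 < S.dg ρ := Nat.pos_of_ne_zero fun e => h.2.1 (S.dg0 _ h.1 e)
def MC (S : PSH R) (s : Multiset R) : Prop := ∀ ρ ∈ s, ρ ∈ S.Cusp
theorem MC.pos {s : Multiset R} (h : S.MC s) : S.Pos s.prod := by
  induction s using Multiset.induction_on with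
  | empty => simpa using pos_I S.one
  | cons a s ih =>
    rw [Multiset.prod_cons]
    exact (pos_I (h a (by simp)).1).mul (ih fun x hx => h x (Multiset.mem_cons_of_mem hx))
theorem der_prod [DecidableEq R] {ρ : R} (hρ : ρ ∈ S.Cusp) {s : Multiset R} (h : S.MC s) :
    S.P ρ s.prod = (s.count ρ : ℤ) • (s.erase ρ).prod := by
  induction s using Multiset.induction_on with
  | empty => simp [S.P_one_right hρ.1 hρ.2.1]
  | cons a s ih =>
    have ih := ih fun x hx => h x (Multiset.mem_cons_of_mem hx)
    rw [Multiset.prod_cons, cusp_der hρ, ih]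
    by_cases e : ρ = a
    · subst e
      simp only [S.P_self hρ.1, Multiset.count_cons_self, Multiset.erase_cons_head]
      by_cases hm : ρ ∈ s
      · conv_rhs => rw [← Multiset.cons_erase hm]
        conv_lhs => rw [← Multiset.cons_erase hm]
        simp [Multiset.prod_cons]; ring
      · simp [Multiset.count_eq_zero_of_notMem hm]
    · rw [cusp_P hρ (h a (by simp)) e, Multiset.count_cons_of_ne e, Multiset.erase_cons_tail]
      · simp; ring
      · exact fun e' => e e'.symm
theorem MC_orth {s t : Multiset R} (hs : S.MC s) (ht : S.MC t) (hst : s ≠ t) : S.fm s.prod t.prod = 0 := by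
  classical
  induction s using Multiset.induction_on generalizing t with
  | empty =>
    obtain ⟨ρ, hm⟩ := Multiset.exists_mem_of_ne_zero (Ne.symm hst)
    obtain ⟨t', rfl⟩ := Multiset.exists_cons_of_mem hm
    have hρ := ht _ (Multiset.mem_cons_self _ _)
    rw [Multiset.prod_cons, S.symm, S.adj, Multiset.prod_zero, S.P_one_right hρ.1 hρ.2.1, map_zero]
  | cons a s ih =>
    rw [Multiset.prod_cons, S.adj, der_prod (hs a (by simp)) ht]
    by_cases hm : a ∈ t
    · rw [map_zsmul, ih (fun x hx => hs x (Multiset.mem_cons_of_mem hx)) (fun x hx => ht x (Multiset.mem_of_mem_erase hx)), smul_zero]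
      rintro rfl; exact hst (Multiset.cons_erase hm)
    · simp [Multiset.count_eq_zero_of_notMem hm]
theorem MC_exists {χ : R} (h : χ ∈ S.I) : ∃ s, S.MC s ∧ S.fm χ s.prod ≠ 0 ∧ (s.map S.dg).sum = S.dg χ := by
  induction hn : S.dg χ using Nat.strong_induction_on generalizing χ with | _ n ih
  subst hn
  by_cases h1 : χ = 1
  · subst h1; exact ⟨0, by simp [MC], by simp [S.orth1 _ h], by simp [S.dg_one]⟩
  by_cases h2 : χ ∈ S.Cusp
  · exact ⟨{χ}, by simpa [MC], by simp [S.orth1 _ h], by simp⟩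
  have h3 : ∃ u ∈ S.I, u ≠ 1 ∧ u ≠ χ ∧ S.P u χ ≠ 0 := by
    by_contra! H; exact h2 ⟨h, h1, H⟩
  obtain ⟨u, hu, hu1, huχ, hP⟩ := h3
  obtain ⟨v, hv, h4, h5⟩ := S.P_ne (v := 1) hu h hP
  have du : S.dg u ≠ 0 := fun e => hu1 (S.dg0 _ hu e)
  have dv : S.dg v ≠ 0 := fun e => by
    rw [S.dg0 _ hv e, mul_one] at h4; exact h4 (S.orth _ h _ hu (Ne.symm huχ))
  obtain ⟨s, hs, hs1, hs2⟩ := ih (S.dg u) (by omega) hu rfl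
  obtain ⟨t, ht, ht1, ht2⟩ := ih (S.dg v) (by omega) hv rfl
  refine ⟨s + t, fun x hx => (Multiset.mem_add.1 hx).elim (hs x) (ht x), ?_, by simp [hs2, ht2, h5]⟩
  rw [Multiset.prod_add]
  have e : s.prod * t.prod = u * v + ((s.prod - u) * t.prod + u * (t.prod - v)) := by ring
  have p1 := ((hs.pos.sub hu hs1).mul ht.pos).add ((pos_I hu).mul (ht.pos.sub hv ht1))
  have := p1 χ h
  have := ((pos_I hu).mul (pos_I hv)) χ h
  rw [e, map_add]; omega
theorem MC_unique {χ : R} (h : χ ∈ S.I) {s t : Multiset R} (hs : S.MC s) (ht : S.MC t) (h1 : S.fm χ s.prod ≠ 0)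
    (h2 : S.fm χ t.prod ≠ 0) : s = t := by
  by_contra e
  exact hs.pos.fm_ne ht.pos h h1 h2 (MC_orth hs ht e)
end PSH
end GLW
end
end
section
universe u
open scoped MatrixGroups
noncomputable section
namespace GLW
namespace PSH
variable {R : Type u} [CommRing R] {S : PSH R}
theorem P_sub (a b c : R) : S.P (a - b) c = S.P a c - S.P b c := by rw [map_sub, AddMonoidHom.sub_apply]
theorem P_add (a b c : R) : S.P (a + b) c = S.P a c + S.P b c := by rw [map_add, AddMonoidHom.add_apply]
theorem I_ne {u : R} (h : u ∈ S.I) : u ≠ 0 := by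
  rintro rfl; have := S.orth1 _ h; simp at this
theorem rho_sq {ρ u v : R} (h : ρ ∈ S.Cusp) (hu : u ∈ S.I) (hv : v ∈ S.I) (huv : u ≠ v) (e : ρ * ρ = u + v) :
    S.P ρ v = ρ := by
  have h1 : S.P ρ u + S.P ρ v = ρ + ρ := by
    rw [← map_add, ← e, cusp_der h, S.P_self h.1]; ring
  have pu := (pos_I h.1).P (pos_I hu)
  have pv := (pos_I h.1).P (pos_I hv)
  have a1 : S.fm ρ (S.P ρ v) = 1 := by
    rw [fmP, e, map_add, AddMonoidHom.add_apply, S.orth1 _ hv, S.orth _ hu _ hv huv]; rfl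
  refine S.ext' fun w hw => ?_
  by_cases ew : w = ρ
  · subst ew; rw [a1, S.orth1 _ hw]
  · rw [S.orth _ hw _ h.1 ew]
    have := congrArg (S.fm w) h1
    rw [map_add, map_add, S.orth _ hw _ h.1 ew] at this
    have := pu w hw; have := pv w hw; omega
theorem P_y {ρ y : R} (h : ρ ∈ S.Cusp) (hy : S.P ρ y = ρ) (x : R) :
    S.P y (ρ * x) = S.P ρ x + ρ * S.P y x := S.ext' fun w hw => by
  rw [fmP, S.symm, S.adj, cusp_der h, hy, map_add, map_add, S.symm, S.adj, S.symm x, S.adj, S.symm w (ρ * _), S.adj, S.symm (S.P y x)]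
structure XSt (S : PSH R) (ρ y : R) (a b : R) : Prop where
  ha : a ∈ S.I
  hb : b ∈ S.I
  hP : S.P ρ b = a
  ya : S.P y a = 0
  yb : S.P y b = 0
  hz : ρ * a - b = 0 ∨ (ρ * a - b ∈ S.I ∧ S.P y (ρ * a - b) ≠ 0)
theorem XSt.step {ρ y a b : R} (h : ρ ∈ S.Cusp) (hy : y ∈ S.I) (hρy : S.P ρ y = ρ) (X : XSt S ρ y a b) :
    ∃ c, XSt S ρ y b c := by
  have p := (pos_I h.1).mul (pos_I X.hb)
  have d : S.P ρ (ρ * b) = b + ρ * a := by rw [cusp_der h, S.P_self h.1, X.hP]; ring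
  have n2 : S.fm (ρ * b) (ρ * b) = 2 := by
    rw [S.adj, d, map_add, S.orth1 _ X.hb, S.symm, S.adj, X.hP, S.orth1 _ X.ha]; rfl
  have key : ∀ u ∈ S.I, ∀ v ∈ S.I, u ≠ v → ρ * b = u + v → S.P y u = 0 → S.P y v = a → XSt S ρ y b u := by
    intro u hu v hv huv e yu yv
    refine ⟨X.hb, hu, ?_, X.yb, yu, Or.inr ⟨by rw [e, add_sub_cancel_left]; exact hv, by rw [e, add_sub_cancel_left, yv]; exact I_ne X.ha⟩⟩
    have q : ∀ w ∈ S.I, S.fm (ρ * b) w ≠ 0 → S.Pos (S.P ρ w - b) := fun w hw hh =>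
      ((pos_I h.1).P (pos_I hw)).sub X.hb (by rw [fmP]; exact hh)
    have q1 := q u hu (by rw [e, map_add, AddMonoidHom.add_apply, S.orth1 _ hu, S.orth _ hv _ hu huv.symm]; simp)
    have q2 := q v hv (by rw [e, map_add, AddMonoidHom.add_apply, S.orth1 _ hv, S.orth _ hu _ hv huv]; simp)
    have es : (S.P ρ u - b) + (S.P ρ v - b) = ρ * a - b := by
      have : S.P ρ u + S.P ρ v = b + ρ * a := by rw [← map_add, ← e, d]
      linear_combination this
    have : S.P ρ u - b = 0 := by
      rcases X.hz with hz | ⟨hz, hz'⟩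
      · rw [hz] at es; exact q1.add_zero q2 es
      · rcases q1.split q2 hz es with h0 | h0
        · exact h0
        · exfalso
          rw [h0, add_zero] at es
          apply hz'
          rw [← es, map_sub, X.yb, PP, mul_comm, ← PP, yu, map_zero, sub_zero]
    exact sub_eq_zero.1 this
  obtain ⟨u, hu, v, hv, huv, e⟩ := p.norm_two n2
  have ya : S.P y u + S.P y v = a := by rw [← map_add, ← e, P_y h hρy, X.yb, X.hP, mul_zero, add_zero]
  rcases ((pos_I hy).P (pos_I hu)).split ((pos_I hy).P (pos_I hv)) X.ha ya with h0 | h0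
  · exact ⟨u, key u hu v hv huv e h0 (by rw [← ya, h0, zero_add])⟩
  · exact ⟨v, key v hv u hu huv.symm (by rw [e, add_comm]) h0 (by rw [← ya, h0, add_zero])⟩
structure XSeq (S : PSH R) (ρ : R) (x : ℕ → R) : Prop where
  cusp : ρ ∈ S.Cusp
  zero : x 0 = 1
  one : x 1 = ρ
  mem : ∀ n, x n ∈ S.I
  P_x : ∀ i n, S.P (x i) (x n) = if i ≤ n then x (n - i) else 0
  P_o : ∀ w ∈ S.I, (∀ i, w ≠ x i) → ∀ n, S.P w (x n) = 0
theorem exists_cusp {w : R} (hw : w ∈ S.I) (h1 : w ≠ 1) : ∃ ρ ∈ S.Cusp, ∃ w' ∈ S.I, S.fm w (ρ * w') ≠ 0 := by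
  obtain ⟨s, hs, h2, h3⟩ := MC_exists hw
  have : s ≠ 0 := by
    rintro rfl
    rw [Multiset.prod_zero, S.orth _ hw _ S.one h1] at h2; exact h2 rfl
  obtain ⟨ρ, hm⟩ := Multiset.exists_mem_of_ne_zero this
  obtain ⟨t, rfl⟩ := Multiset.exists_cons_of_mem hm
  refine ⟨ρ, hs ρ hm, ?_⟩
  rw [Multiset.prod_cons, S.symm, S.adj] at h2
  obtain ⟨w', hw', h4⟩ := S.exu (a := S.P ρ w) fun e => h2 (by rw [e, map_zero])
  rw [fmP, S.symm] at h4
  exact ⟨w', hw', h4⟩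
theorem P_le {w a c : R} (hw : w ∈ S.I) (ha : S.Pos a) (hc : S.Pos c) (h : S.fm w a ≠ 0) (h0 : S.P a c = 0) : S.P w c = 0 := by
  refine Pos.add_zero ((pos_I hw).P hc) ((ha.sub hw h).P hc) ?_
  rw [← P_add]; simpa using h0
theorem exists_xseq {ρ u y : R} (h : ρ ∈ S.Cusp) (hu : u ∈ S.I) (hy : y ∈ S.I) (huy : u ≠ y) (e : ρ * ρ = u + y) :
    ∃ x, XSeq S ρ x ∧ x 2 = u := by
  have hρy := rho_sq h hu hy huy e
  have yρ : S.P y ρ = 0 := by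
    refine h.2.2 y hy ?_ ?_
    · rintro rfl
      rw [S.P_one_right h.1 h.2.1] at hρy; exact I_ne h.1 hρy.symm
    · rintro rfl
      rw [S.P_self h.1] at hρy; exact h.2.1 hρy.symm
  have y1 : S.P y 1 = 0 := by
    refine S.P_one_right hy ?_
    rintro rfl
    rw [S.P_one_right h.1 h.2.1] at hρy; exact I_ne h.1 hρy.symm
  have X0 : XSt S ρ y 1 ρ := ⟨S.one, h.1, S.P_self h.1, y1, yρ, by simp⟩
  let f : ℕ → {p : R × R // XSt S ρ y p.1 p.2} := fun n => Nat.rec ⟨(1, ρ), X0⟩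
    (fun _ p => ⟨(p.1.2, (p.2.step h hy hρy).choose), (p.2.step h hy hρy).choose_spec⟩) n
  let x : ℕ → R := fun n => (f n).1.1
  have hx : ∀ n, XSt S ρ y (x n) (x (n + 1)) := fun n => (f n).2
  have x0 : x 0 = 1 := rfl
  have x1 : x 1 = ρ := rfl
  clear_value x
  have hP0 : ∀ n, S.P ρ (x (n + 1)) = x n := fun n => (hx n).hP
  have fmx : ∀ n, S.fm (x (n+1)) (ρ * x n) ≠ 0 := fun n => by
    rw [S.symm, S.adj, hP0, S.orth1 _ (hx n).ha]; simp
  have hPo : ∀ ρ' ∈ S.Cusp, ρ' ≠ ρ → ∀ n, S.P ρ' (x n) = 0 := by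
    intro ρ' h' ne n
    induction n with
    | zero => rw [x0, S.P_one_right h'.1 h'.2.1]
    | succ n ih =>
      have h2 : S.P ρ' (ρ * x n) = 0 := by rw [cusp_der h', ih, cusp_P h' h ne]; ring
      have h3 := ((pos_I h.1).mul (pos_I (hx n).ha)).sub (hx n).hb (fmx n)
      refine Pos.add_zero ((pos_I h'.1).P (pos_I (hx n).hb)) ((pos_I h'.1).P h3) ?_
      rw [← map_add]; simpa using h2
  have hz : ∀ i n, S.P (ρ * x i - x (i+1)) (x n) = 0 := by
    intro i n
    rcases (hx i).hz with hz | ⟨hz, hz'⟩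
    · rw [hz]; simp
    · obtain ⟨w, hw, h4⟩ := S.exu hz'
      rw [fmP, S.symm] at h4
      refine P_le hz ((pos_I hy).mul (pos_I hw)) (pos_I (hx n).ha) h4 ?_
      rw [mul_comm, ← PP, (hx n).ya, map_zero]
  have hz2 : ∀ i n, S.P (x (i+1)) (x (n+1)) = S.P (x i) (x n) := by
    intro i n
    have := hz i (n+1)
    rw [P_sub, mul_comm, ← PP, hP0] at this
    exact (sub_eq_zero.1 this).symm
  have dx : ∀ n, S.dg (x n) = n * S.dg ρ := by
    intro n
    induction n with
    | zero => rw [x0, S.dg_one]; simp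
    | succ n ih => rw [S.deg _ h.1 _ (hx n).ha _ (hx n).hb (fmx n), ih]; ring
  have hd := cusp_dg h
  refine ⟨x, ⟨h, x0, x1, fun n => (hx n).ha, ?_, ?_⟩, ?_⟩
  · intro i
    induction i with
    | zero => intro n; rw [x0, P_one]; simp
    | succ i ih =>
      intro n
      cases n with
      | zero =>
        rw [x0, S.P_one_right (hx (i+1)).ha]
        · simp
        · intro e
          have := dx (i+1)
          rw [e, S.dg_one] at this
          have : 0 < (i + 1) * S.dg ρ := Nat.mul_pos (Nat.succ_pos i) hd
          omega
      | succ n => rw [hz2, ih]; simp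
  · intro w hw hne n
    induction n generalizing w with
    | zero => rw [x0]; exact S.P_one_right hw (by rw [← x0]; exact hne 0)
    | succ n ih =>
      obtain ⟨ρ', hρ', w', hw', h4⟩ := exists_cusp hw (by rw [← x0]; exact hne 0)
      have pm := (pos_I hρ'.1).mul (pos_I hw')
      by_cases er : ρ' = ρ
      · subst er
        by_cases ew : ∀ i, w' ≠ x i
        · refine P_le hw pm (pos_I (hx n).hb) h4 ?_
          rw [mul_comm, ← PP, hP0, ih w' hw' ew]
        · push Not at ew
          obtain ⟨i, rfl⟩ := ew
          have h5 : S.fm w (ρ' * x i - x (i+1)) ≠ 0 := by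
            rw [map_sub, S.orth _ hw _ (hx i).hb (hne _), sub_zero]; exact h4
          exact P_le hw (pm.sub (hx i).hb (fmx i)) (pos_I (hx n).hb) h5 (hz i (n+1))
      · refine P_le hw pm (pos_I (hx n).hb) h4 ?_
        rw [mul_comm, ← PP, hPo _ hρ' er, map_zero]
  · have := fmx 1
    by_contra ne
    rw [x1, e, map_add, S.orth _ (hx 1).hb _ hu ne, zero_add] at this
    have e2 : x 2 = y := by by_contra ne2; exact this (S.orth _ (hx 1).hb _ hy ne2)
    have := (hx 1).yb
    rw [show x (1+1) = y from e2, S.P_self hy] at this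
    exact I_ne S.one this
namespace XSeq
variable {ρ : R} {x : ℕ → R} (X : XSeq S ρ x)
include X
theorem inj : Function.Injective x := by
  have : ∀ i j, i < j → x i ≠ x j := by
    intro i j h e
    have h1 := X.P_x j i
    rw [if_neg (by omega), ← e, S.P_self (X.mem i)] at h1
    exact I_ne S.one h1
  intro i j e
  rcases lt_trichotomy i j with h | h | h
  · exact absurd e (this _ _ h)
  · exact h
  · exact absurd e.symm (this _ _ h)
theorem P_mul (k : ℕ) (b c : R) : S.P (x k) (b * c) = ∑ p ∈ Finset.HasAntidiagonal.antidiagonal k, S.P (x p.1) b * S.P (x p.2) c := by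
  classical
  rw [S.hopf, finsum_eq_sum_of_support_subset (s := (Finset.range (k+1)).image fun i => (⟨x i, X.mem i⟩ : S.I)),
    Finset.sum_image, Finset.Nat.sum_antidiagonal_eq_sum_range_succ (f := fun i j => S.P (x i) b * S.P (x j) c)]
  · refine Finset.sum_congr rfl fun i hi => ?_
    rw [X.P_x, if_pos (by simpa [Nat.lt_succ_iff] using hi)]
  · intro i _ j _ e; exact X.inj (congrArg Subtype.val e)
  · intro u hu
    by_contra H
    refine hu ?_
    show S.P u.1 b * S.P (S.P u.1 (x k)) c = 0
    have : S.P u.1 (x k) = 0 := by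
      by_cases hh : ∀ i, u.1 ≠ x i
      · exact X.P_o _ u.2 hh k
      · push Not at hh
        obtain ⟨i, hi⟩ := hh
        rw [hi, X.P_x, if_neg]
        intro hik
        exact H (by simp only [Finset.coe_image, Set.mem_image]; exact ⟨i, by simp; omega, Subtype.ext hi.symm⟩)
    rw [this]; simp
theorem P_one_zero {k : ℕ} (hk : 0 < k) : S.P (x k) 1 = 0 :=
  S.P_one_right (X.mem k) (by rw [← X.zero]; exact fun e => by have := X.inj e; omega)
def T : R →+* PowerSeries R where
  toFun b := PowerSeries.mk fun k => S.P (x k) b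
  map_zero' := by ext; simp
  map_add' a b := by ext; simp
  map_one' := by
    ext k
    rw [PowerSeries.coeff_mk, PowerSeries.coeff_one]
    split_ifs with h
    · rw [h, X.zero, P_one]
    · exact X.P_one_zero (by omega)
  map_mul' a b := by
    ext k
    rw [PowerSeries.coeff_mk, PowerSeries.coeff_mul, X.P_mul]
    simp only [PowerSeries.coeff_mk]
theorem dg_x (n : ℕ) : S.dg (x n) = n * S.dg ρ := by
  induction n with
  | zero => rw [X.zero, S.dg_one]; simp
  | succ n ih =>
    have h : S.fm (x (n+1)) (ρ * x n) ≠ 0 := by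
      rw [S.symm, S.adj, ← X.one, X.P_x, if_pos (by omega)]
      simp [S.orth1 _ (X.mem n)]
    rw [S.deg _ X.cusp.1 _ (X.mem n) _ (X.mem _) h, ih]; ring
theorem P_other {ρ' : R} {x' : ℕ → R} (X' : XSeq S ρ' x') (h : ρ' ≠ ρ) {k : ℕ} (hk : 0 < k) (i : ℕ) : S.P (x k) (x' i) = 0 := by
  refine X'.P_o _ (X.mem k) (fun j e => ?_) i
  have h1 := X.P_x 1 k
  rw [X.one, if_pos (by omega)] at h1
  rw [e] at h1
  have h2 := X'.P_o _ X.cusp.1 (fun i e' => ?_) j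
  · rw [h2] at h1; exact I_ne (X.mem _) h1.symm
  · have h3 := X.cusp.2.2 (x' 1) (X'.mem 1)
    rw [X'.one] at h3
    have h3 := h3 X'.cusp.2.1 h
    rw [e', ← X'.one, X'.P_x] at h3
    by_cases hi : i = 0
    · rw [hi, X'.zero] at e'; exact X.cusp.2.1 e'
    · rw [if_pos (by omega)] at h3; exact I_ne (X'.mem _) h3
end XSeq
end PSH
end GLW
end
end
section
universe u
open scoped MatrixGroups
noncomputable section
namespace GLW
theorem sum_inj_le {m : ℕ} (l : Fin m → ℕ) (h : Function.Injective l) : m.choose 2 ≤ ∑ i, l i := by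
  induction m with
  | zero => simp
  | succ m ih =>
    obtain ⟨i0, hi0⟩ := Finite.exists_max l
    have h1 := ih (l ∘ i0.succAbove) (h.comp Fin.succAbove_right_injective)
    rw [Fin.sum_univ_succAbove _ i0]
    have h2 : m ≤ l i0 := by
      have : (Finset.univ.image l) ⊆ Finset.range (l i0 + 1) := by
        intro y hy
        simp only [Finset.mem_image, Finset.mem_univ, true_and] at hy
        obtain ⟨i, rfl⟩ := hy
        have := hi0 i
        simp; omega
      have := Finset.card_le_card this
      rw [Finset.card_image_of_injective _ h] at this
      simp at this; omega
    have h3 : (m+1).choose 2 = m + m.choose 2 := by rw [Nat.choose_succ_succ' m 1, Nat.choose_one_right]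
    simp only [Function.comp] at h1
    omega
theorem le_max_inj {m : ℕ} (l : Fin (m+1) → ℕ) (h : Function.Injective l) {i0} (hi0 : ∀ i, l i ≤ l i0) : m ≤ l i0 := by
  have : (Finset.univ.image l) ⊆ Finset.range (l i0 + 1) := by
    intro y hy
    simp only [Finset.mem_image, Finset.mem_univ, true_and] at hy
    obtain ⟨i, rfl⟩ := hy
    have := hi0 i
    simp; omega
  have := Finset.card_le_card this
  rw [Finset.card_image_of_injective _ h] at this
  simp at this; omega
section sl
variable {R : Type u} [CommRing R]
def xs (x : ℕ → R) (l j : ℕ) : R := if j ≤ l then x (l - j) else 0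
def sl (x : ℕ → R) {m : ℕ} (l : Fin m → ℕ) : R := (Matrix.of fun i j : Fin m => xs x (l i) (m - 1 - j)).det
theorem sl_row (x : ℕ → R) {m : ℕ} (l : Fin (m+1) → ℕ) (i0 : Fin (m+1)) :
    ∃ c : Fin (m+1) → R, c 0 = (-1)^(i0 : ℕ) * sl x (l ∘ i0.succAbove) ∧ sl x l = ∑ j : Fin (m+1), xs x (l i0) (m - j) * c j := by
  refine ⟨fun j => (-1)^(i0 + j : ℕ) * ((Matrix.of fun i j : Fin (m+1) => xs x (l i) (m - j)).submatrix i0.succAbove j.succAbove).det, ?_, ?_⟩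
  · simp only [Fin.val_zero, add_zero, sl]
    congr 2
    ext i j
    simp only [Matrix.submatrix_apply, Matrix.of_apply, Function.comp, Fin.succAbove_zero, Fin.val_succ]
    congr 1; omega
  · unfold sl
    rw [Matrix.det_succ_row _ i0]
    refine Finset.sum_congr rfl fun j _ => ?_
    simp only [Matrix.of_apply, Nat.add_sub_cancel]
    ring
theorem sl_noninj (x : ℕ → R) {m : ℕ} (l : Fin m → ℕ) (h : ¬ Function.Injective l) : sl x l = 0 := by
  simp only [Function.Injective, not_forall] at h
  obtain ⟨i, j, e, hij⟩ := h
  refine Matrix.det_zero_of_row_eq hij ?_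
  ext k; simp [e]
theorem sl_start (x : ℕ → R) (h : x 0 = 1) (m : ℕ) : sl x (fun i : Fin m => m - 1 - (i : ℕ)) = 1 := by
  unfold sl
  rw [Matrix.det_of_upperTriangular]
  · refine Finset.prod_eq_one fun i _ => ?_
    rw [Matrix.of_apply, xs, if_pos le_rfl, Nat.sub_self, h]
  · intro i j hij
    have : (j : ℕ) < i := hij
    simp only [Matrix.of_apply, xs]
    rw [if_neg]; have := i.2; omega
theorem trace_row_col {n : Type} [Fintype n] [DecidableEq n] (A B : Matrix n n R) :
    ∑ i, (A.updateRow i (B i)).det = ∑ j, (A.updateCol j (fun i => B i j)).det := by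
  have h1 : ∀ i, (A.updateRow i (B i)).det = (B * A.adjugate) i i := by
    intro i
    rw [← Matrix.cramer_transpose_apply, Matrix.cramer_eq_adjugate_mulVec, ← Matrix.adjugate_transpose, Matrix.mulVec_transpose]
    rfl
  have h2 : ∀ j, (A.updateCol j (fun i => B i j)).det = (A.adjugate * B) j j := by
    intro j
    rw [← Matrix.cramer_apply, Matrix.cramer_eq_adjugate_mulVec]
    rfl
  simp only [h1, h2]
  exact Matrix.trace_mul_comm B A.adjugate
theorem pieri (x : ℕ → R) (hx : x 0 = 1) {m : ℕ} (l : Fin m → ℕ) (i1 : Fin m) (h0 : l i1 = 0) :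
    x 1 * sl x l = ∑ i, sl x (Function.update l i (l i + 1)) := by
  obtain ⟨m, rfl⟩ : ∃ m', m = m' + 1 := ⟨m - 1, by have := i1.2; omega⟩
  set A : Matrix (Fin (m+1)) (Fin (m+1)) R := Matrix.of fun i j => xs x (l i) (m + 1 - 1 - j) with hA
  set B : Matrix (Fin (m+1)) (Fin (m+1)) R := Matrix.of fun i j => xs x (l i + 1) (m + 1 - 1 - j) with hB
  have h1 : ∀ i, sl x (Function.update l i (l i + 1)) = (A.updateRow i (B i)).det := by
    intro i
    unfold sl
    congr 1
    ext i' j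
    by_cases e : i' = i
    · subst e; simp [hB]
    · simp [hA, Matrix.updateRow_ne e, Function.update_of_ne e]
  simp only [h1]
  rw [trace_row_col, Finset.sum_eq_single (Fin.last m)]
  · rw [Matrix.det_succ_row _ i1, Finset.sum_eq_single (Fin.last m)]
    · unfold sl
      rw [← hA, Matrix.det_succ_row A i1, Finset.sum_eq_single (Fin.last m)]
      · rw [Matrix.submatrix_updateCol_succAbove]
        simp [hA, hB, h0, xs, hx]
        ring
      · intro j _ hj
        have : (j : ℕ) < m := Fin.val_lt_last hj
        have : A i1 j = 0 := by simp only [hA, Matrix.of_apply, xs, h0]; rw [if_neg (by omega)]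
        rw [this]; ring
      · simp
    · intro j _ hj
      have : (j : ℕ) < m := Fin.val_lt_last hj
      rw [Matrix.updateCol_ne hj]
      have : A i1 j = 0 := by simp only [hA, Matrix.of_apply, xs, h0]; rw [if_neg (by omega)]
      rw [this]; ring
    · simp
  · intro j _ hj
    have hj' : (j : ℕ) < m := Fin.val_lt_last hj
    refine Matrix.det_zero_of_column_eq (i := j) (j := ⟨j + 1, by omega⟩) (by intro e; have := congrArg Fin.val e; simp at this) fun i => ?_
    rw [Matrix.updateCol_self, Matrix.updateCol_ne (by intro e; have := congrArg Fin.val e; simp at this)]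
    simp only [hA, hB, Matrix.of_apply, xs]
    have : (m + 1 - 1 - (j : ℕ) ≤ l i + 1) ↔ (m + 1 - 1 - (j + 1 : ℕ) ≤ l i) := by omega
    simp only [this]
    congr 2; omega
  · simp
end sl
namespace PSH
variable {R : Type u} [CommRing R] {S : PSH R}
namespace XSeq
variable {ρ : R} {x : ℕ → R} (X : XSeq S ρ x)
include X
theorem T_coeff (b : R) (k : ℕ) : PowerSeries.coeff k (X.T b) = S.P (x k) b := by
  show PowerSeries.coeff k (PowerSeries.mk fun k => S.P (x k) b) = _
  rw [PowerSeries.coeff_mk]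
theorem T_xs (l j k : ℕ) : S.P (x k) (xs x l j) = xs x l (j + k) := by
  unfold xs
  split_ifs with h1 h2 h2
  · rw [X.P_x, if_pos (by omega)]; congr 1; omega
  · rw [X.P_x, if_neg (by omega)]
  · omega
  · simp
theorem T_sl {m : ℕ} (l : Fin (m+1) → ℕ) (k : ℕ) :
    S.P (x k) (sl x l) = ∑ i : Fin (m+1), (-1)^(i : ℕ) * xs x (l i) (m + k) * sl x (l ∘ i.succAbove) := by
  rw [← X.T_coeff, sl, RingHom.map_det]
  set B : Matrix (Fin (m+1)) (Fin (m+1)) (PowerSeries R) :=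
    Matrix.of fun i j => if j = 0 then X.T (xs x (l i) m) else PowerSeries.C (xs x (l i) (m - j)) with hB
  have h : (X.T.mapMatrix (Matrix.of fun i j : Fin (m+1) => xs x (l i) (m + 1 - 1 - j))).det = B.det := by
    refine Matrix.det_eq_of_forall_col_eq_smul_add_pred (fun _ => PowerSeries.X) ?_ ?_
    · intro i; simp [hB]
    · intro i j
      simp only [hB, RingHom.mapMatrix_apply, Matrix.map_apply, Matrix.of_apply, Fin.succ_ne_zero, if_false, Nat.add_sub_cancel]
      ext k
      rw [map_add, X.T_coeff, X.T_xs, PowerSeries.coeff_C]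
      cases k with
      | zero => simp
      | succ k =>
        rw [PowerSeries.coeff_succ_X_mul, X.T_coeff, X.T_xs]
        simp only [Nat.succ_ne_zero, if_false, zero_add, Fin.val_succ, Fin.val_castSucc]
        congr 1; have := j.2; omega
  rw [h, Matrix.det_succ_column_zero, map_sum]
  refine Finset.sum_congr rfl fun i _ => ?_
  have h2 : (B.submatrix i.succAbove Fin.succ).det = PowerSeries.C (sl x (l ∘ i.succAbove)) := by
    unfold sl
    rw [RingHom.map_det]
    congr 1
    ext1 a b
    simp only [hB, Matrix.submatrix_apply, Matrix.of_apply, Fin.succ_ne_zero, if_false, RingHom.mapMatrix_apply, Matrix.map_apply, Function.comp, Fin.val_succ]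
    congr 2; omega
  rw [h2, PowerSeries.coeff_mul_C]
  congr 1
  simp only [hB, Matrix.of_apply, if_true]
  rw [show ((-1 : PowerSeries R) ^ (i : ℕ)) = PowerSeries.C ((-1)^(i:ℕ)) by simp, PowerSeries.coeff_C_mul, X.T_coeff, X.T_xs]
theorem P_mul_of {Q : R} (hQ : ∀ k > 0, S.P (x k) Q = 0) (k : ℕ) (b : R) : S.P (x k) (b * Q) = S.P (x k) b * Q := by
  rw [X.P_mul, Finset.sum_eq_single (k, 0)]
  · rw [X.zero, P_one]
  · rintro ⟨a, b⟩ h1 h2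
    rw [hQ b, mul_zero]
    rcases Nat.eq_zero_or_pos b with h | h
    · subst h; simp at h1; subst h1; exact absurd rfl h2
    · exact h
  · simp
theorem fm_sl {m : ℕ} (l : Fin m → ℕ) (hl : Function.Injective l) {Q : R} (hQ : ∀ k > 0, S.P (x k) Q = 0) :
    S.fm (sl x l * Q) (sl x l * Q) = S.fm Q Q := by
  induction m with
  | zero => simp [sl]
  | succ m ih =>
    obtain ⟨i0, hi0⟩ := Finite.exists_max l
    have hm := le_max_inj l hl hi0
    obtain ⟨c, hc, hs⟩ := sl_row x l i0
    rw [← ih (l ∘ i0.succAbove) (hl.comp Fin.succAbove_right_injective)]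
    conv_lhs => enter [1, 2, 1]; rw [hs]
    have h1 : ∀ j : Fin (m+1), xs x (l i0) (m - j) = x (l i0 + j - m) := fun j => by
      have := j.2
      rw [xs, if_pos (by omega)]; congr 1; omega
    simp only [h1]
    rw [Finset.sum_mul, map_sum, AddMonoidHom.finset_sum_apply, Finset.sum_eq_single 0]
    · rw [mul_assoc, S.adj, X.P_mul_of hQ, X.T_sl, Finset.sum_eq_single i0]
      · have : xs x (l i0) (m + (l i0 + (0 : Fin (m+1)) - m)) = 1 := by
          rw [xs, if_pos (by simp; omega), ← X.zero]; congr 1; simp; omega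
        rw [this, hc, mul_one]
        rcases neg_one_pow_eq_or R (i0 : ℕ) with h | h <;> simp [h]
      · intro i _ hi
        have h2 := hi0 i
        have h3 : l i ≠ l i0 := fun e => hi (hl e)
        rw [xs, if_neg (by simp; omega)]; ring
      · simp
    · intro j _ hj
      have hj : 0 < (j : ℕ) := Nat.pos_of_ne_zero fun e => hj (Fin.ext e)
      rw [mul_assoc, S.adj, X.P_mul_of hQ, X.T_sl, Finset.sum_eq_zero]
      · simp
      · intro i _
        have h2 := hi0 i
        rw [xs, if_neg (by simp; omega)]; ring
    · simp
theorem pow_mem (m k : ℕ) (hk : k ≤ m) : ρ ^ k ∈ AddSubgroup.closure {s | ∃ l : Fin m → ℕ, Function.Injective l ∧ ∑ i, l i = m.choose 2 + k ∧ s = sl x l} := by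
  induction k with
  | zero =>
    refine AddSubgroup.subset_closure ⟨fun i : Fin m => m - 1 - (i : ℕ), ?_, ?_, ?_⟩
    · intro i j e; ext; have := i.2; have := j.2; simp at e; omega
    · rw [Fin.sum_univ_eq_sum_range (fun i => m - 1 - i), Finset.sum_range_reflect (fun i => i), Finset.sum_range_id, Nat.choose_two_right]; rfl
    · rw [sl_start x X.zero, pow_zero]
  | succ k ih =>
    have ih := ih (by omega)
    rw [pow_succ']
    refine AddSubgroup.closure_induction (p := fun b _ => ρ * b ∈ AddSubgroup.closure {s | ∃ l : Fin m → ℕ, Function.Injective l ∧ ∑ i, l i = m.choose 2 + (k+1) ∧ s = sl x l}) ?_ (by simp) ?_ ?_ ih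
    · rintro _ ⟨l, hl, hs, rfl⟩
      have : ∃ i1, l i1 = 0 := by
        by_contra! H
        have h1 := sum_inj_le (fun i => l i - 1) (fun i j e => hl (by have := H i; have := H j; simp at e; omega))
        have h2 : ∑ i, l i = ∑ i, (l i - 1) + m := by
          have h3 : ∑ i : Fin m, (l i - 1) + ∑ i : Fin m, 1 = ∑ i, l i := by
            rw [← Finset.sum_add_distrib]
            refine Finset.sum_congr rfl fun i _ => ?_
            have := H i; omega
          rw [← h3]; simp
        omega
      obtain ⟨i1, h0⟩ := this
      rw [← X.one, pieri x X.zero l i1 h0]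
      refine AddSubgroup.sum_mem _ fun i _ => ?_
      by_cases hi : Function.Injective (Function.update l i (l i + 1))
      · refine AddSubgroup.subset_closure ⟨_, hi, ?_, rfl⟩
        rw [Finset.sum_update_of_mem (Finset.mem_univ i), ← add_assoc, ← hs, ← Finset.add_sum_erase _ _ (Finset.mem_univ i), Finset.sdiff_singleton_eq_erase]
        ring
      · rw [sl_noninj x _ hi]; exact AddSubgroup.zero_mem _
    · intro a b _ _ ha hb; rw [mul_add]; exact AddSubgroup.add_mem _ ha hb
    · intro a _ ha; rw [mul_neg]; exact AddSubgroup.neg_mem _ ha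
end XSeq
theorem prod_ann {x : R → ℕ → R} {ρ : R} (A : Finset R) (hA : ∀ ρ ∈ A, XSeq S ρ (x ρ)) (hρ : XSeq S ρ (x ρ)) (hn : ρ ∉ A)
    {m : ℕ} (l : R → Fin m → ℕ) {k : ℕ} (hk : 0 < k) : S.P (x ρ k) (∏ σ ∈ A, sl (x σ) (l σ)) = 0 := by
  classical
  have hs : ∀ σ ∈ A, ∀ k > 0, ∀ l : Fin m → ℕ, S.P (x ρ k) (sl (x σ) l) = 0 := by
    intro σ hσ k hk l
    have ne : σ ≠ ρ := by rintro rfl; exact hn hσ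
    have : hρ.T (sl (x σ) l) = PowerSeries.C (sl (x σ) l) := by
      unfold sl
      rw [RingHom.map_det, RingHom.map_det]
      congr 1
      ext1 i j
      simp only [RingHom.mapMatrix_apply, Matrix.map_apply, Matrix.of_apply]
      ext k
      rw [hρ.T_coeff, PowerSeries.coeff_C]
      split_ifs with h
      · rw [h, hρ.zero, P_one]
      · unfold xs; split_ifs
        · exact hρ.P_other (hA σ hσ) ne (by omega) _
        · simp
    rw [← hρ.T_coeff, this, PowerSeries.coeff_C, if_neg (by omega)]
  clear hn
  induction A using Finset.induction_on generalizing k with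
  | empty => rw [Finset.prod_empty]; exact hρ.P_one_zero hk
  | insert a A ha ih =>
    rw [Finset.prod_insert ha, hρ.P_mul_of fun k hk => ih (fun σ h => hA σ (by simp [h])) hk (fun σ h => hs σ (by simp [h])), hs a (by simp) k hk, zero_mul]
theorem prod_norm {x : R → ℕ → R} (A : Finset R) (hA : ∀ ρ ∈ A, XSeq S ρ (x ρ)) {m : ℕ} (l : R → Fin m → ℕ)
    (hl : ∀ ρ ∈ A, Function.Injective (l ρ)) : S.fm (∏ σ ∈ A, sl (x σ) (l σ)) (∏ σ ∈ A, sl (x σ) (l σ)) = 1 := by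
  classical
  induction A using Finset.induction_on with
  | empty => simp [S.orth1 _ S.one]
  | insert a A ha ih =>
    have hA' : ∀ ρ ∈ A, XSeq S ρ (x ρ) := fun σ h => hA σ (by simp [h])
    rw [Finset.prod_insert ha, (hA a (by simp)).fm_sl (l a) (hl a (by simp)), ih hA' (fun σ h => hl σ (by simp [h]))]
    intro k hk
    exact prod_ann A hA' (hA a (by simp)) ha l hk
theorem closure_mul {s t : Set R} {K : AddSubgroup R} (h : ∀ a ∈ s, ∀ b ∈ t, a * b ∈ K) {a b : R} (ha : a ∈ AddSubgroup.closure s)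
    (hb : b ∈ AddSubgroup.closure t) : a * b ∈ K := by
  refine AddSubgroup.closure_induction (p := fun a _ => a * b ∈ K) ?_ (by simp) ?_ ?_ ha
  · intro a ha
    refine AddSubgroup.closure_induction (p := fun b _ => a * b ∈ K) (fun b hb => h a ha b hb) (by simp) ?_ ?_ hb
    · intro c d _ _ h h'; rw [mul_add]; exact AddSubgroup.add_mem _ h h'
    · intro c _ h; rw [mul_neg]; exact AddSubgroup.neg_mem _ h
  · intro c d _ _ h h'; rw [add_mul]; exact AddSubgroup.add_mem _ h h'
  · intro c _ h; rw [neg_mul]; exact AddSubgroup.neg_mem _ h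
theorem prod_mem {x : R → ℕ → R} (A : Finset R) (hA : ∀ ρ ∈ A, XSeq S ρ (x ρ)) {m : ℕ} (k : R → ℕ) (hk : ∀ ρ, k ρ ≤ m) :
    ∏ ρ ∈ A, ρ ^ k ρ ∈ AddSubgroup.closure {s | ∃ l : R → Fin m → ℕ, (∀ ρ ∈ A, Function.Injective (l ρ) ∧
      ∑ i, l ρ i = m.choose 2 + k ρ) ∧ s = ∏ σ ∈ A, sl (x σ) (l σ)} := by
  classical
  induction A using Finset.induction_on with
  | empty => exact AddSubgroup.subset_closure ⟨fun _ _ => 0, by simp, by simp⟩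
  | insert a A ha ih =>
    have h1 := ih fun σ h => hA σ (by simp [h])
    have h2 := (hA a (by simp)).pow_mem m (k a) (hk a)
    rw [Finset.prod_insert ha]
    refine closure_mul ?_ h2 h1
    · rintro _ ⟨l, hl, hs, rfl⟩ _ ⟨l', hl', rfl⟩
      refine AddSubgroup.subset_closure ⟨Function.update l' a l, ?_, ?_⟩
      · intro ρ hρ
        by_cases e : ρ = a
        · subst e; simp [hl, hs]
        · rw [Function.update_of_ne e]; exact hl' ρ (by simpa [e] using hρ)
      · rw [Finset.prod_insert ha, Function.update_self]
        congr 1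
        refine Finset.prod_congr rfl fun σ hσ => ?_
        rw [Function.update_of_ne (by rintro rfl; exact ha hσ)]
theorem structure_thm {x : R → ℕ → R} (hx : ∀ ρ ∈ S.Cusp, XSeq S ρ (x ρ)) {χ : R} (hχ : χ ∈ S.I) :
    ∃ (A : Finset R) (k : R → ℕ) (m : ℕ) (l : R → Fin m → ℕ), (∀ ρ ∈ A, ρ ∈ S.Cusp ∧ 0 < k ρ ∧ Function.Injective (l ρ) ∧
      ∑ i, l ρ i = m.choose 2 + k ρ) ∧ (χ = ∏ σ ∈ A, sl (x σ) (l σ) ∨ -χ = ∏ σ ∈ A, sl (x σ) (l σ)) ∧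
      ∑ ρ ∈ A, k ρ * S.dg ρ = S.dg χ ∧ S.fm χ (∏ ρ ∈ A, ρ ^ k ρ) ≠ 0 := by
  classical
  obtain ⟨s, hs, h1, h2⟩ := MC_exists hχ
  have hc : ∀ ρ ∈ s.toFinset, ρ ∈ S.Cusp := fun ρ h => hs ρ (by simpa using h)
  have h3 := prod_mem s.toFinset (x := x) (fun ρ h => hx ρ (hc ρ h)) (m := Multiset.card s) (fun ρ => s.count ρ) (fun ρ => Multiset.count_le_card _ _)
  rw [← Finset.prod_multiset_count] at h3
  have h4 : ∃ l : R → Fin (Multiset.card s) → ℕ, (∀ ρ ∈ s.toFinset, Function.Injective (l ρ) ∧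
      ∑ i, l ρ i = (Multiset.card s).choose 2 + s.count ρ) ∧ S.fm χ (∏ σ ∈ s.toFinset, sl (x σ) (l σ)) ≠ 0 := by
    by_contra! H
    apply h1
    refine AddSubgroup.closure_induction (p := fun b _ => S.fm χ b = 0) ?_ (by simp) ?_ ?_ h3
    · rintro _ ⟨l, hl, rfl⟩; exact H l hl
    · intro a b _ _ ha hb; rw [map_add, ha, hb]; rfl
    · intro a _ ha; rw [map_neg, ha]; rfl
  obtain ⟨l, hl, h5⟩ := h4
  refine ⟨s.toFinset, fun ρ => s.count ρ, Multiset.card s, l, fun ρ h => ⟨hc ρ h, Multiset.count_pos.2 (by simpa using h), hl ρ h⟩, ?_, ?_, ?_⟩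
  · rcases norm_one (prod_norm s.toFinset (x := x) (fun ρ h => hx ρ (hc ρ h)) l fun ρ h => (hl ρ h).1) with h | h
    · left; by_contra e; exact h5 (S.orth _ hχ _ h e)
    · right; by_contra e; apply h5
      have := S.orth _ hχ _ h fun e' => e (by rw [e', neg_neg])
      simpa using this
  · rw [← h2, Finset.sum_multiset_map_count]; simp
  · rwa [← Finset.prod_multiset_count]
end PSH
end GLW
end
end
section
universe u
open scoped MatrixGroups
noncomputable section
namespace GLW
variable {F : Type} [Field F] [Fintype F]
theorem mult_nat {H G G₁ G₂ : Type} [Group H] [Fintype H] [Group G] [Fintype G] [Group G₁] [Fintype G₁] [Group G₂] [Fintype G₂]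
    (π : H →* G) (π₁ : H →* G₁) (π₂ : H →* G₂) {w : G → ℂ} {u : G₁ → ℂ} {v : G₂ → ℂ} (hw : w ∈ IrrC G) (hu : u ∈ IrrC G₁) (hv : v ∈ IrrC G₂) :
    ∃ k : ℕ, (Fintype.card H : ℂ)⁻¹ * ∑ h, w (π h) * (starRingEnd ℂ (u (π₁ h)) * starRingEnd ℂ (v (π₂ h))) = k := by
  obtain ⟨V, _, _, _, ρ, _, rfl⟩ := hw
  obtain ⟨V₁, _, _, _, ρ₁, _, rfl⟩ := hu
  obtain ⟨V₂, _, _, _, ρ₂, _, rfl⟩ := hv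
  have := Representation.card_inv_mul_sum_char_mul_char_eq_finrank (ρ := (Representation.tprod (ρ₁.comp π₁) (ρ₂.comp π₂))) (σ := ρ.comp π)
  rw [Nat.card_eq_fintype_card] at this
  refine ⟨_, Eq.trans ?_ this⟩
  congr 1
  refine Finset.sum_congr rfl fun h _ => ?_
  rw [Representation.char_tensor, Pi.mul_apply, ← char_inv, ← char_inv, ← map_inv, ← map_inv]
  rfl
variable (F) in
abbrev Gn (n : ℕ) := (Fin n → F) ≃ₗ[F] (Fin n → F)
variable (F) in
def Par (i j : ℕ) : Subgroup (Gn F i × Gn F j × (((Fin i → F) × (Fin j → F)) ≃ₗ[F] ((Fin i → F) × (Fin j → F)))) where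
  carrier := {p | (∀ x, p.2.2 (x, 0) = (p.1 x, 0)) ∧ ∀ z, (p.2.2 z).2 = p.2.1 z.2}
  one_mem' := ⟨fun x => rfl, fun z => rfl⟩
  mul_mem' := by
    rintro ⟨a, b, c⟩ ⟨a', b', c'⟩ ⟨h1, h2⟩ ⟨h1', h2'⟩
    simp only at h1 h2 h1' h2'
    exact ⟨fun x => by simp [LinearEquiv.mul_apply, h1, h1'], fun z => by simp [LinearEquiv.mul_apply, h2, h2']⟩
  inv_mem' := by
    rintro ⟨a, b, c⟩ ⟨h1, h2⟩
    simp only at h1 h2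
    refine ⟨fun x => ?_, fun z => ?_⟩
    · show c.symm (x, 0) = (a.symm x, 0)
      rw [LinearEquiv.symm_apply_eq, h1]; simp
    · show (c.symm z).2 = b.symm z.2
      rw [LinearEquiv.eq_symm_apply, ← h2]; simp
theorem ext_mat_apply {i j : ℕ} (α : Gn F i) (β : Gn F j) (B) (z) : (ext (mat i (α : Module.End F _)) (mat j (β : Module.End F _)) B).x z = (α z.1 + B z.2, β z.2) := rfl
def parL {i j : ℕ} (α : Gn F i) (β : Gn F j) (B : (Fin j → F) →ₗ[F] (Fin i → F)) : ((Fin i → F) × (Fin j → F)) ≃ₗ[F] ((Fin i → F) × (Fin j → F)) where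
  toFun z := (α z.1 + B z.2, β z.2)
  invFun z := (α.symm (z.1 - B (β.symm z.2)), β.symm z.2)
  map_add' x y := by ext1 <;> simp; abel
  map_smul' c x := by ext1 <;> simp
  left_inv z := by simp
  right_inv z := by simp
theorem parL_apply {i j : ℕ} (α : Gn F i) (β : Gn F j) (B) (z) : parL α β B z = (α z.1 + B z.2, β z.2) := rfl
def parM {i j : ℕ} (p : Gn F i × Gn F j × ((Fin j → F) →ₗ[F] (Fin i → F))) : Par F i j :=
  ⟨(p.1, p.2.1, parL p.1 p.2.1 p.2.2), ⟨fun x => by simp [parL_apply], fun z => rfl⟩⟩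
variable (F) in
def parEquiv (i j : ℕ) : (Gn F i × Gn F j × ((Fin j → F) →ₗ[F] (Fin i → F))) ≃ Par F i j :=
  Equiv.ofBijective parM (by
    constructor
    · rintro ⟨a, b, c⟩ ⟨a', b', c'⟩ h
      have h1 : (a, b, parL a b c) = (a', b', parL a' b' c') := congrArg Subtype.val h
      simp only [Prod.mk.injEq] at h1
      obtain ⟨rfl, rfl, h2⟩ := h1
      refine Prod.ext rfl (Prod.ext rfl (LinearMap.ext fun z => ?_))
      have := LinearEquiv.congr_fun h2 (0, z)
      simp only [parL_apply, Prod.mk.injEq] at this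
      simpa using this.1
    · rintro ⟨⟨a, b, c⟩, h1, h2⟩
      simp only at h1 h2
      refine ⟨(a, b, (LinearMap.fst F _ _) ∘ₗ c.toLinearMap ∘ₗ (LinearMap.inr F _ _)), Subtype.ext (Prod.ext rfl (Prod.ext rfl ?_))⟩
      refine LinearEquiv.ext fun z => ?_
      show parL a b _ z = c z
      have : c z = c (z.1, 0) + c (0, z.2) := by rw [← map_add]; simp
      rw [parL_apply]
      refine Prod.ext ?_ (h2 z).symm
      rw [this, h1]; simp)
theorem parEquiv_apply {i j : ℕ} (p : Gn F i × Gn F j × ((Fin j → F) →ₗ[F] (Fin i → F))) : (parEquiv F i j p).1 = (p.1, p.2.1, parL p.1 p.2.1 p.2.2) := rfl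
def autC {V W : Type} [AddCommGroup V] [Module F V] [AddCommGroup W] [Module F W] (c : V ≃ₗ[F] W) : (V ≃ₗ[F] V) →* (W ≃ₗ[F] W) where
  toFun g := c.symm.trans (g.trans c)
  map_one' := by ext; simp
  map_mul' a b := by ext; simp [LinearEquiv.mul_apply]
def Sup {K : Type u} [Zero K] (a : Hall F K) : Prop := ∀ M, ¬ Function.Bijective M.x → a M = 0
theorem pr_gl {K : Type u} [AddCommGroup K] [Module ℂ K] {a : Hall F ℂ} (ha : Sup a) (n : ℕ) (h : Hall F K) :
    pr n a h = (gl F n : ℂ)⁻¹ • ∑ g : Gn F n, starRingEnd ℂ (a (mat n g)) • h (mat n g) := by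
  classical
  unfold pr
  congr 1
  symm
  refine Fintype.sum_of_injective (fun g : Gn F n => (g : Module.End F (Fin n → F))) LinearEquiv.toLinearMap_injective _ _ (fun x hx => ?_) (fun g => rfl)
  rw [ha]
  · simp
  · intro hb
    exact hx ⟨LinearEquiv.ofBijective _ hb, by ext; simp⟩
variable (F) in
def Irr (n : ℕ) : Set (Hall F ℂ) := {a | (fun g : Gn F n => a (mat n g)) ∈ IrrC (Gn F n) ∧ ∀ M, a M ≠ 0 → M.d = n ∧ Function.Bijective M.x}
theorem Irr.sup {n} {a : Hall F ℂ} (h : a ∈ Irr F n) : Sup a := fun M hM => by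
  by_contra H; exact hM (h.2 M H).2
theorem Irr.deg {n} {a : Hall F ℂ} (h : a ∈ Irr F n) {M : Ob F} (hM : M.d ≠ n) : a M = 0 := by
  by_contra H; exact hM (h.2 M H).1
theorem Iso.bij {M N : Ob F} (h : Iso M N) (hM : Function.Bijective M.x) : Function.Bijective N.x := by
  obtain ⟨e, he⟩ := h
  have : (N.x : N.V → N.V) = e ∘ M.x ∘ e.symm := by
    ext v; simp [he]
  rw [this]; exact e.bijective.comp (hM.comp e.symm.bijective)
theorem exists_mat_gl {n : ℕ} {M : Ob F} (hd : M.d = n) (hb : Function.Bijective M.x) : ∃ g : Gn F n, Iso M (mat n g) := by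
  subst hd
  obtain ⟨x, hx⟩ := exists_mat M
  exact ⟨LinearEquiv.ofBijective x (hx.bij hb), hx⟩
theorem iso_mat_conj {n : ℕ} {g g' : Gn F n} (h : Iso (mat n g) (mat n (g' : Module.End F _))) : ∃ e : Gn F n, e * g * e⁻¹ = g' := by
  obtain ⟨e, he⟩ := h
  refine ⟨e, ?_⟩
  rw [mul_inv_eq_iff_eq_mul]
  exact LinearEquiv.ext he
theorem Irr.ext {n} {a b : Hall F ℂ} (ha : ∀ M, a M ≠ 0 → M.d = n ∧ Function.Bijective M.x) (hb : ∀ M, b M ≠ 0 → M.d = n ∧ Function.Bijective M.x)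
   (h : ∀ g : Gn F n, a (mat n g) = b (mat n g)) : a = b := by
  ext M
  by_cases H : M.d = n ∧ Function.Bijective M.x
  · obtain ⟨g, hg⟩ := exists_mat_gl H.1 H.2
    exact (a.inv hg).trans ((h g).trans (b.inv hg).symm)
  · have h1 : a M = 0 := by by_contra h1; exact H (ha _ h1)
    have h2 : b M = 0 := by by_contra h1; exact H (hb _ h1)
    exact h1.trans h2.symm
open Classical in
def mkH {n : ℕ} (f : Gn F n → ℂ) (hf : ∀ g h, f (h * g * h⁻¹) = f g) : Hall F ℂ :=
  ⟨fun M => if H : M.d = n ∧ Function.Bijective M.x then f (exists_mat_gl H.1 H.2).choose else 0, fun {M N} h => by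
    have hd := h.d
    have hiff : (M.d = n ∧ Function.Bijective M.x) ↔ (N.d = n ∧ Function.Bijective N.x) :=
      ⟨fun H => ⟨hd ▸ H.1, h.bij H.2⟩, fun H => ⟨hd ▸ H.1, h.symm.bij H.2⟩⟩
    by_cases H : M.d = n ∧ Function.Bijective M.x
    · have H' := hiff.1 H
      rw [dif_pos H, dif_pos H']
      obtain ⟨e, he⟩ := iso_mat_conj (((exists_mat_gl H.1 H.2).choose_spec.symm.trans h).trans (exists_mat_gl H'.1 H'.2).choose_spec)
      rw [← he, hf]
    · rw [dif_neg H, dif_neg (fun h => H (hiff.2 h))]⟩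
theorem mkH_mat {n : ℕ} (f : Gn F n → ℂ) (hf) (g : Gn F n) : (mkH f hf) (mat n g) = f g := by
  have H : (mat n (g : Module.End F _)).d = n ∧ Function.Bijective (mat n (g : Module.End F _)).x := ⟨mat_d _ _, g.bijective⟩
  refine (dif_pos H).trans ?_
  obtain ⟨e, he⟩ := iso_mat_conj (exists_mat_gl H.1 H.2).choose_spec
  rw [← he, hf]
theorem mkH_sup {n : ℕ} (f : Gn F n → ℂ) (hf) (M) (h : (mkH f hf) M ≠ 0) : M.d = n ∧ Function.Bijective M.x := by
  by_contra H; exact h (dif_neg H)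
theorem Irr_surj {n} {f : Gn F n → ℂ} (hf : f ∈ IrrC (Gn F n)) : ∃ a ∈ Irr F n, ∀ g : Gn F n, a (mat n g) = f g := by
  refine ⟨mkH f (fun g h => irr_conj hf g h), ⟨?_, mkH_sup _ _⟩, mkH_mat _ _⟩
  have : (fun g : Gn F n => (mkH f (fun g h => irr_conj hf g h)) (mat n g)) = f := funext fun g => mkH_mat _ _ g
  rw [this]; exact hf
theorem Irr_fin (n : ℕ) : (Irr F n).Finite := by
  refine Set.Finite.of_finite_image (f := fun (a : Hall F ℂ) (g : Gn F n) => a (mat n g)) ((irr_fin (G := Gn F n)).subset ?_) ?_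
  · rintro _ ⟨a, ha, rfl⟩; exact ha.1
  · intro a ha b hb h
    exact Irr.ext ha.2 hb.2 fun g => congrFun h g
open Classical in
theorem Irr_orth {n} {a b : Hall F ℂ} (ha : a ∈ Irr F n) (hb : b ∈ Irr F n) : ip n a b = if a = b then 1 else 0 := by
  have := irr_orth ha.1 hb.1
  rw [ip, pr_gl (Irr.sup ha)]
  refine this.trans ?_
  congr 1
  rw [eq_iff_iff]
  exact ⟨fun h => Irr.ext ha.2 hb.2 fun g => congrFun h g, fun h => by rw [h]⟩
variable (F) in
def IrrF (n : ℕ) : Finset (Hall F ℂ) := (Irr_fin n).toFinset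
theorem mem_IrrF {n} {a : Hall F ℂ} : a ∈ IrrF F n ↔ a ∈ Irr F n := by simp [IrrF]
theorem complete {h : Hall F ℂ} (hs : Sup h) (M : Ob F) : h M = ∑ u ∈ IrrF F M.d, ip M.d u h * u M := by
  classical
  set n := M.d with hn
  by_cases hb : Function.Bijective M.x
  swap
  · rw [hs M hb, Finset.sum_eq_zero]
    intro u hu; rw [Irr.sup (mem_IrrF.1 hu) M hb, mul_zero]
  obtain ⟨g, hg⟩ := exists_mat_gl hn.symm hb
  let c : Hall F ℂ := h - ∑ u ∈ IrrF F n, ip n u h • u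
  have hc : ∀ M, c M = h M - ∑ u ∈ IrrF F n, ip n u h * u M := by
    intro M
    show c.f M = _
    simp only [c, Hall.sub_f, Hall.sum_f, Hall.smul_f, smul_eq_mul]
  have key : (fun g : Gn F n => starRingEnd ℂ (c (mat n g))) = 0 := by
    refine irr_complete _ (fun g h => ?_) (fun χ hχ => ?_)
    · congr 1
      refine c.inv (Iso.symm ⟨h, fun v => ?_⟩)
      show h (g v) = (h * g * h⁻¹) (h v)
      simp [LinearEquiv.mul_apply]
    · obtain ⟨a, ha, hae⟩ := Irr_surj hχ
      have h1 : ip n a c = 0 := by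
        have : ip n a c = ip n a h - ∑ u ∈ IrrF F n, ip n u h * ip n a u := by
          simp only [ip, pr, hc]
          simp only [smul_eq_mul, mul_sub, Finset.sum_sub_distrib, Finset.mul_sum]
          rw [Finset.sum_comm (s := Finset.univ)]
          congr 1
          refine Finset.sum_congr rfl fun u _ => ?_
          refine Finset.sum_congr rfl fun x _ => ?_
          ring
        rw [this, Finset.sum_eq_single a]
        · rw [Irr_orth ha ha]; simp
        · intro b hb hne; rw [Irr_orth ha (mem_IrrF.1 hb), if_neg hne.symm, mul_zero]
        · intro hh; exact absurd (mem_IrrF.2 ha) hh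
      rw [ip, pr_gl (Irr.sup ha)] at h1
      have h2 := (smul_eq_zero.1 h1).resolve_left (inv_ne_zero (gl_pos n))
      have h3 := congrArg (starRingEnd ℂ) h2
      rw [map_sum, map_zero] at h3
      rw [← h3]
      refine Finset.sum_congr rfl fun g _ => ?_
      simp only [smul_eq_mul, map_mul, Complex.conj_conj]
      rw [hae, mul_comm]
  have h4 := congrFun key g
  have h5 : c (mat n g) = 0 := by simpa using h4
  have h6 := hc M
  rw [c.inv hg, h5] at h6
  exact (sub_eq_zero.1 h6.symm)
theorem ext_bij {M N : Ob F} {B} (h : Function.Bijective (ext M N B).x) : Function.Bijective M.x ∧ Function.Bijective N.x := by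
  have hM : Function.Injective M.x := by
    intro a b e
    have := h.1 (a₁ := (a, 0)) (a₂ := (b, 0)) (by simp [e])
    exact congrArg Prod.fst this
  have hN : Function.Surjective N.x := by
    intro b
    obtain ⟨⟨x, y⟩, hz⟩ := h.2 (0, b)
    exact ⟨y, congrArg Prod.snd hz⟩
  exact ⟨⟨hM, Finite.injective_iff_surjective.1 hM⟩, ⟨Finite.injective_iff_surjective.2 hN, hN⟩⟩
theorem Sup.phi {a : Hall F ℂ} (h : Sup a) {M N : Ob F} (hb : ¬ Function.Bijective M.x ∨ ¬ Function.Bijective N.x) : (Phi a M).f N = 0 := by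
  rw [Phi_f]
  refine avg_const _ _ fun B => h _ fun hB => ?_
  have := ext_bij hB
  tauto
theorem Sup.mul {a b : Hall F ℂ} (ha : Sup a) (hb : Sup b) : Sup (a * b) := by
  intro M hM
  refine (Hall.mul_f a b M).trans (Finset.sum_eq_zero fun W _ => ?_)
  by_cases h1 : Function.Bijective (M.sub W).x
  · by_cases h2 : Function.Bijective (M.quot W).x
    · exfalso
      apply hM
      have : Function.Injective M.x := by
        rw [injective_iff_map_eq_zero]
        intro v hv
        have h3 : (Submodule.Quotient.mk v : M.V ⧸ W.1) = 0 := h2.1 (by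
          rw [map_zero]
          show Submodule.Quotient.mk (M.x v) = _
          rw [hv]; rfl)
        rw [Submodule.Quotient.mk_eq_zero] at h3
        have h4 : (⟨v, h3⟩ : W.1) = 0 := h1.1 (by
          rw [map_zero]
          exact Subtype.ext hv)
        exact congrArg Subtype.val h4
      exact ⟨this, Finite.injective_iff_surjective.1 this⟩
    · rw [hb _ h2, mul_zero]
  · rw [ha _ h1, zero_mul]
theorem ip_conj (n) (a b : Hall F ℂ) : starRingEnd ℂ (ip n a b) = ip n b a := by
  simp only [ip, pr, smul_eq_mul, map_mul, map_inv₀, map_sum, Complex.conj_conj, map_natCast]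
  congr 1
  exact Finset.sum_congr rfl fun x _ => mul_comm _ _
theorem pr_deg {K : Type u} [AddCommGroup K] [Module ℂ K] {a : Hall F ℂ} (h : Hall F K) {n} (hd : ∀ M : Ob F, M.d = n → a M = 0) : pr n a h = 0 := by
  unfold pr
  rw [Finset.sum_eq_zero, smul_zero]
  intro x _
  rw [hd _ (mat_d _ _)]; simp
theorem ip_nat {i j n : ℕ} {u v w : Hall F ℂ} (hu : u ∈ Irr F i) (hv : v ∈ Irr F j) (hw : w ∈ Irr F n) : ∃ k : ℕ, ip n (u * v) w = k ∧ (k ≠ 0 → i + j = n) := by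
  classical
  have hadj := adj u v w n
  by_cases hij : i + j = n
  swap
  · refine ⟨0, ?_, by simp⟩
    rw [hadj, Finset.sum_eq_zero]; · simp
    rintro ⟨p, q⟩ hpq
    simp at hpq
    by_cases hp : p = i
    · refine pr_deg _ fun M hM => Irr.deg hv ?_
      omega
    · have : perp p u w = 0 := pr_deg _ fun M hM => Irr.deg hu (by omega)
      simp only [this]
      simp [ip, pr]
  subst hij
  rw [Finset.sum_eq_single (i, j)] at hadj
  · have e : ∀ g : ((Fin i → F) × (Fin j → F)) ≃ₗ[F] ((Fin i → F) × (Fin j → F)), Function.Bijective g := fun g => g.bijective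
    let c : ((Fin i → F) × (Fin j → F)) ≃ₗ[F] (Fin (i + j) → F) := LinearEquiv.ofFinrankEq _ _ (by simp)
    let π : Par F i j →* Gn F (i + j) := (autC c).comp ((MonoidHom.snd _ _).comp ((MonoidHom.snd _ _).comp (Par F i j).subtype))
    obtain ⟨k, hk⟩ := mult_nat π ((MonoidHom.fst _ _).comp (Par F i j).subtype) (((MonoidHom.fst _ _).comp (MonoidHom.snd _ _)).comp (Par F i j).subtype) hw.1 hu.1 hv.1
    refine ⟨k, ?_, fun _ => rfl⟩
    rw [hadj, ← hk, ← (parEquiv F i j).sum_comp, Fintype.card_congr (parEquiv F i j).symm]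
    have h1 : ∀ (α : Gn F i) (β : Gn F j) B, w (ext (mat i (α : Module.End F _)) (mat j (β : Module.End F _)) B) = w (mat (i + j) (π (parEquiv F i j (α, β, B)) : Module.End F _)) := by
      intro α β B
      refine w.inv ⟨c, fun z => ?_⟩
      show c _ = c ((parEquiv F i j (α, β, B)).1.2.2 (c.symm (c z)))
      rw [LinearEquiv.symm_apply_apply]; rfl
    simp only [ip]
    rw [pr_gl (Irr.sup hv)]
    have h2 : ∀ N : Ob F, (perp i u w) N = (gl F i : ℂ)⁻¹ * ∑ g : Gn F i, starRingEnd ℂ (u (mat i g)) * (Phi w (mat i g)).f N := by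
      intro N
      rw [perp, pr_gl (Irr.sup hu)]
      show Hall.f _ N = _
      rw [Hall.smul_f, Hall.sum_f]
      simp [Hall.smul_f]
    simp only [h2, Phi_f, avg, h1, Fintype.card_prod, Fintype.sum_prod_type, smul_eq_mul]
    rw [Finset.sum_comm]
    simp only [Finset.mul_sum, gl]
    push_cast
    refine Finset.sum_congr rfl fun β _ => Finset.sum_congr rfl fun α _ => Finset.sum_congr rfl fun B _ => ?_
    rw [mul_inv, mul_inv]
    have e1 : ((MonoidHom.fst _ _).comp (Par F i j).subtype) (parEquiv F i j (α, β, B)) = α := rfl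
    have e2 : (((MonoidHom.fst _ _).comp (MonoidHom.snd _ _)).comp (Par F i j).subtype) (parEquiv F i j (α, β, B)) = β := rfl
    rw [e1, e2]
    ring
  · rintro ⟨p, q⟩ hpq hne
    by_cases hp : p = i
    · refine pr_deg _ fun M hM => Irr.deg hv ?_
      intro h; apply hne; ext <;> simp <;> simp at hM <;> omega
    · have : perp p u w = 0 := pr_deg _ fun M hM => Irr.deg hu (by omega)
      simp only [this]
      simp [ip, pr]
  · simp
end GLW
end
end
section
universe u
open scoped MatrixGroups
noncomputable section
namespace GLW
variable {F : Type} [Field F] [Fintype F]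
section Pr
variable {K : Type u} [Ring K] [Module ℂ K]
theorem pr_add_r (n) (a : Hall F ℂ) (h h' : Hall F K) : pr n a (h + h') = pr n a h + pr n a h' := by
  simp only [pr]
  rw [← smul_add, ← Finset.sum_add_distrib]
  congr 1
  exact Finset.sum_congr rfl fun x _ => smul_add _ _ _
def FD (a : Hall F ℂ) : Prop := ∃ D, ∀ M : Ob F, D < M.d → a M = 0
def Pr (a : Hall F ℂ) (h : Hall F K) : K := ∑ᶠ n, pr n a h
theorem FD.fin {a : Hall F ℂ} (ha : FD a) (h : Hall F K) : (Function.support fun n => pr n a h).Finite := by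
  obtain ⟨D, hD⟩ := ha
  refine (Set.finite_Iic D).subset fun n hn => ?_
  by_contra H
  exact hn (pr_deg h fun M hM => hD M (by simp at H; omega))
theorem Pr_add_l {a b : Hall F ℂ} (ha : FD a) (hb : FD b) (h : Hall F K) : Pr (a + b) h = Pr a h + Pr b h := by
  unfold Pr
  rw [← finsum_add_distrib (ha.fin h) (hb.fin h)]
  simp only [pr_add_l]
theorem Pr_add_r {a : Hall F ℂ} (ha : FD a) (h h' : Hall F K) : Pr a (h + h') = Pr a h + Pr a h' := by
  unfold Pr
  rw [← finsum_add_distrib (ha.fin h) (ha.fin h')]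
  simp only [pr_add_r]
theorem Pr_single {a : Hall F ℂ} {n} (ha : ∀ M : Ob F, M.d ≠ n → a M = 0) (h : Hall F K) : Pr a h = pr n a h :=
  finsum_eq_single _ _ fun m hm => pr_deg h fun M hM => ha M (by omega)
end Pr
variable (F) in
def II : Set (Hall F ℂ) := {a | ∃ n, a ∈ Irr F n}
theorem irr_lin {G : Type} [Group G] (μ : G →* ℂ) : (fun g => μ g) ∈ IrrC G := by
  let ρ : Representation ℂ G ℂ := ((Algebra.lmul ℂ ℂ : ℂ →ₐ[ℂ] Module.End ℂ ℂ) : ℂ →* Module.End ℂ ℂ).comp μ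
  refine ⟨ℂ, inferInstance, inferInstance, inferInstance, ρ, ?_, ?_⟩
  · have hb : (⊥ : Subrepresentation ρ).toSubmodule = ⊥ := rfl
    have ht : (⊤ : Subrepresentation ρ).toSubmodule = ⊤ := rfl
    have : Nontrivial (Subrepresentation ρ) := ⟨⊥, ⊤, fun h => bot_ne_top (hb.symm.trans ((congrArg Subrepresentation.toSubmodule h).trans ht))⟩
    refine ⟨fun a => ?_⟩
    rcases eq_bot_or_eq_top a.toSubmodule with h | h
    · exact Or.inl (Subrepresentation.toSubmodule_injective h)
    · exact Or.inr (Subrepresentation.toSubmodule_injective h)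
  · funext g
    show LinearMap.trace ℂ ℂ (Algebra.lmul ℂ ℂ (μ g)) = _
    have : (Algebra.lmul ℂ ℂ (μ g)) = (μ g) • LinearMap.id := by ext; simp
    rw [this]; simp
theorem Irr_one : (1 : Hall F ℂ) ∈ Irr F 0 := by
  have hs : ∀ M : Ob F, M.d = 0 → Function.Bijective M.x := by
    intro M hM
    obtain ⟨e, he⟩ := iso_zero hM (mat_d 0 (LinearMap.id : Module.End F _))
    have : Subsingleton M.V := e.toEquiv.subsingleton
    exact ⟨fun a b _ => Subsingleton.elim _ _, fun b => ⟨b, Subsingleton.elim _ _⟩⟩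
  refine ⟨?_, ?_⟩
  · have : (fun g : Gn F 0 => (1 : Hall F ℂ) (mat 0 g)) = fun g => (1 : Gn F 0 →* ℂ) g := by
      funext g
      rw [Hall.one_f, if_pos (mat_d _ _)]; rfl
    rw [this]
    exact irr_lin _
  · intro M hM
    rw [Hall.one_f] at hM
    have : M.d = 0 := by by_contra h; simp [h] at hM
    exact ⟨this, hs M this⟩
theorem Irr_zero {a : Hall F ℂ} (h : a ∈ Irr F 0) : a = 1 := by
  classical
  by_contra hne
  have h1 := Irr_orth h h
  have h2 := Irr_orth (Irr_one (F := F)) h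
  rw [if_neg (Ne.symm hne), ip, pr_zero, Hall.one_f, if_pos (mat_d _ _)] at h2
  rw [if_pos rfl, ip, pr_zero] at h1
  simp at h2
  simp [h2] at h1
theorem Irr_uniq {a : Hall F ℂ} {i j} (h : a ∈ Irr F i) (h' : a ∈ Irr F j) : i = j := by
  classical
  by_contra hne
  have h1 := Irr_orth h h
  rw [if_pos rfl, ip, pr_deg _ fun M hM => Irr.deg h' (by omega)] at h1
  exact one_ne_zero h1.symm
theorem mul_deg {u v : Hall F ℂ} {i j} (hu : ∀ M : Ob F, M.d ≠ i → u M = 0) (hv : ∀ M : Ob F, M.d ≠ j → v M = 0) (M : Ob F) (hM : M.d ≠ i + j) : (u * v) M = 0 := by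
  refine (Hall.mul_f u v M).trans (Finset.sum_eq_zero fun W _ => ?_)
  by_cases h : (M.sub W).d = i
  · rw [hv (M.quot W), mul_zero]
    intro h2
    have := d_add M W
    omega
  · rw [hu _ h, zero_mul]
theorem Irr_mul {u v : Hall F ℂ} {i j} (hu : u ∈ Irr F i) (hv : v ∈ Irr F j) :
    u * v = ∑ w ∈ IrrF F (i + j), ip (i + j) w (u * v) • w := by
  ext M
  refine Eq.trans ?_ (Hall.sum_f _ _ M).symm
  by_cases h : M.d = i + j
  · refine (complete ((Irr.sup hu).mul (Irr.sup hv)) M).trans ?_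
    rw [h]; rfl
  · refine (mul_deg (fun M => Irr.deg hu) (fun M => Irr.deg hv) M h).trans (Finset.sum_eq_zero fun w hw => ?_).symm
    show _ • w M = 0
    rw [Irr.deg (mem_IrrF.1 hw) h, smul_zero]
theorem ip_nat' {i j n : ℕ} {u v w : Hall F ℂ} (hu : u ∈ Irr F i) (hv : v ∈ Irr F j) (hw : w ∈ Irr F n) :
    ∃ k : ℕ, ip n (u * v) w = k ∧ ip n w (u * v) = k ∧ (k ≠ 0 → i + j = n) := by
  obtain ⟨k, h1, h2⟩ := ip_nat hu hv hw
  refine ⟨k, h1, ?_, h2⟩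
  rw [← ip_conj, h1]; simp
variable (F) in
def RR : Subring (Hall F ℂ) where
  carrier := AddSubgroup.closure (II F)
  zero_mem' := zero_mem _
  add_mem' := add_mem
  neg_mem' := neg_mem
  one_mem' := AddSubgroup.subset_closure (show _ ∈ II F from ⟨0, Irr_one⟩)
  mul_mem' := by
    intro a b ha hb
    refine AddSubgroup.closure_induction (p := fun a _ => a * b ∈ AddSubgroup.closure (II F)) ?_ ?_ ?_ ?_ ha
    · rintro u ⟨i, hu⟩
      refine AddSubgroup.closure_induction (p := fun b _ => u * b ∈ AddSubgroup.closure (II F)) ?_ ?_ ?_ ?_ hb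
      · rintro v ⟨j, hv⟩
        rw [Irr_mul hu hv]
        refine sum_mem fun w hw => ?_
        obtain ⟨k, -, hk, -⟩ := ip_nat' hu hv (mem_IrrF.1 hw)
        rw [hk]
        have : (k : ℂ) • w = k • w := Nat.cast_smul_eq_nsmul ℂ k w
        rw [this]
        exact nsmul_mem (AddSubgroup.subset_closure (show w ∈ II F from ⟨_, mem_IrrF.1 hw⟩)) k
      · rw [mul_zero]; exact zero_mem _
      · intro x y _ _ hx hy; rw [mul_add]; exact add_mem hx hy
      · intro x _ hx; rw [mul_neg]; exact neg_mem hx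
    · rw [zero_mul]; exact zero_mem _
    · intro x y _ _ hx hy; rw [add_mul]; exact add_mem hx hy
    · intro x _ hx; rw [neg_mul]; exact neg_mem hx
theorem Irr.mem {u : Hall F ℂ} {i} (hu : u ∈ Irr F i) : u ∈ RR F := AddSubgroup.subset_closure (show u ∈ II F from ⟨i, hu⟩)
@[elab_as_elim]
theorem RR_ind {p : ↥(RR F) → Prop} (h1 : ∀ (u : Hall F ℂ) (i) (hu : u ∈ Irr F i), p ⟨u, Irr.mem hu⟩) (h0 : p 0) (ha : ∀ a b, p a → p b → p (a + b)) (hn : ∀ a, p a → p (-a)) (a : RR F) : p a := by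
  obtain ⟨a, h⟩ := a
  refine AddSubgroup.closure_induction (p := fun a h => p (⟨a, h⟩ : ↥(RR F))) ?_ h0 ?_ ?_ h
  · rintro u ⟨i, hu⟩; exact h1 u i hu
  · intro x y _ _ hx hy; exact ha _ _ hx hy
  · intro x _ hx; exact hn _ hx
theorem RR_fd (a : RR F) : FD a.1 := by
  induction a using RR_ind with
  | h1 u i hu => exact ⟨i, fun M hM => Irr.deg hu (by omega)⟩
  | h0 => exact ⟨0, fun M _ => rfl⟩
  | ha a b ha hb =>
    obtain ⟨D, hD⟩ := ha
    obtain ⟨E, hE⟩ := hb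
    refine ⟨D + E, fun M hM => ?_⟩
    show a.1 M + b.1 M = 0
    rw [hD M (by omega), hE M (by omega), add_zero]
  | hn a ha =>
    obtain ⟨D, hD⟩ := ha
    exact ⟨D, fun M hM => by show - a.1 M = 0; rw [hD M hM, neg_zero]⟩
theorem RR_sup (a : RR F) : Sup a.1 := by
  induction a using RR_ind with
  | h1 u i hu => exact Irr.sup hu
  | h0 => exact fun M _ => rfl
  | ha a b ha hb => exact fun M hM => by show a.1 M + b.1 M = 0; rw [ha M hM, hb M hM, add_zero]
  | hn a ha => exact fun M hM => by show - a.1 M = 0; rw [ha M hM, neg_zero]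
section
variable (K : Type u) [Ring K] [Module ℂ K]
variable (F) in
def PrH : RR F →+ Hall F K →+ K :=
  AddMonoidHom.mk' (fun a => AddMonoidHom.mk' (fun h => Pr a.1 h) fun h h' => Pr_add_r (RR_fd a) h h')
    fun a b => by ext h; exact Pr_add_l (RR_fd a) (RR_fd b) h
theorem PrH_irr {u : Hall F ℂ} {i} (hu : u ∈ Irr F i) (h : Hall F K) : PrH F K ⟨u, Irr.mem hu⟩ h = pr i u h :=
  Pr_single (fun M => Irr.deg hu) h
end
theorem perp_sup {i : ℕ} {u b : Hall F ℂ} (hb : Sup b) : Sup (perp i u b) := by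
  intro M hM
  show (pr i u (Phi b)).f M = 0
  rw [pr, Hall.smul_f, Hall.sum_f]
  rw [Finset.sum_eq_zero, smul_zero]
  intro x _
  show _ • (Phi b (mat i x)).f M = 0
  rw [hb.phi (Or.inr hM), smul_zero]
theorem ip_adj {i j} {u v b : Hall F ℂ} (hu : u ∈ Irr F i) (hv : v ∈ Irr F j) : ip (i + j) (u * v) b = ip j v (perp i u b) := by
  rw [adj]
  rw [Finset.sum_eq_single (i, j)]
  · rintro ⟨p, q⟩ hpq hne
    simp at hpq
    by_cases hp : p = i
    · refine pr_deg _ fun M hM => ?_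
      refine Irr.deg hv fun h => hne ?_
      ext <;> simp <;> simp at hM <;> omega
    · have : perp p u b = 0 := pr_deg _ fun M hM => Irr.deg hu (by omega)
      simp only [this]
      simp [ip, pr]
  · simp
theorem perp_eq {i} {u b : Hall F ℂ} (hu : u ∈ Irr F i) (hb : Sup b) (M : Ob F) :
    (perp i u b) M = ∑ v ∈ IrrF F M.d, ip (i + M.d) (u * v) b * v M := by
  rw [complete (perp_sup hb)]
  exact Finset.sum_congr rfl fun v hv => by rw [ip_adj hu (mem_IrrF.1 hv)]
variable (F) in
open Classical in
def UU (n : ℕ) : Finset (Hall F ℂ) := (Finset.range (n + 1)).biUnion (IrrF F)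
theorem mem_UU {n} {u : Hall F ℂ} : u ∈ UU F n ↔ ∃ i ≤ n, u ∈ Irr F i := by
  simp [UU, mem_IrrF, Nat.lt_succ_iff]
theorem sum_UU {A : Type*} [AddCommMonoid A] {n m : ℕ} (hm : m ≤ n) (f : Hall F ℂ → A) (h : ∀ u i, u ∈ Irr F i → i ≠ m → f u = 0) :
    ∑ u ∈ UU F n, f u = ∑ u ∈ IrrF F m, f u := by
  symm
  refine Finset.sum_subset (fun u hu => mem_UU.2 ⟨m, hm, mem_IrrF.1 hu⟩) fun u hu hn => ?_
  obtain ⟨i, hi, hu⟩ := mem_UU.1 hu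
  refine h u i hu ?_
  rintro rfl; exact hn (mem_IrrF.2 hu)
theorem perp_irr {i n} {u w : Hall F ℂ} (hu : u ∈ Irr F i) (hw : w ∈ Irr F n) :
    perp i u w = ∑ v ∈ UU F n, ip n (u * v) w • v := by
  ext M
  refine (perp_eq hu (Irr.sup hw) M).trans (Eq.trans ?_ (Hall.sum_f _ _ M).symm)
  by_cases h : i + M.d = n
  · have := sum_UU (F := F) (m := M.d) (n := n) (by omega) (fun v => (ip n (u * v) w • v) M) (fun v j hv hj => by
      show _ • v M = 0
      rw [Irr.deg hv (Ne.symm hj), smul_zero])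
    refine Eq.trans ?_ this.symm
    rw [h]; rfl
  · rw [Finset.sum_eq_zero, Finset.sum_eq_zero]
    · intro v hv
      obtain ⟨j, hj, hv⟩ := mem_UU.1 hv
      show _ • v M = 0
      by_cases hd : M.d = j
      · obtain ⟨k, h1, -, h2⟩ := ip_nat' hu hv hw
        rw [h1]
        have : k = 0 := by by_contra H; have := h2 H; omega
        rw [this]; simp
      · rw [Irr.deg hv hd, smul_zero]
    · intro v hv
      have : ip (i + M.d) (u * v) w = 0 := by
        rw [← ip_conj, ip, pr_deg _ fun N hN => Irr.deg hw (by omega), map_zero]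
      rw [this, zero_mul]
theorem perp_mem {i n} {u w : Hall F ℂ} (hu : u ∈ Irr F i) (hw : w ∈ Irr F n) : perp i u w ∈ RR F := by
  rw [perp_irr hu hw]
  refine sum_mem fun v hv => ?_
  obtain ⟨j, hj, hv⟩ := mem_UU.1 hv
  obtain ⟨k, h1, -, -⟩ := ip_nat' hu hv hw
  rw [h1]
  have : (k : ℂ) • v = k • v := Nat.cast_smul_eq_nsmul ℂ k v
  rw [this]
  exact nsmul_mem (Irr.mem hv) k
theorem PrH_mem (a b : RR F) : PrH F (Hall F ℂ) a (Phi b.1) ∈ RR F := by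
  induction a using RR_ind with
  | h1 u i hu =>
    rw [PrH_irr _ hu]
    induction b using RR_ind with
    | h1 w n hw => exact perp_mem hu hw
    | h0 =>
      have : Phi (0 : RR F).1 = 0 := map_zero (PhiH F)
      rw [this, ← PrH_irr _ hu, map_zero]; exact zero_mem _
    | ha a b ha hb =>
      have : Phi (a + b).1 = Phi a.1 + Phi b.1 := map_add (PhiH F) a.1 b.1
      rw [this, pr_add_r]; exact add_mem ha hb
    | hn a ha =>
      have : Phi (-a).1 = -Phi a.1 := map_neg (PhiH F) a.1
      rw [this, ← PrH_irr _ hu, map_neg, PrH_irr _ hu]; exact neg_mem ha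
  | h0 => rw [map_zero]; exact zero_mem _
  | ha a b ha hb => rw [map_add]; exact add_mem ha hb
  | hn a ha => rw [map_neg]; exact neg_mem ha
variable (F) in
def PP : RR F →+ RR F →+ RR F :=
  AddMonoidHom.mk' (fun a => AddMonoidHom.mk' (fun b => ⟨_, PrH_mem a b⟩) fun b c => Subtype.ext (by
    show PrH F _ a (PhiH F (b.1 + c.1)) = PrH F _ a (PhiH F b.1) + PrH F _ a (PhiH F c.1)
    rw [map_add, map_add])) fun a b => by
      ext c : 1
      refine Subtype.ext ?_
      show PrH F _ (a + b) (Phi c.1) = PrH F _ a (Phi c.1) + PrH F _ b (Phi c.1)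
      rw [map_add]; rfl
abbrev irr {u : Hall F ℂ} {i} (hu : u ∈ Irr F i) : RR F := ⟨u, Irr.mem hu⟩
theorem PP_irr {u : Hall F ℂ} {i} (hu : u ∈ Irr F i) (b : RR F) : (PP F (irr hu) b).1 = perp i u b.1 := PrH_irr _ hu _
theorem IP_int (a b : RR F) : ∃ k : ℤ, PrH F ℂ a b.1 = k := by
  induction a using RR_ind with
  | h1 u i hu =>
    induction b using RR_ind with
    | h1 w n hw =>
      rw [PrH_irr _ hu]
      by_cases h : i = n
      · subst h
        classical
        refine ⟨if u = w then 1 else 0, (Irr_orth hu hw).trans ?_⟩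
        split_ifs <;> simp
      · refine ⟨0, ?_⟩
        have : ip i u w = 0 := by
          rw [← ip_conj, ip, pr_deg _ fun N hN => Irr.deg hw (by omega), map_zero]
        simpa using this
    | h0 => exact ⟨0, by rw [Subring.coe_zero, map_zero]; simp⟩
    | ha a b ha hb =>
      obtain ⟨k, hk⟩ := ha; obtain ⟨l, hl⟩ := hb
      exact ⟨k + l, by rw [Subring.coe_add, map_add, hk, hl]; simp⟩
    | hn a ha =>
      obtain ⟨k, hk⟩ := ha
      exact ⟨-k, by rw [Subring.coe_neg, map_neg, hk]; simp⟩
  | h0 => exact ⟨0, by rw [map_zero]; simp⟩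
  | ha a b ha hb =>
    obtain ⟨k, hk⟩ := ha; obtain ⟨l, hl⟩ := hb
    exact ⟨k + l, by rw [map_add, AddMonoidHom.add_apply, hk, hl]; simp⟩
  | hn a ha =>
    obtain ⟨k, hk⟩ := ha
    exact ⟨-k, by rw [map_neg, AddMonoidHom.neg_apply, hk]; simp⟩
def fm0 (a b : RR F) : ℤ := (IP_int a b).choose
theorem fm0_eq (a b : RR F) : (fm0 a b : ℂ) = PrH F ℂ a b.1 := (IP_int a b).choose_spec.symm
variable (F) in
def fmH : RR F →+ RR F →+ ℤ :=
  AddMonoidHom.mk' (fun a => AddMonoidHom.mk' (fun b => fm0 a b) fun b c => by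
    apply Int.cast_injective (α := ℂ)
    rw [Int.cast_add, fm0_eq, fm0_eq, fm0_eq, Subring.coe_add, map_add]) fun a b => by
      ext c : 1
      apply Int.cast_injective (α := ℂ)
      show ((fm0 (a + b) c : ℤ) : ℂ) = ((fm0 a c + fm0 b c : ℤ) : ℂ)
      rw [Int.cast_add, fm0_eq, fm0_eq, fm0_eq, map_add]; rfl
theorem fmH_eq (a b : RR F) : (fmH F a b : ℂ) = PrH F ℂ a b.1 := fm0_eq a b
theorem fmH_irr {u : Hall F ℂ} {i} (hu : u ∈ Irr F i) (b : RR F) : (fmH F (irr hu) b : ℂ) = ip i u b.1 := (fm0_eq _ b).trans (PrH_irr _ hu _)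
theorem fmH_mul {u v : Hall F ℂ} {i j} (hu : u ∈ Irr F i) (hv : v ∈ Irr F j) (b : RR F) : (fmH F (irr hu * irr hv) b : ℂ) = ip (i + j) (u * v) b.1 :=
  (fm0_eq _ b).trans (Pr_single (mul_deg (fun M => Irr.deg hu) (fun M => Irr.deg hv)) _)
theorem hom_ext {A : Type*} [AddCommGroup A] {f g : RR F →+ A} (h : ∀ (u : Hall F ℂ) (i) (hu : u ∈ Irr F i), f (irr hu) = g (irr hu)) (a) : f a = g a := by
  induction a using RR_ind with
  | h1 u i hu => exact h u i hu
  | h0 => rw [map_zero, map_zero]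
  | ha a b ha hb => rw [map_add, map_add, ha, hb]
  | hn a ha => rw [map_neg, map_neg, ha]
theorem fm_symm (a b : RR F) : fmH F a b = fmH F b a := by
  refine hom_ext (f := fmH F a) (g := (fmH F).flip a) (fun w n hw => ?_) b
  refine hom_ext (f := (fmH F).flip (irr hw)) (g := (fmH F (irr hw))) (fun u i hu => ?_) a
  apply Int.cast_injective (α := ℂ)
  show ((fmH F (irr hu) (irr hw) : ℤ) : ℂ) = _
  rw [fmH_irr, fmH_irr]
  by_cases h : i = n
  · subst h
    classical
    rw [Irr_orth hu hw, Irr_orth hw hu]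
    simp only [eq_comm]
  · rw [← ip_conj, ip, pr_deg _ fun N hN => Irr.deg hw (by omega), map_zero, ← ip_conj, ip, pr_deg _ fun N hN => Irr.deg hu (by omega), map_zero]
theorem fm_adj (a b c : RR F) : fmH F (a * b) c = fmH F b (PP F a c) := by
  have h1 : ∀ (u : Hall F ℂ) (i) (hu : u ∈ Irr F i) b, fmH F (irr hu * b) c = fmH F b (PP F (irr hu) c) := by
    intro u i hu b
    refine hom_ext (f := ((fmH F).flip c).comp (AddMonoidHom.mulLeft (irr hu))) (g := (fmH F).flip (PP F (irr hu) c)) (fun v j hv => ?_) b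
    apply Int.cast_injective (α := ℂ)
    show ((fmH F (irr hu * irr hv) c : ℤ) : ℂ) = (fmH F (irr hv) (PP F (irr hu) c) : ℤ)
    rw [fmH_mul hu hv, fmH_irr, ip_adj hu hv, PP_irr]
  exact hom_ext (f := ((fmH F).flip c).comp (AddMonoidHom.mulRight b)) (g := (fmH F b).comp ((PP F).flip c)) (fun u i hu => h1 u i hu b) a
def slc (b : Hall F ℂ) (N : Ob F) : Hall F ℂ := ⟨fun M => (Phi b M).f N, fun {M M'} e => congrArg (fun z : Hall F ℂ => z.f N) ((Phi b).inv e)⟩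
theorem slc_pr (b u : Hall F ℂ) (N : Ob F) (n) : ip n u (slc b N) = (perp n u b).f N := by
  rw [perp, pr, Hall.smul_f, Hall.sum_f]
  rfl
theorem Phi_exp {b : Hall F ℂ} (hb : Sup b) (M : Ob F) : Phi b M = ∑ u ∈ IrrF F M.d, u M • perp M.d u b := by
  refine Hall.ext (funext fun N => ?_)
  have hs : Sup (slc b N) := by
    intro M hM
    show (Phi b M).f N = 0
    have := Sup.phi hb (M := M) (N := N) (Or.inl hM)
    exact this
  have h1 := complete hs M
  rw [Hall.sum_f]
  refine Eq.trans h1 ?_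
  refine Finset.sum_congr rfl fun u hu => ?_
  rw [slc_pr, mul_comm]
  rfl
theorem Phi_exp' {b : Hall F ℂ} (hb : Sup b) (M : Ob F) {n : ℕ} (hn : M.d ≤ n) : Phi b M = ∑ u ∈ UU F n, u M • Pr u (Phi b) := by
  rw [sum_UU hn, Phi_exp hb]
  · exact Finset.sum_congr rfl fun u hu => by rw [Pr_single fun M => Irr.deg (mem_IrrF.1 hu)]
  · intro u i hu hi
    rw [Irr.deg hu (Ne.symm hi), zero_smul]
theorem Phi_mul_exp {b c : Hall F ℂ} (hb : Sup b) (hc : Sup c) (M : Ob F) (n : ℕ) (hn : M.d ≤ n) :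
    Phi (b * c) M = ∑ u ∈ UU F n, ∑ v ∈ UU F n, (u * v) M • (Pr u (Phi b) * Pr v (Phi c)) := by
  have h1 : Phi (b * c) = Phi b * Phi c := map_mul (PhiH F) b c
  rw [h1]
  refine (Hall.mul_f _ _ M).trans ?_
  have h2 : ∀ W : M.S, Phi b (M.sub W) * Phi c (M.quot W) = ∑ u ∈ UU F n, ∑ v ∈ UU F n, (u (M.sub W) * v (M.quot W)) • (Pr u (Phi b) * Pr v (Phi c)) := by
    intro W
    have := d_add M W
    rw [Phi_exp' hb (M.sub W) (n := n) (by omega), Phi_exp' hc (M.quot W) (n := n) (by omega), Finset.sum_mul_sum]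
    refine Finset.sum_congr rfl fun u _ => Finset.sum_congr rfl fun v _ => ?_
    rw [smul_mul_smul_comm]
  refine (Finset.sum_congr rfl fun W _ => h2 W).trans ?_
  rw [Finset.sum_comm]
  refine Finset.sum_congr rfl fun u _ => ?_
  rw [Finset.sum_comm]
  refine Finset.sum_congr rfl fun v _ => ?_
  rw [← Finset.sum_smul]; rfl
theorem perp_mul {b c w : Hall F ℂ} (hb : Sup b) (hc : Sup c) {n} (hw : w ∈ Irr F n) :
    perp n w (b * c) = ∑ u ∈ UU F n, ∑ v ∈ UU F n, ip n w (u * v) • (Pr u (Phi b) * Pr v (Phi c)) := by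
  rw [perp, pr]
  have : ∀ x, Phi (b * c) (mat n x) = ∑ u ∈ UU F n, ∑ v ∈ UU F n, (u * v) (mat n x) • (Pr u (Phi b) * Pr v (Phi c)) := fun x => Phi_mul_exp hb hc _ n (mat_d _ _).le
  simp only [this, Finset.smul_sum]
  rw [Finset.sum_comm]
  refine Finset.sum_congr rfl fun u _ => ?_
  rw [Finset.sum_comm]
  refine Finset.sum_congr rfl fun v _ => ?_
  rw [ip, pr, ← Finset.smul_sum, smul_assoc, Finset.sum_smul]
  simp only [smul_assoc]
variable (F) in
def IR : Set (RR F) := {a | a.1 ∈ II F}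
theorem PP_zero {u w : Hall F ℂ} {i n} (hu : u ∈ Irr F i) (hw : w ∈ Irr F n) (h : n < i) : PP F (irr hu) (irr hw) = 0 := by
  refine Subtype.ext ((PP_irr hu _).trans ?_)
  rw [perp_irr hu hw]
  refine Finset.sum_eq_zero fun v hv => ?_
  obtain ⟨j, hj, hv⟩ := mem_UU.1 hv
  obtain ⟨k, h1, -, h2⟩ := ip_nat' hu hv hw
  rw [h1]
  have : k = 0 := by by_contra H; have := h2 H; omega
  rw [this]; simp
theorem PP_fin (a : RR F) : {u : IR F | PP F u.1 a ≠ 0}.Finite := by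
  induction a using RR_ind with
  | h1 w n hw =>
    refine Set.Finite.subset (s := {u : IR F | u.1.1 ∈ UU F n}) ?_ ?_
    · refine Set.Finite.of_finite_image (f := fun u : IR F => u.1.1) ((UU F n).finite_toSet.subset ?_) ?_
      · rintro _ ⟨u, hu, rfl⟩; exact hu
      · intro u _ v _ h; exact Subtype.ext (Subtype.ext h)
    · rintro ⟨⟨u, hu⟩, i, hi⟩ h
      by_contra H
      apply h
      exact PP_zero hi hw (by by_contra H'; exact H (mem_UU.2 ⟨i, by omega, hi⟩))
  | h0 => simp
  | ha a b ha hb =>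
    refine (ha.union hb).subset fun u hu => ?_
    by_contra H
    simp only [Set.mem_union, Set.mem_setOf_eq, not_or, not_not] at H
    exact hu (by rw [map_add, H.1, H.2, add_zero])
  | hn a ha => simpa using ha
theorem PP_hopf (a b c : RR F) : PP F a (b * c) = ∑ᶠ u : IR F, PP F u.1 b * PP F (PP F u.1 a) c := by
  have hf : ∀ a, (Function.support fun u : IR F => PP F u.1 b * PP F (PP F u.1 a) c).Finite := fun a => (PP_fin a).subset fun u hu h => hu (by
    show _ * PP F (PP F u.1 a) c = 0
    rw [h, map_zero]; simp)
  induction a using RR_ind with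
  | h1 w n hw =>
    have h1 : ∀ u : IR F, u.1.1 ∈ UU F n → (PP F u.1 b * PP F (PP F u.1 (irr hw)) c).1 = ∑ v ∈ UU F n, ip n w (u.1.1 * v) • (Pr u.1.1 (Phi b.1) * Pr v (Phi c.1)) := by
      rintro ⟨⟨u, _⟩, i, hi⟩ _
      have e : PP F (irr hi) (irr hw) = ∑ v ∈ (UU F n).attach, fmH F (irr hi * irr (mem_UU.1 v.2).choose_spec.2) (irr hw) • irr (mem_UU.1 v.2).choose_spec.2 := by
        refine Subtype.ext ((PP_irr hi _).trans ?_)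
        rw [perp_irr hi hw]
        refine Eq.trans ?_ (map_sum (RR F).subtype _ _).symm
        rw [← Finset.sum_attach]
        refine Finset.sum_congr rfl fun v _ => ?_
        rw [map_zsmul, ← Int.cast_smul_eq_zsmul ℂ]
        congr 1
        have hv := (mem_UU.1 v.2).choose_spec.2
        rw [fm_symm, fmH_irr]
        obtain ⟨k, h1, h2, -⟩ := ip_nat' hi hv hw
        rw [h1]; exact h2.symm
      show (PP F (irr hi) b * PP F (PP F (irr hi) (irr hw)) c).1 = _
      rw [e, map_sum, AddMonoidHom.finsetSum_apply, Finset.mul_sum]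
      refine (map_sum (RR F).subtype _ _).trans ?_
      rw [← Finset.sum_attach (UU F n)]
      refine Finset.sum_congr rfl fun v _ => ?_
      have hv := (mem_UU.1 v.2).choose_spec.2
      rw [map_zsmul, AddMonoidHom.zsmul_apply, mul_smul_comm, map_zsmul, ← Int.cast_smul_eq_zsmul ℂ]
      congr 1
      rw [fm_symm, fmH_irr]; rfl
    have hA : {u : IR F | u.1.1 ∈ UU F n}.Finite := by
      refine Set.Finite.of_finite_image (f := fun u : IR F => u.1.1) ((UU F n).finite_toSet.subset ?_) ?_
      · rintro _ ⟨u, hu, rfl⟩; exact hu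
      · intro u _ v _ h; exact Subtype.ext (Subtype.ext h)
    rw [finsum_eq_sum_of_support_subset (s := hA.toFinset)]
    · refine Subtype.ext ((PP_irr hw _).trans ?_)
      refine Eq.trans ?_ (map_sum (RR F).subtype _ _).symm
      refine (perp_mul (RR_sup b) (RR_sup c) hw).trans ?_
      symm
      refine Finset.sum_bij (fun u _ => u.1.1) (fun u hu => by simpa using hu) (fun u _ v _ h => Subtype.ext (Subtype.ext h)) ?_ ?_
      · intro u hu
        obtain ⟨i, _, hi⟩ := mem_UU.1 hu
        exact ⟨⟨irr hi, i, hi⟩, by simpa using hu, rfl⟩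
      · intro u hu
        exact h1 u (by simpa using hu)
    · rintro ⟨⟨u, hu⟩, i, hi⟩ h
      rw [Set.Finite.coe_toFinset]
      by_contra H
      apply h
      show PP F (irr hi) b * PP F (PP F (irr hi) (irr hw)) c = 0
      rw [PP_zero hi hw (by by_contra H'; exact H (mem_UU.2 ⟨i, by omega, hi⟩)), map_zero]; simp
  | h0 => rw [finsum_eq_zero_of_forall_eq_zero]; · simp
          intro u; simp
  | ha a a' ha hb =>
    rw [map_add, AddMonoidHom.add_apply, ha, hb, ← finsum_add_distrib (hf a) (hf a')]
    simp only [map_add, AddMonoidHom.add_apply, mul_add]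
  | hn a ha =>
    rw [map_neg, AddMonoidHom.neg_apply, ha, ← finsum_neg_distrib]
    simp only [map_neg, AddMonoidHom.neg_apply, mul_neg]
open Classical in
def dgR (a : RR F) : ℕ := if h : a ∈ IR F then h.choose else 0
theorem dgR_irr {u : Hall F ℂ} {i} (hu : u ∈ Irr F i) : dgR (irr hu) = i := by
  have h : irr hu ∈ IR F := ⟨i, hu⟩
  exact (dif_pos h).trans (Irr_uniq h.choose_spec hu)
theorem fm_nat {u v w : Hall F ℂ} {i j n} (hu : u ∈ Irr F i) (hv : v ∈ Irr F j) (hw : w ∈ Irr F n) : ∃ k : ℕ, fmH F (irr hw) (irr hu * irr hv) = k ∧ (k ≠ 0 → i + j = n) := by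
  obtain ⟨k, h1, h2, h3⟩ := ip_nat' hu hv hw
  refine ⟨k, ?_, h3⟩
  apply Int.cast_injective (α := ℂ)
  rw [fmH_irr]
  exact h2.trans (by simp)
variable (F) in
def SS : PSH (RR F) where
  I := IR F
  dg := dgR
  fm := fmH F
  P := PP F
  symm := fm_symm
  orth1 := by
    classical
    rintro ⟨u, _⟩ ⟨i, hu⟩
    apply Int.cast_injective (α := ℂ)
    exact (fmH_irr hu _).trans ((Irr_orth hu hu).trans (by simp))
  orth := by
    classical
    rintro ⟨u, _⟩ ⟨i, hu⟩ ⟨v, _⟩ ⟨j, hv⟩ hne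
    apply Int.cast_injective (α := ℂ)
    refine (fmH_irr hu (irr hv)).trans ?_
    by_cases h : i = j
    · subst h
      rw [Irr_orth hu hv, if_neg]; · simp
      exact fun h => hne (Subtype.ext h)
    · show ip i u v = _
      rw [← ip_conj, ip, pr_deg _ fun N hN => Irr.deg hv (by omega), map_zero]; simp
  span := by
    rw [eq_top_iff]
    rintro a -
    induction a using RR_ind with
    | h1 u i hu => exact AddSubgroup.subset_closure (show irr hu ∈ IR F from ⟨i, hu⟩)
    | h0 => exact zero_mem _
    | ha a b ha hb => exact add_mem ha hb
    | hn a ha => exact neg_mem ha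
  one := ⟨0, Irr_one⟩
  adj := fm_adj
  pos := by
    rintro ⟨u, _⟩ ⟨i, hu⟩ ⟨v, _⟩ ⟨j, hv⟩ ⟨w, _⟩ ⟨n, hw⟩
    obtain ⟨k, h1, -⟩ := fm_nat hu hv hw
    show 0 ≤ fmH F (irr hw) (irr hu * irr hv)
    rw [h1]; positivity
  deg := by
    rintro ⟨u, _⟩ ⟨i, hu⟩ ⟨v, _⟩ ⟨j, hv⟩ ⟨w, _⟩ ⟨n, hw⟩ h
    obtain ⟨k, h1, h2⟩ := fm_nat hu hv hw
    show dgR (irr hw) = dgR (irr hu) + dgR (irr hv)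
    rw [dgR_irr, dgR_irr, dgR_irr]
    have h : fmH F (irr hw) (irr hu * irr hv) ≠ 0 := h
    exact (h2 (by rintro rfl; exact h (h1.trans rfl))).symm
  dg0 := by
    rintro ⟨u, _⟩ ⟨i, hu⟩ h
    have h : dgR (irr hu) = 0 := h
    rw [dgR_irr] at h
    subst h
    exact Subtype.ext (Irr_zero hu)
  hopf := PP_hopf
  hfin := PP_fin
end GLW
end
end
section
universe u
open scoped MatrixGroups
noncomputable section
namespace GLW
variable {F : Type} [Field F] [Fintype F]
open Polynomial
theorem aeval_hom {M N : Ob F} (φ : M.V →ₗ[F] N.V) (h : ∀ v, φ (M.x v) = N.x (φ v)) (p : F[X]) (v : M.V) :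
    φ (aeval M.x p v) = aeval N.x p (φ v) := by
  induction p using Polynomial.induction_on' with
  | add p q hp hq => simp [hp, hq]
  | monomial n a =>
    simp only [aeval_monomial, Module.End.mul_apply, Module.algebraMap_end_apply, map_smul]
    congr 1
    induction n generalizing v with
    | zero => simp
    | succ n ih => rw [pow_succ, pow_succ, Module.End.mul_apply, Module.End.mul_apply, ih, h]
theorem aeval_sub (M : Ob F) (W : M.S) (p : F[X]) (v : W.1) : ((aeval (M.sub W).x p v : W.1) : M.V) = aeval M.x p v.1 :=
  aeval_hom (M := M.sub W) W.1.subtype (fun _ => rfl) p v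
theorem aeval_quot (M : Ob F) (W : M.S) (p : F[X]) (v : M.V) : aeval (M.quot W).x p (Submodule.Quotient.mk v : M.V ⧸ W.1) = Submodule.Quotient.mk (aeval M.x p v) :=
  (aeval_hom (N := M.quot W) W.1.mkQ (fun _ => rfl) p v).symm
theorem aeval_mem {M : Ob F} (W : M.S) (p : F[X]) {v : M.V} (hv : v ∈ W.1) : aeval M.x p v ∈ W.1 := by
  rw [← aeval_sub M W p ⟨v, hv⟩]; exact Subtype.mem _
theorem fin_adj {g : F[X]} (hg : g.Monic) : Finite (AdjoinRoot g) := by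
  have : Module.Finite F (AdjoinRoot g) := (AdjoinRoot.powerBasis' hg).finite
  exact Module.finite_of_finite F
def cyc (g : F[X]) (hg : g.Monic) : Ob F :=
  haveI := fin_adj hg
  ⟨AdjoinRoot g, LinearMap.mulLeft F (AdjoinRoot.root g)⟩
theorem cyc_d {g : F[X]} (hg : g.Monic) : (cyc g hg).d = g.natDegree := by
  refine (AdjoinRoot.powerBasis' hg).finrank.trans ?_
  simp
def cmk {g : F[X]} (hg : g.Monic) (p : F[X]) : (cyc g hg).V := AdjoinRoot.mk g p
theorem cmk_surj {g : F[X]} (hg : g.Monic) (w : (cyc g hg).V) : ∃ p, cmk hg p = w := AdjoinRoot.mk_surjective w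
theorem cmk_zero {g : F[X]} (hg : g.Monic) {p} : cmk hg p = 0 ↔ g ∣ p := AdjoinRoot.mk_eq_zero
theorem cmk_eq {g : F[X]} (hg : g.Monic) {p q} : cmk hg p = cmk hg q ↔ g ∣ p - q := AdjoinRoot.mk_eq_mk
theorem aeval_cmk {g : F[X]} (hg : g.Monic) (p q : F[X]) : aeval (cyc g hg).x p (cmk hg q) = cmk hg (p * q) := by
  have h1 : (cyc g hg).x = Algebra.lmul F (AdjoinRoot g) (AdjoinRoot.root g) := rfl
  have h2 := aeval_algHom_apply (Algebra.lmul F (AdjoinRoot g)) (AdjoinRoot.root g) p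
  have h3 : aeval (cyc g hg).x p = Algebra.lmul F (AdjoinRoot g) (aeval (AdjoinRoot.root g) p) := h2
  rw [h3, AdjoinRoot.aeval_eq]
  show AdjoinRoot.mk g p * AdjoinRoot.mk g q = AdjoinRoot.mk g (p * q)
  rw [map_mul]
theorem cyc_lift {g : F[X]} (hg : g.Monic) {M : Ob F} (v : M.V) (h0 : aeval M.x g v = 0) :
    ∃ ψ : (cyc g hg).V →ₗ[F] M.V, (∀ p, ψ (cmk hg p) = aeval M.x p v) ∧ ∀ a, ψ ((cyc g hg).x a) = M.x (ψ a) := by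
  let ψ0 : F[X] →ₗ[F] M.V := (LinearMap.applyₗ v) ∘ₗ (aeval M.x).toLinearMap
  have hker : (LinearMap.ker (AdjoinRoot.mkₐ g).toLinearMap) ≤ LinearMap.ker ψ0 := by
    intro p hp
    obtain ⟨q, rfl⟩ := AdjoinRoot.mk_eq_zero.1 (show AdjoinRoot.mk g p = 0 from hp)
    show aeval M.x (g * q) v = 0
    rw [mul_comm, map_mul, Module.End.mul_apply, h0, map_zero]
  let e := (AdjoinRoot.mkₐ g).toLinearMap.quotKerEquivOfSurjective (show Function.Surjective (AdjoinRoot.mkₐ g).toLinearMap from AdjoinRoot.mk_surjective)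
  let ψ : (cyc g hg).V →ₗ[F] M.V := ((LinearMap.ker (AdjoinRoot.mkₐ g).toLinearMap).liftQ ψ0 hker) ∘ₗ e.symm.toLinearMap
  have hψ : ∀ p, ψ (cmk hg p) = aeval M.x p v := fun p => by
    have : e.symm (cmk hg p) = Submodule.Quotient.mk p := by
      exact (LinearEquiv.symm_apply_eq e).2 rfl
    exact (congrArg (Submodule.liftQ _ ψ0 hker) this).trans rfl
  refine ⟨ψ, hψ, fun a => ?_⟩
  obtain ⟨p, rfl⟩ := cmk_surj hg a
  have := aeval_cmk hg X p
  rw [aeval_X] at this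
  rw [this, hψ, hψ, map_mul, aeval_X]; rfl
theorem iso_cyc {g : F[X]} (hg : g.Monic) {M : Ob F} (v : M.V) (h0 : aeval M.x g v = 0) (hgen : ∀ w, ∃ p : F[X], aeval M.x p v = w)
    (hann : ∀ p : F[X], aeval M.x p v = 0 → g ∣ p) : Iso (cyc g hg) M := by
  obtain ⟨ψ, hψ, hψ'⟩ := cyc_lift hg v h0
  have hb : Function.Bijective ψ := by
    constructor
    · rw [injective_iff_map_eq_zero]
      intro a ha
      obtain ⟨p, rfl⟩ := cmk_surj hg a
      rw [hψ] at ha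
      exact (cmk_zero hg).2 (hann p ha)
    · intro w
      obtain ⟨p, hp⟩ := hgen w
      exact ⟨cmk hg p, (hψ p).trans hp⟩
  exact ⟨LinearEquiv.ofBijective ψ hb, hψ'⟩
theorem cyc_congr {g h : F[X]} (hg : g.Monic) (hh : h.Monic) (e : g = h) : Iso (cyc g hg) (cyc h hh) := by
  subst e; exact Iso.refl _
def cW {g : F[X]} (hg : g.Monic) (h : F[X]) : (cyc g hg).S :=
  ⟨LinearMap.range (aeval (cyc g hg).x h), by
    rintro _ ⟨w, rfl⟩
    refine ⟨(cyc g hg).x w, ?_⟩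
    rw [← Module.End.mul_apply, ← Module.End.mul_apply]
    congr 1
    have : aeval (cyc g hg).x (h * X) = aeval (cyc g hg).x (X * h) := by rw [mul_comm]
    simpa using this⟩
theorem mem_cW {g h : F[X]} (hg : g.Monic) (hd : h ∣ g) (p : F[X]) : cmk hg p ∈ (cW hg h).1 ↔ h ∣ p := by
  constructor
  · rintro ⟨w, hw⟩
    obtain ⟨q, rfl⟩ := cmk_surj hg w
    rw [aeval_cmk, cmk_eq] at hw
    have h1 := hd.trans hw
    exact (dvd_sub_right (dvd_mul_right h q)).1 h1
  · rintro ⟨q, rfl⟩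
    exact ⟨cmk hg q, aeval_cmk hg h q⟩
theorem cW_quot {g h : F[X]} (hg : g.Monic) (hh : h.Monic) (hd : h ∣ g) : Iso (cyc h hh) ((cyc g hg).quot (cW hg h)) := by
  refine iso_cyc hh (Submodule.Quotient.mk (cmk hg 1)) ?_ ?_ ?_
  · rw [aeval_quot, aeval_cmk, Submodule.Quotient.mk_eq_zero, mem_cW hg hd, mul_one]
  · intro w
    induction w using Submodule.Quotient.induction_on with | _ w =>
    obtain ⟨p, rfl⟩ := cmk_surj hg w
    exact ⟨p, by rw [aeval_quot, aeval_cmk, mul_one]⟩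
  · intro p hp
    rwa [aeval_quot, aeval_cmk, Submodule.Quotient.mk_eq_zero, mem_cW hg hd, mul_one] at hp
theorem cW_sub {g h h' : F[X]} (hg : g.Monic) (hh : h'.Monic) (hd : h * h' = g) : Iso (cyc h' hh) ((cyc g hg).sub (cW hg h)) := by
  have hd' : h ∣ g := ⟨h', hd.symm⟩
  have h0 : h ≠ 0 := by rintro rfl; simp at hd; exact hg.ne_zero hd.symm
  refine iso_cyc hh ⟨cmk hg h, (mem_cW hg hd' h).2 dvd_rfl⟩ ?_ ?_ ?_
  · refine Subtype.ext ((aeval_sub _ _ _ _).trans ?_)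
    rw [aeval_cmk, mul_comm, hd]; exact (cmk_zero hg).2 dvd_rfl
  · rintro ⟨w, hw⟩
    obtain ⟨p, rfl⟩ := cmk_surj hg w
    obtain ⟨q, rfl⟩ := (mem_cW hg hd' p).1 hw
    exact ⟨q, Subtype.ext ((aeval_sub _ _ _ _).trans (by rw [aeval_cmk, mul_comm]))⟩
  · intro p hp
    have := (aeval_sub _ _ _ _).symm.trans (congrArg Subtype.val hp)
    rw [aeval_cmk] at this
    have := (cmk_zero hg).1 this
    rw [← hd, mul_comm] at this
    exact (mul_dvd_mul_iff_right h0).1 this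
theorem cW_all {g : F[X]} (hg : g.Monic) (W : (cyc g hg).S) : ∃ h, h.Monic ∧ h ∣ g ∧ W = cW hg h := by
  classical
  let I : Ideal F[X] :=
    { carrier := {p | cmk hg p ∈ W.1}
      zero_mem' := by
        show cmk hg 0 ∈ W.1
        rw [(cmk_zero hg).2 (dvd_zero _)]; exact zero_mem _
      add_mem' := by
        intro a b ha hb
        have : cmk hg (a + b) = cmk hg a + cmk hg b := map_add (AdjoinRoot.mk g) a b
        show cmk hg (a + b) ∈ W.1
        rw [this]; exact add_mem ha hb
      smul_mem' := by
        intro c a ha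
        show cmk hg (c * a) ∈ W.1
        rw [← aeval_cmk]; exact aeval_mem W c ha }
  have hgI : g ∈ I := by
    show cmk hg g ∈ W.1
    rw [(cmk_zero hg).2 dvd_rfl]; exact zero_mem _
  obtain ⟨h, hh⟩ := (IsPrincipalIdealRing.principal I).principal
  have hmem : ∀ p, cmk hg p ∈ W.1 ↔ h ∣ p := by
    intro p
    show p ∈ I ↔ _
    rw [hh]; exact Ideal.mem_span_singleton
  have hhg : h ∣ g := (hmem g).1 hgI
  have h0 : h ≠ 0 := by rintro rfl; exact hg.ne_zero (zero_dvd_iff.1 hhg)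
  refine ⟨normalize h, monic_normalize h0, normalize_dvd_iff.2 hhg, Subtype.ext (Submodule.ext fun w => ?_)⟩
  obtain ⟨p, rfl⟩ := cmk_surj hg w
  rw [mem_cW hg (normalize_dvd_iff.2 hhg), hmem, normalize_dvd_iff]
theorem kap_mul {K : Type u} [CommRing K] {f : F[X]} (hf : f.Monic) (hi : Irreducible f) (a b : Hall F K) (k : ℕ) :
    (a * b) (cyc (f ^ k) (hf.pow k)) = ∑ p ∈ Finset.HasAntidiagonal.antidiagonal k, a (cyc (f ^ p.1) (hf.pow p.1)) * b (cyc (f ^ p.2) (hf.pow p.2)) := by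
  refine (Hall.mul_f a b _).trans ?_
  symm
  have hnd : 0 < f.natDegree := hi.natDegree_pos
  refine Finset.sum_bij (fun p _ => cW (hf.pow k) (f ^ p.2)) (fun _ _ => Finset.mem_univ _) ?_ ?_ ?_
  · rintro ⟨i, j⟩ hp ⟨i', j'⟩ hp' h
    have hp := Finset.HasAntidiagonal.mem_antidiagonal.1 hp
    have hp' := Finset.HasAntidiagonal.mem_antidiagonal.1 hp'
    simp only at hp hp'
    have h1 := (cW_quot (hf.pow k) (hf.pow j) (pow_dvd_pow f (by omega : j ≤ k))).d
    have h2 := (cW_quot (hf.pow k) (hf.pow j') (pow_dvd_pow f (by omega : j' ≤ k))).d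
    simp only at h
    rw [← h, ← h1, cyc_d, cyc_d, natDegree_pow, natDegree_pow] at h2
    have := Nat.eq_of_mul_eq_mul_right hnd h2
    ext <;> simp <;> omega
  · intro W _
    obtain ⟨h, hm, hd, rfl⟩ := cW_all (hf.pow k) W
    obtain ⟨j, hj, hj'⟩ := (dvd_prime_pow hi.prime k).1 hd
    have := eq_of_monic_of_associated hm (hf.pow j) hj'
    subst this
    exact ⟨(k - j, j), by simp; omega, rfl⟩
  · rintro ⟨i, j⟩ hp
    have hp := Finset.HasAntidiagonal.mem_antidiagonal.1 hp
    simp only at hp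
    rw [a.inv (cW_sub (hf.pow k) (hf.pow i) (h := f ^ j) (by rw [← pow_add, add_comm, hp])), b.inv (cW_quot (hf.pow k) (hf.pow j) (pow_dvd_pow f (by omega : j ≤ k)))]
end GLW
end
end
section
universe u
open scoped MatrixGroups
noncomputable section
namespace GLW
variable {F : Type} [Field F] [Fintype F]
open Polynomial
abbrev sc (F : Type) [Field F] [Fintype F] (n : ℕ) : Ob F := mat n 1
theorem mX : (X - 1 : F[X]).Monic := by simpa using monic_X_sub_C (1 : F)
theorem dX : (X - 1 : F[X]).natDegree = 1 := by simpa using natDegree_X_sub_C (1 : F)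
theorem iX : Irreducible (X - 1 : F[X]) := by simpa using irreducible_X_sub_C (1 : F)
theorem oneX {p : F[X]} : (X - 1) ∣ p ↔ p.eval 1 = 0 := by
  have := dvd_iff_isRoot (p := p) (a := (1 : F)); simpa using this
abbrev J (F : Type) [Field F] [Fintype F] (k : ℕ) : Ob F := cyc ((X - 1) ^ k) (mX.pow k)
theorem J_d (k : ℕ) : (J F k).d = k := by rw [cyc_d, natDegree_pow, dX, mul_one]
theorem iso_of_inj {M N : Ob F} (φ : M.V →ₗ[F] N.V) (h : ∀ v, φ (M.x v) = N.x (φ v)) (hi : Function.Injective φ) (hd : M.d = N.d) : Iso M N :=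
  ⟨LinearEquiv.ofBijective φ ⟨hi, (LinearMap.injective_iff_surjective_of_finrank_eq_finrank hd).1 hi⟩, h⟩
theorem iso_id {M N : Ob F} (h : M.d = N.d) (hM : ∀ v, M.x v = v) (hN : ∀ v, N.x v = v) : Iso M N :=
  ⟨LinearEquiv.ofFinrankEq M.V N.V h, fun v => by rw [hM, hN]⟩
theorem ext_aX {n : ℕ} {N : Ob F} (B : N.V →ₗ[F] (sc F n).V) (m : (sc F n).V) (w : N.V) :
    aeval (ext (sc F n) N B).x (X - 1 : F[X]) (m, w) = (B w, aeval N.x (X - 1 : F[X]) w) := by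
  simp
theorem ext_case0 {n k : ℕ} (B : (J F (k+1)).V →ₗ[F] (sc F n).V) (h : B (cmk _ ((X-1)^k)) = 0) :
    Iso (ext (sc F n) (J F (k+1)) B) (ext (sc F n) (J F (k+1)) 0) := by
  let U : Module.End F (J F (k+1)).V := aeval (J F (k+1)).x (X - 1 : F[X])
  have hU : ∀ w, U w = (J F (k+1)).x w - w := fun w => by simp [U]
  have hk : LinearMap.ker U ≤ LinearMap.ker B := by
    intro w hw
    obtain ⟨p, rfl⟩ := cmk_surj _ w
    have h1 : U (cmk _ p) = 0 := hw
    rw [show U (cmk _ p) = _ from aeval_cmk _ _ _, cmk_zero, pow_succ', mul_dvd_mul_iff_left mX.ne_zero] at h1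
    obtain ⟨r, hr⟩ := h1
    have h2 : cmk (mX.pow (k+1)) p = (r.eval 1) • cmk (mX.pow (k+1)) ((X-1)^k : F[X]) := by
      have h3 : (r.eval 1) • cmk (mX.pow (k+1)) ((X-1)^k : F[X]) = cmk (mX.pow (k+1)) (C (r.eval 1) * (X-1)^k : F[X]) := by
        rw [← aeval_cmk, aeval_C]; rfl
      rw [h3, cmk_eq, hr, mul_comm, ← sub_mul, pow_succ']
      refine mul_dvd_mul_right (oneX.2 (by simp)) _
    rw [LinearMap.mem_ker, h2, map_smul, h, smul_zero]
  obtain ⟨φ, hφ⟩ : ∃ φ : (J F (k+1)).V →ₗ[F] (sc F n).V, φ ∘ₗ U = B := by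
    obtain ⟨g, hg⟩ := ((LinearMap.ker U).liftQ U le_rfl).exists_leftInverse_of_injective (by
      exact Submodule.ker_liftQ_eq_bot _ _ _ le_rfl)
    refine ⟨(LinearMap.ker U).liftQ B hk ∘ₗ g, LinearMap.ext fun w => ?_⟩
    have := LinearMap.congr_fun hg (Submodule.Quotient.mk w)
    show (LinearMap.ker U).liftQ B hk (g (U w)) = B w
    have h5 : g (U w) = Submodule.Quotient.mk w := this
    rw [h5]; rfl
  refine ⟨shear (-φ), fun v => (shear_ext (M := sc F n) (N := J F (k+1)) (-φ) B v).trans ?_⟩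
  have h7 : (B - (sc F n).x ∘ₗ (-φ) + (-φ) ∘ₗ (J F (k+1)).x) = 0 := ?_
  · rw [h7]
  refine LinearMap.ext fun w => ?_
  have h6 := LinearMap.congr_fun hφ w
  simp only [LinearMap.comp_apply, hU, map_sub] at h6
  simp [← h6]
theorem ext_case1 {n k : ℕ} (B : (J F (k+1)).V →ₗ[F] (sc F (n+1)).V) (h : B (cmk _ ((X-1)^k)) ≠ 0) :
    Iso (ext (sc F n) (J F (k+2)) 0) (ext (sc F (n+1)) (J F (k+1)) B) := by
  set m0 := B (cmk _ ((X-1)^k)) with hm0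
  let M := ext (sc F (n+1)) (J F (k+1)) B
  have hv : ∀ j, aeval M.x ((X - 1 : F[X])^(j+1)) (0, cmk _ 1) = (B (cmk _ ((X-1)^j)), cmk _ ((X-1)^(j+1))) := by
    intro j
    induction j with
    | zero => rw [zero_add, pow_one, ext_aX, aeval_cmk, mul_one, pow_zero]
    | succ j ih => rw [pow_succ', map_mul, Module.End.mul_apply, ih, ext_aX, aeval_cmk, ← pow_succ']
  have hv1 : aeval M.x ((X - 1 : F[X])^(k+1)) (0, cmk _ 1) = (m0, 0) := by
    rw [hv, (cmk_zero (mX.pow (k+1))).2 dvd_rfl]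
  have hv2 : aeval M.x ((X - 1 : F[X])^(k+2)) (0, cmk _ 1) = 0 := by
    rw [show k + 2 = (k+1)+1 from rfl, pow_succ', map_mul, Module.End.mul_apply, hv1, ext_aX]; simp; rfl
  obtain ⟨ψ, hψ, hψ'⟩ := cyc_lift (mX.pow (k+2)) (M := M) _ hv2
  obtain ⟨H, hH⟩ := (Submodule.span F {m0}).exists_isCompl
  have hHd : Module.finrank F (Fin n → F) = Module.finrank F H := by
    have := Submodule.finrank_add_eq_of_isCompl hH
    rw [finrank_span_singleton h] at this
    simp at this ⊢; omega
  let e := LinearEquiv.ofFinrankEq _ _ hHd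
  let φ : (Fin n → F) × (J F (k+2)).V →ₗ[F] M.V := LinearMap.coprod (LinearMap.inl F _ _ ∘ₗ H.subtype ∘ₗ e.toLinearMap) ψ
  have hφ : ∀ a b, φ (a, b) = ((e a : Fin (n+1) → F), 0) + ψ b := fun a b => by
    show LinearMap.inl F _ _ (H.subtype (e a)) + ψ b = _
    rfl
  refine iso_of_inj (M := ext (sc F n) (J F (k+2)) 0) φ ?_ ?_ ?_
  · rintro ⟨a, b⟩
    have h1 : (ext (sc F n) (J F (k+2)) 0).x (a, b) = (a, (J F (k+2)).x b) := by simp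
    rw [h1, hφ, hφ, map_add]
    congr 1
    · simp
    · exact hψ' b
  · rw [injective_iff_map_eq_zero]
    rintro ⟨a, b⟩ hab
    rw [hφ] at hab
    obtain ⟨p, rfl⟩ := cmk_surj _ b
    rw [hψ] at hab
    have h2 : (aeval M.x p (0, cmk _ 1)).2 = aeval (J F (k+1)).x p (cmk _ 1) := aeval_hom (M := M) (N := J F (k+1)) (LinearMap.snd F _ _) (fun _ => rfl) p _
    have h3 := congrArg Prod.snd hab
    rw [Prod.snd_add, h2, aeval_cmk, mul_one] at h3
    have h3 : cmk (mX.pow (k+1)) p = 0 := by simpa using h3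
    obtain ⟨r, rfl⟩ := (cmk_zero _).1 h3
    rw [mul_comm, map_mul, Module.End.mul_apply, hv1] at hab
    have h4 : aeval M.x r (m0, 0) = (r.eval 1 • m0, 0) := by
      have h5 := aeval_hom (M := sc F (n+1)) (N := M) (LinearMap.inl F _ _) (fun v => by simp [M]) r m0
      have h6 : aeval (sc F (n+1)).x r = (r.eval 1) • (1 : Module.End F (Fin (n+1) → F)) := by
        have := aeval_algebraMap_apply (A := F) (B := Module.End F (Fin (n+1) → F)) (1 : F) r
        rw [map_one, Algebra.algebraMap_eq_smul_one] at this
        exact this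
      rw [h6] at h5
      exact h5.symm
    rw [h4] at hab
    have h7 : (e a : Fin (n+1) → F) + r.eval 1 • m0 = 0 := congrArg Prod.fst hab
    have h8 : (e a : Fin (n+1) → F) ∈ Submodule.span F {m0} ⊓ H := by
      refine ⟨?_, (e a).2⟩
      rw [eq_neg_of_add_eq_zero_left h7]
      exact neg_mem (Submodule.smul_mem _ _ (Submodule.mem_span_singleton_self _))
    rw [hH.inf_eq_bot, Submodule.mem_bot] at h8
    rw [h8, zero_add, smul_eq_zero] at h7
    have h9 := oneX.2 (h7.resolve_right h)
    have h10 : a = 0 := by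
      have : e a = 0 := Subtype.ext h8
      simpa using this
    rw [h10]
    refine Prod.ext rfl ((cmk_zero _).2 ?_)
    rw [pow_succ]; exact mul_dvd_mul_left _ h9
  · rw [ext_d, ext_d, J_d, J_d, mat_d, mat_d]; omega
theorem rel1 (a : Hall F ℂ) (n k : ℕ) : (Fintype.card F : ℂ)^(n+1) * (Phi a (sc F (n+1))).f (J F (k+1)) =
    a (ext (sc F (n+1)) (J F (k+1)) 0) + ((Fintype.card F : ℂ)^(n+1) - 1) * a (ext (sc F n) (J F (k+2)) 0) := by
  classical
  let t : (J F (k+1)).V := cmk _ ((X-1)^k)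
  have ht : t ≠ 0 := by
    intro h
    have := (cmk_zero (mX.pow (k+1))).1 h
    rw [pow_dvd_pow_iff mX.ne_zero iX.not_isUnit] at this
    omega
  let L : ((J F (k+1)).V →ₗ[F] (sc F (n+1)).V) →+ (Fin (n+1) → F) := (LinearMap.applyₗ (R := F) t).toAddMonoidHom
  have hL : Function.Surjective L := by
    intro m
    obtain ⟨f, hf⟩ := Module.Projective.exists_dual_ne_zero F ht
    refine ⟨((f t)⁻¹ • f).smulRight m, ?_⟩
    show ((f t)⁻¹ • f t) • m = m
    rw [smul_eq_mul, inv_mul_cancel₀ hf, one_smul]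
  rw [Phi_f]
  have h1 : (fun B => a (ext (sc F (n+1)) (J F (k+1)) B)) = fun B => (fun m : Fin (n+1) → F => if m = 0 then a (ext (sc F (n+1)) (J F (k+1)) 0) else a (ext (sc F n) (J F (k+2)) 0)) (L B) := by
    funext B
    by_cases h : L B = 0
    · simp only [h, if_true]; exact a.inv (ext_case0 B h)
    · simp only [h, if_false]; exact (a.inv (ext_case1 B h)).symm
  rw [h1, avg_surj L hL (fun m : Fin (n+1) → F => if m = 0 then a (ext (sc F (n+1)) (J F (k+1)) 0) else a (ext (sc F n) (J F (k+2)) 0)), avg]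
  have hc : (Fintype.card (Fin (n+1) → F) : ℂ) = (Fintype.card F : ℂ)^(n+1) := by
    rw [Fintype.card_fun, Fintype.card_fin]; push_cast; rfl
  have hq : (Fintype.card F : ℂ)^(n+1) ≠ 0 := pow_ne_zero _ (by simp)
  rw [hc, mul_inv_cancel_left₀ hq, ← Finset.add_sum_erase _ _ (Finset.mem_univ 0), if_pos rfl]
  congr 1
  rw [Finset.sum_congr rfl (fun m hm => if_neg (Finset.ne_of_mem_erase hm)), Finset.sum_const, Finset.card_erase_of_mem (Finset.mem_univ _), Finset.card_univ, nsmul_eq_mul, Nat.cast_sub (Fintype.card_pos), hc]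
  simp
theorem rel0 (a : Hall F ℂ) (k : ℕ) : a (ext (sc F 0) (J F k) 0) = a (J F k) := a.inv (ext_left (by rw [mat_d]) _)
theorem rel2 (a : Hall F ℂ) (n : ℕ) : a (sc F (n+1)) = a (ext (sc F n) (J F 1) 0) := by
  refine a.inv (iso_id ?_ (fun _ => rfl) ?_)
  · rw [ext_d, J_d, mat_d, mat_d]
  · rintro ⟨m, w⟩
    obtain ⟨p, rfl⟩ := cmk_surj _ w
    have h2 := aeval_cmk (mX.pow 1) (X - 1 : F[X]) p
    rw [(cmk_zero _ (p := (X-1)*p)).2 (by simp)] at h2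
    have h1 : (J F 1).x (cmk _ p) = cmk _ p := by
      simpa [sub_eq_zero] using h2
    simp [h1]
theorem rel_zero (a : Hall F ℂ) : ∀ n k, (∀ n' k', n' ≤ n → n' + k' = n + k → (Phi a (sc F n')).f (J F (k'+1)) = 0) →
    a (ext (sc F n) (J F (k+1)) 0) = 0 := by
  intro n
  induction n with
  | zero =>
    intro k h
    rw [rel0, ← h 0 k le_rfl rfl, Phi_left a (by rw [mat_d])]
  | succ n ih =>
    intro k h
    have h1 := rel1 a n k
    rw [h _ _ le_rfl rfl, mul_zero, ih (k+1) (fun n' k' h1 h2 => h n' k' (by omega) (by omega)), mul_zero, add_zero] at h1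
    exact h1.symm
theorem rel_shift (a : Hall F ℂ) (n : ℕ) : ∀ j k, (∀ n' k', n < n' → n' ≤ n + j → n' + k' = n + j + k → (Phi a (sc F n')).f (J F (k'+1)) = 0) →
    a (ext (sc F (n + j)) (J F (k+1)) 0) = (-1)^j * (∏ i ∈ Finset.range j, ((Fintype.card F : ℂ)^(n+i+1) - 1)) * a (ext (sc F n) (J F (k+j+1)) 0) := by
  intro j
  induction j with
  | zero => intro k h; simp
  | succ j ih =>
    intro k h
    have h1 := rel1 a (n+j) k
    rw [h (n+j+1) k (by omega) (by omega) (by omega), mul_zero, show k+2 = (k+1)+1 from rfl, ih (k+1) (fun n' k' h1 h2 h3 => h n' k' h1 (by omega) (by omega))] at h1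
    have h2 := eq_neg_of_add_eq_zero_left h1.symm
    rw [show n + (j+1) = n+j+1 from rfl, h2, Finset.prod_range_succ, show k + 1 + j + 1 = k + (j+1) + 1 by omega]
    ring
end GLW
end
end
section
universe u
open scoped MatrixGroups
noncomputable section
namespace GLW
variable {F : Type} [Field F] [Fintype F]
open Polynomial
section evH
variable {A K : Type*} [CommRing A] [CommRing K] (c : ℕ → A →+ K)
def evP (hf : ∀ a, ∃ D, ∀ k, D < k → c k a = 0) (a : A) : K[X] :=
  ∑ k ∈ Finset.range ((hf a).choose + 1), monomial k (c k a)
theorem evP_coeff (hf : ∀ a, ∃ D, ∀ k, D < k → c k a = 0) (a : A) (k : ℕ) : (evP c hf a).coeff k = c k a := by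
  simp only [evP, finset_sum_coeff, coeff_monomial]
  rw [Finset.sum_ite_eq' (Finset.range _)]
  split_ifs with h
  · rfl
  · exact ((hf a).choose_spec k (by simpa [Nat.lt_succ_iff] using h)).symm
def evH (h1 : ∀ k, c k 1 = if k = 0 then 1 else 0)
    (hm : ∀ k a b, c k (a * b) = ∑ p ∈ Finset.HasAntidiagonal.antidiagonal k, c p.1 a * c p.2 b)
    (hf : ∀ a, ∃ D, ∀ k, D < k → c k a = 0) : A →+* K :=
  (Polynomial.evalRingHom (1:K)).comp
    { toFun := evP c hf
      map_one' := by ext k; rw [evP_coeff, h1, coeff_one]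
      map_mul' := fun a b => by ext k; rw [evP_coeff, hm, coeff_mul]; simp only [evP_coeff]
      map_zero' := by ext k; rw [evP_coeff, map_zero, coeff_zero]
      map_add' := fun a b => by ext k; rw [coeff_add, evP_coeff, map_add, evP_coeff, evP_coeff] }
theorem evH_single {h1 : ∀ k, c k 1 = if k = 0 then 1 else 0}
    {hm : ∀ k a b, c k (a * b) = ∑ p ∈ Finset.HasAntidiagonal.antidiagonal k, c p.1 a * c p.2 b}
    {hf : ∀ a, ∃ D, ∀ k, D < k → c k a = 0} {a : A} {n : ℕ} (h : ∀ k, k ≠ n → c k a = 0) :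
    evH c h1 hm hf a = c n a := by
  have : evP c hf a = monomial n (c n a) := by
    ext k
    rw [evP_coeff, coeff_monomial]
    split_ifs with hk
    · rw [hk]
    · exact h k (Ne.symm hk)
  show (evP c hf a).eval 1 = _
  rw [this]; simp
end evH
def evO (M : Ob F) : RR F →+ ℂ := AddMonoidHom.mk' (fun a => a.1 M) fun a b => rfl
def kap (F : Type) [Field F] [Fintype F] : RR F →+* ℂ :=
  evH (fun k => evO (J F k))
    (fun k => by
      show (1 : Hall F ℂ) (J F k) = _
      rw [Hall.one_f, J_d])
    (fun k a b => by
      show (a.1 * b.1) (J F k) = _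
      rw [kap_mul mX iX]; rfl)
    (fun a => by
      obtain ⟨D, hD⟩ := RR_fd a
      exact ⟨D, fun k hk => hD _ (by rw [J_d]; exact hk)⟩)
theorem kap_irr {u : Hall F ℂ} {n} (hu : u ∈ Irr F n) : kap F (irr hu) = u (J F n) :=
  evH_single _ fun k hk => Irr.deg hu (by rw [J_d]; exact hk)
theorem scsub (n : ℕ) (W : (sc F n).S) : Iso ((sc F n).sub W) (sc F ((sc F n).sub W).d) :=
  iso_id (by rw [mat_d]) (fun v => rfl) fun v => rfl
theorem scquot (n : ℕ) (W : (sc F n).S) : Iso ((sc F n).quot W) (sc F ((sc F n).quot W).d) := by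
  refine iso_id (by rw [mat_d]) (fun v => ?_) fun v => rfl
  obtain ⟨v, rfl⟩ := Submodule.Quotient.mk_surjective _ v
  rfl
theorem sc_mul (a b : Hall F ℂ) (n : ℕ) : (a * b) (sc F n) = ∑ p ∈ Finset.HasAntidiagonal.antidiagonal n,
    (gl F n : ℂ) / (gl F p.1 * gl F p.2 * (Fintype.card F : ℂ) ^ (p.1 * p.2)) * (a (sc F p.1) * b (sc F p.2)) := by
  classical
  rw [Hall.mul_f]
  have h1 : ∀ W : (sc F n).S, ((sc F n).sub W).d + ((sc F n).quot W).d = n := fun W => by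
    rw [d_add, mat_d]
  rw [← Finset.sum_fiberwise_of_maps_to (s := Finset.univ) (t := Finset.HasAntidiagonal.antidiagonal n)
    (g := fun W : (sc F n).S => (((sc F n).sub W).d, ((sc F n).quot W).d)) (fun W _ => by simpa using h1 W)]
  refine Finset.sum_congr rfl fun p hp => ?_
  rw [Finset.HasAntidiagonal.mem_antidiagonal] at hp
  rw [Finset.sum_congr rfl (g := fun _ => a (sc F p.1) * b (sc F p.2))]
  · rw [Finset.sum_const, nsmul_eq_mul]
    congr 1
    have h2 := (W_cnt (F := F) hp).1
    have h3 : Fintype.card ((Fin p.2 → F) →ₗ[F] (Fin p.1 → F)) = Fintype.card F ^ (p.1 * p.2) := by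
      rw [← Nat.card_eq_fintype_card, Module.natCard_eq_pow_finrank (K := F), Module.finrank_linearMap]
      simp [Nat.card_eq_fintype_card, mul_comm]
    rw [h3] at h2
    rw [eq_div_iff (by
      have := gl_pos (F := F) p.1; have := gl_pos (F := F) p.2
      have : (Fintype.card F : ℂ) ≠ 0 := Nat.cast_ne_zero.2 Fintype.card_ne_zero
      positivity), ← h2]
    push_cast
    congr 2
    refine Finset.card_bij (fun W _ => W.1) ?_ ?_ ?_
    · intro W hW
      simp only [Finset.mem_filter, Finset.mem_univ, true_and] at hW ⊢
      exact congrArg Prod.fst hW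
    · intro W _ W' _ h; exact Subtype.ext h
    · intro W hW
      simp only [Finset.mem_filter, Finset.mem_univ, true_and] at hW
      refine ⟨⟨W, fun v hv => hv⟩, ?_, rfl⟩
      have := h1 ⟨W, fun v hv => hv⟩
      have h4 : ((sc F n).sub ⟨W, fun v hv => hv⟩).d = p.1 := hW
      have h5 : ((sc F n).quot ⟨W, fun v hv => hv⟩).d = p.2 := by omega
      exact Finset.mem_filter.2 ⟨Finset.mem_univ _, (congrArg₂ Prod.mk h4 h5 : (_, _) = (p.1, p.2))⟩
  · intro W hW
    simp only [Finset.mem_filter, Finset.mem_univ, true_and] at hW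
    rw [a.inv (scsub n W), b.inv (scquot n W)]
    rw [← hW]
theorem add_ch2 (i j : ℕ) : (i + j).choose 2 = i.choose 2 + j.choose 2 + i * j := by
  induction j with
  | zero => simp
  | succ j ih =>
    rw [← add_assoc, Nat.choose_succ_succ' (i+j) 1, Nat.choose_succ_succ' j 1, ih, Nat.choose_one_right, Nat.choose_one_right]
    ring
def dco (F : Type) [Field F] [Fintype F] (n : ℕ) : ℂ := (Fintype.card F : ℂ) ^ (n.choose 2) / gl F n
def del (F : Type) [Field F] [Fintype F] : RR F →+* ℂ :=
  evH (fun k => (AddMonoidHom.mulLeft (dco F k)).comp (evO (sc F k)))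
    (fun k => by
      show dco F k * (1 : Hall F ℂ) (sc F k) = _
      rw [Hall.one_f, mat_d]
      split_ifs with h
      · subst h; simp [dco, gl_zero]
      · simp)
    (fun k a b => by
      show dco F k * (a.1 * b.1) (sc F k) = _
      rw [sc_mul, Finset.mul_sum]
      refine Finset.sum_congr rfl fun p hp => ?_
      rw [Finset.HasAntidiagonal.mem_antidiagonal] at hp
      show _ = (dco F p.1 * a.1 (sc F p.1)) * (dco F p.2 * b.1 (sc F p.2))
      have h0 : (Fintype.card F : ℂ) ≠ 0 := Nat.cast_ne_zero.2 Fintype.card_ne_zero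
      have h1 := gl_pos (F := F) p.1; have h2 := gl_pos (F := F) p.2; have h3 := gl_pos (F := F) k
      have h4 : k.choose 2 = p.1.choose 2 + p.2.choose 2 + p.1 * p.2 := by
        rw [← hp, add_ch2]
      rw [dco, dco, dco, h4, pow_add, pow_add]
      field_simp)
    (fun a => by
      obtain ⟨D, hD⟩ := RR_fd a
      refine ⟨D, fun k hk => ?_⟩
      show dco F k * a.1 (sc F k) = 0
      rw [hD _ (by rw [mat_d]; exact hk), mul_zero])
theorem del_irr {u : Hall F ℂ} {n} (hu : u ∈ Irr F n) : del F (irr hu) = dco F n * u (sc F n) :=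
  evH_single _ fun k hk => by
    show dco F k * u (sc F k) = 0
    rw [Irr.deg hu (by rw [mat_d]; exact hk), mul_zero]
end GLW
end
end
section
universe u
open scoped MatrixGroups
noncomputable section
namespace GLW
variable {F : Type} [Field F] [Fintype F]
open Polynomial
theorem cyc_bij {g : F[X]} (hg : g.Monic) (h0 : IsCoprime g X) : Function.Bijective (cyc g hg).x := by
  haveI := (cyc g hg).fin
  rw [← Finite.injective_iff_bijective]
  rw [← LinearMap.ker_eq_bot, LinearMap.ker_eq_bot']
  intro v hv
  obtain ⟨p, rfl⟩ := cmk_surj hg v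
  have h1 := aeval_cmk hg X p
  rw [aeval_X] at h1
  rw [h1, cmk_zero] at hv
  exact (cmk_zero hg).2 (h0.dvd_of_dvd_mul_left hv)
theorem J_bij (k : ℕ) : Function.Bijective (J F k).x := by
  refine cyc_bij _ (IsCoprime.pow_left ?_)
  refine ⟨-1, 1, by ring⟩
theorem irr_val_int {u : Hall F ℂ} {n} (hu : u ∈ Irr F n) {M : Ob F} (hd : M.d = n) (hb : Function.Bijective M.x) : IsIntegral ℤ (u M) := by
  obtain ⟨g, hg⟩ := exists_mat_gl hd hb
  rw [u.inv hg]
  exact irr_int hu.1 g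
theorem irr_sc {u : Hall F ℂ} {n} (hu : u ∈ Irr F n) : ∃ d : ℕ, 0 < d ∧ u (sc F n) = d := irr_one hu.1
def Q0 : Subfield ℂ := (algebraMap ℚ ℂ).fieldRange
theorem Y_rat {w : Hall F ℂ} {N} (hw : w ∈ Irr F N) (n k : ℕ) (h : ∀ v ∈ Irr F k, v (J F k) ∈ Q0) : (Phi w (sc F n)).f (J F k) ∈ Q0 := by
  rw [Phi_exp (Irr.sup hw), Hall.sum_f]
  refine sum_mem fun u hu => ?_
  rw [mem_IrrF, mat_d] at hu
  rw [Hall.smul_f, mat_d, perp_eq hu (Irr.sup hw)]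
  obtain ⟨d, -, hd⟩ := irr_sc hu
  rw [hd]
  refine mul_mem (natCast_mem _ d) (sum_mem fun v hv => ?_)
  rw [mem_IrrF, J_d] at hv
  rw [J_d]
  refine mul_mem ?_ (h v hv)
  by_cases hk : n + k = N
  · rw [hk]
    obtain ⟨j, hj, -⟩ := ip_nat hu hv hw
    rw [hj]; exact natCast_mem _ j
  · have : ip (n + k) (u * v) w = 0 := by
      simp only [ip, pr]
      rw [Finset.sum_eq_zero fun x _ => by rw [Irr.deg hw (by rw [mat_d]; exact hk), smul_zero], smul_zero]
    rw [this]; exact zero_mem _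
theorem kap_rat (N : ℕ) : ∀ w ∈ Irr F N, w (J F N) ∈ Q0 := by
  induction N using Nat.strong_induction_on with
  | _ N IH =>
  intro w hw
  rcases N with _ | m
  · obtain rfl := Irr_zero hw
    rw [Hall.one_f, J_d]; simp
  have hq : ∀ k, (Fintype.card F : ℂ) ^ k ∈ Q0 := fun k => pow_mem (natCast_mem _ _) _
  have key : ∀ j, j ≤ m → w (ext (sc F (m - j)) (J F (j+1)) 0) ∈ Q0 := by
    intro j
    induction j with
    | zero =>
      intro _
      rw [Nat.sub_zero, zero_add, ← rel2]
      obtain ⟨d, -, hd⟩ := irr_sc hw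
      rw [hd]; exact natCast_mem _ d
    | succ j ih =>
      intro hj
      have h1 := rel1 w (m - (j+1)) j
      rw [show m - (j+1) + 1 = m - j by omega] at h1
      have h2 := Y_rat hw (m - j) (j+1) (IH (j+1) (by omega))
      have hne : (Fintype.card F : ℂ) ^ (m-j) - 1 ≠ 0 := by
        rw [sub_ne_zero]
        have : 1 < Fintype.card F ^ (m-j) := Nat.one_lt_pow (by omega) Fintype.one_lt_card
        exact_mod_cast this.ne'
      have h3 : w (ext (sc F (m - (j+1))) (J F (j+2)) 0) = ((Fintype.card F : ℂ) ^ (m-j) * (Phi w (sc F (m-j))).f (J F (j+1)) - w (ext (sc F (m-j)) (J F (j+1)) 0)) / ((Fintype.card F : ℂ) ^ (m-j) - 1) := by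
        rw [eq_div_iff hne, h1]; ring
      rw [show j + 1 + 1 = j + 2 from rfl, h3]
      exact div_mem (sub_mem (mul_mem (hq _) h2) (ih (by omega))) (sub_mem (hq _) (one_mem _))
  have h4 := key m le_rfl
  rw [Nat.sub_self, rel0] at h4
  exact h4
theorem kap_int {w : Hall F ℂ} {N} (hw : w ∈ Irr F N) : ∃ z : ℤ, w (J F N) = z := by
  obtain ⟨r, hr⟩ := kap_rat N w hw
  have h1 := irr_val_int hw (J_d N) (J_bij N)
  rw [← hr] at h1
  have h2 : IsIntegral ℤ r := (isIntegral_algebraMap_iff (algebraMap ℚ ℂ).injective).1 h1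
  obtain ⟨z, hz⟩ := IsIntegrallyClosed.isIntegral_iff.1 h2
  exact ⟨z, by rw [← hr, ← hz]; simp⟩
theorem perp_PP {u w : Hall F ℂ} {i n} (hu : u ∈ Irr F i) (hw : w ∈ Irr F n) : perp i u w = ((SS F).P (irr hu) (irr hw)).1 := by
  show perp i u w = (PP F (irr hu) (irr hw)).1
  rw [PP_irr hu]
theorem IR_ex {a : RR F} (ha : a ∈ (SS F).I) : ∃ n, a.1 ∈ Irr F n := ha
theorem IR_mem {u : Hall F ℂ} {i} (hu : u ∈ Irr F i) : irr hu ∈ (SS F).I := ⟨i, hu⟩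
theorem dg_irr {u : Hall F ℂ} {i} (hu : u ∈ Irr F i) : (SS F).dg (irr hu) = i := dgR_irr hu
theorem dg_mem {a : RR F} (ha : a ∈ (SS F).I) : a.1 ∈ Irr F ((SS F).dg a) := by
  obtain ⟨n, hn⟩ := ha
  have : (SS F).dg a = n := dgR_irr hn
  rw [this]; exact hn
theorem cusp_Phi {ρ : RR F} (hρ : ρ ∈ (SS F).Cusp) (M : Ob F) (h0 : M.d ≠ 0) (h1 : M.d ≠ (SS F).dg ρ) : Phi ρ.1 M = 0 := by
  have hr := dg_mem hρ.1
  rw [Phi_exp (Irr.sup hr)]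
  refine Finset.sum_eq_zero fun u hu => ?_
  rw [mem_IrrF] at hu
  rw [perp_PP hu hr, hρ.2.2 _ (IR_mem hu)]
  · exact smul_zero _
  · intro h
    have := congrArg (SS F).dg h
    rw [dg_irr, (SS F).dg_one] at this
    exact h0 this
  · intro h
    have := congrArg (SS F).dg h
    rw [dg_irr] at this
    exact h1 this
theorem cusp_deg {ρ : RR F} (hρ : ρ ∈ (SS F).Cusp) {d : ℕ} (hd : (SS F).dg ρ = d + 1) :
    ρ.1 (sc F (d+1)) = (-1)^d * (∏ i ∈ Finset.range d, ((Fintype.card F : ℂ)^(i+1) - 1)) * ρ.1 (J F (d+1)) := by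
  have := rel_shift ρ.1 0 d 0 (fun n' k' h1 h2 h3 => by
    rw [cusp_Phi hρ _ (by rw [mat_d]; omega) (by rw [mat_d]; omega)]; rfl)
  rw [rel2, ← rel0]
  rw [Nat.zero_add, Nat.zero_add] at this
  simpa only [Nat.zero_add] using this
theorem cusp_kap {ρ : RR F} (hρ : ρ ∈ (SS F).Cusp) : ∃ z : ℤ, z ≠ 0 ∧ kap F ρ = z := by
  have hr := dg_mem hρ.1
  obtain ⟨z, hz⟩ := kap_int hr
  have h2 : kap F ρ = z := (kap_irr hr).trans hz
  refine ⟨z, ?_, h2⟩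
  rintro rfl
  have h0 := (SS F).cusp_dg hρ
  obtain ⟨d, hd⟩ : ∃ d, (SS F).dg ρ = d + 1 := ⟨_, (Nat.succ_pred_eq_of_pos h0).symm⟩
  have h3 := cusp_deg hρ hd
  rw [hd] at hz hr
  obtain ⟨e, he, he2⟩ := irr_sc hr
  rw [hz, he2] at h3
  simp at h3
  omega
end GLW
end
end
section
universe u
open scoped MatrixGroups
noncomputable section
namespace GLW
section cnt
variable {A B : Type*}
def MS (w : A → ℕ) (n : ℕ) : Set (Multiset A) := {s | (s.map w).sum = n}
theorem MS_le {w : A → ℕ} {n} {s : Multiset A} (h : s ∈ MS w n) {a : A} (ha : a ∈ s) : w a ≤ n := by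
  rw [← (show (s.map w).sum = n from h)]
  exact Multiset.single_le_sum (fun _ _ => Nat.zero_le _) _ (Multiset.mem_map_of_mem _ ha)
theorem MS_fin {w : A → ℕ} (hw : ∀ a, 0 < w a) (hf : ∀ d, {a | w a = d}.Finite) (n : ℕ) : (MS w n).Finite := by
  classical
  have h1 : {a | w a ≤ n}.Finite := by
    refine ((Set.finite_Iic n).biUnion fun d _ => hf d).subset fun a ha => ?_
    simp only [Set.mem_iUnion, Set.mem_setOf_eq, Set.mem_Iic]
    exact ⟨_, ha, rfl⟩
  refine (Finset.finite_toSet ((n • h1.toFinset.1).powerset.toFinset)).subset fun s hs => ?_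
  simp only [Finset.mem_coe, Multiset.mem_toFinset, Multiset.mem_powerset]
  rw [Multiset.le_iff_count]
  intro a
  by_cases ha : a ∈ s
  · rw [Multiset.count_nsmul, Multiset.count_eq_one_of_mem h1.toFinset.nodup (by simpa using MS_le hs ha), mul_one]
    refine (Multiset.count_le_card a s).trans ?_
    rw [← (show (s.map w).sum = n from hs)]
    have := Multiset.card_nsmul_le_sum (s := s.map w) (a := 1) (fun x hx => by
      obtain ⟨a, -, rfl⟩ := Multiset.mem_map.1 hx; exact hw a)
    simpa using this
  · rw [Multiset.count_eq_zero_of_notMem ha]; exact Nat.zero_le _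
theorem MS_emb {w : A → ℕ} {w' : B → ℕ} (hw' : ∀ a, 0 < w' a) (hf' : ∀ d, {a | w' a = d}.Finite) {n : ℕ} (φ : A → B)
    (hi : Set.InjOn φ {a | w a ≤ n}) (hφ : ∀ a, w a ≤ n → w' (φ a) = w a) :
    (MS w n).ncard ≤ (MS w' n).ncard ∧ ((∃ b, w' b = n ∧ ∀ a, w a ≤ n → φ a ≠ b) → (MS w n).ncard < (MS w' n).ncard) := by
  classical
  have hmaps : ∀ s ∈ MS w n, Multiset.map φ s ∈ MS w' n := fun s hs => by
    show ((s.map φ).map w').sum = n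
    rw [Multiset.map_map, Multiset.map_congr rfl (f := w' ∘ φ) (g := w) fun a ha => hφ a (MS_le hs ha)]
    exact hs
  have hinj : Set.InjOn (Multiset.map φ) (MS w n) := by
    rcases isEmpty_or_nonempty A with hA | hA
    · intro s _ t _ _
      rw [Multiset.eq_zero_of_forall_notMem (s := s) fun a => (hA.false a).elim, Multiset.eq_zero_of_forall_notMem (s := t) fun a => (hA.false a).elim]
    have h := hi.leftInvOn_invFunOn
    refine Set.LeftInvOn.injOn (f₁' := Multiset.map (Function.invFunOn φ {a | w a ≤ n})) fun s hs => ?_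
    rw [Multiset.map_map, Multiset.map_congr rfl (f := Function.invFunOn φ {a | w a ≤ n} ∘ φ) (g := id) fun a ha => h (MS_le hs ha), Multiset.map_id]
  have hfin := MS_fin hw' hf' n
  refine ⟨Set.ncard_le_ncard_of_injOn _ hmaps hinj hfin, ?_⟩
  rintro ⟨b, hb, hb2⟩
  rw [← Set.ncard_image_of_injOn hinj]
  refine Set.ncard_lt_ncard (Set.ssubset_iff_subset_ne.2 ⟨Set.image_subset_iff.2 hmaps, ?_⟩) hfin
  intro h
  have : ({b} : Multiset B) ∈ MS w' n := by simpa [MS] using hb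
  rw [← h] at this
  obtain ⟨s, hs, hs2⟩ := this
  rw [Multiset.map_eq_singleton] at hs2
  obtain ⟨a, rfl, ha⟩ := hs2
  exact hb2 a (MS_le hs (by simp)) ha
def wp (w : A → ℕ) : A × ℕ → ℕ := fun p => w p.1 * (p.2 + 1)
theorem wp_pos {w : A → ℕ} (hw : ∀ a, 0 < w a) (p) : 0 < wp w p := Nat.mul_pos (hw _) (Nat.succ_pos _)
theorem wp_fin {w : A → ℕ} (hw : ∀ a, 0 < w a) (hf : ∀ d, {a | w a = d}.Finite) (n : ℕ) : {p | wp w p = n}.Finite := by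
  have h1 : {a | w a ≤ n}.Finite := by
    refine ((Set.finite_Iic n).biUnion fun d _ => hf d).subset fun a ha => ?_
    simp only [Set.mem_iUnion, Set.mem_setOf_eq, Set.mem_Iic]
    exact ⟨_, ha, rfl⟩
  refine (h1.prod (Set.finite_Iic n)).subset fun p hp => ?_
  have hp : w p.1 * (p.2 + 1) = n := hp
  have h2 := hw p.1
  simp only [Set.mem_prod, Set.mem_setOf_eq, Set.mem_Iic]
  constructor <;> nlinarith
theorem ex_emb {w : A → ℕ} {w' : B → ℕ} (hf' : ∀ d, {a | w' a = d}.Finite) (hf : ∀ d, {a | w a = d}.Finite) (n : ℕ) (b₀ : B)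
    (h : ∀ d ≤ n, {a | w a = d}.ncard ≤ {b | w' b = d}.ncard) :
    ∃ φ : A → B, Set.InjOn φ {a | w a ≤ n} ∧ (∀ a, w a ≤ n → w' (φ a) = w a) := by
  classical
  have h1 : ∀ d, ∃ φ : A → B, d ≤ n → Set.InjOn φ {a | w a = d} ∧ ∀ a, w a = d → w' (φ a) = d := by
    intro d
    by_cases hd : d ≤ n
    · haveI : Nonempty B := ⟨b₀⟩
      obtain ⟨φ, h1, h2⟩ := (hf d).exists_injOn_of_encard_le (t := {b | w' b = d}) (by
        rw [← (hf d).cast_ncard_eq, ← (hf' d).cast_ncard_eq]; exact_mod_cast h d hd)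
      exact ⟨φ, fun _ => ⟨h2, fun a ha => h1 ha⟩⟩
    · exact ⟨fun _ => b₀, fun h => (hd h).elim⟩
  choose φ hφ using h1
  refine ⟨fun a => φ (w a) a, ?_, fun a ha => (hφ _ ha).2 a rfl⟩
  intro a ha a' ha' h
  have h2 : w a = w a' := by
    rw [← (hφ _ ha).2 a rfl, ← (hφ _ ha').2 a' rfl]; exact congrArg w' h
  refine (hφ _ ha).1 rfl h2.symm ?_
  simp only at h
  rw [h, h2]
theorem ex_emb2 {w : A → ℕ} {w' : B → ℕ} (hf' : ∀ d, {a | w' a = d}.Finite) (hf : ∀ d, {a | w a = d}.Finite) (n : ℕ)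
    (h : ∀ d < n, {a | w a = d}.ncard = {b | w' b = d}.ncard) (h2 : {a | w a = n}.ncard < {b | w' b = n}.ncard) :
    ∃ φ : A → B, Set.InjOn φ {a | w a ≤ n} ∧ (∀ a, w a ≤ n → w' (φ a) = w a) ∧ ∃ b, w' b = n ∧ ∀ a, w a ≤ n → φ a ≠ b := by
  classical
  have hne : {b | w' b = n}.Nonempty := by
    rw [← Set.ncard_pos (hf' n)]; omega
  obtain ⟨b₀, -⟩ := hne
  obtain ⟨φ, h3, h4⟩ := ex_emb hf' hf n b₀ (fun d hd => by
    rcases hd.lt_or_eq with hd | rfl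
    · exact (h d hd).le
    · exact h2.le)
  refine ⟨φ, h3, h4, ?_⟩
  by_contra H
  push Not at H
  have : {b | w' b = n} ⊆ φ '' {a | w a = n} := fun b hb => by
    obtain ⟨a, ha, rfl⟩ := H b hb
    exact ⟨a, by rw [Set.mem_setOf_eq, ← h4 a ha]; exact hb, rfl⟩
  have h5 := Set.ncard_le_ncard this ((hf n).image _)
  have h6 := Set.ncard_image_le (f := φ) (hf n)
  omega
theorem cnt_main {w : A → ℕ} {w' : B → ℕ} (hw : ∀ a, 0 < w a) (hw' : ∀ a, 0 < w' a) (hf : ∀ d, {a | w a = d}.Finite) (hf' : ∀ d, {a | w' a = d}.Finite)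
    (h1 : ∀ n, (MS w n).ncard ≤ (MS w' n).ncard) (h2 : ∀ n, (MS (wp w') n).ncard ≤ (MS (wp w) n).ncard) (n : ℕ) :
    (MS w n).ncard = (MS w' n).ncard := by
  have key : ∀ n, {a | w a = n}.ncard = {b | w' b = n}.ncard := by
    intro n
    induction n using Nat.strong_induction_on with
    | _ n ih =>
    rcases lt_trichotomy {a | w a = n}.ncard {b | w' b = n}.ncard with h | h | h
    · exfalso
      obtain ⟨φ, h3, h4, b, hb, hb2⟩ := ex_emb2 hf' hf n ih h
      have hle : ∀ p : A × ℕ, wp w p ≤ n → w p.1 ≤ n := fun p hp => (Nat.le_mul_of_pos_right _ (Nat.succ_pos _)).trans hp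
      have := (MS_emb (w := wp w) (wp_pos hw') (wp_fin hw' hf') (n := n) (fun p => (φ p.1, p.2)) (fun p hp p' hp' e => by
        have e1 := congrArg Prod.fst e
        have e2 := congrArg Prod.snd e
        exact Prod.ext (h3 (hle p hp) (hle p' hp') e1) e2) (fun p hp => by
          show w' (φ p.1) * _ = _
          rw [h4 _ (hle p hp)]; rfl)).2 ⟨(b, 0), by simpa [wp] using hb, fun p hp e => hb2 p.1 (hle p hp) (congrArg Prod.fst e)⟩
      exact absurd (h2 n) (by omega)
    · exact h
    · exfalso
      obtain ⟨φ, h3, h4, h5⟩ := ex_emb2 hf hf' n (fun d hd => (ih d hd).symm) h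
      have := (MS_emb hw hf φ h3 h4).2 h5
      exact absurd (h1 n) (by omega)
  refine le_antisymm (h1 n) ?_
  rcases isEmpty_or_nonempty A with hA | ⟨⟨a₀⟩⟩
  · have hB : IsEmpty B := ⟨fun b => by
      have h3 := key (w' b)
      have h4 : 0 < {b' | w' b' = w' b}.ncard := (Set.ncard_pos (hf' _)).2 ⟨b, rfl⟩
      rw [← h3, Set.ncard_pos (hf _)] at h4
      exact hA.false h4.some⟩
    exact (MS_emb hw hf (fun b : B => hB.elim b) (fun b => hB.elim b) (fun b => hB.elim b)).1
  · obtain ⟨φ, h3, h4⟩ := ex_emb hf hf' n a₀ (fun d _ => (key d).ge)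
    exact (MS_emb hw hf φ h3 h4).1
end cnt
end GLW
end
end
section
universe u
open scoped MatrixGroups
noncomputable section
namespace GLW
variable {F : Type} [Field F] [Fintype F]
open Polynomial
variable (F) in
abbrev BB : Type := {f : F[X] // f.Monic ∧ Irreducible f ∧ f ≠ X}
variable (F) in
def wB : BB F → ℕ := fun f => f.1.natDegree
variable (F) in
abbrev AA : Type 1 := {ρ : RR F // ρ ∈ (SS F).Cusp}
variable (F) in
def wA : AA F → ℕ := fun ρ => (SS F).dg ρ.1
theorem wB_pos (f : BB F) : 0 < wB F f := f.2.2.1.natDegree_pos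
theorem wA_pos (f : AA F) : 0 < wA F f := (SS F).cusp_dg f.2
theorem wB_fin (d : ℕ) : {f | wB F f = d}.Finite := by
  have h : (degreeLT F (d+1) : Set F[X]).Finite := by
    have : Finite (degreeLT F (d+1)) := Finite.of_equiv _ (degreeLTEquiv F (d+1)).symm.toEquiv
    exact Set.toFinite _
  refine Set.Finite.of_finite_image (f := fun f : BB F => f.1) (h.subset ?_) Subtype.val_injective.injOn
  rintro _ ⟨f, hf, rfl⟩
  simp only [SetLike.mem_coe, mem_degreeLT]
  have hf : f.1.natDegree = d := hf
  refine (degree_le_natDegree).trans_lt ?_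
  rw [hf]; exact_mod_cast Nat.lt_succ_self d
theorem wA_fin (d : ℕ) : {f | wA F f = d}.Finite := by
  refine Set.Finite.of_finite_image (f := fun f : AA F => f.1.1) ((IrrF F d).finite_toSet.subset ?_) (Subtype.val_injective.comp Subtype.val_injective).injOn
  rintro _ ⟨f, hf, rfl⟩
  have h1 := dg_mem f.2.1
  have hf : (SS F).dg f.1 = d := hf
  rw [hf] at h1
  exact mem_IrrF.2 h1
theorem ex_ms {h : F[X]} (hm : h.Monic) (h0 : ¬ X ∣ h) : ∃ s : Multiset (BB F), s ∈ MS (wB F) h.natDegree ∧ (s.map Subtype.val).prod = h := by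
  classical
  have h1 : ∀ f ∈ UniqueFactorizationMonoid.normalizedFactors h, f.Monic ∧ Irreducible f ∧ f ≠ X := by
    intro f hf
    have hi := UniqueFactorizationMonoid.irreducible_of_normalized_factor f hf
    refine ⟨?_, hi, ?_⟩
    · rw [← UniqueFactorizationMonoid.normalize_normalized_factor f hf]
      exact monic_normalize hi.ne_zero
    · rintro rfl
      exact h0 (UniqueFactorizationMonoid.dvd_of_mem_normalizedFactors hf)
  have hp : (UniqueFactorizationMonoid.normalizedFactors h).prod = h := by
    rw [UniqueFactorizationMonoid.prod_normalizedFactors_eq hm.ne_zero, hm.normalize_eq_self]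
  obtain ⟨s, hs⟩ : ∃ s : Multiset (BB F), s.map Subtype.val = UniqueFactorizationMonoid.normalizedFactors h := by
    refine ⟨(UniqueFactorizationMonoid.normalizedFactors h).pmap (fun a ha => ⟨a, ha⟩) h1, ?_⟩
    rw [Multiset.map_pmap]
    exact (Multiset.pmap_eq_map _ (fun a => a) _ _).trans (Multiset.map_id' _)
  refine ⟨s, ?_, by rw [hs, hp]⟩
  rw [← hs] at hp
  show (s.map (wB F)).sum = _
  rw [← hp, natDegree_multiset_prod_of_monic _ (fun f hf => by
    obtain ⟨g, -, rfl⟩ := Multiset.mem_map.1 hf; exact g.2.1), Multiset.map_map]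
  rfl
theorem unit_cnt (n : ℕ) : {v : (J F n).V | ∀ p, cmk (mX.pow n) p = v → n = 0 ∨ p.eval 1 ≠ 0}.ncard ≤ (MS (wB F) n).ncard := by
  classical
  have h1 : ∀ v : (J F n).V, ∃ r : F[X], r.degree < n ∧ cmk (mX.pow n) r = v := by
    intro v
    obtain ⟨p, rfl⟩ := cmk_surj _ v
    refine ⟨p %ₘ (X - 1)^n, ?_, ?_⟩
    · refine (degree_modByMonic_lt _ (mX.pow n)).trans_le ?_
      rw [degree_eq_natDegree (mX.pow n).ne_zero, natDegree_pow, dX, mul_one]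
    · rw [cmk_eq]
      refine ⟨-(p /ₘ (X-1)^n), ?_⟩
      have := modByMonic_add_div p ((X-1)^n)
      linear_combination this
  choose r hr1 hr2 using h1
  have hdeg : ∀ v, ((r v).comp (X + 1)).degree < n := fun v => by
    by_cases h0 : r v = 0
    · rw [h0, zero_comp, degree_zero]; exact WithBot.bot_lt_coe n
    · have := hr1 v
      rw [degree_eq_natDegree h0] at this
      refine degree_le_natDegree.trans_lt ?_
      rw [natDegree_comp, show (X + 1 : F[X]).natDegree = 1 by simpa using natDegree_X_add_C (1:F), mul_one]
      exact this
  let h : (J F n).V → F[X] := fun v => X^n + (r v).comp (X+1)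
  have hm : ∀ v, (h v).Monic := fun v => monic_X_pow_add (hdeg v)
  have hn : ∀ v, (h v).natDegree = n := fun v => by
    rw [natDegree_add_eq_left_of_degree_lt (by rw [degree_X_pow]; exact hdeg v), natDegree_X_pow]
  have h2 : ∀ v : (J F n).V, ∃ s : Multiset (BB F), (∀ p, cmk (mX.pow n) p = v → n = 0 ∨ p.eval 1 ≠ 0) → s ∈ MS (wB F) n ∧ (s.map Subtype.val).prod = h v := by
    intro v
    by_cases hv : ∀ p, cmk (mX.pow n) p = v → n = 0 ∨ p.eval 1 ≠ 0
    · obtain ⟨s, hs⟩ := ex_ms (hm v) (by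
        rw [X_dvd_iff, coeff_zero_eq_eval_zero]
        rcases Nat.eq_zero_or_pos n with h0 | h0
        · have : h v = 1 := (hm v).natDegree_eq_zero.1 (by rw [hn, h0])
          rw [this]; simp
        · have := (hv _ (hr2 v)).resolve_left h0.ne'
          simp only [h, eval_add, eval_pow, eval_X, eval_comp, eval_one, zero_add]
          rw [zero_pow h0.ne', zero_add]
          exact this)
      rw [hn] at hs
      exact ⟨s, fun _ => hs⟩
    · exact ⟨0, fun h => (hv h).elim⟩
  choose s hs using h2
  refine Set.ncard_le_ncard_of_injOn s (fun v hv => (hs v hv).1) ?_ (MS_fin wB_pos wB_fin n)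
  intro v hv v' hv' e
  have h3 : h v = h v' := by rw [← (hs v hv).2, ← (hs v' hv').2, e]
  have h4 : (r v).comp (X+1) = (r v').comp (X+1) := add_left_cancel h3
  have h5 := congrArg (fun p => p.comp (X - 1)) h4
  simp only [comp_assoc, add_comp, X_comp, one_comp, sub_add_cancel, comp_X] at h5
  rw [← hr2 v, h5, hr2]
open Classical in
theorem aut_cnt (n : ℕ) : gl F n ≤ (MS (wB F) n).ncard * (Finset.univ.filter fun x : Module.End F (Fin n → F) => Iso (mat n x) (J F n)).card := by
  let f : ((J F n).V ≃ₗ[F] (Fin n → F)) → Module.End F (Fin n → F) := fun e => conjE e (J F n).x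
  have hE : gl F n = (Finset.univ : Finset ((J F n).V ≃ₗ[F] (Fin n → F))).card := by
    rw [Finset.card_univ, gl]
    let φ : (J F n).V ≃ₗ[F] (Fin n → F) := LinearEquiv.ofFinrankEq _ _ (by rw [Module.finrank_fin_fun]; exact J_d n)
    exact Fintype.card_congr ⟨fun e => φ.trans e, fun e => φ.symm.trans e, fun e => by ext; simp, fun e => by ext; simp⟩
  rw [hE]
  have h1 : (Finset.univ.image f) ⊆ Finset.univ.filter fun x : Module.End F (Fin n → F) => Iso (mat n x) (J F n) := by
    intro x hx
    obtain ⟨e, -, rfl⟩ := Finset.mem_image.1 hx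
    exact Finset.mem_filter.2 ⟨Finset.mem_univ _, (iso_conj e (J F n).x).symm⟩
  refine le_trans (Finset.card_le_mul_card_image (f := f) Finset.univ (MS (wB F) n).ncard ?_) (Nat.mul_le_mul_left _ (Finset.card_le_card h1))
  intro x hx
  obtain ⟨e', -, he'⟩ := Finset.mem_image.1 hx
  refine le_trans ?_ (unit_cnt n)
  rw [← Set.ncard_coe_finset]
  have hc : ∀ e, f e = x → ∀ v, (e.trans e'.symm) ((J F n).x v) = (J F n).x ((e.trans e'.symm) v) := by
    intro e he v
    rw [← he'] at he
    have := LinearMap.congr_fun he (e v)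
    simp only [f, conjE, LinearEquiv.coe_toEquiv, LinearEquiv.conj_apply, LinearMap.comp_apply, LinearEquiv.coe_coe, LinearEquiv.symm_apply_apply] at this
    simp only [LinearEquiv.trans_apply]
    rw [this, LinearEquiv.symm_apply_apply]
  have hv : ∀ e, f e = x → ∀ p q, cmk (mX.pow n) q = (e.trans e'.symm) (cmk (mX.pow n) 1) → (e.trans e'.symm) (cmk (mX.pow n) p) = cmk (mX.pow n) (p * q) := by
    intro e he p q hq
    have := aeval_hom (M := J F n) (N := J F n) (e.trans e'.symm).toLinearMap (hc e he) p (cmk (mX.pow n) 1)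
    rw [aeval_cmk, mul_one] at this
    refine this.trans ?_
    rw [← aeval_cmk, hq]; rfl
  haveI := (J F n).fin
  refine Set.ncard_le_ncard_of_injOn (fun e => (e.trans e'.symm) (cmk (mX.pow n) 1)) ?_ ?_ (Set.toFinite _)
  · intro e he q hq
    have he : f e = x := by simpa using he
    by_contra H
    push Not at H
    obtain ⟨h0, h2⟩ := H
    obtain ⟨m, rfl⟩ := Nat.exists_eq_succ_of_ne_zero h0
    obtain ⟨q', rfl⟩ := oneX.2 h2
    have h3 := hv e he ((X-1)^m) _ hq
    rw [(cmk_zero (p := (X-1)^m * ((X-1)*q')) (mX.pow (m+1))).2 ⟨q', by ring⟩] at h3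
    have h4 := (LinearEquiv.map_eq_zero_iff _).1 h3
    rw [cmk_zero, pow_dvd_pow_iff iX.ne_zero iX.not_isUnit] at h4
    omega
  · intro e he e₂ he₂ h
    have he : f e = x := by simpa using he
    have he₂ : f e₂ = x := by simpa using he₂
    obtain ⟨q, hq⟩ := cmk_surj (mX.pow n) ((e.trans e'.symm) (cmk (mX.pow n) 1))
    ext1 v
    obtain ⟨p, rfl⟩ := cmk_surj _ v
    have h1 := (hv e he p q hq).trans (hv e₂ he₂ p q (hq.trans h)).symm
    simpa using h1
theorem kap_sum (n : ℕ) : ∑ u ∈ IrrF F n, Complex.normSq (u (J F n)) ≤ (MS (wB F) n).ncard := by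
  classical
  set c := (Finset.univ.filter fun x : Module.End F (Fin n → F) => Iso (mat n x) (J F n)).card with hc
  have hs : Sup (ind (J F n) : Hall F ℂ) := fun M hM => by
    rw [ind_f, if_neg]
    intro h
    exact hM (h.symm.bij (J_bij n))
  have h1 := complete hs (J F n)
  rw [ind_f, if_pos (Iso.refl _), J_d] at h1
  have h2 : ∀ u : Hall F ℂ, ip n u (ind (J F n)) = (gl F n : ℂ)⁻¹ * (c * starRingEnd ℂ (u (J F n))) := by
    intro u
    simp only [ip, pr, smul_eq_mul]
    congr 1
    rw [hc, ← nsmul_eq_mul, ← Finset.sum_const, Finset.sum_filter]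
    refine Finset.sum_congr rfl fun x _ => ?_
    rw [ind_f]
    split_ifs with h
    · rw [u.inv h, mul_one]
    · rw [mul_zero]
  have h3 : (gl F n : ℝ) = c * ∑ u ∈ IrrF F n, Complex.normSq (u (J F n)) := by
    have h4 : ((gl F n : ℝ) : ℂ) = ((c * ∑ u ∈ IrrF F n, Complex.normSq (u (J F n)) : ℝ) : ℂ) := by
      have hg := gl_pos (F := F) n
      calc ((gl F n : ℝ) : ℂ) = gl F n * 1 := by simp
        _ = _ := by
          rw [h1, Finset.mul_sum]
          push_cast
          rw [Finset.mul_sum]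
          refine Finset.sum_congr rfl fun u _ => ?_
          rw [h2, Complex.normSq_eq_conj_mul_self]
          field_simp
    exact_mod_cast h4
  have h5 : (gl F n : ℝ) ≤ (MS (wB F) n).ncard * c := by exact_mod_cast aut_cnt (F := F) n
  have hg : (0:ℝ) < gl F n := by
    have := gl_pos (F := F) n
    exact_mod_cast Nat.pos_of_ne_zero (by exact_mod_cast this)
  have hc0 : (0:ℝ) < c := by
    rcases (Nat.zero_le c).lt_or_eq with h | h
    · exact_mod_cast h
    · rw [← h, Nat.cast_zero, mul_zero] at h5; linarith
  rw [h3, mul_comm] at h5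
  exact le_of_mul_le_mul_right h5 hc0
end GLW
end
end
section
universe u
open scoped MatrixGroups
noncomputable section
namespace GLW
variable {F : Type} [Field F] [Fintype F]
open Polynomial
theorem sq_split {R : Type u} [CommRing R] {S : PSH R} {ρ : R} (h : ρ ∈ S.Cusp) : ∃ u ∈ S.I, ∃ y ∈ S.I, u ≠ y ∧ ρ * ρ = u + y := by
  refine PSH.Pos.norm_two ((PSH.pos_I h.1).mul (PSH.pos_I h.1)) ?_
  rw [S.adj, PSH.cusp_der h, S.P_self h.1, one_mul, mul_one, map_add, S.orth1 _ h.1]; rfl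
theorem kap_I {χ : RR F} (h : χ ∈ (SS F).I) : kap F χ = χ.1 (J F ((SS F).dg χ)) := kap_irr (dg_mem h)
theorem kap_Z {χ : RR F} (h : χ ∈ (SS F).I) : ∃ z : ℤ, kap F χ = z := by
  rw [kap_I h]; exact kap_int (dg_mem h)
theorem AA_mc (s : Multiset (AA F)) : (SS F).MC (s.map Subtype.val) := fun ρ hρ => by
  obtain ⟨a, -, rfl⟩ := Multiset.mem_map.1 hρ; exact a.2
theorem AA_lift {t : Multiset (RR F)} (ht : (SS F).MC t) : ∃ s : Multiset (AA F), s.map Subtype.val = t := by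
  have ht : ∀ a ∈ t, a ∈ (SS F).Cusp := ht
  refine ⟨t.pmap (fun a ha => ⟨a, ha⟩) ht, ?_⟩
  rw [Multiset.map_pmap]
  exact (Multiset.pmap_eq_map _ (fun a => a) _ _).trans (Multiset.map_id' _)
theorem AA_dg {χ : RR F} (h : χ ∈ (SS F).I) {s : Multiset (AA F)} (h1 : (SS F).fm χ (s.map Subtype.val).prod ≠ 0) : s ∈ MS (wA F) ((SS F).dg χ) := by
  obtain ⟨t, ht, h2, h3⟩ := (SS F).MC_exists h
  obtain rfl := PSH.MC_unique h ht (AA_mc s) h2 h1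
  rw [Multiset.map_map] at h3
  exact h3
theorem ex_vs (s : Multiset (AA F)) : ∃ χ ∈ (SS F).I, (SS F).fm χ (s.map Subtype.val).prod ≠ 0 ∧ kap F χ ≠ 0 := by
  by_contra H
  push Not at H
  have h1 : kap F (s.map Subtype.val).prod ≠ 0 := by
    rw [map_multiset_prod, Multiset.map_map, Ne, Multiset.prod_eq_zero_iff, Multiset.mem_map]
    rintro ⟨a, -, ha⟩
    obtain ⟨z, hz, hz2⟩ := cusp_kap a.2
    have ha : kap F a.1 = 0 := ha
    rw [ha] at hz2
    exact hz (by exact_mod_cast hz2.symm)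
  obtain ⟨S, hS, -⟩ := (SS F).exp (s.map Subtype.val).prod
  apply h1
  rw [hS, map_sum]
  refine Finset.sum_eq_zero fun v _ => ?_
  rw [map_zsmul]
  by_cases h : (SS F).fm v.1 (s.map Subtype.val).prod = 0
  · rw [h, zero_smul]
  · rw [H _ v.2 h, smul_zero]
def vs (s : Multiset (AA F)) : RR F := (ex_vs s).choose
theorem vs_mem (s : Multiset (AA F)) : vs s ∈ (SS F).I := (ex_vs s).choose_spec.1
theorem vs_fm (s : Multiset (AA F)) : (SS F).fm (vs s) (s.map Subtype.val).prod ≠ 0 := (ex_vs s).choose_spec.2.1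
theorem vs_kap (s : Multiset (AA F)) : kap F (vs s) ≠ 0 := (ex_vs s).choose_spec.2.2
open Classical in
def KK (F : Type) [Field F] [Fintype F] (n : ℕ) : Finset (Hall F ℂ) := (IrrF F n).filter fun u => u (J F n) ≠ 0
theorem vs_inj : Function.Injective (fun s : Multiset (AA F) => (vs s).1) := by
  intro s t h
  have h : vs s = vs t := Subtype.ext h
  have h1 := vs_fm t
  rw [← h] at h1
  exact Multiset.map_injective Subtype.val_injective (PSH.MC_unique (vs_mem s) (AA_mc s) (AA_mc t) (vs_fm s) h1)
theorem vs_KK {n} {s : Multiset (AA F)} (hs : s ∈ MS (wA F) n) : (vs s).1 ∈ KK F n := by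
  have h1 : (SS F).dg (vs s) = n := by rw [← show (s.map (wA F)).sum = n from hs, AA_dg (vs_mem s) (vs_fm s)]
  have h2 := dg_mem (vs_mem s)
  have h3 := vs_kap s
  rw [kap_I (vs_mem s), h1] at h3
  rw [h1] at h2
  exact Finset.mem_filter.2 ⟨mem_IrrF.2 h2, h3⟩
theorem KK_le (n : ℕ) : (MS (wA F) n).ncard ≤ (KK F n).card := by
  rw [← Set.ncard_coe_finset]
  exact Set.ncard_le_ncard_of_injOn _ (fun s hs => vs_KK hs) vs_inj.injOn (Finset.finite_toSet _)
theorem normSq_ge {n} {u : Hall F ℂ} (hu : u ∈ KK F n) : 1 ≤ Complex.normSq (u (J F n)) := by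
  obtain ⟨h1, h2⟩ := Finset.mem_filter.1 hu
  obtain ⟨z, hz⟩ := kap_int (mem_IrrF.1 h1)
  rw [hz, Complex.normSq_intCast]
  have : z ≠ 0 := by rintro rfl; simp at hz; exact h2 hz
  have : 1 ≤ z * z := by nlinarith [Int.one_le_abs this, abs_mul_abs_self z]
  exact_mod_cast this
theorem KK_sum (n : ℕ) : ∑ u ∈ KK F n, Complex.normSq (u (J F n)) ≤ (MS (wB F) n).ncard :=
  (Finset.sum_le_sum_of_subset_of_nonneg (Finset.filter_subset _ _) fun _ _ _ => Complex.normSq_nonneg _).trans (kap_sum n)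
theorem AB_le (n : ℕ) : (MS (wA F) n).ncard ≤ (MS (wB F) n).ncard := by
  refine (KK_le n).trans ?_
  have h1 := KK_sum (F := F) n
  have h2 : ((KK F n).card : ℝ) ≤ ∑ u ∈ KK F n, Complex.normSq (u (J F n)) := by
    have := Finset.card_nsmul_le_sum (KK F n) (fun u => Complex.normSq (u (J F n))) 1 fun u hu => normSq_ge hu
    simpa using this
  exact_mod_cast h2.trans h1
theorem vs_surj (H : ∀ n, (MS (wA F) n).ncard = (MS (wB F) n).ncard) (n : ℕ) {u : Hall F ℂ} (hu : u ∈ KK F n) :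
    (∃ s ∈ MS (wA F) n, (vs s).1 = u) ∧ Complex.normSq (u (J F n)) = 1 := by
  have h1 := KK_sum (F := F) n
  have h3 := KK_le (F := F) n
  rw [H] at h3
  have h2 : ((KK F n).card : ℝ) ≤ ∑ u ∈ KK F n, Complex.normSq (u (J F n)) := by
    have := Finset.card_nsmul_le_sum (KK F n) (fun u => Complex.normSq (u (J F n))) 1 fun u hu => normSq_ge hu
    simpa using this
  have h4 : (KK F n).card ≤ (MS (wB F) n).ncard := by exact_mod_cast h2.trans h1
  constructor
  · have h5 := Set.eq_of_subset_of_ncard_le (s := (fun s : Multiset (AA F) => (vs s).1) '' MS (wA F) n) (t := ↑(KK F n))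
      (by rintro _ ⟨s, hs, rfl⟩; exact vs_KK hs) (by
        rw [Set.ncard_image_of_injective _ vs_inj, Set.ncard_coe_finset, H]; exact h4) (Finset.finite_toSet _)
    have : u ∈ (↑(KK F n) : Set (Hall F ℂ)) := hu
    rw [← h5] at this
    exact this
  · have h6 : ∑ u ∈ KK F n, (1:ℝ) = ∑ u ∈ KK F n, Complex.normSq (u (J F n)) := by
      refine le_antisymm (by simpa using h2) (h1.trans ?_)
      simpa using h3
    exact ((Finset.sum_eq_sum_iff_of_le fun u hu => normSq_ge hu).1 h6 u hu).symm
theorem KK_mem {χ : RR F} (h : χ ∈ (SS F).I) (hk : kap F χ ≠ 0) : χ.1 ∈ KK F ((SS F).dg χ) := by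
  rw [kap_I h] at hk
  exact Finset.mem_filter.2 ⟨mem_IrrF.2 (dg_mem h), hk⟩
theorem kap_pm (H : ∀ n, (MS (wA F) n).ncard = (MS (wB F) n).ncard) {ρ : RR F} (h : ρ ∈ (SS F).Cusp) : kap F ρ = 1 ∨ kap F ρ = -1 := by
  obtain ⟨z, hz, hz2⟩ := cusp_kap h
  have h1 := (vs_surj H _ (KK_mem h.1 (by rw [hz2]; exact_mod_cast hz))).2
  rw [← kap_I h.1, hz2, Complex.normSq_intCast] at h1
  have h1 : z * z = 1 := by exact_mod_cast h1
  rw [hz2]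
  rcases Int.isUnit_iff.1 (IsUnit.of_mul_eq_one _ h1) with rfl | rfl <;> simp
theorem kap_uni (H : ∀ n, (MS (wA F) n).ncard = (MS (wB F) n).ncard) {χ χ' : RR F} (h : χ ∈ (SS F).I) (h' : χ' ∈ (SS F).I) {t : Multiset (RR F)} (ht : (SS F).MC t)
    (h1 : (SS F).fm χ t.prod ≠ 0) (h1' : (SS F).fm χ' t.prod ≠ 0) (h2 : kap F χ ≠ 0) (h2' : kap F χ' ≠ 0) : χ = χ' := by
  have key : ∀ {χ : RR F} (h : χ ∈ (SS F).I) (h1 : (SS F).fm χ t.prod ≠ 0) (h2 : kap F χ ≠ 0), ∃ s : Multiset (AA F), s.map Subtype.val = t ∧ vs s = χ := by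
    intro χ h h1 h2
    obtain ⟨s, -, hs⟩ := (vs_surj H _ (KK_mem h h2)).1
    have hs : vs s = χ := Subtype.ext hs
    have h3 := vs_fm s
    rw [hs] at h3
    exact ⟨s, PSH.MC_unique h (AA_mc s) ht h3 h1, hs⟩
  obtain ⟨s, h3, rfl⟩ := key h h1 h2
  obtain ⟨s', h3', rfl⟩ := key h' h1' h2'
  rw [Multiset.map_injective Subtype.val_injective (h3.trans h3'.symm)]
end GLW
end
end
section
universe u
open scoped MatrixGroups
noncomputable section
namespace GLW
variable {F : Type} [Field F] [Fintype F]
open Polynomial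
def rk (M : Ob F) (p : F[X]) : ℕ := Module.finrank F (LinearMap.range (aeval M.x p))
theorem rk_iso {M N : Ob F} (h : Iso M N) (p : F[X]) : rk M p = rk N p := by
  obtain ⟨e, h⟩ := h
  have : LinearMap.range (aeval N.x p) = (LinearMap.range (aeval M.x p)).map e.toLinearMap := by
    rw [← LinearMap.range_comp]
    have h2 : e.toLinearMap ∘ₗ aeval M.x p = aeval N.x p ∘ₗ e.toLinearMap := LinearMap.ext fun v => aeval_hom (M := M) (N := N) e.toLinearMap h p v
    rw [h2, LinearMap.range_comp, LinearEquiv.range, Submodule.map_top]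
  rw [rk, rk, this]
  exact (LinearEquiv.finrank_map_eq e _).symm
theorem aeval_ext0 (M N : Ob F) (p : F[X]) (v : M.V × N.V) : aeval (ext M N 0).x p v = (aeval M.x p v.1, aeval N.x p v.2) := by
  refine Prod.ext ?_ ?_
  · exact aeval_hom (M := ext M N 0) (N := M) (LinearMap.fst F _ _) (fun v => by simp) p v
  · exact aeval_hom (M := ext M N 0) (N := N) (LinearMap.snd F _ _) (fun v => by simp) p v
theorem rk_ext (M N : Ob F) (p : F[X]) : rk (ext M N 0) p = rk M p + rk N p := by
  have : aeval (ext M N 0).x p = (aeval M.x p).prodMap (aeval N.x p) := LinearMap.ext fun v => aeval_ext0 M N p v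
  rw [rk, this, LinearMap.range_prodMap]
  have e : ((LinearMap.range (aeval M.x p)).prod (LinearMap.range (aeval N.x p))) ≃ₗ[F] LinearMap.range (aeval M.x p) × LinearMap.range (aeval N.x p) :=
    { toFun := fun v => (⟨v.1.1, v.2.1⟩, ⟨v.1.2, v.2.2⟩), map_add' := fun _ _ => rfl, map_smul' := fun _ _ => rfl
      invFun := fun v => ⟨(v.1.1, v.2.1), v.1.2, v.2.2⟩, left_inv := fun _ => rfl, right_inv := fun _ => rfl }
  rw [e.finrank_eq, Module.finrank_prod, rk, rk]
theorem cop {f g : BB F} (h : f ≠ g) (i j : ℕ) : IsCoprime (f.1 ^ i) (g.1 ^ j) := by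
  refine IsCoprime.pow ((f.2.2.1.coprime_iff_not_dvd).2 fun hd => h (Subtype.ext ?_))
  exact eq_of_monic_of_associated f.2.1 g.2.1 (f.2.2.1.associated_of_dvd g.2.2.1 hd)
open Classical in
def rw' (f : BB F) (i : ℕ) (e : BB F × ℕ) : ℕ := if e.1 = f then (e.2 + 1 - i) * wB F f else (e.2+1) * wB F e.1
theorem rk_cyc (f g : BB F) (i k : ℕ) : rk (cyc (g.1^(k+1)) (g.2.1.pow _)) (f.1^i) = rw' f i (g, k) := by
  classical
  unfold rw'
  set hg := g.2.1.pow (k+1)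
  split_ifs with h
  · simp only at h; subst h
    rcases le_total i (k+1) with hi | hi
    · have := (cW_sub hg (g.2.1.pow (k+1-i)) (by rw [← pow_add]; congr 1; omega : g.1^i * g.1^(k+1-i) = g.1^(k+1))).d
      rw [cyc_d, natDegree_pow] at this
      exact this.symm
    · rw [Nat.sub_eq_zero_of_le hi, zero_mul, rk]
      have : aeval (cyc (g.1^(k+1)) hg).x (g.1^i) = 0 := by
        ext v; obtain ⟨p, rfl⟩ := cmk_surj hg v
        rw [aeval_cmk, LinearMap.zero_apply, cmk_zero]
        exact (pow_dvd_pow _ hi).mul_right _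
      rw [this, LinearMap.range_zero, finrank_bot]
  · have : LinearMap.range (aeval (cyc (g.1^(k+1)) hg).x (f.1^i)) = ⊤ := by
      rw [LinearMap.range_eq_top]; intro v
      obtain ⟨p, rfl⟩ := cmk_surj hg v
      obtain ⟨a, b, e⟩ := cop (Ne.symm h) i (k+1)
      refine ⟨cmk hg (a * p), ?_⟩
      rw [aeval_cmk, cmk_eq]
      exact ⟨-b * p, by linear_combination p * e⟩
    rw [rk, this, finrank_top]
    exact (cyc_d hg).trans (natDegree_pow _ _)
theorem ex_ob (c : Multiset (BB F × ℕ)) : ∃ M : Ob F, Function.Bijective M.x ∧ M.d = (c.map (wp (wB F))).sum ∧ ∀ f i, rk M (f.1^i) = (c.map (rw' f i)).sum := by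
  induction c using Multiset.induction with
  | empty =>
    have h0 : (mat (F := F) 0 1).d = 0 := mat_d 0 _
    refine ⟨mat 0 1, Function.bijective_id, h0, fun f i => ?_⟩
    have := Submodule.finrank_le (LinearMap.range (aeval (mat (F := F) 0 1).x (f.1^i)))
    have : rk (mat (F := F) 0 1) (f.1^i) ≤ (mat (F := F) 0 1).d := this
    simp; omega
  | cons e c ih =>
    obtain ⟨M, h1, h2, h3⟩ := ih
    have hb := cyc_bij (e.1.2.1.pow (e.2+1)) (by
      have : IsCoprime e.1.1 X := (e.1.2.2.1.coprime_iff_not_dvd).2 fun hd => e.1.2.2.2 (eq_of_monic_of_associated e.1.2.1 monic_X (e.1.2.2.1.associated_of_dvd irreducible_X hd))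
      exact this.pow_left)
    refine ⟨ext (cyc (e.1.1^(e.2+1)) (e.1.2.1.pow _)) M 0, ?_, ?_, fun f i => ?_⟩
    · have : (ext (cyc (e.1.1^(e.2+1)) (e.1.2.1.pow _)) M 0).x = fun v : _ × M.V => ((cyc (e.1.1^(e.2+1)) (e.1.2.1.pow _)).x v.1, M.x v.2) := by
        funext v; simp
      rw [this]; exact hb.prodMap h1
    · rw [ext_d, h2, cyc_d, natDegree_pow, Multiset.map_cons, Multiset.sum_cons, wp, wB, mul_comm]
    · rw [rk_ext, h3, rk_cyc, Multiset.map_cons, Multiset.sum_cons]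
theorem ob_cnt (c : Multiset (BB F × ℕ)) (f : BB F) (j : ℕ) : ∀ [DecidableEq (BB F × ℕ)], (c.map (rw' f j)).sum + (c.map (rw' f (j+2))).sum = 2 * (c.map (rw' f (j+1))).sum + wB F f * c.count (f, j) := by
  intro _
  induction c using Multiset.induction with
  | empty => simp
  | cons e c ih =>
    have : rw' f j e + rw' f (j+2) e = 2 * rw' f (j+1) e + wB F f * (if (f, j) = e then 1 else 0) := by
      unfold rw'
      obtain ⟨g, k⟩ := e
      by_cases h : g = f
      · subst h; simp only [if_true]
        have : (k+1-j) + (k+1-(j+2)) = 2 * (k+1-(j+1)) + (if (g, j) = (g, k) then 1 else 0) := by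
          by_cases hk : j = k
          · subst hk; rw [if_pos rfl]; omega
          · rw [if_neg (by simpa using hk)]; omega
        linear_combination (wB F g) * this
      · simp [h, Ne.symm h, two_mul]
    simp only [Multiset.map_cons, Multiset.sum_cons, Multiset.count_cons]
    linear_combination this + ih
variable (F) in
def ob (c : Multiset (BB F × ℕ)) : Ob F := (ex_ob c).choose
theorem ob_bij (c : Multiset (BB F × ℕ)) : Function.Bijective (ob F c).x := (ex_ob c).choose_spec.1
theorem ob_d (c : Multiset (BB F × ℕ)) : (ob F c).d = (c.map (wp (wB F))).sum := (ex_ob c).choose_spec.2.1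
theorem ob_iso {c c' : Multiset (BB F × ℕ)} (h : Iso (ob F c) (ob F c')) : c = c' := by
  classical
  have h1 : ∀ f i, (c.map (rw' f i)).sum = (c'.map (rw' f i)).sum := fun f i => by
    rw [← (ex_ob c).choose_spec.2.2, ← (ex_ob c').choose_spec.2.2]; exact rk_iso h _
  ext ⟨f, j⟩
  have h2 := ob_cnt c f j
  rw [h1, h1, h1, ob_cnt c' f j] at h2
  exact (Nat.eq_of_mul_eq_mul_left (wB_pos f) (Nat.add_left_cancel h2)).symm
end GLW
end
end
section
universe u
open scoped MatrixGroups
noncomputable section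
namespace GLW
variable {F : Type} [Field F] [Fintype F]
open Polynomial PSH
theorem sl_mem {R : Type u} [CommRing R] (T : Subring R) {x : ℕ → R} (h : ∀ n, x n ∈ T) {m} (l : Fin m → ℕ) : sl x l ∈ T := by
  rw [sl, Matrix.det_apply']
  refine sum_mem fun σ _ => mul_mem (intCast_mem T _) (prod_mem fun i _ => ?_)
  rw [Matrix.of_apply, xs]
  split_ifs
  exacts [h _, zero_mem _]
def mon (x : RR F → ℕ → RR F) (t : Multiset (AA F × ℕ)) : RR F := (t.map fun p => x p.1.1 (p.2+1)).prod
theorem mon_mem {x : RR F → ℕ → RR F} (hx : ∀ ρ ∈ (SS F).Cusp, XSeq (SS F) ρ (x ρ)) {χ : RR F} (hχ : χ ∈ (SS F).I) :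
    χ ∈ AddSubgroup.closure (Set.range (mon x)) := by
  have h1 : χ ∈ Subring.closure {a | ∃ ρ ∈ (SS F).Cusp, ∃ k, x ρ k = a} := by
    obtain ⟨A, k, m, l, h, hc, -⟩ := structure_thm hx hχ
    have : ∏ σ ∈ A, sl (x σ) (l σ) ∈ Subring.closure {a | ∃ ρ ∈ (SS F).Cusp, ∃ k, x ρ k = a} :=
      Subring.prod_mem _ fun σ hσ => sl_mem (Subring.closure _) (fun n => Subring.subset_closure (s := {a | ∃ ρ ∈ (SS F).Cusp, ∃ k, x ρ k = a}) ⟨σ, (h σ hσ).1, n, rfl⟩) _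
    rcases hc with e | e
    · rwa [e]
    · rw [← e] at this; exact neg_mem_iff.1 this
  rw [Subring.mem_closure_iff] at h1
  refine AddSubgroup.closure_mono ?_ h1
  intro a ha
  induction ha using Submonoid.closure_induction with
  | mem a h =>
    obtain ⟨ρ, hρ, k, rfl⟩ := h
    rcases k with _ | k
    · exact ⟨0, by rw [(hx ρ hρ).zero]; rfl⟩
    · exact ⟨{(⟨ρ, hρ⟩, k)}, by simp [mon]⟩
  | one => exact ⟨0, rfl⟩
  | mul a b _ _ ha hb =>
    obtain ⟨s, rfl⟩ := ha
    obtain ⟨t, rfl⟩ := hb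
    exact ⟨s + t, by simp [mon]⟩
theorem mon_deg {x : RR F → ℕ → RR F} (hx : ∀ ρ ∈ (SS F).Cusp, XSeq (SS F) ρ (x ρ)) (t : Multiset (AA F × ℕ)) :
    ∀ M : Ob F, M.d ≠ (t.map (wp (wA F))).sum → (mon x t).1 M = 0 := by
  induction t using Multiset.induction with
  | empty => intro M hM; exact Irr.deg Irr_one hM
  | cons p t ih =>
    intro M hM
    have X := hx _ p.1.2
    have h := dg_mem (X.mem (p.2+1))
    have e : mon x (p ::ₘ t) = x p.1.1 (p.2+1) * mon x t := by simp [mon]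
    rw [e]
    refine mul_deg (fun M hM => Irr.deg h hM) ih M ?_
    rw [X.dg_x]
    simp only [Multiset.map_cons, Multiset.sum_cons, wp, wA] at hM
    rwa [mul_comm]
theorem ex_x : ∃ x : RR F → ℕ → RR F, ∀ ρ ∈ (SS F).Cusp, XSeq (SS F) ρ (x ρ) := by
  have : ∀ ρ : RR F, ∃ x, ρ ∈ (SS F).Cusp → XSeq (SS F) ρ x := fun ρ => by
    by_cases h : ρ ∈ (SS F).Cusp
    · obtain ⟨u, hu, y, hy, huy, e⟩ := sq_split h
      obtain ⟨x, hx, -⟩ := exists_xseq h hu hy huy e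
      exact ⟨x, fun _ => hx⟩
    · exact ⟨fun _ => 0, fun h' => absurd h' h⟩
  choose x hx using this
  exact ⟨x, hx⟩
theorem BA_le (n : ℕ) : (MS (wp (wB F)) n).ncard ≤ (MS (wp (wA F)) n).ncard := by
  classical
  obtain ⟨x, hx⟩ := ex_x (F := F)
  have fB := MS_fin (wp_pos (wB_pos (F := F))) (wp_fin wB_pos wB_fin) n
  have fA := MS_fin (wp_pos (wA_pos (F := F))) (wp_fin wA_pos wA_fin) n
  haveI := fB.fintype
  haveI := fA.fintype
  let E : RR F →+ (MS (wp (wB F)) n → ℂ) := ⟨⟨fun a c => a.1 (ob F c.1), rfl⟩, fun a b => rfl⟩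
  have hd : ∀ c : MS (wp (wB F)) n, (ob F c.1).d = n := fun c => (ob_d c.1).trans c.2
  set Sp := Submodule.span ℂ (Set.range fun t : MS (wp (wA F)) n => E (mon x t.1)) with hSp
  have h1 : ∀ χ ∈ (SS F).I, E χ ∈ Sp := by
    intro χ hχ
    have : AddSubgroup.closure (Set.range (mon x)) ≤ Sp.toAddSubgroup.comap E := by
      rw [AddSubgroup.closure_le]
      rintro _ ⟨t, rfl⟩
      by_cases ht : t ∈ MS (wp (wA F)) n
      · exact Submodule.subset_span ⟨⟨t, ht⟩, rfl⟩
      · have : E (mon x t) = 0 := funext fun c => mon_deg hx t _ (by rw [hd]; exact Ne.symm ht)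
        show E (mon x t) ∈ Sp
        rw [this]; exact zero_mem _
    exact this (mon_mem hx hχ)
  have h2 : Sp = ⊤ := by
    rw [eq_top_iff, ← (Pi.basisFun ℂ (MS (wp (wB F)) n)).span_eq, Submodule.span_le]
    rintro _ ⟨c, rfl⟩
    have e : (Pi.basisFun ℂ (MS (wp (wB F)) n)) c = ∑ u ∈ (IrrF F n).attach, ip n u.1 (ind (ob F c.1)) • E (irr (mem_IrrF.1 u.2)) := by
      funext c'
      have hs : Sup (ind (ob F c.1) : Hall F ℂ) := fun M hM => by
        rw [ind_f, if_neg fun h => hM (h.symm.bij (ob_bij _))]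
      have := complete hs (ob F c'.1)
      rw [hd, ind_f, ← Finset.sum_attach] at this
      rw [Finset.sum_apply]
      refine Eq.trans ?_ this
      rw [Pi.basisFun_apply, Pi.single_apply]
      refine if_congr ⟨fun h => ?_, fun h => Subtype.ext (ob_iso h)⟩ rfl rfl
      subst h; exact Iso.refl _
    rw [e]
    exact sum_mem fun u _ => Submodule.smul_mem _ _ (h1 _ (IR_mem _))
  have h3 := finrank_range_le_card (R := ℂ) (fun t : MS (wp (wA F)) n => E (mon x t.1))
  rw [Set.finrank, ← hSp, h2, finrank_top, Module.finrank_fintype_fun_eq_card] at h3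
  rwa [← Nat.card_coe_set_eq, ← Nat.card_coe_set_eq, Nat.card_eq_fintype_card, Nat.card_eq_fintype_card]
theorem AB_eq (n : ℕ) : (MS (wA F) n).ncard = (MS (wB F) n).ncard := cnt_main wA_pos wB_pos wA_fin wB_fin AB_le BA_le n
end GLW
end
end
section
universe u
open scoped MatrixGroups
noncomputable section
namespace GLW
variable {F : Type} [Field F] [Fintype F]
open Polynomial PSH
theorem fm_xpow {R : Type u} [CommRing R] {S : PSH R} {ρ : R} {x : ℕ → R} (X : XSeq S ρ x) {v : R} (hv : v ∈ S.I) (k : ℕ) : ∀ {a}, S.Pos a → S.fm v (a * x k) ≤ S.fm v (a * ρ^k) := by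
  induction k with
  | zero => intro a ha; rw [X.zero, pow_zero]
  | succ k ih =>
    intro a ha
    have hp := pos_I X.cusp.1
    have h1 : S.fm (x (k+1)) (ρ * x k) = 1 := by
      rw [S.symm, S.adj, ← X.one, X.P_x, if_pos (by omega), Nat.add_sub_cancel, S.orth1 _ (X.mem k)]
    have h2 := (hp.mul (pos_I (X.mem k))).sub (X.mem (k+1)) (by rw [h1]; exact one_ne_zero)
    have h3 := (ha.mul h2) v hv
    rw [mul_sub, map_sub, ← mul_assoc] at h3
    have := ih (ha.mul hp)
    rw [mul_assoc a ρ (ρ^k), ← pow_succ'] at this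
    linarith
theorem kap_x {ρ : RR F} {x : ℕ → RR F} (X : XSeq (SS F) ρ x) (h2 : kap F (x 2) = 0) (n : ℕ) (hn : 2 ≤ n) : kap F (x n) = 0 := by
  obtain ⟨n, rfl⟩ := Nat.exists_eq_add_of_le hn
  by_contra hk
  have hp : ∀ i, (SS F).Pos (x i) := fun i => pos_I (X.mem i)
  have key : ∀ v ∈ (SS F).I, (SS F).fm v (x 2 * x n) ≠ 0 → (SS F).fm v ((Multiset.replicate (2+n) ρ).prod) ≠ 0 := by
    intro v hv h
    have h0 := ((hp 2).mul (hp n)) v hv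
    have e1 := fm_xpow X hv n (hp 2)
    have e2 := fm_xpow X hv 2 (a := ρ^n) (by
      have := MC.pos (S := SS F) (s := Multiset.replicate n ρ) (fun σ h => by rw [Multiset.eq_of_mem_replicate h]; exact X.cusp)
      rwa [Multiset.prod_replicate] at this)
    rw [mul_comm (ρ^n), mul_comm (ρ^n), ← pow_add] at e2
    rw [Multiset.prod_replicate]
    omega
  have h1 : (SS F).fm (x (2+n)) (x 2 * x n) = 1 := by
    rw [(SS F).symm, (SS F).adj, X.P_x, if_pos (by omega), Nat.add_sub_cancel_left, (SS F).orth1 _ (X.mem n)]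
  obtain ⟨s, e, hs⟩ := (SS F).exp (x 2 * x n)
  have h3 := congrArg (kap F) e
  rw [map_mul, h2, zero_mul, map_sum, Finset.sum_eq_single (⟨x (2+n), X.mem _⟩ : (SS F).I)] at h3
  · rw [h1, one_smul] at h3; exact hk h3.symm
  · intro v _ hne
    rw [map_zsmul]
    by_cases hf : (SS F).fm v.1 (x 2 * x n) = 0
    · rw [hf, zero_smul]
    by_cases hk' : kap F v.1 = 0
    · rw [hk', smul_zero]
    refine absurd (Subtype.ext ?_) hne
    exact kap_uni AB_eq v.2 (X.mem _) (t := Multiset.replicate (2+n) ρ) (fun σ h => by rw [Multiset.eq_of_mem_replicate h]; exact X.cusp) (key _ v.2 hf)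
      (key _ (X.mem _) (by rw [h1]; exact one_ne_zero)) hk' hk
  · intro h
    have := hs _ h
    rw [h1] at this; exact absurd this one_ne_zero
theorem ex_xk : ∃ x : RR F → ℕ → RR F, ∀ ρ ∈ (SS F).Cusp, XSeq (SS F) ρ (x ρ) ∧ ∀ n, 2 ≤ n → kap F (x ρ n) = 0 := by
  have : ∀ ρ : RR F, ∃ x, ρ ∈ (SS F).Cusp → XSeq (SS F) ρ x ∧ ∀ n, 2 ≤ n → kap F (x n) = 0 := fun ρ => by
    by_cases h : ρ ∈ (SS F).Cusp
    · obtain ⟨u, hu, y, hy, huy, e⟩ := sq_split h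
      have : kap F u = 0 ∨ kap F y = 0 := by
        by_contra! hc
        have ht : ({ρ, ρ} : Multiset (RR F)).prod = u + y := by rw [← e]; simp
        refine huy (kap_uni AB_eq hu hy (t := {ρ, ρ}) (fun σ hσ => by simp at hσ; rwa [hσ]) ?_ ?_ hc.1 hc.2) <;>
        rw [ht, map_add]
        · rw [(SS F).orth1 _ hu, (SS F).orth _ hu _ hy huy]; simp
        · rw [(SS F).orth1 _ hy, (SS F).orth _ hy _ hu huy.symm]; simp
      rcases this with h0 | h0
      · obtain ⟨x, hx, h2⟩ := exists_xseq h hu hy huy e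
        exact ⟨x, fun _ => ⟨hx, kap_x hx (by rw [h2, h0])⟩⟩
      · obtain ⟨x, hx, h2⟩ := exists_xseq h hy hu huy.symm (by rw [e, add_comm])
        exact ⟨x, fun _ => ⟨hx, kap_x hx (by rw [h2, h0])⟩⟩
    · exact ⟨fun _ => 0, fun h' => absurd h' h⟩
  choose x hx using this
  exact ⟨x, hx⟩
variable {ρ : RR F} {x : ℕ → RR F} (X : XSeq (SS F) ρ x)
include X in
theorem x_irr (i : ℕ) : (x i).1 ∈ Irr F (i * (SS F).dg ρ) := by
  have := dg_mem (X.mem i)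
  rwa [X.dg_x] at this
include X in
theorem Phi_x (n : ℕ) (M : Ob F) : Phi (x n).1 M = ∑ i ∈ Finset.range (n+1), (x i).1 M • (x (n-i)).1 := by
  classical
  have hp := (SS F).cusp_dg X.cusp
  rw [Phi_exp (Irr.sup (x_irr X n))]
  have h0 : ∀ u ∈ IrrF F M.d, (∀ i ≤ n, (x i).1 ≠ u) → u M • perp M.d u (x n).1 = 0 := by
    intro u hu h
    rw [mem_IrrF] at hu
    rw [perp_PP hu (x_irr X n)]
    have : (SS F).P (irr hu) (x n) = 0 := by
      by_cases hc : ∃ i, irr hu = x i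
      · obtain ⟨i, hi⟩ := hc
        rw [hi, X.P_x, if_neg fun hle => h i hle (by rw [← hi])]
      · exact X.P_o _ (IR_mem hu) (not_exists.1 hc) n
    show u M • ((SS F).P (irr hu) (x n)).1 = 0
    rw [this]; exact smul_zero _
  by_cases hi : ∃ i ≤ n, M.d = i * (SS F).dg ρ
  · obtain ⟨i, hi, hd⟩ := hi
    have hu : (x i).1 ∈ Irr F M.d := by rw [hd]; exact x_irr X i
    have hj : ∀ j, j ≠ i → M.d ≠ j * (SS F).dg ρ := fun j hj e => hj (Nat.eq_of_mul_eq_mul_right hp (by rw [← e, hd]))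
    rw [Finset.sum_eq_single (x i).1, Finset.sum_eq_single i, perp_PP hu (x_irr X n)]
    · have := X.P_x i n
      rw [if_pos hi] at this
      rw [← this]
    · intro j _ hji; rw [Irr.deg (x_irr X j) (hj j hji), zero_smul]
    · intro h; exact absurd (Finset.mem_range.2 (by omega)) h
    · intro u hu hne
      refine h0 u hu fun j _ e => ?_
      by_cases hji : j = i
      · subst hji; exact hne e.symm
      · have := Irr.deg (x_irr X j) (hj j hji)
        rw [e] at this
        subst e
        exact hj j hji (Irr_uniq (mem_IrrF.1 hu) (x_irr X j))
    · intro h; exact absurd (mem_IrrF.2 hu) h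
  · push Not at hi
    rw [Finset.sum_eq_zero, Finset.sum_eq_zero]
    · intro i hin; rw [Irr.deg (x_irr X i) (hi i (by simpa [Nat.lt_succ_iff] using hin)), zero_smul]
    · intro u hu
      exact h0 u hu fun i hin e => by
        subst e
        exact hi i hin (Irr_uniq (mem_IrrF.1 hu) (x_irr X i))
end GLW
end
end
section
universe u
open scoped MatrixGroups
noncomputable section
namespace GLW
variable {F : Type} [Field F] [Fintype F]
open Polynomial PSH
variable (F) in
def glE (n : ℕ) : GL (Fin n) F ≃* Gn F n := Matrix.GeneralLinearGroup.toLin.trans (LinearMap.GeneralLinearGroup.generalLinearEquiv F _)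
variable (F) in
abbrev qq : ℂ := (Fintype.card F : ℂ)
theorem gl_card (n : ℕ) : gl F n = Nat.card (GL (Fin n) F) := by
  rw [Nat.card_congr (glE F n).toEquiv, Nat.card_eq_fintype_card, gl]
theorem gl_nat (n : ℕ) : gl F n = Fintype.card F ^ n.choose 2 * ∏ i ∈ Finset.range n, (Fintype.card F ^ (i+1) - 1) := by
  rw [gl_card, Matrix.card_GL_field, Fin.prod_univ_eq_prod_range (fun i => Fintype.card F ^ n - Fintype.card F ^ i) n, Nat.choose_two_right, ← Finset.sum_range_id, ← Finset.prod_pow_eq_pow_sum,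
    ← Finset.prod_range_reflect (fun i => Fintype.card F ^ (i+1) - 1), ← Finset.prod_mul_distrib]
  refine Finset.prod_congr rfl fun i hi => ?_
  rw [Finset.mem_range] at hi
  rw [Nat.mul_sub, mul_one, ← pow_add]
  congr 2; omega
theorem q_one : 1 < Fintype.card F := Fintype.one_lt_card
theorem q_ne (i : ℕ) : qq F ^ (i+1) - 1 ≠ 0 := by
  rw [sub_ne_zero]
  have := Nat.one_lt_pow (Nat.succ_ne_zero i) (q_one (F := F))
  exact_mod_cast this.ne'
theorem q_cast (i : ℕ) : ((Fintype.card F ^ (i+1) - 1 : ℕ) : ℂ) = qq F ^ (i+1) - 1 := by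
  rw [Nat.cast_sub (Nat.one_le_pow _ _ Fintype.card_pos)]; simp
theorem dco_eq (n : ℕ) : dco F n = (∏ i ∈ Finset.range n, (qq F ^ (i+1) - 1))⁻¹ := by
  have h : (gl F n : ℂ) = qq F ^ n.choose 2 * ∏ i ∈ Finset.range n, (qq F ^ (i+1) - 1) := by
    rw [gl_nat, Nat.cast_mul, Nat.cast_prod, Nat.cast_pow]
    congr 1; exact Finset.prod_congr rfl fun i _ => q_cast i
  have hq : qq F ≠ 0 := Nat.cast_ne_zero.2 Fintype.card_ne_zero
  rw [dco, h, div_mul_cancel_left₀ (pow_ne_zero _ hq)]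
def hh (Q : ℂ) (n : ℕ) : ℂ := ∏ s ∈ Finset.range n, Q^s / (Q^(s+1) - 1)
variable {ρ : RR F} {x : ℕ → RR F} (X : XSeq (SS F) ρ x) (hk : ∀ n, 2 ≤ n → kap F (x n) = 0)
include X hk in
theorem phi_sc {n n' k' : ℕ} (h : n' + k' + 1 = (n+1) * (SS F).dg ρ) (hn : n' ≠ n * (SS F).dg ρ) : (Phi (x (n+1)).1 (sc F n')).f (J F (k'+1)) = 0 := by
  rw [Phi_x X, Hall.sum_f]
  refine Finset.sum_eq_zero fun i hi => ?_
  rw [Hall.smul_f, smul_eq_mul]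
  by_cases h1 : n' = i * (SS F).dg ρ
  · have h2 : k' + 1 = (n + 1 - i) * (SS F).dg ρ := by rw [Nat.sub_mul]; omega
    rw [h2, ← kap_irr (x_irr X (n+1-i))]
    have : i ≠ n := fun e => hn (e ▸ h1)
    have h3 : i ≠ n + 1 := fun e => by subst e; omega
    have hi := Finset.mem_range.1 hi
    have := hk (n+1-i) (by omega)
    exact mul_eq_zero_of_right _ this
  · rw [Irr.deg (x_irr X i) (by rwa [mat_d]), zero_mul]
include X hk in
theorem x_deg (n : ℕ) {d : ℕ} (hd : (SS F).dg ρ = d + 1) : (x (n+1)).1 (sc F ((n+1)*(d+1))) =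
    (-1)^d * (∏ i ∈ Finset.range d, (qq F ^ (n*(d+1)+i+1) - 1)) * (qq F ^ (n*(d+1)) * ((x n).1 (sc F (n*(d+1))) * kap F ρ)) := by
  have h1 := rel_shift (x (n+1)).1 (n*(d+1)) d 0 (fun n' k' a b c => phi_sc X hk (by rw [hd, c]; ring) (by rw [hd]; omega))
  have e : (n+1)*(d+1) = n*(d+1) + d + 1 := by ring
  rw [e, rel2, h1]
  congr 1
  rw [zero_add]
  rcases n with _ | n
  · rw [Nat.zero_mul, rel0, ← hd, X.zero, zero_add, X.one, pow_zero, one_mul, kap_I X.cusp.1]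
    show _ = (1 : Hall F ℂ).f (sc F 0) * _
    rw [Hall.one_f, if_pos (mat_d 0 _), one_mul]
  · have e2 : (n+1)*(d+1) = n*(d+1) + d + 1 := by ring
    have h3 := rel1 (x (n+1+1)).1 (n*(d+1)+d) d
    rw [rel_zero (x (n+1+1)).1 (n*(d+1)+d) (d+1) (fun n' k' a b => phi_sc X hk (by rw [hd, b]; ring) (by rw [hd]; omega)), mul_zero, add_zero, ← e2] at h3
    rw [← h3]
    congr 1
    rw [Phi_x X, Hall.sum_f, Finset.sum_eq_single (n+1)]
    · rw [Hall.smul_f, smul_eq_mul, show n+1+1-(n+1) = 1 by omega, X.one, kap_I X.cusp.1, hd]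
    · intro i _ hi
      rw [Hall.smul_f, Irr.deg (x_irr X i), zero_smul]
      rw [mat_d, hd]
      exact fun e => hi (Nat.eq_of_mul_eq_mul_right (Nat.succ_pos d) e).symm
    · intro h; simp at h
include X hk in
theorem del_x : ∃ ε : ℂ, (ε = 1 ∨ ε = -1) ∧ ∀ n, del F (x n) = ε^n * hh (qq F ^ (SS F).dg ρ) n := by
  obtain ⟨d, hd⟩ := Nat.exists_eq_succ_of_ne_zero ((SS F).cusp_dg X.cusp).ne'
  have hd : (SS F).dg ρ = d + 1 := hd
  refine ⟨(-1)^d * kap F ρ, ?_, fun n => ?_⟩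
  · rcases kap_pm AB_eq X.cusp with h | h <;> rcases neg_one_pow_eq_or ℂ d with h' | h' <;> rw [h, h'] <;> simp
  induction n with
  | zero => rw [X.zero, map_one]; simp [hh]
  | succ n ih =>
    have e1 : del F (x (n+1)) = dco F _ * _ := del_irr (x_irr X (n+1))
    have e2 : del F (x n) = dco F _ * _ := del_irr (x_irr X n)
    rw [e2] at ih
    rw [e1, hh, Finset.prod_range_succ, ← hh, hd, x_deg X hk n hd]
    rw [hd] at ih
    have e3 : dco F ((n+1)*(d+1)) * ∏ i ∈ Finset.range d, (qq F ^ (n*(d+1)+i+1) - 1) = dco F (n*(d+1)) * (qq F ^ ((n+1)*(d+1)) - 1)⁻¹ := by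
      rw [dco_eq, dco_eq, show (n+1)*(d+1) = n*(d+1) + (d+1) by ring, Finset.prod_range_add, Finset.prod_range_succ _ d]
      have h1 : ∏ i ∈ Finset.range d, (qq F ^ (n*(d+1)+i+1) - 1) ≠ 0 := Finset.prod_ne_zero_iff.2 fun i _ => q_ne _
      have h2 := q_ne (F := F) (n*(d+1)+d)
      rw [show n*(d+1)+(d+1) = n*(d+1)+d+1 by ring, mul_inv, mul_inv]
      field_simp
    rw [← pow_mul, ← pow_mul, mul_comm (d+1) n, mul_comm (d+1) (n+1), pow_succ, div_eq_mul_inv]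
    linear_combination ((-1)^d * (qq F ^ (n*(d+1)) * ((x n).1 (sc F (n*(d+1))) * kap F ρ))) * e3 + ((-1)^d * qq F ^ (n*(d+1)) * kap F ρ * (qq F ^ ((n+1)*(d+1)) - 1)⁻¹) * ih
end GLW
end
end
section
universe u
open scoped MatrixGroups
noncomputable section
namespace GLW
open Polynomial PSH
def TT {m : ℕ} (l : Fin m → ℕ) (i : Fin m) : Finset ℕ := (Finset.Icc 1 (l i)).filter fun s => ∀ j, l j ≠ l i - s
theorem TT_eq {m : ℕ} {l : Fin m → ℕ} (h : StrictAnti l) (i : Fin m) {A : Type*} [CommMonoid A] (f : ℕ → A) :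
    (∏ j ∈ Finset.Ioi i, f (l i - l j)) * ∏ s ∈ TT l i, f s = ∏ s ∈ Finset.range (l i), f (s+1) := by
  classical
  have h1 : ∏ s ∈ Finset.range (l i), f (s+1) = ∏ s ∈ Finset.Icc 1 (l i), f s := by
    rw [Finset.range_eq_Ico, Finset.prod_Ico_add' f 0 (l i) 1, zero_add]; rfl
  rw [h1, ← Finset.prod_filter_not_mul_prod_filter (Finset.Icc 1 (l i)) (fun s => ∀ j, l j ≠ l i - s)]
  congr 1
  refine Finset.prod_bij (fun j _ => l i - l j) (fun j hj => ?_) (fun j hj j' hj' e => ?_) (fun s hs => ?_) (fun _ _ => rfl)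
  · have := h (Finset.mem_Ioi.1 hj)
    rw [Finset.mem_filter, Finset.mem_Icc]
    exact ⟨by omega, fun hc => hc j (by omega)⟩
  · have h1 := h (Finset.mem_Ioi.1 hj)
    have h2 := h (Finset.mem_Ioi.1 hj')
    exact h.injective (by omega)
  · rw [Finset.mem_filter, Finset.mem_Icc] at hs
    obtain ⟨hs, hj⟩ := hs
    push Not at hj
    obtain ⟨j, hj⟩ := hj
    exact ⟨j, Finset.mem_Ioi.2 (h.lt_iff_gt.1 (by omega)), by omega⟩
theorem TT_card {m : ℕ} {l : Fin m → ℕ} (h : StrictAnti l) (i : Fin m) : (m - 1 - i) + (TT l i).card = l i := by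
  have := TT_eq h i (A := Multiplicative ℕ) (fun _ => Multiplicative.ofAdd 1)
  simp only [Finset.prod_const, Fin.card_Ioi, Finset.card_range] at this
  have := congrArg Multiplicative.toAdd this
  simpa using this
theorem hh_sub {Q : ℂ} (hQ : ∀ i : ℕ, Q^(i+1) ≠ 1) (h0 : Q ≠ 0) (l c : ℕ) : (if c ≤ l then hh Q (l - c) else 0) = hh Q l * ∏ t ∈ Finset.range c, (-Q^(t+1) * ((Q^l)⁻¹ - (Q^t)⁻¹)) := by
  induction c with
  | zero => simp
  | succ c ih =>
    rw [Finset.prod_range_succ, ← mul_assoc, ← ih]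
    rcases lt_trichotomy c l with hl | rfl | hl
    · obtain ⟨k, rfl⟩ := Nat.exists_eq_add_of_lt hl
      rw [if_pos (by omega), if_pos (by omega), show c + k + 1 - c = k+1 by omega, show c+k+1-(c+1) = k by omega, hh, hh, Finset.prod_range_succ]
      have := sub_ne_zero.2 (hQ k)
      field_simp
      ring
    · simp
    · simp [hl.not_ge, (show ¬ c + 1 ≤ l by omega)]
theorem ch_id (lam b : ℕ) : (lam + b).choose 2 + (b+1).choose 2 = lam.choose 2 + (lam + b) * b := by
  have h1 := add_ch2 lam b
  have h2 := add_ch2 b 1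
  have h3 : 2 * b.choose 2 + b = b * b := by
    induction b with
    | zero => rfl
    | succ b ih => have := ih (add_ch2 _ _) (add_ch2 _ _); rw [add_ch2 b 1]; simp; nlinarith
  simp at h2; nlinarith
theorem sum_r (l : ℕ) : ∑ s ∈ Finset.range l, s = l.choose 2 := by rw [Finset.sum_range_id, Nat.choose_two_right]
theorem det_eval {m : ℕ} {l : Fin m → ℕ} (h : StrictAnti l) {Q : ℕ} (hQ : 2 ≤ Q) {ε : ℂ} (hε : ‖ε‖ = 1) :
    ‖(Matrix.of fun i j : Fin m => if m - 1 - (j:ℕ) ≤ l i then ε^(l i - (m - 1 - j)) * hh Q (l i - (m - 1 - j)) else 0).det‖ *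
      ∏ i, ∏ s ∈ TT l i, ((Q:ℝ)^s - 1) = (Q:ℝ)^(∑ i, (TT l i).card.choose 2) := by
  have e0 : ε ≠ 0 := fun h => by simp [h] at hε
  have q0 : (Q:ℂ) ≠ 0 := Nat.cast_ne_zero.2 (by omega)
  have r0 : (Q:ℝ) ≠ 0 := Nat.cast_ne_zero.2 (by omega)
  have q1 : ∀ i : ℕ, i ≠ 0 → 1 < (Q:ℝ)^i := fun i hi => one_lt_pow₀ (by exact_mod_cast hQ) hi
  have q2 : ∀ i : ℕ, (Q:ℂ)^(i+1) ≠ 1 := fun i e => by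
    have := q1 (i+1) (by omega)
    have e : (Q:ℝ)^(i+1) = 1 := by exact_mod_cast e
    linarith
  let v : Fin m → ℂ := fun i => ((Q:ℂ)^(l i))⁻¹
  let p : Fin m → ℂ[X] := fun j => ∏ t ∈ Finset.range j, (Polynomial.X - C ((Q:ℂ)^t)⁻¹)
  let c : ℕ → ℂ := fun b => (ε^b)⁻¹ * ∏ t ∈ Finset.range b, (-(Q:ℂ)^(t+1))
  have hV := Matrix.det_eval_matrixOfPolynomials_eq_det_vandermonde v p
    (fun i => by simp only [p]; rw [natDegree_prod_of_monic _ _ fun t _ => monic_X_sub_C _]; simp) (fun i => monic_prod_of_monic _ _ fun t _ => monic_X_sub_C _)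
  have hM : (Matrix.of fun i j : Fin m => if m - 1 - (j:ℕ) ≤ l i then ε^(l i - (m - 1 - j)) * hh Q (l i - (m - 1 - j)) else 0) =
      Matrix.of fun i j => (ε^(l i) * hh Q (l i)) * (Matrix.of fun i j : Fin m => c (m-1-j) * ((Matrix.of fun i j => (p j).eval (v i)).submatrix id Fin.revPerm) i j) i j := by
    ext i j
    simp only [Matrix.of_apply, Matrix.submatrix_apply, id, p, c, v, Polynomial.eval_prod, eval_sub, eval_X, eval_C]
    have e1 : ((Fin.revPerm j : Fin m) : ℕ) = m - 1 - j := by simp [Fin.val_rev]; omega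
    rw [e1]
    have := hh_sub q2 q0 (l i) (m-1-j)
    rw [Finset.prod_mul_distrib] at this
    rw [mul_assoc, mul_assoc, mul_left_comm (hh _ _), ← this]
    split_ifs with hc
    · rw [← mul_assoc, pow_sub₀ _ e0 hc]
    · simp
  rw [hM, Matrix.det_mul_column, Matrix.det_mul_row, Matrix.det_permute', ← hV, Matrix.det_vandermonde]
  have hs : ‖((Equiv.Perm.sign (Fin.revPerm : Equiv.Perm (Fin m)) : ℤˣ) : ℂ)‖ = 1 := by
    rcases Int.units_eq_one_or (Equiv.Perm.sign (Fin.revPerm : Equiv.Perm (Fin m))) with h | h <;> simp [h]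
  rw [norm_mul, norm_mul, norm_mul, hs, one_mul, norm_prod, norm_prod, norm_prod, ← Finset.prod_mul_distrib, ← Finset.prod_mul_distrib, ← Finset.prod_mul_distrib, ← Finset.prod_pow_eq_pow_sum]
  refine Finset.prod_congr rfl fun i _ => ?_
  have n1 : ‖ε ^ l i * hh Q (l i)‖ = (Q:ℝ)^((l i).choose 2) / ∏ s ∈ Finset.range (l i), ((Q:ℝ)^(s+1) - 1) := by
    rw [norm_mul, norm_pow, hε, one_pow, one_mul, hh, norm_prod, ← sum_r, ← Finset.prod_pow_eq_pow_sum, ← Finset.prod_div_distrib]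
    refine Finset.prod_congr rfl fun s _ => ?_
    have : (Q:ℂ)^s / ((Q:ℂ)^(s+1) - 1) = (((Q:ℝ)^s / ((Q:ℝ)^(s+1) - 1) : ℝ) : ℂ) := by push_cast; rfl
    rw [this, Complex.norm_of_nonneg]
    have := q1 (s+1) (by omega)
    exact div_nonneg (by positivity) (by linarith)
  have n2 : ‖c (m-1-i)‖ = (Q:ℝ)^((m-1-i+1).choose 2) := by
    simp only [c, norm_mul, norm_inv, norm_pow, hε, one_pow, inv_one, one_mul, norm_prod, norm_neg, Complex.norm_natCast]
    rw [Finset.prod_pow_eq_pow_sum, ← sum_r, Finset.sum_range_succ']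
    simp
  have n3 : ‖∏ j ∈ Finset.Ioi i, (v j - v i)‖ = (∏ j ∈ Finset.Ioi i, ((Q:ℝ)^(l i - l j) - 1)) / (Q:ℝ)^(l i * (m-1-i)) := by
    rw [norm_prod, pow_mul, ← Fin.card_Ioi, ← Finset.prod_const, ← Finset.prod_div_distrib]
    refine Finset.prod_congr rfl fun j hj => ?_
    have hl := h (Finset.mem_Ioi.1 hj)
    have : v j - v i = ((((Q:ℝ)^(l i - l j) - 1) / (Q:ℝ)^(l i) : ℝ) : ℂ) := by
      push_cast; simp only [v]
      rw [pow_sub₀ _ q0 hl.le]; field_simp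
    rw [this, Complex.norm_of_nonneg]
    have := q1 (l i - l j) (by omega)
    exact div_nonneg (by linarith) (by positivity)
  rw [n1, n2, n3]
  have hT := TT_eq h i (fun s => (Q:ℝ)^s - 1)
  have hc := TT_card h i
  rw [← hT]
  have z1 : ∏ j ∈ Finset.Ioi i, ((Q:ℝ)^(l i - l j) - 1) ≠ 0 := Finset.prod_ne_zero_iff.2 fun j hj => by
    have := q1 (l i - l j) (by have := h (Finset.mem_Ioi.1 hj); omega)
    linarith
  have z2 : ∏ s ∈ TT l i, ((Q:ℝ)^s - 1) ≠ 0 := Finset.prod_ne_zero_iff.2 fun s hs => by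
    have := q1 s (by have := (Finset.mem_Icc.1 (Finset.mem_filter.1 hs).1); omega)
    linarith
  have := ch_id (TT l i).card (m-1-i)
  rw [add_comm (TT l i).card, hc] at this
  have := congrArg ((Q:ℝ) ^ ·) this
  simp only [pow_add] at this
  field_simp
  linear_combination this
end GLW
end
end
section
universe u
open scoped MatrixGroups
noncomputable section
namespace GLW
variable {F : Type} [Field F] [Fintype F]
open Polynomial PSH
theorem sl_sort {R : Type u} [CommRing R] (x : ℕ → R) {m : ℕ} (l : Fin m → ℕ) (h : Function.Injective l) :
    ∃ l' : Fin m → ℕ, StrictAnti l' ∧ ∑ i, l' i = ∑ i, l i ∧ (sl x l = sl x l' ∨ sl x l = - sl x l') := by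
  let σ := Tuple.sort (OrderDual.toDual ∘ l)
  have hm : Monotone ((OrderDual.toDual ∘ l) ∘ σ) := Tuple.monotone_sort _
  have hs : StrictMono ((OrderDual.toDual ∘ l) ∘ σ) := hm.strictMono_of_injective ((OrderDual.toDual.injective.comp h).comp σ.injective)
  refine ⟨l ∘ σ, fun i j hij => hs hij, Equiv.sum_comp σ l, ?_⟩
  have : sl x (l ∘ σ) = _ := Matrix.det_permute σ (Matrix.of fun i j : Fin m => xs x (l i) (m - 1 - j))
  rw [this, ← sl]
  rcases Int.units_eq_one_or (Equiv.Perm.sign σ) with h | h <;> simp [h]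
theorem sum_TT {m : ℕ} {l : Fin m → ℕ} (h : StrictAnti l) {k : ℕ} (e : ∑ i, l i = m.choose 2 + k) : ∑ i, (TT l i).card = k := by
  have h1 : ∑ i : Fin m, (m - 1 - (i:ℕ)) = m.choose 2 := by
    rw [Fin.sum_univ_eq_sum_range (fun i => m - 1 - i), Finset.sum_range_reflect (fun i => i), sum_r]
  have h2 : ∑ i : Fin m, ((m - 1 - (i:ℕ)) + (TT l i).card) = ∑ i, l i := Finset.sum_congr rfl fun i _ => TT_card h i
  rw [Finset.sum_add_distrib, h1, e] at h2
  omega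
theorem struct2 {x : RR F → ℕ → RR F} (hx : ∀ ρ ∈ (SS F).Cusp, XSeq (SS F) ρ (x ρ)) {χ : RR F} (hχ : χ ∈ (SS F).I) :
    ∃ (A : Finset (RR F)) (k : RR F → ℕ) (m : ℕ) (l : RR F → Fin m → ℕ),
      (∀ ρ ∈ A, ρ ∈ (SS F).Cusp ∧ 0 < k ρ ∧ StrictAnti (l ρ) ∧ ∑ i, (TT (l ρ) i).card = k ρ) ∧
      (χ = ∏ σ ∈ A, sl (x σ) (l σ) ∨ -χ = ∏ σ ∈ A, sl (x σ) (l σ)) ∧ ∑ ρ ∈ A, k ρ * (SS F).dg ρ = (SS F).dg χ ∧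
      (SS F).fm χ (∏ ρ ∈ A, ρ ^ k ρ) ≠ 0 := by
  classical
  obtain ⟨A, k, m, l, h, hc, h1, h2⟩ := structure_thm hx hχ
  have : ∀ ρ, ∃ l' : Fin m → ℕ, ρ ∈ A → StrictAnti l' ∧ ∑ i, l' i = ∑ i, l ρ i ∧ (sl (x ρ) (l ρ) = sl (x ρ) l' ∨ sl (x ρ) (l ρ) = - sl (x ρ) l') := fun ρ => by
    by_cases hρ : ρ ∈ A
    · obtain ⟨l', h'⟩ := sl_sort (x ρ) (l ρ) (h ρ hρ).2.2.1
      exact ⟨l', fun _ => h'⟩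
    · exact ⟨l ρ, fun h => absurd h hρ⟩
  choose l' hl' using this
  refine ⟨A, k, m, l', fun ρ hρ => ⟨(h ρ hρ).1, (h ρ hρ).2.1, (hl' ρ hρ).1, sum_TT (hl' ρ hρ).1 ((hl' ρ hρ).2.1.trans (h ρ hρ).2.2.2)⟩, ?_, h1, h2⟩
  have : ∀ B ⊆ A, ∏ σ ∈ B, sl (x σ) (l σ) = ∏ σ ∈ B, sl (x σ) (l' σ) ∨ ∏ σ ∈ B, sl (x σ) (l σ) = - ∏ σ ∈ B, sl (x σ) (l' σ) := by
    intro B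
    induction B using Finset.induction_on with
    | empty => simp
    | insert ρ B hB ih =>
      intro hA
      rw [Finset.prod_insert hB, Finset.prod_insert hB]
      rcases ih ((Finset.subset_insert _ _).trans hA) with e | e <;> rcases (hl' ρ (hA (Finset.mem_insert_self _ _))).2.2 with e' | e' <;> rw [e, e'] <;> simp
  rcases this A subset_rfl with e | e <;> rcases hc with e' | e' <;> rw [e] at e'
  exacts [Or.inl e', Or.inr e', Or.inr (by rw [e', neg_neg]), Or.inl (by rw [← neg_neg χ, e', neg_neg])]
theorem deg_formula {x : RR F → ℕ → RR F} (hx : ∀ ρ ∈ (SS F).Cusp, XSeq (SS F) ρ (x ρ) ∧ ∀ n, 2 ≤ n → kap F (x ρ n) = 0) {χ : RR F} (hχ : χ ∈ (SS F).I)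
    {A : Finset (RR F)} {m : ℕ} {l : RR F → Fin m → ℕ} (h : ∀ ρ ∈ A, ρ ∈ (SS F).Cusp ∧ StrictAnti (l ρ))
    (hc : χ = ∏ σ ∈ A, sl (x σ) (l σ) ∨ -χ = ∏ σ ∈ A, sl (x σ) (l σ)) {d : ℕ} (hd : χ.1 (sc F ((SS F).dg χ)) = d) :
    d * (∏ ρ ∈ A, ∏ i, ∏ s ∈ TT (l ρ) i, (Fintype.card F ^ ((SS F).dg ρ * s) - 1)) * Fintype.card F ^ ((SS F).dg χ).choose 2 =
      Fintype.card F ^ (∑ ρ ∈ A, (SS F).dg ρ * ∑ i, (TT (l ρ) i).card.choose 2) * gl F ((SS F).dg χ) := by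
  have q2 : 2 ≤ Fintype.card F := Fintype.one_lt_card
  have e1 : ‖del F χ‖ = ∏ ρ ∈ A, ‖del F (sl (x ρ) (l ρ))‖ := by
    have : ‖del F χ‖ = ‖del F (∏ σ ∈ A, sl (x σ) (l σ))‖ := by
      rcases hc with e | e
      · rw [← e]
      · rw [← e, map_neg, norm_neg]
    rw [this, map_prod, norm_prod]
  have e2 : ∀ ρ ∈ A, ‖del F (sl (x ρ) (l ρ))‖ * ∏ i, ∏ s ∈ TT (l ρ) i, (((Fintype.card F ^ ((SS F).dg ρ * s) - 1 : ℕ)) : ℝ) = (Fintype.card F : ℝ) ^ ((SS F).dg ρ * ∑ i, (TT (l ρ) i).card.choose 2) := by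
    intro ρ hρ
    obtain ⟨X, hk⟩ := hx ρ (h ρ hρ).1
    obtain ⟨ε, hε, hd⟩ := del_x X hk
    have hQ : 2 ≤ Fintype.card F ^ (SS F).dg ρ := q2.trans (Nat.le_self_pow ((SS F).cusp_dg X.cusp).ne' _)
    have := det_eval (h ρ hρ).2 hQ (ε := ε) (by rcases hε with e | e <;> simp [e])
    rw [pow_mul, ← Nat.cast_pow, ← this]
    congr 1
    · rw [sl, RingHom.map_det]
      congr 2
      ext i j
      simp only [RingHom.mapMatrix_apply, Matrix.map_apply, Matrix.of_apply, xs]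
      split_ifs
      · rw [hd]; push_cast; rfl
      · rw [map_zero]
    · refine Finset.prod_congr rfl fun i _ => Finset.prod_congr rfl fun s _ => ?_
      rw [Nat.cast_sub (Nat.one_le_pow _ _ (by omega)), pow_mul]; push_cast; rfl
  have e3 := Finset.prod_congr (rfl : A = A) e2
  rw [Finset.prod_mul_distrib, ← e1, Finset.prod_pow_eq_pow_sum] at e3
  have e4 : del F χ = dco F ((SS F).dg χ) * d := hd ▸ del_irr (dg_mem hχ)
  have e5 : ‖del F χ‖ * ((∏ i ∈ Finset.range ((SS F).dg χ), (Fintype.card F ^ (i+1) - 1) : ℕ) : ℝ) = d := by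
    have hp : ∏ i ∈ Finset.range ((SS F).dg χ), (qq F ^ (i+1) - 1) ≠ 0 := Finset.prod_ne_zero_iff.2 fun i _ => q_ne _
    have : ((∏ i ∈ Finset.range ((SS F).dg χ), (Fintype.card F ^ (i+1) - 1) : ℕ) : ℂ) = ∏ i ∈ Finset.range ((SS F).dg χ), (qq F ^ (i+1) - 1) := by
      rw [Nat.cast_prod]
      refine Finset.prod_congr rfl fun i _ => ?_
      rw [Nat.cast_sub (Nat.one_le_pow _ _ (by omega))]; push_cast; rfl
    rw [← Complex.norm_natCast, ← norm_mul, this, e4, dco_eq, mul_right_comm, inv_mul_cancel₀ hp, one_mul, Complex.norm_natCast]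
  rw [gl_nat]
  have : (d:ℝ) * ((∏ ρ ∈ A, ∏ i, ∏ s ∈ TT (l ρ) i, (Fintype.card F ^ ((SS F).dg ρ * s) - 1) : ℕ) : ℝ) = ((Fintype.card F ^ (∑ ρ ∈ A, (SS F).dg ρ * ∑ i, (TT (l ρ) i).card.choose 2) * ∏ i ∈ Finset.range ((SS F).dg χ), (Fintype.card F ^ (i+1) - 1) : ℕ) : ℝ) := by
    rw [Nat.cast_mul (_ ^ _), Nat.cast_pow, ← e3, ← e5]
    simp only [Nat.cast_prod]
    ring
  rw [← Nat.cast_mul, Nat.cast_inj] at this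
  rw [this]; ring
theorem two_ch (n : ℕ) : 2 * n.choose 2 + n = n * n := by
  have := ch_id 1 n; have := add_ch2 n 1
  rw [add_comm 1 n] at *; simp at *; nlinarith
theorem z_bound {ι : Type*} {A : Finset ι} {m : ℕ} {d : ι → ℕ} {c : ι → Fin m → ℕ} {N B : ℕ} (h : ∑ ρ ∈ A, (∑ i, c ρ i) * d ρ = N) (hB : ∀ ρ ∈ A, ∀ i, c ρ i ≤ B) :
    2 * (∑ ρ ∈ A, d ρ * ∑ i, (c ρ i).choose 2) + N ≤ N * B := by
  rw [← h, Finset.mul_sum, ← Finset.sum_add_distrib, Finset.sum_mul]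
  refine Finset.sum_le_sum fun ρ hρ => ?_
  have : 2 * (∑ i, (c ρ i).choose 2) + ∑ i, c ρ i ≤ (∑ i, c ρ i) * B := by
    rw [Finset.mul_sum, ← Finset.sum_add_distrib, Finset.sum_mul]
    exact Finset.sum_le_sum fun i _ => (two_ch _).trans_le (Nat.mul_le_mul_left _ (hB ρ hρ i))
  nlinarith
theorem sl_exc {R : Type u} [CommRing R] {x : ℕ → R} (h0 : x 0 = 1) {m : ℕ} {l : Fin m → ℕ} (h : StrictAnti l) {N : ℕ} (hN : 0 < N) (i0 : Fin m) (hi : (TT l i0).card = N)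
    (hs : ∑ i, (TT l i).card = N) : sl x l = x N := by
  have hz : ∀ i, i ≠ i0 → l i = m - 1 - i := by
    intro i hi'
    have h1 := TT_card h i
    have : (TT l i).card + (TT l i0).card ≤ ∑ i, (TT l i).card := by
      rw [← Finset.sum_pair hi' (f := fun i => (TT l i).card)]
      exact Finset.sum_le_sum_of_subset (Finset.subset_univ _)
    omega
  have h2 := TT_card h i0
  have hi0 : (i0 : ℕ) = 0 := by
    by_contra hne
    have h3 : (⟨i0 - 1, by omega⟩ : Fin m) < i0 := Fin.lt_def.2 (by simp; omega)
    have h4 := h h3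
    rw [hz _ h3.ne] at h4
    have := i0.2
    simp at h4; omega
  rw [sl, Matrix.det_of_upperTriangular]
  · rw [Finset.prod_eq_single i0]
    · rw [Matrix.of_apply, xs, if_pos (by omega)]; congr 1; omega
    · intro i _ hi
      rw [Matrix.of_apply, xs, hz i hi, if_pos le_rfl, Nat.sub_self, h0]
    · simp
  · intro i j hij
    have hij : j < i := hij
    rw [Matrix.of_apply, xs, if_neg]
    have := Fin.lt_def.1 hij
    rw [hz i (fun e => by rw [e] at this; omega)]
    have := i.2
    omega
end GLW
end
end
section
universe u
open scoped MatrixGroups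
noncomputable section
namespace GLW
variable {F : Type} [Field F] [Fintype F]
open Polynomial PSH
theorem sl_map {R R' : Type*} [CommRing R] [CommRing R'] (φ : R →+* R') (x : ℕ → R) {m : ℕ} (l : Fin m → ℕ) : φ (sl x l) = sl (fun n => φ (x n)) l := by
  rw [sl, sl, RingHom.map_det]
  congr 1
  ext i j
  simp only [RingHom.mapMatrix_apply, Matrix.map_apply, Matrix.of_apply, xs]
  split_ifs <;> simp
theorem sl_stab {R : Type u} [CommRing R] {y t c : ℕ → R} {j0 : ℕ} (hj : 0 < j0) (h0 : c 0 = 1) (hc : ∀ j, ¬ j0 ∣ j → c j = 0)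
    (hy : ∀ k, y k = ∑ j ∈ Finset.range (k+1), c j * t (k - j)) {m : ℕ} {l : Fin m → ℕ} (h : StrictAnti l) (hT : ∀ i, j0 ∉ TT l i) : sl y l = sl t l := by
  classical
  have hcl : ∀ r i, r * j0 ≤ l i → ∃ i', l i' = l i - r * j0 := by
    intro r i
    induction r with
    | zero => exact fun _ => ⟨i, by simp⟩
    | succ r ih =>
      intro hr
      rw [Nat.succ_mul] at hr ⊢
      obtain ⟨i', hi'⟩ := ih (by omega)
      by_contra H
      push Not at H
      exact hT i' (Finset.mem_filter.2 ⟨Finset.mem_Icc.2 (by omega), fun j => by rw [hi', Nat.sub_sub]; exact H j⟩)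
  let U : Matrix (Fin m) (Fin m) R := Matrix.of fun i i' => if l i' ≤ l i then c (l i - l i') else 0
  have hU : U.det = 1 := by
    rw [Matrix.det_of_upperTriangular]
    · exact Finset.prod_eq_one fun i _ => by simp [U, h0]
    · intro i j hij
      have hij : j < i := hij
      simp only [U, Matrix.of_apply]
      rw [if_neg (h hij).not_ge]
  have hM : (Matrix.of fun i j : Fin m => xs y (l i) (m - 1 - j)) = U * Matrix.of fun i j : Fin m => xs t (l i) (m - 1 - j) := by
    ext i j
    rw [Matrix.mul_apply]
    simp only [Matrix.of_apply, U]
    generalize m - 1 - (j:ℕ) = b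
    have e1 : ∑ i', (if l i' ≤ l i then c (l i - l i') else 0) * xs t (l i') b = ∑ n ∈ Finset.range (l i + 1), c n * xs t (l i - n) b := by
      rw [← Finset.sum_filter_of_ne (s := Finset.univ) (p := fun i' => l i' ≤ l i)]
      swap
      · intro i' _ h1; by_contra h2; rw [if_neg h2, zero_mul] at h1; exact h1 rfl
      refine Finset.sum_bij_ne_zero (fun i' _ _ => l i - l i') (fun i' h1 _ => ?_) (fun i' h1 _ i'' h2 _ e => ?_) (fun n hn hne => ?_) (fun i' h1 _ => ?_)
      · simp
      · simp at h1 h2; exact h.injective (by omega)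
      · have hd : j0 ∣ n := by by_contra H; rw [hc n H, zero_mul] at hne; exact hne rfl
        obtain ⟨r, rfl⟩ := hd
        simp at hn
        obtain ⟨i', hi'⟩ := hcl r i (by rw [mul_comm]; omega)
        rw [mul_comm] at hi'
        have hle : l i' ≤ l i := by omega
        refine ⟨i', by simp [hle], ?_, by omega⟩
        rw [if_pos hle, hi', show l i - (l i - j0 * r) = j0 * r by omega]; exact hne
      · simp at h1
        rw [if_pos h1, show l i - (l i - l i') = l i' by omega]
    rw [e1, xs]
    split_ifs with hb
    · rw [hy, ← Finset.sum_subset (Finset.range_mono (show l i - b + 1 ≤ l i + 1 by omega))]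
      · refine Finset.sum_congr rfl fun n hn => ?_
        simp at hn
        rw [xs, if_pos (by omega), Nat.sub_right_comm]
      · intro n hn hn'
        simp at hn hn'
        rw [xs, if_neg (by omega), mul_zero]
    · refine (Finset.sum_eq_zero fun n _ => ?_).symm
      rw [xs, if_neg (by omega), mul_zero]
  rw [sl, hM, Matrix.det_mul, hU, one_mul, sl]
theorem prim_dvd {f : F[X]} (hf : f.Monic) (hi : Irreducible f) (n : ℕ) : ∀ M : Ob F, M.d = n → (∃ K, aeval M.x (f^K) = 0) → f.natDegree ∣ n := by
  induction n using Nat.strong_induction_on with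
  | _ n ih =>
  rintro M hM ⟨K, hK⟩
  rcases Nat.eq_zero_or_pos n with rfl | hn
  · exact dvd_zero _
  have : ∃ v, v ≠ 0 ∧ aeval M.x f v = 0 := by
    by_contra H
    push Not at H
    have h1 : Function.Injective (aeval M.x f) := (injective_iff_map_eq_zero _).2 fun v hv => by_contra fun h => H v h hv
    rw [map_pow] at hK
    have h2 : Function.Injective ((aeval M.x f)^K) := by rw [Module.End.coe_pow]; exact h1.iterate K
    rw [hK] at h2
    have := d_zero_iff.2 ⟨fun a b => h2 (by simp : (0 : Module.End F M.V) a = (0 : Module.End F M.V) b)⟩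
    omega
  obtain ⟨v, hv, h0⟩ := this
  obtain ⟨ψ, hψ, hψ'⟩ := cyc_lift hf v h0
  have hinj : Function.Injective ψ := by
    rw [injective_iff_map_eq_zero]
    intro a ha
    obtain ⟨p, rfl⟩ := cmk_surj hf a
    rw [hψ] at ha
    rw [cmk_zero]
    by_contra hnd
    obtain ⟨a, b, e⟩ := (hi.coprime_iff_not_dvd).2 hnd
    apply hv
    have := congrArg (fun p => aeval M.x p v) e
    simpa [map_add, map_mul, ha, h0] using this.symm
  let W : M.S := ⟨LinearMap.range ψ, by rintro _ ⟨a, rfl⟩; exact ⟨_, hψ' a⟩⟩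
  have h1 := (iso_sub ψ hψ' W hinj rfl).d
  rw [cyc_d] at h1
  have h2 := d_add M W
  have h3 := hi.natDegree_pos
  have h4 := ih (M.quot W).d (by omega) (M.quot W) rfl ⟨K, LinearMap.ext fun w => by
    induction w using Submodule.Quotient.induction_on with | _ w => rw [aeval_quot, hK]; rfl⟩
  rw [← hM, ← h2, ← h1]
  exact dvd_add dvd_rfl h4
theorem fitting (M : Ob F) (f : F[X]) : ∃ (K : ℕ) (M₁ M₂ : Ob F), Iso M (ext M₁ M₂ 0) ∧ aeval M₁.x (f^K) = 0 ∧ Function.Injective (aeval M₂.x (f^K)) ∧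
    (M₁.d = 0 → Function.Injective (aeval M.x f)) ∧ (M₂.d = 0 → aeval M.x (f^K) = 0) := by
  obtain ⟨k, hk⟩ := Filter.eventually_atTop.1 (LinearMap.eventually_isCompl_ker_pow_range_pow (aeval M.x f))
  have hc := hk (k+1) (by omega)
  rw [← map_pow] at hc
  have hcm : ∀ p v, aeval M.x p (M.x v) = M.x (aeval M.x p v) := fun p v => (aeval_hom (M := M) (N := M) M.x (fun _ => rfl) p v).symm
  let W₁ : M.S := ⟨LinearMap.ker (aeval M.x (f^(k+1))), fun v hv => by rw [LinearMap.mem_ker] at *; rw [hcm, hv, map_zero]⟩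
  let W₂ : M.S := ⟨LinearMap.range (aeval M.x (f^(k+1))), by rintro _ ⟨v, rfl⟩; exact ⟨_, hcm _ v⟩⟩
  refine ⟨k+1, M.sub W₁, M.sub W₂, Iso.symm ⟨Submodule.prodEquivOfIsCompl _ _ hc, fun v => ?_⟩, ?_, ?_, fun h => ?_, fun h => ?_⟩
  · simp [Submodule.coe_prodEquivOfIsCompl', W₁, W₂]
  · refine LinearMap.ext fun v => Subtype.ext ?_
    rw [aeval_sub]; exact v.2
  · refine (injective_iff_map_eq_zero _).2 fun v hv => Subtype.ext ?_
    have h1 := congrArg Subtype.val hv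
    rw [aeval_sub] at h1
    exact Submodule.disjoint_def.1 hc.disjoint _ h1 v.2
  · have h1 : W₁.1 = ⊥ := Submodule.finrank_eq_zero.1 h
    refine (injective_iff_map_eq_zero _).2 fun v hv => ?_
    rw [← Submodule.mem_bot F, ← h1]
    show aeval M.x (f^(k+1)) v = 0
    rw [pow_succ, map_mul, Module.End.mul_apply, hv, map_zero]
  · exact LinearMap.range_eq_bot.1 (Submodule.finrank_eq_zero.1 h)
theorem Phi_cop (a : Hall F ℂ) {M N : Ob F} {p : F[X]} (hM : aeval M.x p = 0) (hN : Function.Injective (aeval N.x p)) : (Phi a M).f N = a (ext M N 0) := by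
  refine avg_const _ _ fun B => ?_
  let L : (N.V →ₗ[F] M.V) →ₗ[F] (N.V →ₗ[F] M.V) := LinearMap.llcomp F _ _ _ M.x - LinearMap.lcomp F _ N.x
  have hL : ∀ C, L C = M.x ∘ₗ C - C ∘ₗ N.x := fun C => rfl
  have hi : Function.Injective L := (injective_iff_map_eq_zero _).2 fun C hC => by
    rw [hL, sub_eq_zero] at hC
    refine LinearMap.ext fun v => ?_
    obtain ⟨w, rfl⟩ := (LinearMap.injective_iff_surjective.1 hN) v
    rw [aeval_hom (M := N) (N := M) C (fun v => (LinearMap.congr_fun hC v).symm), hM]; rfl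
  obtain ⟨C, hC⟩ := Finite.surjective_of_injective hi B
  refine a.inv ⟨shear C, fun v => ?_⟩
  rw [shear_ext, ← hC, hL]
  congr 3; abel
def IF (f : F[X]) : Ideal (Hall F (Hall F ℂ)) where
  carrier := {a | ∀ M : Ob F, (∃ K, aeval M.x (f^K) = 0) → a M = 0}
  add_mem' ha hb := fun M hM => by rw [Hall.add_f, ha M hM, hb M hM, add_zero]
  zero_mem' := fun M hM => rfl
  smul_mem' c a ha := by
    rintro M ⟨K, hK⟩
    rw [smul_eq_mul, Hall.mul_f]
    refine Finset.sum_eq_zero fun W _ => ?_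
    rw [ha (M.quot W) ⟨K, LinearMap.ext fun w => by
      induction w using Submodule.Quotient.induction_on with | _ w => rw [aeval_quot, hK]; rfl⟩, mul_zero]
def mapc (a : Hall F ℂ) : Hall F (Hall F ℂ) := ⟨fun M => a M • 1, fun h => by rw [a.inv h]⟩
theorem vanish {x : RR F → ℕ → RR F} (hx : ∀ ρ ∈ (SS F).Cusp, XSeq (SS F) ρ (x ρ)) {χ : RR F} {A : Finset (RR F)} {m : ℕ} {l : RR F → Fin m → ℕ}
    (h : ∀ ρ ∈ A, ρ ∈ (SS F).Cusp ∧ StrictAnti (l ρ)) (hc : χ = ∏ σ ∈ A, sl (x σ) (l σ) ∨ -χ = ∏ σ ∈ A, sl (x σ) (l σ))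
    {M : Ob F} (hM : χ.1 M ≠ 0) {f : F[X]} (hf : f.Monic) (hi : Irreducible f) (hfi : ¬ Function.Injective (aeval M.x f)) :
    ∃ ρ ∈ A, ∃ i, ∃ s ∈ TT (l ρ) i, f.natDegree ∣ (SS F).dg ρ * s := by
  by_contra H
  push Not at H
  apply hM
  obtain ⟨K, M₁, M₂, hiso, h1, h2, h3, -⟩ := fitting M f
  have hd : M₁.d ≠ 0 := fun h => hfi (h3 h)
  rw [χ.1.inv hiso, ← Phi_cop χ.1 h1 h2]
  let π := Ideal.Quotient.mk (IF f)
  let y : RR F →+* _ := (π.comp (PhiH F : Hall F ℂ →+* Hall F (Hall F ℂ))).comp (RR F).subtype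
  let t : RR F →+* _ := (π.comp (algebraMap (Hall F ℂ) (Hall F (Hall F ℂ)))).comp (RR F).subtype
  have key : ∀ ρ ∈ A, y (sl (x ρ) (l ρ)) = t (sl (x ρ) (l ρ)) := by
    intro ρ hρ
    have X := hx ρ (h ρ hρ).1
    have hp := hi.natDegree_pos
    have hg := Nat.gcd_pos_of_pos_left ((SS F).dg ρ) hp
    rw [sl_map, sl_map]
    refine sl_stab (c := fun j => π (mapc (x ρ j).1)) (j0 := f.natDegree / f.natDegree.gcd ((SS F).dg ρ)) (Nat.div_pos (Nat.gcd_le_left _ hp) hg) ?_ ?_ ?_ (h ρ hρ).2 ?_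
    · have : mapc (x ρ 0).1 = 1 := by
        rw [X.zero]
        ext M : 1
        show (1 : Hall F ℂ).f M • (1 : Hall F ℂ) = (1 : Hall F (Hall F ℂ)).f M
        rw [Hall.one_f, Hall.one_f]; split_ifs <;> simp
      rw [this, map_one]
    · intro j hj
      refine Ideal.Quotient.eq_zero_iff_mem.2 fun M hM => ?_
      show (x ρ j).1.f M • (1 : Hall F ℂ) = 0
      rw [Irr.deg (x_irr X j), zero_smul]
      intro e
      have := prim_dvd hf hi _ M e hM
      refine hj ((Nat.Coprime.dvd_mul_right (Nat.coprime_div_gcd_div_gcd hg)).1 ?_)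
      rw [← Nat.mul_div_assoc _ (Nat.gcd_dvd_right _ _)]
      exact Nat.div_dvd_div (Nat.gcd_dvd_left _ _) this
    · intro k
      have : Phi (x ρ k).1 = ∑ j ∈ Finset.range (k+1), mapc (x ρ j).1 * algebraMap (Hall F ℂ) _ (x ρ (k-j)).1 := by
        ext M : 1
        rw [Phi_x X, Hall.sum_f]
        refine Finset.sum_congr rfl fun j _ => ?_
        rw [mul_comm, ← Algebra.smul_def, Hall.smul_f]
        show _ = (x ρ (k-j)).1 * ((x ρ j).1.f M • 1)
        rw [mul_smul_comm, mul_one]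
      have := congrArg π this
      rw [map_sum] at this
      simp only [map_mul] at this
      exact this
    · intro i hT
      refine H ρ hρ i _ hT ?_
      rw [← Nat.mul_div_assoc _ (Nat.gcd_dvd_left _ _), mul_comm, Nat.mul_div_assoc _ (Nat.gcd_dvd_right _ _)]
      exact dvd_mul_right _ _
  have hyt : y χ = t χ := by
    have : y (∏ σ ∈ A, sl (x σ) (l σ)) = t (∏ σ ∈ A, sl (x σ) (l σ)) := by
      rw [map_prod, map_prod]; exact Finset.prod_congr rfl key
    rcases hc with e | e
    · rwa [e]
    · rwa [← e, map_neg, map_neg, neg_inj] at this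
  have := (Ideal.Quotient.mk_eq_mk_iff_sub_mem _ _).1 hyt M₁ ⟨K, h1⟩
  have e : (algebraMap (Hall F ℂ) (Hall F (Hall F ℂ)) χ.1).f M₁ = 0 := by
    rw [Algebra.algebraMap_eq_smul_one, Hall.smul_f, Hall.one_f, if_neg hd, smul_zero]
  have e2 : Phi χ.1 M₁ - (algebraMap (Hall F ℂ) (Hall F (Hall F ℂ)) χ.1).f M₁ = 0 := this
  rw [e, sub_zero] at e2
  rw [e2]; rfl
end GLW
end
end
section
universe u
open scoped MatrixGroups
noncomputable section
namespace GLW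
variable {F : Type} [Field F] [Fintype F]
open Polynomial PSH
theorem irr_comm {G : Type} [Group G] (hG : ∀ a b : G, a * b = b * a) {f : G → ℂ} (hf : f ∈ IrrC G) : f 1 = 1 ∧ ∀ a b, f (a * b) = f a * f b := by
  obtain ⟨V, _, _, _, ρ, hρ, rfl⟩ := hf
  haveI : IsMulCommutative G := ⟨⟨hG⟩⟩
  have h1 := Representation.IsIrreducible.finrank_eq_one_of_isMulCommutative ρ
  have hc : ∀ g, ρ g = ρ.character g • LinearMap.id := by
    intro g
    obtain ⟨c, h, -⟩ := LinearMap.existsUnique_eq_smul_id_of_finrank_eq_one h1 (ρ g)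
    rw [Representation.character, h, map_smul, LinearMap.trace_id, h1]; simp
  refine ⟨by simp [Representation.char_one, h1], fun a b => ?_⟩
  rw [Representation.character, map_mul, hc a, smul_mul_assoc, map_smul]; rfl
theorem Iso.det {M N : Ob F} (h : Iso M N) : LinearMap.det M.x = LinearMap.det N.x := by
  obtain ⟨e, he⟩ := h
  rw [← LinearMap.det_conj M.x e]
  congr 1
  ext v
  simp [he]
theorem bij_det {M : Ob F} : Function.Bijective M.x ↔ LinearMap.det M.x ≠ 0 := by
  rw [← isUnit_iff_ne_zero, ← LinearMap.isUnit_iff_isUnit_det, Module.End.isUnit_iff]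
theorem det_sub (M : Ob F) (W : M.S) : LinearMap.det M.x = LinearMap.det (M.sub W).x * LinearMap.det (M.quot W).x :=
  LinearMap.det_eq_det_mul_det W.1 M.x W.2
theorem det_ext (M N : Ob F) (B) : LinearMap.det (ext M N B).x = LinearMap.det M.x * LinearMap.det N.x := by
  let W : (ext M N B).S := ⟨LinearMap.range (LinearMap.inl F M.V N.V), by
    rintro _ ⟨v, rfl⟩; exact ⟨M.x v, by simp [ext]⟩⟩
  have h1 : Iso M ((ext M N B).sub W) := iso_sub (M := M) (N := ext M N B) (LinearMap.inl F M.V N.V) (fun v => by simp [ext]) W LinearMap.inl_injective rfl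
  have h2 : Iso ((ext M N B).quot W) N := iso_quot (M := ext M N B) (N := N) (LinearMap.snd F M.V N.V) (fun v => rfl) W LinearMap.snd_surjective (by
    rw [LinearMap.ker_snd])
  rw [det_sub _ W, h2.det, ← h1.det]
def zH (c : F →*₀ ℂ) (n : ℕ) : Hall F ℂ := ⟨fun M => if M.d = n then c (LinearMap.det M.x) else 0, fun h => by rw [h.d, h.det]⟩
theorem z_Irr (c : F →*₀ ℂ) (n : ℕ) : zH c n ∈ Irr F n := by
  refine ⟨?_, fun M hM => ?_⟩
  · convert irr_lin ((c : F →* ℂ).comp ((LinearMap.det : Module.End F (Fin n → F) →* F).comp (DistribMulAction.toModuleEnd F (Fin n → F) : (Gn F n) →* _))) using 2 with g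
    simp only [zH, mat_d, if_true]
    rfl
  · simp only [zH] at hM
    split_ifs at hM with h
    · exact ⟨h, bij_det.2 fun e => hM (by rw [e, map_zero])⟩
    · exact absurd rfl hM
theorem z_ex {a : Hall F ℂ} (ha : a ∈ Irr F 1) : ∃ c : F →*₀ ℂ, a = zH c 1 := by
  classical
  have hs : ∀ g : Module.End F (Fin 1 → F), g = LinearMap.det g • LinearMap.id := fun g => by
    obtain ⟨c, h, -⟩ := LinearMap.existsUnique_eq_smul_id_of_finrank_eq_one (by simp) g
    rw [h, LinearMap.det_smul]; simp
  have hG : ∀ a b : Gn F 1, a * b = b * a := fun a b => by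
    apply LinearEquiv.toLinearMap_injective
    show (a : Module.End F (Fin 1 → F)) * (b : Module.End F (Fin 1 → F)) = (b : Module.End F (Fin 1 → F)) * (a : Module.End F (Fin 1 → F))
    rw [hs a, hs b, smul_mul_smul_comm, smul_mul_smul_comm, mul_comm]
  obtain ⟨h1, h2⟩ := irr_comm hG ha.1
  let A : F → Gn F 1 := fun r => if h : r = 0 then 1 else LinearEquiv.smulOfNeZero F _ r h
  have hA : ∀ r ≠ 0, (A r : Module.End F (Fin 1 → F)) = r • LinearMap.id := fun r h => by
    simp only [A, dif_neg h]; rfl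
  refine ⟨⟨⟨fun r => if r = 0 then 0 else a (mat 1 (A r)), by simp⟩, ?_, ?_⟩, ?_⟩
  · simp only [one_ne_zero, if_false]
    rw [← h1]; congr 2; rw [hA 1 one_ne_zero, one_smul]; rfl
  · intro r s
    by_cases hr : r = 0
    · simp [hr]
    by_cases hs : s = 0
    · simp [hs]
    simp only [mul_eq_zero, hr, hs, or_self, if_false]
    rw [← h2]; congr 2
    rw [hA _ (mul_ne_zero hr hs)]
    show _ = (A r : Module.End F (Fin 1 → F)) * (A s : Module.End F (Fin 1 → F))
    rw [hA r hr, hA s hs, smul_mul_smul_comm]; rfl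
  · refine Irr.ext ha.2 (z_Irr _ 1).2 fun g => ?_
    have h0 := bij_det.1 (show Function.Bijective (mat (F := F) 1 g).x from g.bijective)
    simp only [zH, mat_d, if_true]
    show _ = if _ then _ else _
    rw [if_neg h0]
    congr 2
    rw [hA _ h0]; exact hs _
theorem z_perp (c : F →*₀ ℂ) {i : ℕ} {u : Hall F ℂ} (hu : u ∈ Irr F i) (n : ℕ) : perp i u (zH c n) = if i ≤ n then ip i u (zH c i) • zH c (n - i) else 0 := by
  have key : ∀ x : Module.End F (Fin i → F), Phi (zH c n) (mat i x) = if i ≤ n then zH c i (mat i x) • zH c (n - i) else 0 := by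
    intro x
    ext N : 1
    rw [Phi_f, avg_const _ (if i + N.d = n then c (LinearMap.det x) * c (LinearMap.det N.x) else 0)]
    · split_ifs with h h' h'
      · simp only [zH, Hall.smul_f, mat_d, if_true, if_pos (show N.d = n - i by omega)]; rfl
      · omega
      · simp only [zH, Hall.smul_f, mat_d, if_true, if_neg (show ¬ N.d = n - i by omega)]; simp
      · rfl
    · intro B
      show (if _ then c _ else 0) = _
      rw [det_ext, map_mul, ext_d, mat_d]
  rw [perp, pr]
  simp only [key]
  split_ifs with h
  · rw [ip, pr]
    simp only [smul_eq_mul, Finset.sum_smul, Finset.smul_sum, Finset.mul_sum, mul_smul]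
  · simp
theorem z_seq (c : F →*₀ ℂ) (hc : irr (z_Irr c 1) ∈ (SS F).Cusp) : XSeq (SS F) (irr (z_Irr c 1)) (fun n => irr (z_Irr c n)) where
  cusp := hc
  zero := Subtype.ext (Irr_zero (z_Irr c 0))
  one := rfl
  mem n := IR_mem _
  P_x i n := by
    apply Subtype.ext
    rw [← perp_PP, z_perp c (z_Irr c i), Irr_orth (z_Irr c i) (z_Irr c i), if_pos rfl]
    split_ifs <;> simp
  P_o w hw h n := by
    classical
    obtain ⟨i, hi⟩ := IR_ex hw
    apply Subtype.ext
    rw [show w = irr hi from rfl, ← perp_PP, z_perp c hi, Irr_orth hi (z_Irr c i), if_neg fun e => h i (Subtype.ext e)]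
    simp
theorem fm_def {R : Type*} [CommRing R] (S : PSH R) {a : R} (h : S.fm a a = 0) : a = 0 := by
  obtain ⟨s, hs, h0⟩ := S.exp a
  rw [S.pars a a hs, Finset.sum_eq_zero_iff_of_nonneg fun v _ => mul_self_nonneg _] at h
  rw [hs]
  exact Finset.sum_eq_zero fun v hv => by rw [mul_self_eq_zero.1 (h v hv), zero_smul]
theorem xz_half {R : Type*} [CommRing R] {S : PSH R} {ρ : R} {x z : ℕ → R} (X : XSeq S ρ x) (Z : XSeq S ρ z) (h : ∀ k, 2 ≤ k → ∀ j, x k ≠ z j) (k n : ℕ) (hn : n ≠ 0) :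
    S.P (x (k + 1)) (∑ p ∈ Finset.HasAntidiagonal.antidiagonal n, (-1 : ℤ) ^ p.1 • (x p.1 * z p.2)) = 0 := by
  have e : ∀ i j, S.P (x (k + 1)) (x i * z j) = S.P (x (k + 1)) (x i) * z j + S.P (x k) (x i) * S.P (z 1) (z j) := by
    intro i j
    rw [X.P_mul, Finset.Nat.sum_antidiagonal_succ', X.zero, S.P_one]
    congr 1
    rw [Finset.sum_eq_single (k, 0)]
    · show S.P _ _ * S.P (x (0 + 1)) _ = _
      rw [zero_add, X.one, ← Z.one]
    · rintro ⟨a, b⟩ hp hb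
      rw [Finset.HasAntidiagonal.mem_antidiagonal] at hp
      have : b ≠ 0 := fun e => hb (by simp at hp; ext <;> simp <;> omega)
      rw [Z.P_o (x (b + 1)) (X.mem _) (h _ (by omega)), mul_zero]
    · intro hh; simp at hh
  obtain ⟨m, rfl⟩ := Nat.exists_eq_succ_of_ne_zero hn
  simp only [map_sum, map_zsmul, e, smul_add, Finset.sum_add_distrib, Nat.succ_eq_add_one]
  rw [Finset.Nat.sum_antidiagonal_succ, Finset.Nat.sum_antidiagonal_succ' (n := m)]
  simp only [X.P_x, Z.P_x]
  simp only [zero_add, Nat.not_succ_le_zero, if_false, zero_mul, mul_zero, smul_zero, add_zero, Nat.add_le_add_iff_right, Nat.add_sub_add_right, pow_succ, mul_neg, mul_one, neg_smul, Finset.sum_neg_distrib, Nat.le_add_left, if_true, Nat.add_sub_cancel]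
  rw [if_neg (by omega : ¬ k + 1 ≤ 0), if_neg (by omega : ¬ 1 ≤ 0)]
  simp
theorem xz {R : Type*} [CommRing R] {S : PSH R} {ρ : R} {x z : ℕ → R} (X : XSeq S ρ x) (Z : XSeq S ρ z) (h : ∀ k, 2 ≤ k → ∀ j, x k ≠ z j) (n : ℕ) (hn : n ≠ 0) :
    ∑ p ∈ Finset.HasAntidiagonal.antidiagonal n, (-1 : ℤ) ^ p.1 • (x p.1 * z p.2) = 0 := by
  set w := ∑ p ∈ Finset.HasAntidiagonal.antidiagonal n, (-1 : ℤ) ^ p.1 • (x p.1 * z p.2) with hw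
  have h' : ∀ k, 2 ≤ k → ∀ j, z k ≠ x j := by
    intro k hk j hj
    rcases Nat.lt_or_ge j 2 with hj2 | hj2
    · have : x j = z j := by interval_cases j <;> simp [X.zero, Z.zero, X.one, Z.one]
      have := Z.inj (hj.trans this); omega
    · exact h j hj2 k hj.symm
  have hw' : w = (-1 : ℤ) ^ n • ∑ p ∈ Finset.HasAntidiagonal.antidiagonal n, (-1 : ℤ) ^ p.1 • (z p.1 * x p.2) := by
    rw [hw, ← Finset.Nat.sum_antidiagonal_swap, Finset.smul_sum]
    refine Finset.sum_congr rfl fun p hp => ?_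
    rw [Finset.HasAntidiagonal.mem_antidiagonal] at hp
    rw [smul_smul, ← hp, pow_add, mul_right_comm, ← mul_pow]
    simp [mul_comm]
  apply fm_def S
  rw [(congrArg (S.fm w) hw).trans (map_sum _ _ _)]
  refine Finset.sum_eq_zero fun p hp => ?_
  rw [Finset.HasAntidiagonal.mem_antidiagonal] at hp
  rw [map_zsmul, S.symm]
  rcases Nat.eq_zero_or_eq_succ_pred p.1 with h0 | h0
  · rcases Nat.eq_zero_or_eq_succ_pred p.2 with h1 | h1
    · omega
    · rw [mul_comm, S.adj, h1, hw', map_zsmul, xz_half Z X h' _ _ hn, smul_zero, map_zero, smul_zero]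
  · rw [S.adj, h0, xz_half X Z h _ _ hn, map_zero, smul_zero]
theorem exc {ρ : RR F} {x : ℕ → RR F} (X : XSeq (SS F) ρ x) (hk : ∀ n, 2 ≤ n → kap F (x n) = 0) (hd : (SS F).dg ρ = 1)
    (r : F[X]) (K : ℕ) : ∀ (n : ℕ) (M : Ob F), M.d = n → (x n).1 M ≠ 0 → aeval M.x (r ^ K) = 0 → aeval M.x r = 0 := by
  classical
  have hr : ρ.1 ∈ Irr F 1 := hd ▸ dg_mem X.cusp.1
  obtain ⟨c, hc⟩ := z_ex hr
  obtain rfl : ρ = irr (z_Irr c 1) := Subtype.ext hc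
  have Z := z_seq c X.cusp
  have hx : ∀ i, (x i).1 ∈ Irr F i := fun i => by simpa [hd] using x_irr X i
  have hne : ∀ k, 2 ≤ k → ∀ j, x k ≠ irr (z_Irr c j) := by
    intro k hk2 j e
    have := hk k hk2
    rw [e, kap_irr] at this
    simp only [zH] at this
    rw [if_pos (J_d _)] at this
    exact bij_det.1 (J_bij j) ((map_eq_zero c).1 this)
  have key : ∀ M : Ob F, M.d ≠ 0 → ∑ W : M.S, (-1 : ℂ) ^ (M.sub W).d * (x (M.sub W).d).1 (M.sub W) * c (LinearMap.det (M.quot W).x) = 0 := by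
    intro M hM
    let ev : RR F →+ ℂ := ⟨⟨fun a => a.1 M, rfl⟩, fun _ _ => rfl⟩
    have h := congrArg ev (xz X Z hne M.d hM)
    rw [map_sum, map_zero] at h
    have h2 : ∀ p : ℕ × ℕ, ev ((-1 : ℤ) ^ p.1 • (x p.1 * irr (z_Irr c p.2))) = ∑ W : M.S, (-1 : ℂ) ^ p.1 * ((x p.1).1 (M.sub W) * zH c p.2 (M.quot W)) := fun p => by
      rw [map_zsmul, zsmul_eq_mul, ← Finset.mul_sum, ← Hall.mul_f]
      push_cast; rfl
    simp only [h2] at h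
    rw [Finset.sum_comm] at h
    rw [← h]
    refine Finset.sum_congr rfl fun W _ => ?_
    rw [Finset.sum_eq_single ((M.sub W).d, (M.quot W).d)]
    · simp only [zH, if_true, mul_assoc]
    · rintro ⟨i, j⟩ - hp
      by_cases hi : (M.sub W).d = i
      · have hj : (M.quot W).d ≠ j := fun hj => hp (by rw [hi, hj])
        rw [Irr.deg (z_Irr c j) hj, mul_zero, mul_zero]
      · rw [Irr.deg (hx i) hi, zero_mul, mul_zero]
    · intro hh; exact absurd (Finset.HasAntidiagonal.mem_antidiagonal.2 (d_add M W)) hh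
  let T : Ob F → ℂ := fun M => (-1 : ℂ) ^ M.d * (x M.d).1 M / c (LinearMap.det M.x)
  have hT : ∀ {M N : Ob F}, Iso M N → T M = T N := fun {M N} h => by
    simp only [T]; rw [h.d, h.det, (x N.d).1.inv h]
  have keyT : ∀ M : Ob F, M.d ≠ 0 → LinearMap.det M.x ≠ 0 → ∑ W : M.S, T (M.sub W) = 0 := by
    intro M hM hb
    rw [← mul_right_inj' ((map_ne_zero c).2 hb), mul_zero, Finset.mul_sum, ← key M hM]
    refine Finset.sum_congr rfl fun W _ => ?_
    have h1 := det_sub M W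
    have h2 : LinearMap.det (M.sub W).x ≠ 0 := fun e => hb (by rw [h1, e, zero_mul])
    have h3 := (map_ne_zero c).2 h2
    simp only [T]
    rw [h1, map_mul, mul_assoc, mul_div_assoc', mul_div_assoc, mul_comm (c _)]
    field_simp
  have main : ∀ (n : ℕ) (M : Ob F), M.d = n → LinearMap.det M.x ≠ 0 → aeval M.x (r ^ K) = 0 → aeval M.x r ≠ 0 → T M = 0 := by
    intro n
    induction n using Nat.strong_induction_on with
    | _ n ih =>
    intro M hM hb hK hr0
    have hd0 : M.d ≠ 0 := fun h => hr0 (by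
      have := (d_zero_iff (M := M)).1 h
      ext v; exact Subsingleton.elim _ _)
    let W0 : M.S := ⟨LinearMap.ker (aeval M.x r), fun v hv => by
      rw [LinearMap.mem_ker] at hv ⊢
      rw [← aeval_hom (M := M) (N := M) M.x (fun _ => rfl), hv, map_zero]⟩
    let Wt : M.S := ⟨⊤, fun _ _ => trivial⟩
    have hbs : ∀ W : M.S, LinearMap.det (M.sub W).x ≠ 0 := fun W e => hb (by rw [det_sub M W, e, zero_mul])
    have hne0 : (M.sub W0).d ≠ 0 := fun h => by
      have h1 := d_zero_iff.1 h
      have h2 : Function.Injective (aeval M.x r) := LinearMap.ker_eq_bot.1 (Submodule.eq_bot_iff _ |>.2 fun v hv => congrArg Subtype.val (h1.elim (⟨v, hv⟩ : W0.1) 0))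
      have h3 : Function.Injective ((aeval M.x r) ^ K) := by
        rw [Module.End.coe_pow]; exact h2.iterate K
      rw [← map_pow, hK] at h3
      exact hd0 ((d_zero_iff (M := M)).2 ⟨fun a b => h3 rfl⟩)
    have hs1 := keyT M hd0 hb
    have hs2 := keyT _ hne0 (hbs W0)
    rw [← (eSub W0).sum_comp, Finset.sum_congr rfl fun U _ => hT (iso1 W0 U)] at hs2
    have hs3 : ∑ U ∈ Finset.univ.filter (fun U : M.S => U.1 ≤ W0.1), T (M.sub U) = 0 :=
      (Finset.sum_subtype _ (fun U => by simp) (fun U => T (M.sub U))).trans hs2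
    rw [← Finset.sum_filter_add_sum_filter_not _ (fun U : M.S => U.1 ≤ W0.1), hs3, zero_add, Finset.sum_eq_single Wt] at hs1
    · rw [← hs1]
      exact hT (iso_sub (M := M) (N := M) LinearMap.id (fun _ => rfl) Wt Function.injective_id LinearMap.range_id)
    · intro W hW hWt
      have hW : ¬ W.1 ≤ W0.1 := (Finset.mem_filter.1 hW).2
      have hlt : (M.sub W).d < M.d := Submodule.finrank_lt (s := W.1) fun e => hWt (Subtype.ext e)
      refine ih _ (hM ▸ hlt) (M.sub W) rfl (hbs W) ?_ ?_
      · ext v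
        have := aeval_sub M W (r ^ K) v
        rw [hK] at this
        exact this
      · intro e
        refine hW fun v hv => ?_
        have := aeval_sub M W r ⟨v, hv⟩
        rw [e] at this
        exact LinearMap.mem_ker.2 this.symm
    · intro h
      exfalso
      refine h (Finset.mem_filter.2 ⟨Finset.mem_univ _, fun hle => hr0 ?_⟩)
      ext v
      exact LinearMap.mem_ker.1 (hle trivial)
  intro n M hM hx0 hK
  by_contra h
  have hb := bij_det.1 ((hx n).2 M hx0).2
  have := main n M hM hb hK h
  simp only [T, hM] at this
  rw [div_eq_zero_iff, mul_eq_zero] at this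
  rcases this with (h | h) | h
  · exact pow_ne_zero _ (by norm_num) h
  · exact hx0 h
  · exact (map_ne_zero c).2 hb h
end GLW
end
end
section
universe u
open scoped MatrixGroups
noncomputable section
namespace GLW
variable {F : Type} [Field F] [Fintype F]
open Polynomial PSH
theorem dvd_pow_deg (r p : F[X]) : p ≠ 0 → (∀ f, Irreducible f → f ∣ p → f ∣ r) → p ∣ r ^ p.natDegree := by
  induction p using UniqueFactorizationMonoid.induction_on_prime with
  | h₁ => exact fun h => absurd rfl h
  | h₂ p hp => exact fun _ _ => hp.dvd
  | h₃ a p ha hp ih =>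
    intro h0 h
    have h1 := ih ha fun f hf hd => h f hf (hd.mul_left _)
    rw [natDegree_mul hp.ne_zero ha, pow_add]
    refine mul_dvd_mul ((h p hp.irreducible (dvd_mul_right _ _)).trans (dvd_pow_self _ ?_)) h1
    exact (hp.irreducible.natDegree_pos).ne'
theorem irr_ninj {V : Type} [AddCommGroup V] [Module F V] [Finite V] (y : Module.End F V) {f : F[X]} (hi : Irreducible f) (hd : f ∣ minpoly F y) : ¬ Function.Injective (aeval y f) := by
  intro h
  obtain ⟨k, hk⟩ := hd
  have h0 : minpoly F y ≠ 0 := minpoly.ne_zero (Algebra.IsIntegral.isIntegral y)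
  have hk0 : k ≠ 0 := fun e => h0 (by rw [hk, e, mul_zero])
  have h1 : aeval y k = 0 := by
    have := minpoly.aeval F y
    rw [hk, map_mul] at this
    ext v
    exact h (by simpa using LinearMap.congr_fun this v)
  have h2 := minpoly.degree_le_of_ne_zero F y hk0 h1
  rw [hk, degree_mul, degree_eq_natDegree hi.ne_zero, degree_eq_natDegree hk0] at h2
  have h3 := hi.natDegree_pos
  norm_cast at h2
  omega
theorem kill {n : ℕ} (y : Module.End F (Fin n → F)) (r : F[X]) (h : ∀ f, f.Monic → Irreducible f → ¬ Function.Injective (aeval y f) → f ∣ r) : aeval y (r ^ n) = 0 := by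
  have h0 : minpoly F y ≠ 0 := minpoly.ne_zero (Algebra.IsIntegral.isIntegral y)
  have h1 := dvd_pow_deg r (minpoly F y) h0 fun f hi hd => by
    have hm := monic_mul_leadingCoeff_inv hi.ne_zero
    have ha : Associated f (f * C f.leadingCoeff⁻¹) := associated_mul_unit_right f _ (isUnit_C.2 (isUnit_iff_ne_zero.2 (inv_ne_zero (leadingCoeff_ne_zero.2 hi.ne_zero))))
    refine ha.dvd.trans (h _ hm (ha.irreducible hi) (irr_ninj y (ha.irreducible hi) (ha.symm.dvd.trans hd)))
  have h2 : (minpoly F y).natDegree ≤ n := by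
    have := natDegree_le_of_dvd (LinearMap.minpoly_dvd_charpoly y) (LinearMap.charpoly_monic y).ne_zero
    rwa [LinearMap.charpoly_natDegree, Module.finrank_fin_fun] at this
  obtain ⟨k, hk⟩ := h1.trans (pow_dvd_pow r h2)
  rw [hk, map_mul, minpoly.aeval, zero_mul]
theorem f_dvd {f : F[X]} (hi : Irreducible f) : f ∣ X ^ (Fintype.card F ^ f.natDegree) - X := by
  have := (hi.natDegree_dvd_iff_dvd_X_pow_card_pow_sub_X (n := f.natDegree)).1 dvd_rfl
  rwa [Nat.card_eq_fintype_card] at this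
theorem f_dvd1 {f : F[X]} (hf : f.Monic) (hi : Irreducible f) (hX : f ≠ X) {E : ℕ} (h : Fintype.card F ^ f.natDegree - 1 ∣ E) : f ∣ X ^ E - C 1 := by
  have h1 := f_dvd hi
  have hq : 0 < Fintype.card F ^ f.natDegree := pow_pos Fintype.card_pos _
  obtain ⟨k, hk⟩ := Nat.exists_eq_succ_of_ne_zero hq.ne'
  rw [hk] at h h1
  rw [show (X : F[X]) ^ k.succ - X = X * (X ^ k - 1) by rw [pow_succ]; ring] at h1
  rcases hi.prime.dvd_or_dvd h1 with h2 | h2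
  · exact absurd (eq_of_monic_of_associated hf monic_X (hi.associated_of_dvd irreducible_X h2)) hX
  · obtain ⟨c, rfl⟩ := h
    refine h2.trans ?_
    rw [map_one, pow_mul, ← one_pow (M := F[X]) c]
    simpa using sub_dvd_pow_sub_pow (X ^ k : F[X]) 1 c
theorem f_dvd2 {f : F[X]} (hi : Irreducible f) {a : ℕ} (h : a * (Fintype.card F - 1) = Fintype.card F ^ f.natDegree - 1) : ∃ c, f ∣ X ^ a - C c := by
  classical
  have q2 : 1 < Fintype.card F := Fintype.one_lt_card
  have hq : 1 < Fintype.card F ^ f.natDegree := Nat.one_lt_pow hi.natDegree_pos.ne' q2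
  have ha : a ≠ 0 := by rintro rfl; omega
  have hp : (∏ c : F, (X - C c)) = X ^ Fintype.card F - X := by
    have hm : (X ^ Fintype.card F - X : F[X]).Monic := monic_X_pow_sub (by rw [degree_X]; exact_mod_cast q2)
    rw [← prod_multiset_X_sub_C_of_monic_of_roots_card_eq hm, FiniteField.roots_X_pow_card_sub_X]
    · rfl
    · rw [FiniteField.roots_X_pow_card_sub_X, FiniteField.X_pow_card_sub_X_natDegree_eq _ q2]; rfl
  have h2 := congrArg (fun p : F[X] => p.comp (X ^ a)) hp
  simp only [prod_comp, sub_comp, X_comp, C_comp, pow_comp] at h2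
  have h3 : f ∣ (X ^ a) ^ Fintype.card F - X ^ a := by
    obtain ⟨b, rfl⟩ := Nat.exists_eq_succ_of_ne_zero ha
    refine (f_dvd hi).trans ⟨X ^ b, ?_⟩
    rw [← pow_mul, sub_mul, ← pow_add, pow_succ' X b]
    congr 2
    rw [Nat.mul_sub, mul_one] at h
    have : b.succ ≤ b.succ * Fintype.card F := Nat.le_mul_of_pos_right _ (by omega)
    omega
  rw [← h2] at h3
  obtain ⟨c, -, hc⟩ := (hi.prime.dvd_finsetProd_iff _).1 h3
  exact ⟨c, hc⟩
theorem scal {n : ℕ} (y : Module.End F (Fin n → F)) {a : ℕ} {c : F} {N E z : ℕ} (h : aeval y ((X ^ a - C c) ^ N) = 0) (hN : N ≤ Fintype.card F ^ z) (ha : a ∣ E) :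
    ∃ c, y ^ (E * Fintype.card F ^ z) = algebraMap F _ c := by
  obtain ⟨p, hp⟩ := CharP.exists F
  obtain ⟨k, hpp, hk⟩ := FiniteField.card F p
  haveI := Fact.mk hpp
  obtain ⟨b, rfl⟩ := ha
  have h1 : aeval y ((X ^ a - C c) ^ (Fintype.card F ^ z)) = 0 := by
    obtain ⟨k, hk⟩ := pow_dvd_pow (X ^ a - C c) hN
    rw [hk, map_mul, h, zero_mul]
  rw [hk, ← pow_mul, sub_pow_char_pow, ← C_pow, ← pow_mul, map_sub, map_pow, aeval_X, aeval_C, sub_eq_zero] at h1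
  refine ⟨(c ^ p ^ (k * z)) ^ b, ?_⟩
  rw [map_pow, ← h1, hk, ← pow_mul, ← pow_mul]
  congr 1; ring
theorem box {ι : Type*} (s : Finset ι) (w : ι → ℕ) {q : ℕ} (hq : 2 ≤ q) (h : 2 ≤ s.card) : ∃ E, ∏ b ∈ s, (q ^ w b - 1) = (q - 1) * E ∧ ∀ b ∈ s, q ^ w b - 1 ∣ E := by
  classical
  have hd : ∀ b, q - 1 ∣ q ^ w b - 1 := fun b => by simpa using Nat.sub_dvd_pow_sub_pow q 1 (w b)
  have key : ∀ b ∈ s, (q - 1) * (q ^ w b - 1) ∣ ∏ b ∈ s, (q ^ w b - 1) := by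
    intro b hb
    obtain ⟨b', hb', hne⟩ := Finset.exists_mem_ne (by omega : 1 < s.card) b
    rw [← Finset.mul_prod_erase s _ hb, mul_comm]
    exact mul_dvd_mul dvd_rfl ((hd b').trans (Finset.dvd_prod_of_mem _ (Finset.mem_erase.2 ⟨hne, hb'⟩)))
  obtain ⟨b0, hb0⟩ := Finset.card_pos.1 (by omega : 0 < s.card)
  obtain ⟨E, hE⟩ := (dvd_mul_right _ _).trans (key b0 hb0)
  refine ⟨E, hE, fun b hb => ?_⟩
  have := key b hb
  rw [hE] at this
  exact Nat.dvd_of_mul_dvd_mul_left (by omega) this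
end GLW
end
end
section
universe u
open scoped MatrixGroups
noncomputable section
namespace GLW
variable {F : Type} [Field F] [Fintype F]
open Polynomial PSH
theorem core {n : ℕ} (hn : 1 ≤ n) {u : Hall F ℂ} (hu : u ∈ Irr F n) (g : Gn F n) (hg : u (mat n (g : Module.End F (Fin n → F))) ≠ 0) {d : ℕ} (hd : u (sc F n) = d) :
    ∃ (D : ℕ) (c : F), gl F n = d * (Fintype.card F - 1) * D ∧ (g : Module.End F (Fin n → F)) ^ D = algebraMap F _ c := by
  classical
  set q := Fintype.card F with hq
  have q2 : 2 ≤ q := Fintype.one_lt_card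
  obtain ⟨y, hy⟩ : ∃ y : Module.End F (Fin n → F), y = (g : Module.End F (Fin n → F)) := ⟨_, rfl⟩
  rw [← hy] at hg ⊢
  obtain ⟨x, hx⟩ := ex_xk (F := F)
  have hχ := IR_mem hu
  have hdg : (SS F).dg (irr hu) = n := dg_irr hu
  obtain ⟨A, k, m, l, hA, hc, hs, hf⟩ := struct2 (fun ρ h => (hx ρ h).1) hχ
  have hA' : ∀ ρ ∈ A, ρ ∈ (SS F).Cusp ∧ StrictAnti (l ρ) := fun ρ h => ⟨(hA ρ h).1, (hA ρ h).2.2.1⟩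
  have hdf := deg_formula hx hχ hA' hc (d := d) (by rw [hdg]; exact hd)
  have hva := fun f hf hi hfi => vanish (fun ρ h => (hx ρ h).1) hA' hc (M := mat n y) hg (f := f) hf hi hfi
  rw [hdg] at hs hdf
  have hdp : ∀ ρ ∈ A, 0 < (SS F).dg ρ := fun ρ h => cusp_dg (hA ρ h).1
  have hs' : ∑ ρ ∈ A, (∑ i, (TT (l ρ) i).card) * (SS F).dg ρ = n := by
    rw [← hs]; exact Finset.sum_congr rfl fun ρ h => by rw [(hA ρ h).2.2.2]
  have htk : ∀ ρ ∈ A, ∀ i, (TT (l ρ) i).card ≤ k ρ := fun ρ h i => by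
    rw [← (hA ρ h).2.2.2]; exact Finset.single_le_sum (f := fun i => (TT (l ρ) i).card) (fun _ _ => Nat.zero_le _) (Finset.mem_univ i)
  have hkd : ∀ ρ ∈ A, k ρ * (SS F).dg ρ ≤ n := fun ρ h => by
    rw [← hs]; exact Finset.single_le_sum (f := fun ρ => k ρ * (SS F).dg ρ) (fun _ _ => Nat.zero_le _) h
  have hkn : ∀ ρ ∈ A, k ρ ≤ n := fun ρ h => (Nat.le_mul_of_pos_right _ (hdp ρ h)).trans (hkd ρ h)
  set e := ∑ ρ ∈ A, (SS F).dg ρ * ∑ i, (TT (l ρ) i).card.choose 2 with he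
  have hz1 := z_bound hs' (B := n) fun ρ h i => (htk ρ h i).trans (hkn ρ h)
  have h2c := two_ch n
  obtain ⟨z, hz⟩ : ∃ z, n.choose 2 = e + z := Nat.exists_eq_add_of_le (by omega)
  let Bx : Finset (Σ _ : RR F, Σ _ : Fin m, ℕ) := A.sigma fun ρ => Finset.univ.sigma fun i => TT (l ρ) i
  let w : (Σ _ : RR F, Σ _ : Fin m, ℕ) → ℕ := fun b => (SS F).dg b.1 * b.2.2
  have hE : (∏ ρ ∈ A, ∏ i, ∏ s ∈ TT (l ρ) i, (q ^ ((SS F).dg ρ * s) - 1)) = ∏ b ∈ Bx, (q ^ w b - 1) := by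
    simp only [Bx, Finset.prod_sigma, w]
  have hBc : Bx.card = ∑ ρ ∈ A, k ρ := by
    simp only [Bx, Finset.card_sigma]
    exact Finset.sum_congr rfl fun ρ h => (hA ρ h).2.2.2
  have hgl : gl F n = d * (∏ b ∈ Bx, (q ^ w b - 1)) * q ^ z := by
    rw [hE, hz, pow_add] at hdf
    refine Nat.eq_of_mul_eq_mul_left (pow_pos (by omega : 0 < q) e) ?_
    rw [← hdf]; ring
  have hva' : ∀ f : F[X], f.Monic → Irreducible f → ¬ Function.Injective (aeval y f) → ∃ b ∈ Bx, q ^ f.natDegree - 1 ∣ q ^ w b - 1 := by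
    intro f h1 h2 h3
    obtain ⟨ρ, hρ, i, s, hs, t, ht⟩ := hva f h1 h2 h3
    refine ⟨⟨ρ, i, s⟩, by simp [Bx, hρ, hs], ?_⟩
    show _ ∣ q ^ ((SS F).dg ρ * s) - 1
    rw [ht, pow_mul]
    simpa using Nat.sub_dvd_pow_sub_pow (q ^ f.natDegree) 1 t
  have hnX : ∀ f : F[X], ¬ Function.Injective (aeval y f) → f ≠ X := by
    rintro _ h rfl
    rw [aeval_X, hy] at h
    exact h g.injective
  have hbig : (∀ ρ ∈ A, ∀ i, (TT (l ρ) i).card ≠ n) → n ≤ q ^ z := by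
    intro h
    have h1 := z_bound hs' (B := n - 1) fun ρ hρ i => by
      have := (htk ρ hρ i).trans (hkn ρ hρ)
      have := h ρ hρ i
      omega
    rw [Nat.mul_sub, mul_one] at h1
    have h2 : n ≤ n * n := Nat.le_mul_self n
    have h3 : n ≤ 2 * z := by omega
    have h4 : 2 * z ≤ 2 ^ z := by
      obtain ⟨t, rfl⟩ := Nat.exists_eq_succ_of_ne_zero (show z ≠ 0 by omega)
      have := Nat.lt_two_pow_self (n := t)
      rw [pow_succ]; omega
    exact h3.trans (h4.trans (Nat.pow_le_pow_left q2 z))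
  have hAn : 0 < Bx.card := by
    rw [hBc]
    by_contra h0
    have : ∀ ρ ∈ A, k ρ = 0 := by simpa using h0
    rw [Finset.sum_eq_zero fun ρ h => by rw [this ρ h, zero_mul]] at hs
    omega
  rcases Nat.lt_or_ge Bx.card 2 with hB | hB
  · have hB1 : ∑ ρ ∈ A, k ρ = 1 := by omega
    have hn' : n ≤ q ^ z := by
      rcases Nat.lt_or_ge n 2 with h | h
      · exact (by omega : n ≤ 1).trans (Nat.one_le_pow _ _ (by omega))
      · refine hbig fun ρ hρ i => ?_
        have h1 := htk ρ hρ i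
        have h2 := Finset.single_le_sum (f := k) (fun _ _ => Nat.zero_le _) hρ
        omega
    obtain ⟨ρ, hρ⟩ : A.Nonempty := Finset.nonempty_iff_ne_empty.2 fun e => by rw [e] at hB1; simp at hB1
    have hAρ : A = {ρ} := by
      refine Finset.eq_singleton_iff_unique_mem.2 ⟨hρ, fun σ hσ => by_contra fun hne => ?_⟩
      have := Finset.sum_le_sum_of_subset (f := k) (show {σ, ρ} ⊆ A from fun a ha => by
        rcases Finset.mem_insert.1 ha with rfl | ha
        · exact hσ
        · rwa [Finset.mem_singleton.1 ha])
      rw [Finset.sum_pair hne] at this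
      have := (hA σ hσ).2.1
      have := (hA ρ hρ).2.1
      omega
    have hk1 : k ρ = 1 := by rw [hAρ, Finset.sum_singleton] at hB1; exact hB1
    have hρχ : irr hu = ρ := by
      by_contra hne
      rw [hAρ, Finset.prod_singleton, hk1, pow_one, (SS F).orth _ hχ _ (hA ρ hρ).1.1 hne] at hf
      exact hf rfl
    have hcu : irr hu ∈ (SS F).Cusp := hρχ ▸ (hA ρ hρ).1
    have hmp : ¬ IsUnit (minpoly F y) := by
      haveI : Nonempty (Fin n) := ⟨⟨0, hn⟩⟩
      exact minpoly.not_isUnit F y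
    obtain ⟨f, hfm, hfi, hfd⟩ := exists_monic_irreducible_factor _ hmp
    have hni := irr_ninj y hfi hfd
    obtain ⟨K, M₁, M₂, h1, h2, h3, h4, h5⟩ := fitting (mat n y) f
    have h6 : M₁.d + M₂.d = n := by rw [← ext_d (B := 0), ← h1.d, mat_d]
    have h7 : M₂.d = 0 := by
      by_contra h7
      have h8 : M₁.d ≠ 0 := fun e => hni (h4 e)
      have h9 := cusp_Phi hcu M₁ h8 (by rw [hdg]; omega)
      have := Phi_cop u h2 h3
      rw [show Phi u M₁ = 0 from h9] at this
      exact hg ((u.inv h1).trans this.symm)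
    have h8 : aeval y (f ^ K) = 0 := h5 h7
    obtain ⟨b, hb, hbd⟩ := hva' f hfm hfi hni
    obtain ⟨a, ha⟩ : q - 1 ∣ q ^ f.natDegree - 1 := by simpa using Nat.sub_dvd_pow_sub_pow q 1 f.natDegree
    obtain ⟨c, hc⟩ := f_dvd2 hfi (a := a) (by rw [ha, mul_comm])
    have h9 : aeval y ((X ^ a - C c) ^ n) = 0 := kill y _ fun f' hm' hi' hn' => by
      refine dvd_trans ?_ hc
      have : f' ∣ f ^ K := by
        by_contra hnd
        obtain ⟨s, t, e⟩ := hi'.coprime_iff_not_dvd.2 hnd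
        refine hn' ((injective_iff_map_eq_zero _).2 fun v hv => ?_)
        have := LinearMap.congr_fun (congrArg (aeval y) e) v
        rw [map_add, map_mul, map_mul, h8, mul_zero, add_zero, Module.End.mul_apply, hv, map_zero, map_one] at this
        exact this.symm
      exact hi'.prime.dvd_of_dvd_pow this
    have hBx : Bx = {b} := by
      obtain ⟨b', hb'⟩ := Finset.card_eq_one.1 (by omega : Bx.card = 1)
      rw [hb'] at hb ⊢
      rw [Finset.mem_singleton.1 hb]
    rw [hBx, Finset.prod_singleton] at hgl
    obtain ⟨t, ht⟩ := hbd
    obtain ⟨c', hc'⟩ := scal y h9 hn' (dvd_mul_right a t)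
    refine ⟨_, c', ?_, hc'⟩
    rw [hgl, ht, ha]; ring
  · obtain ⟨E, hE1, hE2⟩ := box Bx w q2 hB
    rw [hE1] at hgl
    have hr : ∀ f : F[X], f.Monic → Irreducible f → ¬ Function.Injective (aeval y f) → f ∣ X ^ E - C 1 := by
      intro f h1 h2 h3
      obtain ⟨b, hb, hbd⟩ := hva' f h1 h2 h3
      exact f_dvd1 h1 h2 (hnX f h3) (hbd.trans (hE2 b hb))
    have hk := kill y _ hr
    suffices H : ∃ N, aeval y ((X ^ E - C (1 : F)) ^ N) = 0 ∧ N ≤ q ^ z by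
      obtain ⟨N, h1, h2⟩ := H
      obtain ⟨c, hc⟩ := scal y h1 h2 dvd_rfl
      exact ⟨_, c, by rw [hgl]; ring, hc⟩
    by_cases hex : ∀ ρ ∈ A, ∀ i, (TT (l ρ) i).card ≠ n
    · exact ⟨n, hk, hbig hex⟩
    · refine ⟨1, ?_, Nat.one_le_pow _ _ (by omega)⟩
      push Not at hex
      obtain ⟨ρ, hρ, i, hi⟩ := hex
      have hkρ : k ρ = n := le_antisymm (hkn ρ hρ) (hi ▸ htk ρ hρ i)
      have hd1 : (SS F).dg ρ = 1 := by
        have h1 := hkd ρ hρ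
        have h2 := hdp ρ hρ
        rw [hkρ] at h1
        have := Nat.le_of_mul_le_mul_left (h1.trans_eq (mul_one n).symm) hn
        omega
      have hAρ : A = {ρ} := by
        refine Finset.eq_singleton_iff_unique_mem.2 ⟨hρ, fun σ hσ => by_contra fun hne => ?_⟩
        have := Finset.sum_le_sum_of_subset (f := fun ρ => k ρ * (SS F).dg ρ) (show {σ, ρ} ⊆ A from fun a ha => by
          rcases Finset.mem_insert.1 ha with rfl | ha
          · exact hσ
          · rwa [Finset.mem_singleton.1 ha])
        rw [Finset.sum_pair hne, hs, hkρ, hd1] at this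
        have := Nat.mul_pos (hA σ hσ).2.1 (hdp σ hσ)
        omega
      have hX := hx ρ (hA ρ hρ).1
      rw [hAρ, Finset.prod_singleton, sl_exc hX.1.zero (hA ρ hρ).2.2.1 hn i hi ((hA ρ hρ).2.2.2.trans hkρ)] at hc
      rw [pow_one]
      refine exc hX.1 hX.2 hd1 _ n n (mat n y) (mat_d _ _) ?_ hk
      rcases hc with h | h
      · rw [← h]; exact hg
      · rw [← h]; exact neg_ne_zero.2 hg
end GLW
end
end
section
universe u
open scoped MatrixGroups
noncomputable section
namespace GLW
open CategoryTheory in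
theorem simple_sub {G : Type} [Group G] (V : FDRep ℂ G) (hV : Simple V) : Nontrivial V ∧ ∀ W : Submodule ℂ V, (∀ g, ∀ v ∈ W, V.ρ g v ∈ W) → W = ⊥ ∨ W = ⊤ := by
  constructor
  · by_contra h
    rw [not_nontrivial_iff_subsingleton] at h
    refine id_nonzero V ?_
    ext v
    exact Subsingleton.elim (α := V) _ _
  · intro W hW
    let σ : Representation ℂ G W :=
      { toFun := fun g => (V.ρ g).restrict (hW g)
        map_one' := by ext v; simp
        map_mul' := fun a b => by ext v; simp }
    let i : FDRep.of σ ⟶ V := ⟨FGModuleCat.ofHom W.subtype, fun g => by ext v; rfl⟩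
    have hi : ∀ v : W, i.hom.hom v = v.1 := fun v => rfl
    haveI : Mono i := ConcreteCategory.mono_of_injective i (fun a b h => Subtype.ext h)
    by_cases h0 : i = 0
    · left
      rw [Submodule.eq_bot_iff]
      intro v hv
      have := hi ⟨v, hv⟩
      rw [h0] at this
      exact this.symm
    · right
      haveI := isIso_of_mono_of_nonzero h0
      rw [eq_top_iff]
      intro v _
      have h1 : (inv i ≫ i).hom.hom v = v := by rw [IsIso.inv_hom_id]; rfl
      rw [← h1]
      exact ((inv i).hom.hom v : W).2
theorem final (F : Type) [Field F] [Fintype F] (n : ℕ) (hn : 1 ≤ n)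
    (V : FDRep ℂ (GL (Fin n) F)) (hV : CategoryTheory.Simple V)
    (g : GL (Fin n) F) (hg : V.character g ≠ 0) :
    orderOf (QuotientGroup.mk g : GL (Fin n) F ⧸ Subgroup.center (GL (Fin n) F)) *
        Module.finrank ℂ V ∣
      (Subgroup.center (GL (Fin n) F)).index := by
  obtain ⟨hnt, hsub⟩ := simple_sub V hV
  let τ : Representation ℂ (Gn F n) V := V.ρ.comp (glE F n).symm.toMonoidHom
  have hτ : τ.character ∈ IrrC (Gn F n) := by
    refine ⟨V, inferInstance, inferInstance, inferInstance, τ, ?_, rfl⟩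
    have hb : (⊥ : Subrepresentation τ).toSubmodule = ⊥ := rfl
    have ht : (⊤ : Subrepresentation τ).toSubmodule = ⊤ := rfl
    have : Nontrivial (Subrepresentation τ) := ⟨⊥, ⊤, fun h => bot_ne_top (hb.symm.trans ((congrArg Subrepresentation.toSubmodule h).trans ht))⟩
    refine ⟨fun a => ?_⟩
    have := hsub a.toSubmodule fun g v hv => by
      have := a.apply_mem_toSubmodule (glE F n g) hv
      simpa [τ] using this
    rcases this with h | h
    · exact Or.inl (Subrepresentation.toSubmodule_injective h)
    · exact Or.inr (Subrepresentation.toSubmodule_injective h)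
  obtain ⟨u, hu, hue⟩ := Irr_surj hτ
  have hg' : u (mat n (glE F n g)) ≠ 0 := by
    rw [hue]
    have : τ.character (glE F n g) = V.character g := by
      simp [τ, Representation.character, FDRep.character]
    rwa [this]
  have hd : u (sc F n) = (Module.finrank ℂ V : ℕ) := (hue 1).trans (Representation.char_one τ)
  obtain ⟨D, c, h1, h2⟩ := core hn hu (glE F n g) hg' hd
  have q2 : 1 < Fintype.card F := Fintype.one_lt_card
  haveI : Nonempty (Fin n) := ⟨⟨0, hn⟩⟩
  have hcc : Nat.card (Subgroup.center (GL (Fin n) F)) = Fintype.card F - 1 := by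
    classical
    rw [Matrix.GeneralLinearGroup.center_eq_range_scalar, ← Fintype.card_units, ← Nat.card_eq_fintype_card]
    refine (Nat.card_congr (MonoidHom.ofInjective (f := Matrix.GeneralLinearGroup.scalar (Fin n)) ?_).toEquiv).symm
    intro a b h
    have h1 : (Matrix.GeneralLinearGroup.scalar (Fin n) a).1 ⟨0, hn⟩ ⟨0, hn⟩ = (Matrix.GeneralLinearGroup.scalar (Fin n) b).1 ⟨0, hn⟩ ⟨0, hn⟩ := by rw [h]
    ext
    simpa using h1
  have hidx : (Subgroup.center (GL (Fin n) F)).index = Module.finrank ℂ V * D := by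
    have h3 := (Subgroup.center (GL (Fin n) F)).card_mul_index
    rw [hcc, ← gl_card, h1] at h3
    refine Nat.eq_of_mul_eq_mul_left (by omega : 0 < Fintype.card F - 1) (h3.trans (by ring))
  have ho : orderOf (QuotientGroup.mk g : GL (Fin n) F ⧸ Subgroup.center (GL (Fin n) F)) ∣ D := by
    rw [orderOf_dvd_iff_pow_eq_one, ← QuotientGroup.mk_pow, QuotientGroup.eq_one_iff, Matrix.GeneralLinearGroup.mem_center_iff_val_mem_range_scalar]
    refine ⟨c, ?_⟩
    apply Matrix.toLin'.injective
    have h3 : ((glE F n g : Gn F n) : Module.End F (Fin n → F)) = Matrix.toLinAlgEquiv' g.1 := rfl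
    rw [h3, ← map_pow] at h2
    change Matrix.toLinAlgEquiv' (algebraMap F _ c) = Matrix.toLinAlgEquiv' (g ^ D : GL (Fin n) F).1
    rw [AlgEquiv.commutes, Units.val_pow_eq_pow_val, h2]
  rw [hidx, mul_comm]
  exact mul_dvd_mul_left _ ho
end GLW
end
end
open scoped MatrixGroups

/-- Let `F` be a finite field, `n ≥ 1`, and `G = GLₙ(F)`. If `χ` is an
irreducible complex character of `G` and `g ∈ G` satisfies `χ(g) ≠ 0`, then the order of
`gZ(G)` in `G/Z(G)` times `χ(1)` divides `|G : Z(G)|`. -/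
theorem orderOf_mul_degree_dvd_index_center_GL
    (F : Type) [Field F] [Fintype F] (n : ℕ) (hn : 1 ≤ n)
    (V : FDRep ℂ (GL (Fin n) F)) (hV : CategoryTheory.Simple V)
    (g : GL (Fin n) F) (hg : V.character g ≠ 0) :
    orderOf (QuotientGroup.mk g : GL (Fin n) F ⧸ Subgroup.center (GL (Fin n) F)) *
        Module.finrank ℂ V ∣
      (Subgroup.center (GL (Fin n) F)).index := by
  exact GLW.final F n hn V hV g hg
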